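/- Let d ∈ {2,3,4}. Set p₂ = (13 + √97)/6, p₃ = (27 + √337)/14, p₄ = 3 and s₂ = (1 + √97)/12, s₃ = (√337 − 1)/28, s₄ = 1/2, and let σ = 3/4 if d = 2, σ = 7/6 if d = 3, σ = 3/2 − δ for an arbitrary fixed δ > 0 if d = 4. Let s > s_d. Then there exists ε > 0 such that whenever the initial data satisfy ‖u(0)‖_{ℓ^{p_d'}} + ‖u_t(0)‖_{ℓ^{p_d'}} ≤ ε, the discrete nonlinear Klein–Gordon equation u_tt − Δu + u ± |u|^{2s}u = 0 (solved in the Duhamel sense) has a global solution u which, for every p ∈ [2, p_d], satisfies ‖u(t)‖_{ℓ^p(ℤ^d)} ≤ C_p (1 + |t|)^{−σ(p−2)/p} (‖u(0)‖_{ℓ^{p'}} + ‖u_t(0)‖_{ℓ^{p'}}) for all t ∈ ℝ. -/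

import Mathlib

open MeasureTheory Real
open scoped ENNReal

noncomputable section

/-- Dispersion relation of the discrete Klein--Gordon equation on `ℤ^d`. -/
def omegaKG (d : ℕ) (ξ : Fin d → ℝ) : ℝ :=
  Real.sqrt (1 + ∑ j : Fin d, 2 * (1 - Real.cos (ξ j)))

/-- The fundamental domain `[0, 2π]^d` of the torus. -/
def cube (d : ℕ) : Set (Fin d → ℝ) := Set.Icc 0 (fun _ => 2 * Real.pi)

/-- The convolution kernel of the Fourier multiplier on `ℤ^d` with symbol `m(ξ)`. -/
def multKernel (d : ℕ) (m : (Fin d → ℝ) → ℝ) (x : Fin d → ℤ) : ℂ :=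
  ((((2 * Real.pi) ^ d)⁻¹ : ℝ) : ℂ) *
    ∫ ξ in cube d,
      Complex.exp (Complex.I * ((∑ j : Fin d, (x j : ℝ) * ξ j : ℝ) : ℂ)) * ((m ξ : ℝ) : ℂ)

/-- The propagator `cos(t√(1−Δ))`, realized as the Fourier multiplier with symbol
`cos(t ω(ξ))`. -/
def cosProp (d : ℕ) (t : ℝ) (f : (Fin d → ℤ) → ℂ) (x : Fin d → ℤ) : ℂ :=
  ∑' y : Fin d → ℤ, multKernel d (fun ξ => Real.cos (t * omegaKG d ξ)) (x - y) * f y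

/-- The propagator `sin(t√(1−Δ))/√(1−Δ)`, realized as the Fourier multiplier with symbol
`sin(t ω(ξ))/ω(ξ)`. -/
def sinProp (d : ℕ) (t : ℝ) (f : (Fin d → ℤ) → ℂ) (x : Fin d → ℤ) : ℂ :=
  ∑' y : Fin d → ℤ, multKernel d (fun ξ => Real.sin (t * omegaKG d ξ) / omegaKG d ξ) (x - y) * f y

/-- The operator `√(1−Δ)`, realized as the Fourier multiplier with symbol `ω(ξ)`. -/
def sqrtOneSubLap (d : ℕ) (f : (Fin d → ℤ) → ℂ) (x : Fin d → ℤ) : ℂ :=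
  ∑' y : Fin d → ℤ, multKernel d (omegaKG d) (x - y) * f y

/-- The solution of the inhomogeneous discrete Klein--Gordon equation with data `(f,g)`
and forcing term `F`, given by Duhamel's formula. -/
def duhamel (d : ℕ) (t : ℝ) (f g : (Fin d → ℤ) → ℂ) (F : ℝ → (Fin d → ℤ) → ℂ)
    (x : Fin d → ℤ) : ℂ :=
  cosProp d t f x + sinProp d t g x + ∫ s in (0:ℝ)..t, sinProp d (t - s) (F s) x

/-- The `L^q` norm in time of an `ℝ≥0∞`-valued function. -/
def lqNorm (q : ℝ≥0∞) (g : ℝ → ℝ≥0∞) : ℝ≥0∞ :=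
  if q = ∞ then essSup g volume else (∫⁻ t, g t ^ q.toReal) ^ (1 / q.toReal)

/-- The mixed space-time norm `‖F‖_{L^q_t ℓ^r_x}`. -/
def mixedNorm (d : ℕ) (q r : ℝ≥0∞) (F : ℝ → (Fin d → ℤ) → ℂ) : ℝ≥0∞ :=
  lqNorm q fun t => eLpNorm (F t) r Measure.count

/-- The dispersive decay rate: `σ = 3/4` for `d = 2`, `σ = 7/6` for `d = 3`,
and `σ = 3/2 − δ` for `d = 4`. -/
def sigmaD (d : ℕ) (δ : ℝ) : ℝ :=
  if d = 2 then 3/4 else if d = 3 then 7/6 else 3/2 - δ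

/-- `p_d`: `p₂ = (13+√97)/6`, `p₃ = (27+√337)/14`, `p₄ = 3`. -/
def pD (d : ℕ) : ℝ :=
  if d = 2 then (13 + Real.sqrt 97) / 6 else if d = 3 then (27 + Real.sqrt 337) / 14 else 3

/-- `s_d`: `s₂ = (1+√97)/12`, `s₃ = (√337−1)/28`, `s₄ = 1/2`. -/
def sD (d : ℕ) : ℝ :=
  if d = 2 then (1 + Real.sqrt 97) / 12 else if d = 3 then (Real.sqrt 337 - 1) / 28 else 1/2

/-- The Hölder conjugate `p' = p/(p−1)` of a real exponent. -/
def conjR (p : ℝ) : ℝ := p / (p - 1)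

/-- The nonlinearity `|u|^{2s} u`. -/
def nonlin (d : ℕ) (s : ℝ) (u : ℝ → (Fin d → ℤ) → ℂ) (τ : ℝ) (y : Fin d → ℤ) : ℂ :=
  ((‖u τ y‖ ^ (2 * s) : ℝ) : ℂ) * u τ y

/-! ### Oscillatory integrals on an interval -/

lemma norm_cexp_I_mul (x : ℝ) : ‖Complex.exp (Complex.I * (x : ℂ))‖ = 1 := by
  rw [mul_comm]; exact Complex.norm_exp_ofReal_mul_I x

lemma hasDerivAt_cexp_I {Φ : ℝ → ℝ} {φ x : ℝ} (h : HasDerivAt Φ φ x) :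
    HasDerivAt (fun y => Complex.exp (Complex.I * (Φ y : ℂ)))
      (Complex.I * (φ : ℂ) * Complex.exp (Complex.I * (Φ x : ℂ))) x := by
  have h1 := (h.ofReal_comp.const_mul Complex.I).cexp
  convert h1 using 1
  ring

lemma continuousOn_of_hasDerivAt {E : Type*} [NormedAddCommGroup E] [NormedSpace ℝ E]
    {f f' : ℝ → E} {s : Set ℝ} (h : ∀ x ∈ s, HasDerivAt f (f' x) x) : ContinuousOn f s :=
  fun x hx => (h x hx).continuousAt.continuousWithinAt

lemma integral_abs_deriv_le {a b μ : ℝ} (hab : a ≤ b) {u u' : ℝ → ℝ}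
    (hu : ∀ x ∈ Set.Icc a b, HasDerivAt u (u' x) x) (hc : ContinuousOn u' (Set.Icc a b))
    (hs : (∀ x ∈ Set.Ioo a b, 0 ≤ u' x) ∨ (∀ x ∈ Set.Ioo a b, u' x ≤ 0))
    (hμ : ∀ x ∈ Set.Icc a b, |u x| ≤ μ) : ∫ x in a..b, |u' x| ≤ 2 * μ := by
  have hint : IntervalIntegrable u' volume a b :=
    ContinuousOn.intervalIntegrable (by rwa [Set.uIcc_of_le hab])
  have hftc : ∫ x in a..b, u' x = u b - u a :=
    intervalIntegral.integral_eq_sub_of_hasDerivAt (by rwa [Set.uIcc_of_le hab]) hint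
  have ha := abs_le.1 (hμ a (Set.left_mem_Icc.2 hab))
  have hb := abs_le.1 (hμ b (Set.right_mem_Icc.2 hab))
  rcases hs with hs | hs
  · have : ∫ x in a..b, |u' x| = ∫ x in a..b, u' x := by
      rw [intervalIntegral.integral_of_le hab, intervalIntegral.integral_of_le hab,
        integral_Ioc_eq_integral_Ioo, integral_Ioc_eq_integral_Ioo]
      exact setIntegral_congr_fun measurableSet_Ioo fun x hx => abs_of_nonneg (hs x hx)
    rw [this, hftc]; linarith
  · have : ∫ x in a..b, |u' x| = ∫ x in a..b, - u' x := by
      rw [intervalIntegral.integral_of_le hab, intervalIntegral.integral_of_le hab,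
        integral_Ioc_eq_integral_Ioo, integral_Ioc_eq_integral_Ioo]
      exact setIntegral_congr_fun measurableSet_Ioo fun x hx => abs_of_nonpos (hs x hx)
    rw [this, intervalIntegral.integral_neg, hftc]; linarith

lemma norm_integral_mul_deriv_cexp_le {a b : ℝ} (hab : a ≤ b) {Φ φ : ℝ → ℝ} {u u' : ℝ → ℂ}
    {μ V : ℝ}
    (hΦ : ∀ x ∈ Set.Icc a b, HasDerivAt Φ (φ x) x) (hφ : ContinuousOn φ (Set.Icc a b))
    (hu : ∀ x ∈ Set.Icc a b, HasDerivAt u (u' x) x) (hc : ContinuousOn u' (Set.Icc a b))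
    (hμa : ‖u a‖ ≤ μ) (hμb : ‖u b‖ ≤ μ) (hV : ∫ x in a..b, ‖u' x‖ ≤ V) :
    ‖∫ x in a..b, u x * (φ x : ℂ) * Complex.exp (Complex.I * (Φ x : ℂ))‖ ≤ 2 * μ + V := by
  have hI : Set.uIcc a b = Set.Icc a b := Set.uIcc_of_le hab
  have hE : ContinuousOn (fun y => Complex.exp (Complex.I * (Φ y : ℂ))) (Set.Icc a b) :=
    continuousOn_of_hasDerivAt fun x hx => hasDerivAt_cexp_I (hΦ x hx)
  have hφ' : ContinuousOn (fun x => (φ x : ℂ)) (Set.Icc a b) :=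
    Complex.continuous_ofReal.comp_continuousOn hφ
  have key := intervalIntegral.integral_mul_deriv_eq_deriv_mul (a := a) (b := b)
    (u := u) (u' := u')
    (v := fun y => Complex.exp (Complex.I * (Φ y : ℂ)))
    (v' := fun x => Complex.I * (φ x : ℂ) * Complex.exp (Complex.I * (Φ x : ℂ)))
    (by rwa [hI]) (by rw [hI]; exact fun x hx => hasDerivAt_cexp_I (hΦ x hx))
    (ContinuousOn.intervalIntegrable (by rwa [hI]))
    (ContinuousOn.intervalIntegrable
      (by rw [hI]; exact (continuousOn_const.mul hφ').mul hE))
  have e1 : ∫ x in a..b, u x * (Complex.I * (φ x : ℂ) * Complex.exp (Complex.I * (Φ x : ℂ)))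
      = Complex.I * ∫ x in a..b, u x * (φ x : ℂ) * Complex.exp (Complex.I * (Φ x : ℂ)) := by
    rw [← intervalIntegral.integral_const_mul]
    congr 1; ext x; ring
  rw [e1] at key
  have e2 : ‖∫ x in a..b, u x * (φ x : ℂ) * Complex.exp (Complex.I * (Φ x : ℂ))‖ =
      ‖Complex.I * ∫ x in a..b, u x * (φ x : ℂ) * Complex.exp (Complex.I * (Φ x : ℂ))‖ := by
    simp
  rw [e2, key]
  have hn := norm_cexp_I_mul
  have e3 : ‖∫ x in a..b, u' x * Complex.exp (Complex.I * (Φ x : ℂ))‖ ≤ V := by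
    refine (intervalIntegral.norm_integral_le_integral_norm hab).trans ?_
    simpa [hn] using hV
  calc _ ≤ ‖u b * Complex.exp (Complex.I * (Φ b : ℂ))‖ + ‖u a * Complex.exp (Complex.I * (Φ a : ℂ))‖
        + ‖∫ x in a..b, u' x * Complex.exp (Complex.I * (Φ x : ℂ))‖ :=
        (norm_sub_le _ _).trans (by gcongr; exact norm_sub_le _ _)
    _ ≤ μ + μ + V := by
        rw [norm_mul, norm_mul, hn, hn, mul_one, mul_one]; gcongr
    _ = _ := by ring

lemma norm_integral_mono_mul_deriv_cexp_le {a b : ℝ} (hab : a ≤ b) {Φ φ u u' : ℝ → ℝ} {μ : ℝ}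
    (hΦ : ∀ x ∈ Set.Icc a b, HasDerivAt Φ (φ x) x) (hφ : ContinuousOn φ (Set.Icc a b))
    (hu : ∀ x ∈ Set.Icc a b, HasDerivAt u (u' x) x) (hc : ContinuousOn u' (Set.Icc a b))
    (hs : (∀ x ∈ Set.Ioo a b, 0 ≤ u' x) ∨ (∀ x ∈ Set.Ioo a b, u' x ≤ 0))
    (hμ : ∀ x ∈ Set.Icc a b, |u x| ≤ μ) :
    ‖∫ x in a..b, (u x : ℂ) * (φ x : ℂ) * Complex.exp (Complex.I * (Φ x : ℂ))‖ ≤ 4 * μ := by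
  have := norm_integral_mul_deriv_cexp_le hab (u := fun x => (u x : ℂ)) (u' := fun x => (u' x : ℂ))
    (μ := μ) (V := 2 * μ) hΦ hφ (fun x hx => (hu x hx).ofReal_comp)
    (Complex.continuous_ofReal.comp_continuousOn hc)
    (by simpa using hμ a (Set.left_mem_Icc.2 hab)) (by simpa using hμ b (Set.right_mem_Icc.2 hab))
    (by simpa using integral_abs_deriv_le hab hu hc hs hμ)
  linarith

/-- An amplitude of bounded variation can be removed from an oscillatory integral. -/
lemma norm_integral_amplitude_le {a b : ℝ} (hab : a ≤ b) {f A A' : ℝ → ℂ} {B M V : ℝ}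
    (hf : ContinuousOn f (Set.Icc a b))
    (hB : ∀ x ∈ Set.Icc a b, ‖∫ y in a..x, f y‖ ≤ B)
    (hA : ∀ x ∈ Set.Icc a b, HasDerivAt A (A' x) x) (hc : ContinuousOn A' (Set.Icc a b))
    (hM : ‖A b‖ ≤ M) (hV : ∫ x in a..b, ‖A' x‖ ≤ V) :
    ‖∫ x in a..b, A x * f x‖ ≤ B * (M + V) := by
  have hI : Set.uIcc a b = Set.Icc a b := Set.uIcc_of_le hab
  have hfi : IntervalIntegrable f volume a b := ContinuousOn.intervalIntegrable (by rwa [hI])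
  have hB0 : 0 ≤ B := (norm_nonneg _).trans (hB a (Set.left_mem_Icc.2 hab))
  have hv : ContinuousOn (fun x => ∫ y in a..x, f y) (Set.Icc a b) := by
    have := intervalIntegral.continuousOn_primitive_interval (a := a) (b := b) (f := f)
      (μ := volume) (by rw [hI]; exact hf.integrableOn_Icc)
    rwa [hI] at this
  have key := intervalIntegral.integral_mul_deriv_eq_deriv_mul_of_hasDerivAt (a := a) (b := b)
    (u := A) (u' := A') (v := fun x => ∫ y in a..x, f y) (v' := f)
    (by rw [hI]; exact continuousOn_of_hasDerivAt hA) (by rwa [hI])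
    (fun x hx => by
      rw [min_eq_left hab, max_eq_right hab] at hx
      exact hA x ⟨hx.1.le, hx.2.le⟩)
    (fun x hx => by
      rw [min_eq_left hab, max_eq_right hab] at hx
      have hnhds : Set.Icc a b ∈ nhds x := Icc_mem_nhds hx.1 hx.2
      refine intervalIntegral.integral_hasDerivAt_right
        (ContinuousOn.intervalIntegrable ?_) ?_ (hf.continuousAt hnhds)
      · rw [Set.uIcc_of_le hx.1.le]; exact hf.mono (Set.Icc_subset_Icc le_rfl hx.2.le)
      · exact ⟨Set.Icc a b, hnhds, hf.aestronglyMeasurable measurableSet_Icc⟩)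
    (ContinuousOn.intervalIntegrable (by rwa [hI])) hfi
  rw [key]
  simp only [intervalIntegral.integral_same, mul_zero, sub_zero]
  have e3 : ‖∫ x in a..b, A' x * ∫ y in a..x, f y‖ ≤ V * B := by
    have h1 : ‖∫ x in a..b, A' x * ∫ y in a..x, f y‖ ≤ ∫ x in a..b, ‖A' x‖ * B := by
      refine intervalIntegral.norm_integral_le_of_norm_le hab ?_
        (ContinuousOn.intervalIntegrable (by rw [hI]; exact hc.norm.mul continuousOn_const))
      refine Filter.Eventually.of_forall fun x hx => ?_
      rw [norm_mul]
      gcongr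
      exact hB x ⟨hx.1.le, hx.2⟩
    rw [intervalIntegral.integral_mul_const] at h1
    exact h1.trans (by gcongr)
  calc _ ≤ ‖A b‖ * ‖∫ y in a..b, f y‖ + V * B := by
        refine (norm_sub_le _ _).trans ?_
        rw [norm_mul]; gcongr
    _ ≤ M * B + V * B := by
        gcongr
        · exact (norm_nonneg _).trans hM
        · exact hB b (Set.right_mem_Icc.2 hab)
    _ = _ := by ring

lemma exists_threshold {a b : ℝ} (hab : a ≤ b) {G : ℝ → ℝ} (hcont : ContinuousOn G (Set.Icc a b))
    (hmono : MonotoneOn G (Set.Icc a b)) (θ : ℝ) :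
    ∃ c ∈ Set.Icc a b, (∀ x ∈ Set.Ioo a c, G x ≤ θ) ∧ (∀ x ∈ Set.Ioo c b, θ ≤ G x) := by
  by_cases h : ∃ x ∈ Set.Icc a b, G x = θ
  · obtain ⟨c, hc, hcθ⟩ := h
    exact ⟨c, hc, fun x hx => hcθ ▸ hmono ⟨hx.1.le, hx.2.le.trans hc.2⟩ hc hx.2.le,
      fun x hx => hcθ ▸ hmono hc ⟨hc.1.trans hx.1.le, hx.2.le⟩ hx.1.le⟩
  · have hivt := intermediate_value_Icc hab hcont
    by_cases h3 : G b ≤ θ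
    · refine ⟨b, Set.right_mem_Icc.2 hab, fun x hx => ?_, by simp⟩
      exact (hmono ⟨hx.1.le, hx.2.le⟩ (Set.right_mem_Icc.2 hab) hx.2.le).trans h3
    · refine ⟨a, Set.left_mem_Icc.2 hab, by simp, fun x hx => ?_⟩
      have : θ ≤ G a := by
        by_contra h4
        obtain ⟨c, hc, hc'⟩ := hivt ⟨(not_le.1 h4).le, (not_le.1 h3).le⟩
        exact h ⟨c, hc, hc'⟩
      exact this.trans (hmono (Set.left_mem_Icc.2 hab) ⟨hx.1.le, hx.2.le⟩ hx.1.le)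

/-- A function with derivative bounded below splits an interval into a part where it is very
negative, a short part, and a part where it is large. -/
lemma exists_split_of_deriv_ge {a b δ ℓ : ℝ} (hab : a ≤ b) (hδ : 0 < δ) (hℓ : 0 < ℓ)
    {G G' : ℝ → ℝ}
    (hG : ∀ x ∈ Set.Icc a b, HasDerivAt G (G' x) x)
    (hl : ∀ x ∈ Set.Ioo a b, 2 * δ ≤ ℓ * G' x) :
    ∃ c₁ c₂, a ≤ c₁ ∧ c₁ ≤ c₂ ∧ c₂ ≤ b ∧ c₂ - c₁ ≤ ℓ ∧
      (∀ x ∈ Set.Ioo a c₁, G x ≤ -δ) ∧ (∀ x ∈ Set.Ioo c₂ b, δ ≤ G x) := by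
  have hcont : ContinuousOn G (Set.Icc a b) := continuousOn_of_hasDerivAt hG
  have hincr : ∀ x ∈ Set.Icc a b, ∀ y ∈ Set.Icc a b, x ≤ y → 2 * δ / ℓ * (y - x) ≤ G y - G x := by
    intro x hx y hy hxy
    refine (convex_Icc a b).mul_sub_le_image_sub_of_le_deriv hcont ?_ ?_ x hx y hy hxy
    · intro z hz
      exact (hG z (interior_subset hz)).differentiableAt.differentiableWithinAt
    · intro z hz
      rw [interior_Icc] at hz
      rw [(hG z ⟨hz.1.le, hz.2.le⟩).deriv, div_le_iff₀ hℓ]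
      linarith [hl z hz]
  have hmono : MonotoneOn G (Set.Icc a b) := by
    intro x hx y hy hxy
    have := hincr x hx y hy hxy
    have h2 : 0 ≤ 2 * δ / ℓ * (y - x) := mul_nonneg (by positivity) (by linarith)
    linarith
  have hδℓ : 0 < 2 * δ / ℓ := by positivity
  have h1 : 2 * δ / ℓ * ℓ = 2 * δ := by field_simp
  obtain ⟨d₁, hd₁, h11, h12⟩ := exists_threshold hab hcont hmono (-δ)
  obtain ⟨d₂, hd₂, h21, h22⟩ := exists_threshold hab hcont hmono δ
  refine ⟨d₁, max d₁ d₂, hd₁.1, le_max_left _ _, max_le hd₁.2 hd₂.2, ?_, h11, fun x hx => h22 x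
    ⟨(le_max_right _ _).trans_lt hx.1, hx.2⟩⟩
  rcases le_total d₂ d₁ with hle | hle
  · rw [max_eq_left hle]; simpa using hℓ.le
  rw [max_eq_right hle]
  by_contra hcon
  push Not at hcon
  set η := (d₂ - d₁ - ℓ) / 4 with hη
  have hη0 : 0 < η := by rw [hη]; linarith
  have hm1 : d₁ + η ∈ Set.Ioo d₁ b := ⟨by linarith, by linarith [hd₂.2]⟩
  have hm2 : d₂ - η ∈ Set.Ioo a d₂ := ⟨by linarith [hd₁.1], by linarith⟩
  have k1 := h12 _ hm1
  have k2 := h21 _ hm2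
  have k3 := hincr (d₁ + η) ⟨by linarith [hd₁.1], hm1.2.le⟩ (d₂ - η)
    ⟨hm2.1.le, by linarith [hd₂.2]⟩ (by linarith)
  have k4 : 2 * δ / ℓ * ℓ < 2 * δ / ℓ * (d₂ - η - (d₁ + η)) :=
    mul_lt_mul_of_pos_left (by rw [hη]; linarith) hδℓ
  rw [h1] at k4
  linarith

lemma norm_integral_le_of_split {a b δ ℓ R B : ℝ} (hab : a ≤ b) (hδ : 0 < δ) (hℓ : 0 < ℓ)
    {G G' : ℝ → ℝ} {f : ℝ → ℂ} (hf : ContinuousOn f (Set.Icc a b))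
    (hR : ∀ x ∈ Set.Icc a b, ‖f x‖ ≤ R)
    (hG : ∀ x ∈ Set.Icc a b, HasDerivAt G (G' x) x)
    (hl : (∀ x ∈ Set.Ioo a b, 2 * δ ≤ ℓ * G' x) ∨ (∀ x ∈ Set.Ioo a b, ℓ * G' x ≤ -(2 * δ)))
    (hprev : ∀ a' b', a ≤ a' → a' ≤ b' → b' ≤ b →
      ((∀ x ∈ Set.Ioo a' b', δ ≤ G x) ∨ (∀ x ∈ Set.Ioo a' b', G x ≤ -δ)) →
      ‖∫ x in a'..b', f x‖ ≤ B) :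
    ‖∫ x in a..b, f x‖ ≤ 2 * B + R * ℓ := by
  have main : ∃ c₁ c₂, a ≤ c₁ ∧ c₁ ≤ c₂ ∧ c₂ ≤ b ∧ c₂ - c₁ ≤ ℓ ∧
      ‖∫ x in a..c₁, f x‖ ≤ B ∧ ‖∫ x in c₂..b, f x‖ ≤ B := by
    rcases hl with hl | hl
    · obtain ⟨c₁, c₂, h1, h2, h3, h4, h5, h6⟩ := exists_split_of_deriv_ge hab hδ hℓ hG hl
      exact ⟨c₁, c₂, h1, h2, h3, h4, hprev a c₁ le_rfl h1 (h2.trans h3) (Or.inr h5),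
        hprev c₂ b (h1.trans h2) h3 le_rfl (Or.inl h6)⟩
    · obtain ⟨c₁, c₂, h1, h2, h3, h4, h5, h6⟩ := exists_split_of_deriv_ge (G := fun x => - G x)
        (G' := fun x => - G' x) hab hδ hℓ (fun x hx => (hG x hx).neg)
        (fun x hx => by have := hl x hx; linarith)
      exact ⟨c₁, c₂, h1, h2, h3, h4,
        hprev a c₁ le_rfl h1 (h2.trans h3) (Or.inl fun x hx => by linarith [h5 x hx]),
        hprev c₂ b (h1.trans h2) h3 le_rfl (Or.inr fun x hx => by linarith [h6 x hx])⟩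
  obtain ⟨c₁, c₂, h1, h2, h3, h4, h5, h6⟩ := main
  have hi : ∀ p q, a ≤ p → p ≤ q → q ≤ b → IntervalIntegrable f volume p q := fun p q hp hpq hq =>
    ContinuousOn.intervalIntegrable
      (by rw [Set.uIcc_of_le hpq]; exact hf.mono (Set.Icc_subset_Icc hp hq))
  have hR0 : 0 ≤ R := (norm_nonneg _).trans (hR a (Set.left_mem_Icc.2 hab))
  have e : ∫ x in a..b, f x = (∫ x in a..c₁, f x) + (∫ x in c₁..c₂, f x) + ∫ x in c₂..b, f x := by
    rw [intervalIntegral.integral_add_adjacent_intervals (hi _ _ le_rfl h1 (h2.trans h3))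
      (hi _ _ h1 h2 h3), intervalIntegral.integral_add_adjacent_intervals
      (hi _ _ le_rfl (h1.trans h2) h3) (hi _ _ (h1.trans h2) h3 le_rfl)]
  have hmid : ‖∫ x in c₁..c₂, f x‖ ≤ R * ℓ := by
    refine (intervalIntegral.norm_integral_le_of_norm_le_const (C := R) fun x hx => ?_).trans ?_
    · rw [Set.uIoc_of_le h2] at hx
      exact hR x ⟨h1.trans hx.1.le, hx.2.trans h3⟩
    · rw [abs_of_nonneg (by linarith)]; gcongr
  rw [e]
  calc _ ≤ B + R * ℓ + B := (norm_add_le _ _).trans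
        (add_le_add ((norm_add_le _ _).trans (add_le_add h5 hmid)) h6)
    _ = _ := by ring

section vdc

variable {a b R μ : ℝ} {Φ ρ g g₁ g₂ g₃ : ℝ → ℝ}

lemma continuousOn_phase (hΦ : ∀ x ∈ Set.Icc a b, HasDerivAt Φ (ρ x * g x) x)
    (hρ : ContinuousOn ρ (Set.Icc a b)) :
    ContinuousOn (fun x => (ρ x : ℂ) * Complex.exp (Complex.I * (Φ x : ℂ))) (Set.Icc a b) :=
  (Complex.continuous_ofReal.comp_continuousOn hρ).mul
    (continuousOn_of_hasDerivAt fun x hx => hasDerivAt_cexp_I (hΦ x hx))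

/-- Van der Corput's lemma, nonstationary case. -/
lemma vanDerCorput_zero (hab : a ≤ b) (hμ : 0 < μ)
    (hΦ : ∀ x ∈ Set.Icc a b, HasDerivAt Φ (ρ x * g x) x)
    (hρ : ContinuousOn ρ (Set.Icc a b))
    (hg : ∀ x ∈ Set.Icc a b, HasDerivAt g (g₁ x) x) (hc : ContinuousOn g₁ (Set.Icc a b))
    (hs : (∀ x ∈ Set.Ioo a b, 0 ≤ g₁ x) ∨ (∀ x ∈ Set.Ioo a b, g₁ x ≤ 0))
    (hl : (∀ x ∈ Set.Ioo a b, μ⁻¹ ≤ g x) ∨ (∀ x ∈ Set.Ioo a b, g x ≤ -μ⁻¹)) :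
    ‖∫ x in a..b, (ρ x : ℂ) * Complex.exp (Complex.I * (Φ x : ℂ))‖ ≤ 4 * μ := by
  rcases hab.eq_or_lt with rfl | hlt
  · simp [hμ.le]
  have hgc : ContinuousOn g (Set.Icc a b) := continuousOn_of_hasDerivAt hg
  have hcl : closure (Set.Ioo a b) = Set.Icc a b := closure_Ioo hlt.ne
  have habs : ∀ x ∈ Set.Icc a b, μ⁻¹ ≤ |g x| := by
    intro x hx
    rcases hl with hl | hl
    · have h1 : μ⁻¹ ≤ g x := ContinuousWithinAt.closure_le (s := Set.Ioo a b) (by rwa [hcl])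
        continuousWithinAt_const ((hgc x hx).mono Set.Ioo_subset_Icc_self) hl
      exact h1.trans (le_abs_self _)
    · have h1 : g x ≤ -μ⁻¹ := ContinuousWithinAt.closure_le (s := Set.Ioo a b) (by rwa [hcl])
        ((hgc x hx).mono Set.Ioo_subset_Icc_self) continuousWithinAt_const hl
      exact (by linarith : μ⁻¹ ≤ -g x).trans (neg_le_abs _)
  have hne : ∀ x ∈ Set.Icc a b, g x ≠ 0 := fun x hx h0 => by
    have := habs x hx
    rw [h0, abs_zero] at this
    exact absurd this (not_le.2 (inv_pos.2 hμ))
  have := norm_integral_mono_mul_deriv_cexp_le hab (Φ := Φ) (φ := fun x => ρ x * g x)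
    (u := fun x => (g x)⁻¹) (u' := fun x => - g₁ x / (g x) ^ 2) (μ := μ) hΦ (hρ.mul hgc)
    (fun x hx => (hg x hx).inv (hne x hx))
    (hc.neg.div (hgc.pow 2) fun x hx => pow_ne_zero _ (hne x hx))
    (by
      rcases hs with hs | hs
      · exact Or.inr fun x hx => div_nonpos_of_nonpos_of_nonneg (by linarith [hs x hx]) (sq_nonneg _)
      · exact Or.inl fun x hx => div_nonneg (by linarith [hs x hx]) (sq_nonneg _))
    (fun x hx => by
      rw [abs_inv]
      exact inv_le_of_inv_le₀ hμ (habs x hx))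
  refine le_trans (le_of_eq ?_) this
  congr 1
  refine intervalIntegral.integral_congr fun x hx => ?_
  rw [Set.uIcc_of_le hab] at hx
  have h0 : (g x : ℂ) ≠ 0 := by exact_mod_cast hne x hx
  push_cast
  field_simp

lemma norm_phase_le {x : ℝ} (h : |ρ x| ≤ R) :
    ‖(ρ x : ℂ) * Complex.exp (Complex.I * (Φ x : ℂ))‖ ≤ R := by
  rw [norm_mul, norm_cexp_I_mul, mul_one, Complex.norm_real]; exact h

/-- Van der Corput's lemma with a first derivative of the reduced phase bounded below. -/
lemma vanDerCorput_one (hab : a ≤ b) (hμ : 0 < μ)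
    (hΦ : ∀ x ∈ Set.Icc a b, HasDerivAt Φ (ρ x * g x) x)
    (hρ : ContinuousOn ρ (Set.Icc a b)) (hR : ∀ x ∈ Set.Icc a b, |ρ x| ≤ R)
    (hg : ∀ x ∈ Set.Icc a b, HasDerivAt g (g₁ x) x) (hc : ContinuousOn g₁ (Set.Icc a b))
    (hl : (∀ x ∈ Set.Ioo a b, (μ ^ 2)⁻¹ ≤ g₁ x) ∨ (∀ x ∈ Set.Ioo a b, g₁ x ≤ -(μ ^ 2)⁻¹)) :
    ‖∫ x in a..b, (ρ x : ℂ) * Complex.exp (Complex.I * (Φ x : ℂ))‖ ≤ (8 + 2 * R) * μ := by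
  have hp : 0 < (μ ^ 2)⁻¹ := by positivity
  have e : 2 * μ⁻¹ = (2 * μ) * (μ ^ 2)⁻¹ := by field_simp
  have := norm_integral_le_of_split (δ := μ⁻¹) (ℓ := 2 * μ) (B := 4 * μ) hab (by positivity)
    (by positivity) (continuousOn_phase hΦ hρ) (fun x hx => norm_phase_le (hR x hx)) hg
    (by
      rcases hl with hl | hl
      · exact Or.inl fun x hx => by rw [e]; have := hl x hx; gcongr
      · refine Or.inr fun x hx => ?_
        rw [e, ← mul_neg]; have := hl x hx; gcongr)
    (fun a' b' h1 h2 h3 h4 => by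
      have hsub : Set.Icc a' b' ⊆ Set.Icc a b := Set.Icc_subset_Icc h1 h3
      have hsub' : Set.Ioo a' b' ⊆ Set.Ioo a b := Set.Ioo_subset_Ioo h1 h3
      refine vanDerCorput_zero h2 hμ (fun x hx => hΦ x (hsub hx)) (hρ.mono hsub)
        (fun x hx => hg x (hsub hx)) (hc.mono hsub) ?_ h4
      rcases hl with hl | hl
      · exact Or.inl fun x hx => hp.le.trans (hl x (hsub' hx))
      · exact Or.inr fun x hx => (hl x (hsub' hx)).trans (by linarith))
  linarith

/-- Van der Corput's lemma with a second derivative of the reduced phase bounded below. -/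
lemma vanDerCorput_two (hab : a ≤ b) (hμ : 0 < μ)
    (hΦ : ∀ x ∈ Set.Icc a b, HasDerivAt Φ (ρ x * g x) x)
    (hρ : ContinuousOn ρ (Set.Icc a b)) (hR : ∀ x ∈ Set.Icc a b, |ρ x| ≤ R)
    (hg : ∀ x ∈ Set.Icc a b, HasDerivAt g (g₁ x) x)
    (hg₁ : ∀ x ∈ Set.Icc a b, HasDerivAt g₁ (g₂ x) x)
    (hl : (∀ x ∈ Set.Ioo a b, (μ ^ 3)⁻¹ ≤ g₂ x) ∨ (∀ x ∈ Set.Ioo a b, g₂ x ≤ -(μ ^ 3)⁻¹)) :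
    ‖∫ x in a..b, (ρ x : ℂ) * Complex.exp (Complex.I * (Φ x : ℂ))‖ ≤ (16 + 6 * R) * μ := by
  have e : 2 * (μ ^ 2)⁻¹ = (2 * μ) * (μ ^ 3)⁻¹ := by field_simp
  have := norm_integral_le_of_split (δ := (μ ^ 2)⁻¹) (ℓ := 2 * μ) (B := (8 + 2 * R) * μ) hab
    (by positivity)
    (by positivity) (continuousOn_phase hΦ hρ) (fun x hx => norm_phase_le (hR x hx)) hg₁
    (by
      rcases hl with hl | hl
      · exact Or.inl fun x hx => by rw [e]; have := hl x hx; gcongr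
      · refine Or.inr fun x hx => ?_
        rw [e, ← mul_neg]; have := hl x hx; gcongr)
    (fun a' b' h1 h2 h3 h4 => by
      have hsub : Set.Icc a' b' ⊆ Set.Icc a b := Set.Icc_subset_Icc h1 h3
      exact vanDerCorput_one h2 hμ (fun x hx => hΦ x (hsub hx)) (hρ.mono hsub)
        (fun x hx => hR x (hsub hx)) (fun x hx => hg x (hsub hx))
        ((continuousOn_of_hasDerivAt hg₁).mono hsub) h4)
  linarith

/-- Van der Corput's lemma with a third derivative of the reduced phase bounded below. -/
lemma vanDerCorput_three (hab : a ≤ b) (hμ : 0 < μ)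
    (hΦ : ∀ x ∈ Set.Icc a b, HasDerivAt Φ (ρ x * g x) x)
    (hρ : ContinuousOn ρ (Set.Icc a b)) (hR : ∀ x ∈ Set.Icc a b, |ρ x| ≤ R)
    (hg : ∀ x ∈ Set.Icc a b, HasDerivAt g (g₁ x) x)
    (hg₁ : ∀ x ∈ Set.Icc a b, HasDerivAt g₁ (g₂ x) x)
    (hg₂ : ∀ x ∈ Set.Icc a b, HasDerivAt g₂ (g₃ x) x)
    (hl : (∀ x ∈ Set.Ioo a b, (μ ^ 4)⁻¹ ≤ g₃ x) ∨ (∀ x ∈ Set.Ioo a b, g₃ x ≤ -(μ ^ 4)⁻¹)) :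
    ‖∫ x in a..b, (ρ x : ℂ) * Complex.exp (Complex.I * (Φ x : ℂ))‖ ≤ (32 + 14 * R) * μ := by
  have e : 2 * (μ ^ 3)⁻¹ = (2 * μ) * (μ ^ 4)⁻¹ := by field_simp
  have := norm_integral_le_of_split (δ := (μ ^ 3)⁻¹) (ℓ := 2 * μ) (B := (16 + 6 * R) * μ) hab
    (by positivity)
    (by positivity) (continuousOn_phase hΦ hρ) (fun x hx => norm_phase_le (hR x hx)) hg₂
    (by
      rcases hl with hl | hl
      · exact Or.inl fun x hx => by rw [e]; have := hl x hx; gcongr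
      · refine Or.inr fun x hx => ?_
        rw [e, ← mul_neg]; have := hl x hx; gcongr)
    (fun a' b' h1 h2 h3 h4 => by
      have hsub : Set.Icc a' b' ⊆ Set.Icc a b := Set.Icc_subset_Icc h1 h3
      exact vanDerCorput_two h2 hμ (fun x hx => hΦ x (hsub hx)) (hρ.mono hsub)
        (fun x hx => hR x (hsub hx)) (fun x hx => hg x (hsub hx)) (fun x hx => hg₁ x (hsub hx)) h4)
  linarith

end vdc

/-! ### Bessel functions of integer order -/

/-- `π` times the Bessel function `J_n`. -/
def besselY (n : ℕ) (x : ℝ) : ℝ := ∫ θ in (0:ℝ)..π, Real.cos (n * θ - x * Real.sin θ)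

/-- The derivative of `besselY`. -/
def besselY' (n : ℕ) (x : ℝ) : ℝ :=
  ∫ θ in (0:ℝ)..π, Real.sin θ * Real.sin (n * θ - x * Real.sin θ)

/-- The second derivative of `besselY`. -/
def besselY'' (n : ℕ) (x : ℝ) : ℝ :=
  ∫ θ in (0:ℝ)..π, -(Real.sin θ ^ 2 * Real.cos (n * θ - x * Real.sin θ))

lemma hasDerivAt_besselPhase (n x θ : ℝ) :
    HasDerivAt (fun θ => n * θ - x * Real.sin θ) (n - x * Real.cos θ) θ := by
  simpa using ((hasDerivAt_id θ).const_mul n).fun_sub ((Real.hasDerivAt_sin θ).const_mul x)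

lemma hasDerivAt_besselPhase₁ (n x θ : ℝ) :
    HasDerivAt (fun θ => n - x * Real.cos θ) (x * Real.sin θ) θ := by
  simpa using ((Real.hasDerivAt_cos θ).const_mul x).const_sub n

lemma hasDerivAt_besselY (n : ℕ) (x : ℝ) : HasDerivAt (besselY n) (besselY' n x) x := by
  refine (intervalIntegral.hasDerivAt_integral_of_dominated_loc_of_deriv_le
    (F := fun x θ => Real.cos (n * θ - x * Real.sin θ))
    (F' := fun x θ => Real.sin θ * Real.sin (n * θ - x * Real.sin θ))
    (bound := fun _ => 1) (s := Set.univ) Filter.univ_mem ?_ ?_ ?_ ?_ ?_ ?_).2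
  · exact Filter.Eventually.of_forall fun x => (by fun_prop : Continuous _).aestronglyMeasurable
  · exact (by fun_prop : Continuous _).intervalIntegrable _ _
  · exact (by fun_prop : Continuous _).aestronglyMeasurable
  · refine Filter.Eventually.of_forall fun θ _ y _ => ?_
    rw [norm_mul]
    exact mul_le_one₀ (Real.abs_sin_le_one _) (norm_nonneg _) (Real.abs_sin_le_one _)
  · exact intervalIntegrable_const
  · refine Filter.Eventually.of_forall fun θ _ y _ => ?_
    have h : HasDerivAt (fun y : ℝ => n * θ - y * Real.sin θ) (-Real.sin θ) y := by
      simpa using ((hasDerivAt_id y).mul_const (Real.sin θ)).const_sub (n * θ)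
    exact h.cos.congr_deriv (by ring)

lemma hasDerivAt_besselY' (n : ℕ) (x : ℝ) : HasDerivAt (besselY' n) (besselY'' n x) x := by
  refine (intervalIntegral.hasDerivAt_integral_of_dominated_loc_of_deriv_le
    (F := fun x θ => Real.sin θ * Real.sin (n * θ - x * Real.sin θ))
    (F' := fun x θ => -(Real.sin θ ^ 2 * Real.cos (n * θ - x * Real.sin θ)))
    (bound := fun _ => 1) (s := Set.univ) Filter.univ_mem ?_ ?_ ?_ ?_ ?_ ?_).2
  · exact Filter.Eventually.of_forall fun x => (by fun_prop : Continuous _).aestronglyMeasurable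
  · exact (by fun_prop : Continuous _).intervalIntegrable _ _
  · exact (by fun_prop : Continuous _).aestronglyMeasurable
  · refine Filter.Eventually.of_forall fun θ _ y _ => ?_
    rw [norm_neg, norm_mul]
    refine mul_le_one₀ ?_ (norm_nonneg _) (Real.abs_cos_le_one _)
    rw [norm_pow]
    exact pow_le_one₀ (norm_nonneg _) (Real.abs_sin_le_one _)
  · exact intervalIntegrable_const
  · refine Filter.Eventually.of_forall fun θ _ y _ => ?_
    have h : HasDerivAt (fun y : ℝ => n * θ - y * Real.sin θ) (-Real.sin θ) y := by
      simpa using ((hasDerivAt_id y).mul_const (Real.sin θ)).const_sub (n * θ)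
    exact (h.sin.const_mul (Real.sin θ)).congr_deriv (by ring)

/-- Bessel's differential equation. -/
lemma besselY_ode (n : ℕ) (x : ℝ) :
    x ^ 2 * besselY'' n x + x * besselY' n x + (x ^ 2 - (n : ℝ) ^ 2) * besselY n x = 0 := by
  have hd : ∀ θ ∈ Set.uIcc 0 π, HasDerivAt
      (fun θ => -(n + x * Real.cos θ) * Real.sin (n * θ - x * Real.sin θ))
      (x ^ 2 * (-(Real.sin θ ^ 2 * Real.cos (n * θ - x * Real.sin θ)))
        + x * (Real.sin θ * Real.sin (n * θ - x * Real.sin θ))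
        + (x ^ 2 - (n : ℝ) ^ 2) * Real.cos (n * θ - x * Real.sin θ)) θ := by
    intro θ _
    have h1 : HasDerivAt (fun θ => -((n : ℝ) + x * Real.cos θ)) (x * Real.sin θ) θ := by
      exact (((Real.hasDerivAt_cos θ).const_mul x).const_add (n : ℝ)).fun_neg.congr_deriv (by ring)
    refine (h1.mul (hasDerivAt_besselPhase n x θ).sin).congr_deriv ?_
    rw [Real.sin_sq θ]; ring
  have hi := intervalIntegral.integral_eq_sub_of_hasDerivAt hd
    ((by fun_prop : Continuous _).intervalIntegrable _ _)
  rw [intervalIntegral.integral_add, intervalIntegral.integral_add,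
    intervalIntegral.integral_const_mul, intervalIntegral.integral_const_mul,
    intervalIntegral.integral_const_mul] at hi
  · rw [besselY'', besselY', besselY, hi]
    simp
  all_goals exact (by fun_prop : Continuous _).intervalIntegrable _ _

lemma abs_besselY_le_pi (n : ℕ) (x : ℝ) : |besselY n x| ≤ π := by
  have := intervalIntegral.norm_integral_le_of_norm_le_const (a := 0) (b := π) (C := 1)
    (f := fun θ => Real.cos (n * θ - x * Real.sin θ)) (fun θ _ => Real.abs_cos_le_one _)
  simpa [besselY, abs_of_pos Real.pi_pos] using this

lemma besselY_eq_re (n : ℕ) (x : ℝ) : besselY n x =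
    (∫ θ in (0:ℝ)..π, ((1:ℝ) : ℂ) *
      Complex.exp (Complex.I * ((n * θ - x * Real.sin θ : ℝ) : ℂ))).re := by
  rw [besselY, ← Complex.reCLM_apply, ← ContinuousLinearMap.intervalIntegral_comp_comm]
  · refine intervalIntegral.integral_congr fun θ _ => ?_
    simp only [Complex.reCLM_apply, Complex.ofReal_one, one_mul]
    rw [mul_comm Complex.I, Complex.exp_ofReal_mul_I_re]
  · exact (by fun_prop : Continuous _).intervalIntegrable _ _

lemma besselY'_eq_im (n : ℕ) (x : ℝ) : besselY' n x =
    (∫ θ in (0:ℝ)..π, (Real.sin θ : ℂ) *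
      Complex.exp (Complex.I * ((n * θ - x * Real.sin θ : ℝ) : ℂ))).im := by
  rw [besselY', ← Complex.imCLM_apply, ← ContinuousLinearMap.intervalIntegral_comp_comm]
  · refine intervalIntegral.integral_congr fun θ _ => ?_
    simp only [Complex.imCLM_apply]
    rw [mul_comm Complex.I, Complex.im_ofReal_mul, Complex.exp_ofReal_mul_I_im]
  · exact (by fun_prop : Continuous _).intervalIntegrable _ _

/-- The uniform bound `|J_n(x)| ≲ x^{-1/3}`. -/
lemma abs_besselY_le_cubeRoot (n : ℕ) {x μ : ℝ} (hμ : 0 < μ) (hx : (μ ^ 3)⁻¹ ≤ x) :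
    |besselY n x| ≤ 110 * μ := by
  rcases le_total 1 μ with h1 | h1
  · exact (abs_besselY_le_pi n x).trans (by linarith [Real.pi_lt_four])
  have hx0 : 0 < x := lt_of_lt_of_le (by positivity) hx
  have hx2 : (μ ^ 2)⁻¹ ≤ x := le_trans (by gcongr ?_⁻¹; nlinarith [sq_nonneg μ]) hx
  have hpi := Real.pi_pos
  set f : ℝ → ℂ := fun θ => ((1:ℝ) : ℂ) *
      Complex.exp (Complex.I * ((n * θ - x * Real.sin θ : ℝ) : ℂ)) with hf
  have hfi : ∀ p q, IntervalIntegrable f volume p q := fun p q =>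
    (by fun_prop : Continuous _).intervalIntegrable _ _
  have e : ∫ θ in (0:ℝ)..π, f θ = (∫ θ in (0:ℝ)..π/3, f θ) + (∫ θ in (π/3)..(2*π/3), f θ)
      + ∫ θ in (2*π/3)..π, f θ := by
    rw [intervalIntegral.integral_add_adjacent_intervals (hfi _ _) (hfi _ _),
      intervalIntegral.integral_add_adjacent_intervals (hfi _ _) (hfi _ _)]
  have hΦ : ∀ θ : ℝ, HasDerivAt (fun θ => (n:ℝ) * θ - x * Real.sin θ)
      (1 * (n - x * Real.cos θ)) θ := fun θ => by
    rw [one_mul]; exact hasDerivAt_besselPhase n x θ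
  have hg₂ : ∀ θ : ℝ, HasDerivAt (fun θ => x * Real.sin θ) (x * Real.cos θ) θ := fun θ =>
    (Real.hasDerivAt_sin θ).const_mul x
  have hμ2 : 0 < 2 * μ := by positivity
  have hc3 : ∀ c : ℝ, 1/2 ≤ c → ((2 * μ) ^ 3)⁻¹ ≤ x * c := by
    intro c hc
    have : ((2 * μ) ^ 3)⁻¹ = (μ ^ 3)⁻¹ * (1/8) := by field_simp; norm_num
    rw [this]
    exact mul_le_mul hx (by linarith) (by norm_num) hx0.le
  have b1 : ‖∫ θ in (0:ℝ)..π/3, f θ‖ ≤ (16 + 6 * 1) * (2 * μ) := by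
    refine vanDerCorput_two (by positivity) hμ2 (fun θ _ => hΦ θ) continuousOn_const
      (fun _ _ => by simp) (fun θ _ => hasDerivAt_besselPhase₁ n x θ) (fun θ _ => hg₂ θ)
      (Or.inl fun θ hθ => hc3 _ ?_)
    rw [← Real.cos_pi_div_three]
    exact Real.cos_le_cos_of_nonneg_of_le_pi hθ.1.le (by linarith) hθ.2.le
  have b3 : ‖∫ θ in (2*π/3)..π, f θ‖ ≤ (16 + 6 * 1) * (2 * μ) := by
    refine vanDerCorput_two (by linarith) hμ2 (fun θ _ => hΦ θ) continuousOn_const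
      (fun _ _ => by simp) (fun θ _ => hasDerivAt_besselPhase₁ n x θ) (fun θ _ => hg₂ θ)
      (Or.inr fun θ hθ => ?_)
    have h2 : 1/2 ≤ - Real.cos θ := by
      rw [← Real.cos_pi_div_three, ← Real.cos_pi_sub]
      exact Real.cos_le_cos_of_nonneg_of_le_pi (by linarith [hθ.2]) (by linarith)
        (by linarith [hθ.1])
    linarith [hc3 _ h2]
  have b2 : ‖∫ θ in (π/3)..(2*π/3), f θ‖ ≤ (8 + 2 * 1) * (2 * μ) := by
    refine vanDerCorput_one (by linarith) hμ2 (fun θ _ => hΦ θ) continuousOn_const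
      (fun _ _ => by simp) (fun θ _ => hasDerivAt_besselPhase₁ n x θ)
      (by fun_prop) (Or.inl fun θ hθ => ?_)
    have h2 : 1/2 ≤ Real.sin θ := by
      rw [← Real.cos_pi_div_three, ← Real.cos_sub_pi_div_two, ← Real.cos_abs (θ - π/2)]
      refine Real.cos_le_cos_of_nonneg_of_le_pi (abs_nonneg _) (by linarith) ?_
      rw [abs_le]; constructor <;> linarith [hθ.1, hθ.2]
    have : ((2 * μ) ^ 2)⁻¹ = (μ ^ 2)⁻¹ * (1/4) := by field_simp; norm_num
    rw [this]
    exact mul_le_mul hx2 (by linarith) (by norm_num) hx0.le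
  rw [besselY_eq_re]
  refine (Complex.abs_re_le_norm _).trans ?_
  change ‖∫ θ in (0:ℝ)..π, f θ‖ ≤ _
  rw [e]
  refine (norm_add₃_le).trans ?_
  linarith

/-- Common decomposition for the oscillatory integrals defining `J_n(x)` and `J_n'(x)` in the
region `n < x`. -/
lemma norm_integral_bessel_le (n : ℕ) {x ς U M V : ℝ} (hx : 0 < x) (hς : 0 < ς)
    (hςx : ς ^ 2 = 1 - (n / x) ^ 2) {a a' : ℝ → ℝ}
    (ha : ∀ θ, HasDerivAt a (a' θ) θ) (ha'c : Continuous a')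
    (hsgn : ∀ θ ∈ Set.Icc 0 π, a' θ * (n - x * Real.cos θ) - a θ * (x * Real.sin θ) ≤ 0)
    (hU : ∀ θ ∈ Set.Icc 0 π, ς ^ 2 / 4 ≤ |n / x - Real.cos θ| →
      ς * Real.sin θ ≤ 5 * |n / x - Real.cos θ| → |a θ| ≤ U * (x * |n / x - Real.cos θ|))
    (hM : ∀ θ ∈ Set.Icc 0 π, Real.sin θ ≤ 3 / 2 * ς → |a θ| ≤ M)
    (hV : ∀ p q, 0 ≤ p → p ≤ q → q ≤ π → (∀ θ ∈ Set.Icc p q, Real.sin θ ≤ 3 / 2 * ς) →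
      (3 * (n / x) - 1) / 2 ≤ Real.cos q → ∫ θ in p..q, |a' θ| ≤ V) :
    ‖∫ θ in (0:ℝ)..π, (a θ : ℂ) *
      Complex.exp (Complex.I * ((n * θ - x * Real.sin θ : ℝ) : ℂ))‖
      ≤ 8 * U + 15 / √(x * ς) * (M + V) := by
  set c : ℝ := n / x with hc
  have hnx : (n:ℝ) = x * c := by rw [hc]; field_simp
  have hc0 : 0 ≤ c := by positivity
  have hc1 : c < 1 := by nlinarith
  have hς2 : ς ^ 2 ≤ 2 * (1 - c) := by nlinarith
  set θa := Real.arccos ((1 + c) / 2) with hθa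
  set θb := Real.arccos ((3 * c - 1) / 2) with hθb
  have hab : θa ≤ θb := Real.arccos_le_arccos (by linarith)
  have ha0 : 0 ≤ θa := Real.arccos_nonneg _
  have hbπ : θb ≤ π := Real.arccos_le_pi _
  have hcosa : Real.cos θa = (1 + c) / 2 := Real.cos_arccos (by linarith) (by linarith)
  have hcosb : Real.cos θb = (3 * c - 1) / 2 := Real.cos_arccos (by linarith) (by linarith)
  have hgap : ∀ θ ∈ Set.Icc 0 π, (1 - c) / 2 ≤ |c - Real.cos θ| →
      ς ^ 2 / 4 ≤ |c - Real.cos θ| ∧ ς * Real.sin θ ≤ 5 * |c - Real.cos θ| := by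
    intro θ hθ h
    refine ⟨by linarith, ?_⟩
    have hs0 : 0 ≤ Real.sin θ := Real.sin_nonneg_of_nonneg_of_le_pi hθ.1 hθ.2
    refine abs_le_of_sq_le_sq' ?_ (by positivity) |>.2
    rw [mul_pow, mul_pow, Real.sin_sq]
    set D := |c - Real.cos θ|
    have hD0 : 0 ≤ D := abs_nonneg _
    have h1 : 1 - Real.cos θ ≤ 3 * D := by
      have : c - Real.cos θ ≤ D := le_abs_self _
      linarith
    have h2 : 0 ≤ 1 - Real.cos θ := by linarith [Real.cos_le_one θ]
    have h3 : 0 ≤ 1 + Real.cos θ := by linarith [Real.neg_one_le_cos θ]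
    have h4 : ς ^ 2 ≤ 4 * D := by linarith
    have h5 : 1 - Real.cos θ ^ 2 ≤ 6 * D := by nlinarith [Real.cos_le_one θ]
    have h6 : 0 ≤ 1 - Real.cos θ ^ 2 := by nlinarith
    nlinarith [mul_le_mul h4 h5 h6 (by positivity)]
  set f : ℝ → ℂ := fun θ => (a θ : ℂ) *
      Complex.exp (Complex.I * ((n * θ - x * Real.sin θ : ℝ) : ℂ)) with hf
  have hac : Continuous a := continuous_iff_continuousAt.2 fun θ => (ha θ).continuousAt
  have hfc : Continuous f := by fun_prop
  have e : ∫ θ in (0:ℝ)..π, f θ = (∫ θ in (0:ℝ)..θa, f θ) + (∫ θ in θa..θb, f θ)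
      + ∫ θ in θb..π, f θ := by
    rw [intervalIntegral.integral_add_adjacent_intervals (hfc.intervalIntegrable _ _)
      (hfc.intervalIntegrable _ _),
      intervalIntegral.integral_add_adjacent_intervals (hfc.intervalIntegrable _ _)
      (hfc.intervalIntegrable _ _)]
  -- the nonstationary parts
  have hns : ∀ p q, 0 ≤ p → p ≤ q → q ≤ π →
      (∀ θ ∈ Set.Icc p q, (1 - c) / 2 ≤ |c - Real.cos θ|) → ‖∫ θ in p..q, f θ‖ ≤ 4 * U := by
    intro p q hp hpq hq hθ
    have hpos : ∀ θ ∈ Set.Icc p q, 0 < |c - Real.cos θ| := fun θ hθ' =>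
      lt_of_lt_of_le (by linarith) (hθ θ hθ')
    have hne : ∀ θ ∈ Set.Icc p q, n - x * Real.cos θ ≠ 0 := fun θ hθ' h0 => by
      rw [hnx, ← mul_sub] at h0
      have := hpos θ hθ'
      rcases mul_eq_zero.1 h0 with h | h
      · exact hx.ne' h
      · rw [h, abs_zero] at this; exact lt_irrefl _ this
    have hsub : ∀ θ ∈ Set.Icc p q, θ ∈ Set.Icc 0 π := fun θ h => ⟨hp.trans h.1, h.2.trans hq⟩
    have := norm_integral_mono_mul_deriv_cexp_le hpq
      (Φ := fun θ => n * θ - x * Real.sin θ) (φ := fun θ => n - x * Real.cos θ)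
      (u := fun θ => a θ / (n - x * Real.cos θ))
      (u' := fun θ => (a' θ * (n - x * Real.cos θ) - a θ * (x * Real.sin θ))
        / (n - x * Real.cos θ) ^ 2) (μ := U)
      (fun θ _ => hasDerivAt_besselPhase n x θ) (by fun_prop)
      (fun θ h => (ha θ).fun_div (hasDerivAt_besselPhase₁ n x θ) (hne θ h))
      (ContinuousOn.div (by fun_prop) (by fun_prop) fun θ h => pow_ne_zero _ (hne θ h))
      (Or.inr fun θ h => div_nonpos_of_nonpos_of_nonneg
        (hsgn θ (hsub θ ⟨h.1.le, h.2.le⟩)) (sq_nonneg _))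
      (fun θ h => by
        have hg := hgap θ (hsub θ h) (hθ θ h)
        rw [abs_div, hnx, ← mul_sub, abs_mul, abs_of_pos hx,
          div_le_iff₀ (mul_pos hx (hpos θ h))]
        exact hU θ (hsub θ h) hg.1 hg.2)
    refine le_trans (le_of_eq ?_) this
    congr 1
    refine intervalIntegral.integral_congr fun θ h => ?_
    rw [Set.uIcc_of_le hpq] at h
    have h0 : ((n - x * Real.cos θ : ℝ) : ℂ) ≠ 0 := by exact_mod_cast hne θ h
    simp only [hf]
    rw [Complex.ofReal_div, div_mul_cancel₀ _ h0]
  have b1 : ‖∫ θ in (0:ℝ)..θa, f θ‖ ≤ 4 * U := by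
    refine hns 0 θa le_rfl ha0 (hab.trans hbπ) fun θ h => ?_
    have : Real.cos θa ≤ Real.cos θ :=
      Real.cos_le_cos_of_nonneg_of_le_pi h.1 (hab.trans hbπ) h.2
    rw [hcosa] at this
    rw [abs_sub_comm]
    exact le_trans (by linarith) (le_abs_self _)
  have b3 : ‖∫ θ in θb..π, f θ‖ ≤ 4 * U := by
    refine hns θb π (ha0.trans hab) hbπ le_rfl fun θ h => ?_
    have : Real.cos θ ≤ Real.cos θb :=
      Real.cos_le_cos_of_nonneg_of_le_pi (ha0.trans hab) h.2 h.1
    rw [hcosb] at this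
    exact le_trans (by linarith) (le_abs_self _)
  have hmid : ∀ θ ∈ Set.Icc θa θb, ς / 2 ≤ Real.sin θ ∧ Real.sin θ ≤ 3 / 2 * ς := by
    intro θ h
    have h1 : Real.cos θ ≤ Real.cos θa :=
      Real.cos_le_cos_of_nonneg_of_le_pi ha0 (h.2.trans hbπ) h.1
    have h2 : Real.cos θb ≤ Real.cos θ :=
      Real.cos_le_cos_of_nonneg_of_le_pi (ha0.trans h.1) hbπ h.2
    rw [hcosa] at h1
    rw [hcosb] at h2
    have hs0 : 0 ≤ Real.sin θ :=
      Real.sin_nonneg_of_nonneg_of_le_pi (ha0.trans h.1) (h.2.trans hbπ)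
    have hsq := Real.sin_sq θ
    constructor
    · refine abs_le_of_sq_le_sq' ?_ hs0 |>.2
      rw [hsq, div_pow, hςx]
      nlinarith
    · refine abs_le_of_sq_le_sq' ?_ (by positivity) |>.2
      rw [hsq, mul_pow, hςx]
      nlinarith
  have hW : 0 < √(x * ς) := Real.sqrt_pos.2 (by positivity)
  have hWsq : √(x * ς) ^ 2 = x * ς := Real.sq_sqrt (by positivity)
  have hmB : ∀ q ∈ Set.Icc θa θb, ‖∫ θ in θa..q, ((1:ℝ):ℂ) *
      Complex.exp (Complex.I * ((n * θ - x * Real.sin θ : ℝ) : ℂ))‖ ≤ 15 / √(x * ς) := by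
    intro q hq
    have := vanDerCorput_one (a := θa) (b := q) (R := 1) (μ := 3/2 / √(x * ς)) hq.1
      (by positivity) (Φ := fun θ => n * θ - x * Real.sin θ) (ρ := fun _ => 1)
      (g := fun θ => n - x * Real.cos θ) (g₁ := fun θ => x * Real.sin θ)
      (fun θ _ => by rw [one_mul]; exact hasDerivAt_besselPhase n x θ) continuousOn_const
      (fun _ _ => by simp) (fun θ _ => hasDerivAt_besselPhase₁ n x θ) (by fun_prop)
      (Or.inl fun θ h => by
        have h1 := (hmid θ ⟨h.1.le, h.2.le.trans hq.2⟩).1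
        rw [div_pow, hWsq, inv_div]
        have : x * (ς / 2) ≤ x * Real.sin θ := by gcongr
        have h3 : 0 < x * ς := by positivity
        refine le_trans ?_ this
        rw [div_le_iff₀ (by norm_num)]
        nlinarith)
    refine this.trans (le_of_eq ?_)
    ring
  have b2 : ‖∫ θ in θa..θb, f θ‖ ≤ 15 / √(x * ς) * (M + V) := by
    have := norm_integral_amplitude_le hab (f := fun θ => ((1:ℝ):ℂ) *
      Complex.exp (Complex.I * ((n * θ - x * Real.sin θ : ℝ) : ℂ))) (A := fun θ => (a θ : ℂ))
      (A' := fun θ => (a' θ : ℂ)) (M := M) (V := V) (by fun_prop) hmB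
      (fun θ _ => (ha θ).ofReal_comp) (by fun_prop)
      (by
        rw [Complex.norm_real]
        exact hM θb ⟨ha0.trans hab, hbπ⟩ (hmid θb (Set.right_mem_Icc.2 hab)).2)
      (by
        simp only [Complex.norm_real, Real.norm_eq_abs]
        exact hV θa θb ha0 hab hbπ (fun θ h => (hmid θ h).2) hcosb.ge)
    refine le_trans (le_of_eq ?_) this
    simp [hf]
  change ‖∫ θ in (0:ℝ)..π, f θ‖ ≤ _
  rw [e]
  refine norm_add₃_le.trans ?_
  linarith

lemma inv_mul_sq_le_inv_sqrt {x ς : ℝ} (hx : 0 < x) (hς : 0 < ς) (h : 1 ≤ x * ς ^ 3) :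
    1 / (x * ς ^ 2) ≤ 1 / √(x * ς) := by
  refine one_div_le_one_div_of_le (Real.sqrt_pos.2 (by positivity)) ?_
  rw [Real.sqrt_le_left (by positivity)]
  have : (x * ς ^ 2) ^ 2 = (x * ς) * (x * ς ^ 3) := by ring
  rw [this]
  exact le_mul_of_one_le_right (by positivity) h

/-- Decay of the Bessel function in the oscillatory region. -/
lemma abs_besselY_le (n : ℕ) {x ς : ℝ} (hx : 0 < x) (hς : 0 < ς)
    (hςx : ς ^ 2 = 1 - (n / x) ^ 2) (h : 1 ≤ x * ς ^ 3) :
    |besselY n x| ≤ 50 / √(x * ς) := by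
  rw [besselY_eq_re]
  refine (Complex.abs_re_le_norm _).trans ?_
  have := norm_integral_bessel_le n (U := 4 / (x * ς ^ 2)) (M := 1) (V := 0) hx hς hςx
    (a := fun _ => 1) (a' := fun _ => 0) (fun θ => hasDerivAt_const _ _) continuous_const
    (fun θ hθ => by
      have := Real.sin_nonneg_of_nonneg_of_le_pi hθ.1 hθ.2
      have : 0 ≤ x * Real.sin θ := by positivity
      linarith)
    (fun θ hθ h1 _ => by
      rw [abs_one, div_mul_eq_mul_div, le_div_iff₀ (by positivity)]
      nlinarith)
    (fun _ _ _ => by simp) (fun p q _ _ _ _ _ => by simp)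
  refine this.trans ?_
  have h2 := inv_mul_sq_le_inv_sqrt hx hς h
  have e : 8 * (4 / (x * ς ^ 2)) = 32 * (1 / (x * ς ^ 2)) := by ring
  have e2 : 50 / √(x * ς) = 50 * (1 / √(x * ς)) := by ring
  have e3 : 15 / √(x * ς) * (1 + 0) = 15 * (1 / √(x * ς)) := by ring
  have h3 : 0 < 1 / √(x * ς) := by positivity
  rw [e, e2, e3]
  linarith

/-- Decay of the derivative of the Bessel function in the oscillatory region. -/
lemma abs_besselY'_le (n : ℕ) {x ς : ℝ} (hx : 0 < x) (hς : 0 < ς)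
    (hςx : ς ^ 2 = 1 - (n / x) ^ 2) (h : 1 ≤ x * ς ^ 3) :
    |besselY' n x| ≤ 150 * ς / √(x * ς) := by
  rw [besselY'_eq_im]
  refine (Complex.abs_im_le_norm _).trans ?_
  have hc0 : (0:ℝ) ≤ n / x := by positivity
  have hc1 : (n:ℝ) / x < 1 := by nlinarith
  have hnx : (n:ℝ) = x * (n / x) := by field_simp
  have := norm_integral_bessel_le n (U := 5 / (x * ς)) (M := 3 / 2 * ς) (V := 5 * ς) hx hς hςx
    (a := Real.sin) (a' := Real.cos) Real.hasDerivAt_sin Real.continuous_cos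
    (fun θ hθ => by
      have e : Real.cos θ * (n - x * Real.cos θ) - Real.sin θ * (x * Real.sin θ)
        = x * ((n / x) * Real.cos θ - (Real.sin θ ^ 2 + Real.cos θ ^ 2)) := by
          field_simp; ring
      rw [e, Real.sin_sq_add_cos_sq]
      refine mul_nonpos_of_nonneg_of_nonpos hx.le ?_
      have := mul_le_mul_of_nonneg_left (Real.cos_le_one θ) hc0
      linarith)
    (fun θ hθ _ h1 => by
      rw [abs_of_nonneg (Real.sin_nonneg_of_nonneg_of_le_pi hθ.1 hθ.2), div_mul_eq_mul_div,
        le_div_iff₀ (by positivity)]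
      nlinarith)
    (fun θ hθ h1 => by rwa [abs_of_nonneg (Real.sin_nonneg_of_nonneg_of_le_pi hθ.1 hθ.2)])
    (fun p q hp hpq hq hs hcq => by
      by_cases hc3 : (n:ℝ) / x < 1 / 3
      · have h1 : 4/5 ≤ ς := by nlinarith
        have h2 : ∫ θ in p..q, |Real.cos θ| ≤ ∫ θ in p..q, (1:ℝ) :=
          intervalIntegral.integral_mono_on hpq
            ((by fun_prop : Continuous _).intervalIntegrable _ _)
            (intervalIntegrable_const) fun θ _ => Real.abs_cos_le_one θ
        rw [intervalIntegral.integral_const] at h2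
        have h3 := Real.pi_lt_four
        simp only [smul_eq_mul, mul_one] at h2
        linarith
      · have hq2 : q ≤ π / 2 := by
          by_contra hcon
          push Not at hcon
          have := Real.cos_neg_of_pi_div_two_lt_of_lt hcon (by linarith [Real.pi_pos])
          linarith
        have := integral_abs_deriv_le hpq (u := Real.sin) (u' := Real.cos) (μ := 3 / 2 * ς)
          (fun θ _ => Real.hasDerivAt_sin θ) (by fun_prop)
          (Or.inl fun θ h => Real.cos_nonneg_of_mem_Icc ⟨by linarith [h.1, Real.pi_pos],
            by linarith [h.2]⟩)
          (fun θ h => by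
            rw [abs_of_nonneg (Real.sin_nonneg_of_nonneg_of_le_pi (hp.trans h.1)
              (h.2.trans hq))]
            exact hs θ h)
        linarith)
  refine this.trans ?_
  have h2 := inv_mul_sq_le_inv_sqrt hx hς h
  have h4 : 1 / (x * ς) ≤ ς * (1 / √(x * ς)) := by
    have : 1 / (x * ς) = ς * (1 / (x * ς ^ 2)) := by field_simp
    rw [this]; gcongr
  have e : 8 * (5 / (x * ς)) = 40 * (1 / (x * ς)) := by ring
  have e2 : 150 * ς / √(x * ς) = 150 * (ς * (1 / √(x * ς))) := by ring
  have e3 : 15 / √(x * ς) * (3 / 2 * ς + 5 * ς) = 195/2 * (ς * (1 / √(x * ς))) := by ring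
  have h3 : 0 < ς * (1 / √(x * ς)) := by positivity
  rw [e, e2, e3]
  linarith

lemma integral_inv_add_sq_le {δ : ℝ} (hδ : 0 < δ) :
    ∫ θ in (0:ℝ)..π, (δ + θ ^ 2 / 5)⁻¹ ≤ 4 / √δ := by
  have hs : 0 < √δ := Real.sqrt_pos.2 hδ
  have hs2 : √δ ^ 2 = δ := Real.sq_sqrt hδ.le
  have h5 : √5 ^ 2 = 5 := Real.sq_sqrt (by norm_num)
  have h50 : 0 < √5 := by positivity
  have hd : ∀ θ ∈ Set.uIcc 0 π, HasDerivAt (fun θ => √5 / √δ * Real.arctan (θ / (√5 * √δ)))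
      (δ + θ ^ 2 / 5)⁻¹ θ := by
    intro θ _
    have h1 := ((hasDerivAt_id θ).div_const (√5 * √δ)).arctan.const_mul (√5 / √δ)
    refine h1.congr_deriv ?_
    have h2 : (id θ / (√5 * √δ)) ^ 2 = θ ^ 2 / (5 * δ) := by
      rw [div_pow, mul_pow, h5, hs2, id]
    rw [h2]
    rw [show (5:ℝ) * δ = 5 * √δ ^ 2 by rw [hs2], show δ + θ ^ 2 / 5 = √δ ^ 2 + θ ^ 2 / 5 by rw [hs2]]
    generalize √δ = s at *
    field_simp
  rw [intervalIntegral.integral_eq_sub_of_hasDerivAt hd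
    (Continuous.intervalIntegrable (by
      refine Continuous.inv₀ (by fun_prop) fun θ => ?_
      positivity) _ _)]
  simp only [zero_div, Real.arctan_zero, mul_zero, sub_zero]
  rw [div_mul_eq_mul_div]
  gcongr
  have h1 := (Real.arctan_lt_pi_div_two (π / (√5 * √δ))).le
  have h2 : √5 ≤ 9/4 := Real.sqrt_le_iff.2 ⟨by norm_num, by norm_num⟩
  have h3 := Real.pi_lt_d2
  calc √5 * Real.arctan (π / (√5 * √δ)) ≤ 9/4 * (π / 2) := by
        gcongr
    _ ≤ 4 := by linarith

/-- Decay of the Bessel function in the exponentially small region. -/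
lemma abs_besselY_le_of_lt (n : ℕ) {x δ : ℝ} (hx : 0 < x) (hδ : 0 < δ)
    (hn : (n:ℝ) = x * (1 + δ)) : |besselY n x| ≤ 28 / (x ^ 2 * δ ^ 2 * √δ) := by
  have hpi := Real.pi_pos
  set g : ℝ → ℝ := fun θ => n - x * Real.cos θ with hg
  have hglow : ∀ θ ∈ Set.Icc 0 π, x * (δ + θ ^ 2 / 5) ≤ g θ := by
    intro θ hθ
    have h1 := Real.cos_le_one_sub_mul_cos_sq (x := θ) (by rw [abs_of_nonneg hθ.1]; exact hθ.2)
    have h2 : Real.cos θ ≤ 1 - θ ^ 2 / 5 := by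
      refine h1.trans ?_
      have h3 : π ^ 2 ≤ 10 := by nlinarith [Real.pi_lt_d2]
      have : θ ^ 2 / 5 ≤ 2 / π ^ 2 * θ ^ 2 := by
        rw [div_mul_eq_mul_div, div_le_div_iff₀ (by norm_num) (by positivity)]
        nlinarith [sq_nonneg θ]
      linarith
    rw [hg]; simp only; rw [hn]
    nlinarith
  have hgδ : ∀ θ ∈ Set.Icc 0 π, x * δ ≤ g θ := fun θ hθ =>
    le_trans (by gcongr; nlinarith [sq_nonneg θ]) (hglow θ hθ)
  have hgpos : ∀ θ ∈ Set.Icc 0 π, 0 < g θ := fun θ hθ =>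
    lt_of_lt_of_le (by positivity) (hgδ θ hθ)
  have hne : ∀ θ ∈ Set.Icc 0 π, g θ ≠ 0 := fun θ hθ => (hgpos θ hθ).ne'
  have hgc : Continuous g := by fun_prop
  have hgd : ∀ θ, HasDerivAt g (x * Real.sin θ) θ := fun θ => hasDerivAt_besselPhase₁ n x θ
  have hI : Set.uIcc 0 π = Set.Icc 0 π := Set.uIcc_of_le hpi.le
  -- first integration by parts
  set Φ : ℝ → ℝ := fun θ => n * θ - x * Real.sin θ with hΦ
  have hΦd : ∀ θ, HasDerivAt Φ (g θ) θ := fun θ => hasDerivAt_besselPhase n x θ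
  have hΦc : Continuous Φ := by fun_prop
  set U : ℝ → ℝ := fun θ => x * Real.sin θ / g θ ^ 3 with hU
  set U' : ℝ → ℝ := fun θ => (x * Real.cos θ * g θ ^ 3 - x * Real.sin θ *
    (3 * g θ ^ 2 * (x * Real.sin θ))) / (g θ ^ 3) ^ 2 with hU'
  have hUd : ∀ θ ∈ Set.Icc 0 π, HasDerivAt U (U' θ) θ := by
    intro θ hθ
    have h1 : HasDerivAt (fun θ => g θ ^ 3) (3 * g θ ^ 2 * (x * Real.sin θ)) θ := by
      simpa using (hgd θ).fun_pow 3
    exact ((Real.hasDerivAt_sin θ).const_mul x).fun_div h1 (pow_ne_zero _ (hne θ hθ))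
  have hU'c : ContinuousOn U' (Set.Icc 0 π) :=
    ContinuousOn.div (by fun_prop) (by fun_prop) fun θ hθ =>
      pow_ne_zero _ (pow_ne_zero _ (hne θ hθ))
  have step : besselY n x = ∫ θ in (0:ℝ)..π, U θ * g θ * Real.sin (Φ θ) := by
    have key := intervalIntegral.integral_mul_deriv_eq_deriv_mul (a := 0) (b := π)
      (u := fun θ => (g θ)⁻¹) (u' := fun θ => -(x * Real.sin θ) / g θ ^ 2)
      (v := fun θ => Real.sin (Φ θ)) (v' := fun θ => Real.cos (Φ θ) * g θ)
      (by rw [hI]; exact fun θ hθ => (hgd θ).fun_inv (hne θ hθ))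
      (fun θ _ => (hΦd θ).sin)
      (ContinuousOn.intervalIntegrable (by
        rw [hI]
        exact ContinuousOn.div (by fun_prop) (by fun_prop) fun θ hθ => pow_ne_zero _ (hne θ hθ)))
      ((by fun_prop : Continuous _).intervalIntegrable _ _)
    have e1 : ∫ θ in (0:ℝ)..π, (g θ)⁻¹ * (Real.cos (Φ θ) * g θ) = besselY n x := by
      refine intervalIntegral.integral_congr fun θ hθ => ?_
      rw [hI] at hθ
      have := hne θ hθ
      simp only [hΦ]
      field_simp
    have e2 : Real.sin (Φ π) = 0 := by simp [hΦ]
    have e3 : Real.sin (Φ 0) = 0 := by simp [hΦ]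
    rw [e1, e2, e3] at key
    rw [key, mul_zero, mul_zero, sub_zero, zero_sub, ← intervalIntegral.integral_neg]
    refine intervalIntegral.integral_congr fun θ hθ => ?_
    rw [hI] at hθ
    have := hne θ hθ
    simp only [hU]
    field_simp
  have hbound : ∀ θ ∈ Set.Icc 0 π, |U' θ| ≤ 7 / (x ^ 2 * δ ^ 2) * (δ + θ ^ 2 / 5)⁻¹ := by
    intro θ hθ
    have hgp := hgpos θ hθ
    have hsq : x * Real.sin θ ^ 2 ≤ 2 * g θ := by
      rw [Real.sin_sq, hg]; simp only; rw [hn]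
      have h0 : 0 ≤ x * δ := by positivity
      have h1 : 0 ≤ x * (1 - Real.cos θ) ^ 2 := by positivity
      nlinarith
    have h1 : |U' θ| ≤ 7 * x / g θ ^ 3 := by
      have e : U' θ = (x * Real.cos θ * g θ - 3 * x * (x * Real.sin θ ^ 2)) / g θ ^ 4 := by
        simp only [hU']; field_simp
      rw [e, abs_div, abs_of_pos (by positivity : 0 < g θ ^ 4),
        div_le_div_iff₀ (by positivity) (by positivity)]
      have h2 : |x * Real.cos θ * g θ - 3 * x * (x * Real.sin θ ^ 2)| ≤ 7 * x * g θ := by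
        have ha : |x * Real.cos θ * g θ| ≤ x * g θ := by
          rw [abs_mul, abs_mul, abs_of_pos hx, abs_of_pos hgp]
          have := Real.abs_cos_le_one θ
          have h3 : 0 ≤ x * g θ := by positivity
          nlinarith
        have hb : |3 * x * (x * Real.sin θ ^ 2)| ≤ 6 * x * g θ := by
          rw [abs_of_nonneg (by positivity)]
          nlinarith
        calc _ ≤ _ := norm_sub_le (x * Real.cos θ * g θ) (3 * x * (x * Real.sin θ ^ 2))
          _ ≤ _ := by simp only [Real.norm_eq_abs]; linarith
      calc _ ≤ 7 * x * g θ * g θ ^ 3 := by gcongr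
        _ = _ := by ring
    refine h1.trans ?_
    have h3 : x ^ 3 * δ ^ 2 * (δ + θ ^ 2 / 5) ≤ g θ ^ 3 := by
      have : x ^ 3 * δ ^ 2 * (δ + θ ^ 2 / 5) = (x * δ) ^ 2 * (x * (δ + θ ^ 2 / 5)) := by ring
      rw [this, pow_succ (g θ)]
      gcongr
      · exact hgδ θ hθ
      · exact hglow θ hθ
    calc 7 * x / g θ ^ 3 ≤ 7 * x / (x ^ 3 * δ ^ 2 * (δ + θ ^ 2 / 5)) := by gcongr
      _ = _ := by field_simp
  have hint : IntervalIntegrable (fun θ : ℝ => (δ + θ ^ 2 / 5)⁻¹) volume 0 π :=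
    Continuous.intervalIntegrable (by
      refine Continuous.inv₀ (by fun_prop) fun θ => ?_
      positivity) _ _
  have hV : ∫ θ in (0:ℝ)..π, ‖(U' θ : ℂ)‖ ≤ 28 / (x ^ 2 * δ ^ 2 * √δ) := by
    calc ∫ θ in (0:ℝ)..π, ‖(U' θ : ℂ)‖
        ≤ ∫ θ in (0:ℝ)..π, 7 / (x ^ 2 * δ ^ 2) * (δ + θ ^ 2 / 5)⁻¹ := by
          refine intervalIntegral.integral_mono_on hpi.le ?_ (hint.const_mul _) fun θ hθ => ?_
          · refine ContinuousOn.intervalIntegrable ?_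
            rw [hI]
            exact (Complex.continuous_ofReal.comp_continuousOn hU'c).norm
          · rw [Complex.norm_real]; exact hbound θ hθ
      _ ≤ 7 / (x ^ 2 * δ ^ 2) * (4 / √δ) := by
          rw [intervalIntegral.integral_const_mul]
          gcongr
          exact integral_inv_add_sq_le hδ
      _ = _ := by field_simp; norm_num
  have main := norm_integral_mul_deriv_cexp_le hpi.le (u := fun θ => (U θ : ℂ))
    (u' := fun θ => (U' θ : ℂ)) (μ := 0) (fun θ _ => hΦd θ) hgc.continuousOn
    (fun θ hθ => (hUd θ hθ).ofReal_comp) (Complex.continuous_ofReal.comp_continuousOn hU'c)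
    (by simp [hU]) (by simp [hU]) hV
  have e : besselY n x = (∫ θ in (0:ℝ)..π, (U θ : ℂ) * (g θ : ℂ) *
      Complex.exp (Complex.I * (Φ θ : ℂ))).im := by
    rw [step, ← Complex.imCLM_apply, ← ContinuousLinearMap.intervalIntegral_comp_comm]
    · refine intervalIntegral.integral_congr fun θ _ => ?_
      simp only [Complex.imCLM_apply]
      rw [mul_comm Complex.I, ← Complex.ofReal_mul, Complex.im_ofReal_mul,
        Complex.exp_ofReal_mul_I_im]
    · refine ContinuousOn.intervalIntegrable ?_
      rw [hI]
      have hUc : ContinuousOn U (Set.Icc 0 π) := continuousOn_of_hasDerivAt hUd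
      exact ((Complex.continuous_ofReal.comp_continuousOn hUc).mul
        (by fun_prop)).mul (by fun_prop)
  rw [e]
  refine (Complex.abs_im_le_norm _).trans (main.trans (by simp))

/-- The phase function of the Bessel function `J_n`. -/
def besselθ (n : ℕ) (x : ℝ) : ℝ := √(x ^ 2 - (n:ℝ) ^ 2) - n * Real.arccos (n / x)

lemma hasDerivAt_besselθ (n : ℕ) {x : ℝ} (hx : (n:ℝ) < x) :
    HasDerivAt (besselθ n) (√(1 - (n / x) ^ 2)) x := by
  have hn : (0:ℝ) ≤ n := Nat.cast_nonneg n
  have hx0 : 0 < x := hn.trans_lt hx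
  have hc0 : (0:ℝ) ≤ n / x := by positivity
  have hc1 : (n:ℝ) / x < 1 := (div_lt_one hx0).2 hx
  have hpos : 0 < x ^ 2 - (n:ℝ) ^ 2 := by nlinarith
  have hq : 0 < 1 - (n / x : ℝ) ^ 2 := by nlinarith
  have e : √(x ^ 2 - (n:ℝ) ^ 2) = x * √(1 - (n / x) ^ 2) := by
    rw [← Real.sqrt_sq hx0.le, ← Real.sqrt_mul (by positivity), Real.sqrt_sq hx0.le]
    congr 1; field_simp
  have hr : 0 < √(1 - (n / x : ℝ) ^ 2) := Real.sqrt_pos.2 hq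
  have hr2 : √(1 - (n / x : ℝ) ^ 2) ^ 2 = 1 - (n / x : ℝ) ^ 2 := Real.sq_sqrt hq.le
  have h1 : HasDerivAt (fun x : ℝ => √(x ^ 2 - (n:ℝ) ^ 2)) (2 * x / (2 * √(x ^ 2 - (n:ℝ) ^ 2))) x := by
    have : HasDerivAt (fun x : ℝ => x ^ 2 - (n:ℝ) ^ 2) (2 * x) x := by
      simpa using (hasDerivAt_pow 2 x).sub_const ((n:ℝ) ^ 2)
    exact this.sqrt hpos.ne'
  have h2 : HasDerivAt (fun x : ℝ => (n:ℝ) / x) (-(n:ℝ) / x ^ 2) x := by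
    simpa using (hasDerivAt_const x (n:ℝ)).fun_div (hasDerivAt_id x) hx0.ne'
  have h3 := (Real.hasDerivAt_arccos (x := (n:ℝ) / x) (by linarith) (by linarith)).comp x h2
  refine (h1.sub (h3.const_mul (n:ℝ))).congr_deriv ?_
  rw [e]
  set r := √(1 - (n / x : ℝ) ^ 2)
  have : (n:ℝ) ^ 2 = x ^ 2 * (1 - r ^ 2) := by rw [hr2]; field_simp; ring
  field_simp
  linarith

/-- The amplitude of the oscillating representation of the Bessel function. -/
def besselA (n : ℕ) (x : ℝ) : ℂ :=
  Complex.exp (Complex.I * ((-besselθ n x : ℝ) : ℂ)) *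
    ((besselY n x : ℂ) + (besselY' n x / √(1 - (n / x) ^ 2) : ℝ) / Complex.I) / 2

/-- The derivative of `besselA`. -/
def besselA' (n : ℕ) (x : ℝ) : ℂ :=
  Complex.exp (Complex.I * ((-besselθ n x : ℝ) : ℂ)) *
    ((-besselY' n x / (x * √(1 - (n / x) ^ 2) ^ 3) : ℝ) / Complex.I) / 2

lemma hasDerivAt_besselA (n : ℕ) {x : ℝ} (hx : (n:ℝ) < x) :
    HasDerivAt (besselA n) (besselA' n x) x := by
  have hn : (0:ℝ) ≤ n := Nat.cast_nonneg n
  have hx0 : 0 < x := hn.trans_lt hx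
  have hc0 : (0:ℝ) ≤ n / x := by positivity
  have hc1 : (n:ℝ) / x < 1 := (div_lt_one hx0).2 hx
  have hq : 0 < 1 - (n / x : ℝ) ^ 2 := by nlinarith
  have hr : 0 < √(1 - (n / x : ℝ) ^ 2) := Real.sqrt_pos.2 hq
  have hr2 : √(1 - (n / x : ℝ) ^ 2) ^ 2 = 1 - (n / x : ℝ) ^ 2 := Real.sq_sqrt hq.le
  have h2 : HasDerivAt (fun x : ℝ => (n:ℝ) / x) (-(n:ℝ) / x ^ 2) x := by
    simpa using (hasDerivAt_const x (n:ℝ)).fun_div (hasDerivAt_id x) hx0.ne'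
  have h3 : HasDerivAt (fun x : ℝ => 1 - ((n:ℝ) / x) ^ 2) (2 * (n:ℝ) ^ 2 / x ^ 3) x := by
    refine ((h2.fun_pow 2).const_sub 1).congr_deriv ?_
    push_cast; field_simp
  have h4 := h3.sqrt hq.ne'
  have h5 := (hasDerivAt_besselY' n x).fun_div h4 hr.ne'
  have h6 := ((hasDerivAt_besselY n x).ofReal_comp).fun_add (h5.ofReal_comp.div_const Complex.I)
  have h7 := hasDerivAt_cexp_I (hasDerivAt_besselθ n hx).fun_neg
  refine ((h7.fun_mul h6).div_const 2).congr_deriv ?_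
  rw [besselA']
  have hode := besselY_ode n x
  have hn2 : (n:ℝ) ^ 2 = x ^ 2 * (1 - √(1 - (n / x : ℝ) ^ 2) ^ 2) := by
    rw [hr2]; field_simp; ring
  generalize √(1 - (n / x : ℝ) ^ 2) = r at *
  rw [hn2] at hode
  have hy'' : besselY'' n x = - besselY' n x / x - r ^ 2 * besselY n x := by
    field_simp
    have : x * (x * besselY'' n x + besselY' n x + x * r ^ 2 * besselY n x) = 0 := by
      linear_combination hode
    rcases mul_eq_zero.1 this with h | h
    · exact absurd h hx0.ne'
    · linear_combination h
  rw [hy'', hn2]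
  have hrc : (r : ℂ) ≠ 0 := by exact_mod_cast hr.ne'
  have hxc : (x : ℂ) ≠ 0 := by exact_mod_cast hx0.ne'
  push_cast
  rw [← sub_eq_zero]
  field_simp
  ring_nf
  simp only [Complex.I_sq]
  ring

lemma besselY_eq_besselA (n : ℕ) (x : ℝ) :
    (besselY n x : ℂ) = besselA n x * Complex.exp (Complex.I * (besselθ n x : ℂ)) +
      (starRingEnd ℂ) (besselA n x) * Complex.exp (Complex.I * ((-besselθ n x : ℝ) : ℂ)) := by
  have h1 : Complex.exp (Complex.I * ((-besselθ n x : ℝ) : ℂ)) *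
      Complex.exp (Complex.I * (besselθ n x : ℂ)) = 1 := by
    rw [← Complex.exp_add]; simp
  have h2 : (starRingEnd ℂ) (besselA n x) = Complex.exp (Complex.I * (besselθ n x : ℂ)) *
    ((besselY n x : ℂ) - (besselY' n x / √(1 - (n / x) ^ 2) : ℝ) / Complex.I) / 2 := by
    rw [besselA]
    simp only [map_div₀, map_mul, map_add, ← Complex.exp_conj, Complex.conj_I, Complex.conj_ofReal,
      map_ofNat]
    congr 2
    · push_cast; ring_nf
    · simp only [div_neg, sub_eq_add_neg]
  rw [h2, besselA]
  linear_combination (-(besselY n x : ℂ)) * h1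

lemma norm_besselA_le (n : ℕ) {x ς : ℝ} (hx : 0 < x) (hς : 0 < ς)
    (hςx : ς ^ 2 = 1 - (n / x) ^ 2) (h : 1 ≤ x * ς ^ 3) :
    ‖besselA n x‖ ≤ 100 / √(x * ς) ∧ ‖besselA' n x‖ ≤ 100 / √(x * ς) / (x * ς ^ 2) := by
  have hy := abs_besselY_le n hx hς hςx h
  have hy' := abs_besselY'_le n hx hς hςx h
  have hr : √(1 - (n / x : ℝ) ^ 2) = ς := by rw [← hςx, Real.sqrt_sq hς.le]
  have hW : 0 < √(x * ς) := Real.sqrt_pos.2 (by positivity)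
  constructor
  · rw [besselA, hr, norm_div, norm_mul, norm_cexp_I_mul, one_mul]
    have h1 : ‖(besselY n x : ℂ) + (besselY' n x / ς : ℝ) / Complex.I‖ ≤ 200 / √(x * ς) := by
      refine (norm_add_le _ _).trans ?_
      rw [norm_div, Complex.norm_I, div_one, Complex.norm_real, Complex.norm_real,
        Real.norm_eq_abs, Real.norm_eq_abs, abs_div, abs_of_pos hς]
      have h2 : |besselY' n x| / ς ≤ 150 / √(x * ς) := by
        rw [div_le_iff₀ hς]; refine hy'.trans (le_of_eq ?_); ring
      have e : 200 / √(x * ς) = 50 / √(x * ς) + 150 / √(x * ς) := by ring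
      rw [e]; gcongr
    have e2 : ‖(2:ℂ)‖ = 2 := by simp
    rw [e2, div_le_iff₀ (by norm_num)]
    refine h1.trans (le_of_eq ?_); ring
  · rw [besselA', hr, norm_div, norm_mul, norm_cexp_I_mul, one_mul, norm_div, Complex.norm_I,
      div_one, Complex.norm_real, Real.norm_eq_abs, abs_div, abs_neg,
      abs_of_pos (by positivity : 0 < x * ς ^ 3)]
    have e2 : ‖(2:ℂ)‖ = 2 := by simp
    rw [e2]
    calc |besselY' n x| / (x * ς ^ 3) / 2 ≤ 150 * ς / √(x * ς) / (x * ς ^ 3) / 2 := by gcongr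
      _ = 75 / √(x * ς) / (x * ς ^ 2) := by field_simp; norm_num
      _ ≤ _ := by gcongr; norm_num

/-- One integration by parts against `e^{-itv²}`, at the level of amplitudes `P(b,v)`. -/
def ibpAmp (P : ℝ × ℝ → ℝ) (p : ℝ × ℝ) : ℝ := fderiv ℝ (fun q => P q / (2 * q.2)) p (0, 1)

section NonStationary

variable {P : ℝ × ℝ → ℝ} {U : Set (ℝ × ℝ)}

lemma contDiffOn_ibpAux (hU0 : ∀ p ∈ U, 0 < p.2) (hP : ContDiffOn ℝ ((⊤ : ℕ∞) : WithTop ℕ∞) P U) :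
    ContDiffOn ℝ ((⊤ : ℕ∞) : WithTop ℕ∞) (fun q => P q / (2 * q.2)) U :=
  hP.div (contDiffOn_const.mul contDiffOn_snd) fun p hp => by have := hU0 p hp; positivity

lemma contDiffOn_ibpAmp (hU : IsOpen U) (hU0 : ∀ p ∈ U, 0 < p.2)
    (hP : ContDiffOn ℝ ((⊤ : ℕ∞) : WithTop ℕ∞) P U) :
    ContDiffOn ℝ ((⊤ : ℕ∞) : WithTop ℕ∞) (ibpAmp P) U := by
  have := (contDiffOn_ibpAux hU0 hP).fderiv_of_isOpen hU
    (m := ((⊤ : ℕ∞) : WithTop ℕ∞)) (by norm_cast)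
  exact this.clm_apply contDiffOn_const

lemma hasDerivAt_ibpAmp (hU : IsOpen U) (hU0 : ∀ p ∈ U, 0 < p.2)
    (hP : ContDiffOn ℝ ((⊤ : ℕ∞) : WithTop ℕ∞) P U) {b v : ℝ} (h : (b, v) ∈ U) :
    HasDerivAt (fun v => P (b, v) / (2 * v)) (ibpAmp P (b, v)) v := by
  have h1 : DifferentiableAt ℝ (fun q : ℝ × ℝ => P q / (2 * q.2)) (b, v) :=
    (((contDiffOn_ibpAux hU0 hP).contDiffAt (hU.mem_nhds h))).differentiableAt (by simp)
  have h2 : HasDerivAt (fun v : ℝ => (b, v)) ((0:ℝ), (1:ℝ)) v :=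
    (hasDerivAt_const v b).prodMk (hasDerivAt_id v)
  exact h1.hasFDerivAt.comp_hasDerivAt v h2

lemma ibpAmp_eventually (hU : IsOpen U) (hU0 : ∀ p ∈ U, 0 < p.2)
    (hP : ContDiffOn ℝ ((⊤ : ℕ∞) : WithTop ℕ∞) P U) {b v : ℝ} (h : (b, v) ∈ U)
    (hz : ∀ᶠ v' in nhds v, P (b, v') = 0) : ∀ᶠ v' in nhds v, ibpAmp P (b, v') = 0 := by
  have hmem : ∀ᶠ v' in nhds v, (b, v') ∈ U :=
    (Continuous.prodMk_right b).continuousAt.eventually_mem (hU.mem_nhds h)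
  filter_upwards [hmem, hz.eventually_nhds] with v' hv' hz'
  have h1 := hasDerivAt_ibpAmp hU hU0 hP hv'
  have h2 : (fun v => P (b, v) / (2 * v)) =ᶠ[nhds v'] fun _ => 0 := by
    filter_upwards [hz'] with w hw
    rw [hw, zero_div]
  exact h1.unique ((hasDerivAt_const v' (0:ℝ)).congr_of_eventuallyEq h2)

lemma norm_integral_ibpAmp (hU : IsOpen U) (hU0 : ∀ p ∈ U, 0 < p.2)
    (hP : ContDiffOn ℝ ((⊤ : ℕ∞) : WithTop ℕ∞) P U) {b v₀ v₁ t : ℝ} (ht : 0 < t) (hv : v₀ ≤ v₁)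
    (hb : ∀ v ∈ Set.Icc v₀ v₁, (b, v) ∈ U) (h0 : P (b, v₀) = 0) (h1 : P (b, v₁) = 0) :
    ‖∫ v in v₀..v₁, (P (b, v) : ℂ) * Complex.exp (Complex.I * ((-t * v ^ 2 : ℝ) : ℂ))‖ =
      ‖∫ v in v₀..v₁, (ibpAmp P (b, v) : ℂ) *
        Complex.exp (Complex.I * ((-t * v ^ 2 : ℝ) : ℂ))‖ / t := by
  have hI : Set.uIcc v₀ v₁ = Set.Icc v₀ v₁ := Set.uIcc_of_le hv
  have hc : ContinuousOn (fun v => ibpAmp P (b, v)) (Set.Icc v₀ v₁) :=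
    (contDiffOn_ibpAmp hU hU0 hP).continuousOn.comp (Continuous.prodMk_right b).continuousOn hb
  have hd : ∀ v, HasDerivAt (fun v : ℝ => -t * v ^ 2) (-t * (2 * v)) v := fun v => by
    simpa using (hasDerivAt_pow 2 v).const_mul (-t)
  have key := intervalIntegral.integral_mul_deriv_eq_deriv_mul (a := v₀) (b := v₁)
    (u := fun v => ((P (b, v) / (2 * v) : ℝ) : ℂ)) (u' := fun v => (ibpAmp P (b, v) : ℂ))
    (fun v hv' => (hasDerivAt_ibpAmp hU hU0 hP (hb v (hI ▸ hv'))).ofReal_comp)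
    (fun v _ => hasDerivAt_cexp_I (hd v))
    (ContinuousOn.intervalIntegrable (by
      rw [hI]; exact Complex.continuous_ofReal.comp_continuousOn hc))
    ((by fun_prop : Continuous _).intervalIntegrable _ _)
  simp only [h0, h1, zero_div, Complex.ofReal_zero, zero_mul, sub_zero, zero_sub] at key
  have e : ∫ v in v₀..v₁, ((P (b, v) / (2 * v) : ℝ) : ℂ) * (Complex.I * ((-t * (2 * v) : ℝ) : ℂ) *
      Complex.exp (Complex.I * ((-t * v ^ 2 : ℝ) : ℂ))) =
      (-(Complex.I * t)) * ∫ v in v₀..v₁, (P (b, v) : ℂ) *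
        Complex.exp (Complex.I * ((-t * v ^ 2 : ℝ) : ℂ)) := by
    rw [← intervalIntegral.integral_const_mul]
    refine intervalIntegral.integral_congr fun v hv' => ?_
    have : (v:ℂ) ≠ 0 := by exact_mod_cast (hU0 _ (hb v (hI ▸ hv'))).ne'
    push_cast
    field_simp
  rw [e] at key
  have := congrArg norm key
  rw [norm_mul, norm_neg, norm_neg, norm_mul, Complex.norm_I, one_mul, Complex.norm_real,
    Real.norm_eq_abs, abs_of_pos ht] at this
  rw [← this]; field_simp

lemma exists_norm_integral_nonstationary_le (hU : IsOpen U) (hU0 : ∀ p ∈ U, 0 < p.2)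
    (hP : ContDiffOn ℝ ((⊤ : ℕ∞) : WithTop ℕ∞) P U) {K : Set ℝ} (hK : IsCompact K) {v₀ v₁ : ℝ}
    (hv : v₀ ≤ v₁) (hb : ∀ b ∈ K, ∀ v ∈ Set.Icc v₀ v₁, (b, v) ∈ U)
    (h0 : ∀ b ∈ K, ∀ᶠ v in nhds v₀, P (b, v) = 0) (h1 : ∀ b ∈ K, ∀ᶠ v in nhds v₁, P (b, v) = 0) :
    ∃ C, ∀ b ∈ K, ∀ t > 0,
      ‖∫ v in v₀..v₁, (P (b, v) : ℂ) * Complex.exp (Complex.I * ((-t * v ^ 2 : ℝ) : ℂ))‖ ≤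
        C / t ^ 2 := by
  have hP1 := contDiffOn_ibpAmp hU hU0 hP
  have hP2 := contDiffOn_ibpAmp hU hU0 hP1
  obtain ⟨B, hB⟩ := (hK.prod (isCompact_Icc (a := v₀) (b := v₁))).exists_bound_of_continuousOn
    (f := ibpAmp (ibpAmp P)) (hP2.continuousOn.mono fun p hp => hb p.1 hp.1 p.2 hp.2)
  refine ⟨B * |v₁ - v₀|, fun b hbK t ht => ?_⟩
  have hm0 := hb b hbK v₀ (Set.left_mem_Icc.2 hv)
  have hm1 := hb b hbK v₁ (Set.right_mem_Icc.2 hv)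
  rw [norm_integral_ibpAmp hU hU0 hP ht hv (hb b hbK) (h0 b hbK).self_of_nhds
    (h1 b hbK).self_of_nhds,
    norm_integral_ibpAmp hU hU0 hP1 ht hv (hb b hbK)
      (ibpAmp_eventually hU hU0 hP hm0 (h0 b hbK)).self_of_nhds
      (ibpAmp_eventually hU hU0 hP hm1 (h1 b hbK)).self_of_nhds, div_div, ← sq]
  gcongr
  refine intervalIntegral.norm_integral_le_of_norm_le_const fun v hv' => ?_
  rw [Set.uIoc_of_le hv] at hv'
  rw [norm_mul, norm_cexp_I_mul, mul_one, Complex.norm_real]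
  exact hB (b, v) ⟨hbK, hv'.1.le, hv'.2⟩

end NonStationary

/-- Smooth cutoff equal to `1` on `[1/2, 2]` and supported in `[1/4, 4]`. -/
def cutY (y : ℝ) : ℝ := Real.smoothTransition (4 * y - 1) * Real.smoothTransition (2 - y / 2)

/-- Smooth decreasing cutoff equal to `1` on `(-∞, 1/4]` and vanishing on `[1/2, ∞)`. -/
def cutV (v : ℝ) : ℝ := Real.smoothTransition (2 - 4 * v)

/-- The inverse on `(0, ∞)` of the map `y ↦ y - b / y`. -/
def subY (b v : ℝ) : ℝ := (v + √(v ^ 2 + 4 * b)) / 2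

/-- The amplitude in the variable `v = y - b / y`, for the measure `dy` (`e = 1`) or
`b y⁻² dy` (`e = -1`). -/
def subH (e b v : ℝ) : ℝ := cutY (subY b v) * ((1 + e * (v / √(v ^ 2 + 4 * b))) / 2)

/-- The nonstationary part of the amplitude. -/
def subP (e : ℝ) (p : ℝ × ℝ) : ℝ := subH e p.1 p.2 + subH e p.1 (-p.2) - cutV p.2

lemma contDiff_cutY : ContDiff ℝ ((⊤ : ℕ∞) : WithTop ℕ∞) cutY :=
  (Real.smoothTransition.contDiff.comp (by fun_prop)).mul
    (Real.smoothTransition.contDiff.comp (by fun_prop))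

lemma contDiff_cutV : ContDiff ℝ ((⊤ : ℕ∞) : WithTop ℕ∞) cutV :=
  Real.smoothTransition.contDiff.comp (by fun_prop)

lemma cutY_eq_one {y : ℝ} (h1 : 1/2 ≤ y) (h2 : y ≤ 2) : cutY y = 1 := by
  rw [cutY, Real.smoothTransition.one_of_one_le (by linarith),
    Real.smoothTransition.one_of_one_le (by linarith), one_mul]

lemma cutY_eq_zero {y : ℝ} (h : y ≤ 1/4 ∨ 4 ≤ y) : cutY y = 0 := by
  rcases h with h | h
  · rw [cutY, Real.smoothTransition.zero_of_nonpos (by linarith), zero_mul]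
  · rw [cutY, Real.smoothTransition.zero_of_nonpos (x := 2 - y / 2) (by linarith), mul_zero]

lemma cutV_eq_one {v : ℝ} (h : v ≤ 1/4) : cutV v = 1 :=
  Real.smoothTransition.one_of_one_le (by linarith)

lemma cutV_eq_zero {v : ℝ} (h : 1/2 ≤ v) : cutV v = 0 :=
  Real.smoothTransition.zero_of_nonpos (by linarith)

lemma contDiffOn_subP (e : ℝ) :
    ContDiffOn ℝ ((⊤ : ℕ∞) : WithTop ℕ∞) (subP e) {p | 0 < p.1 ∧ 0 < p.2} := by
  intro p hp
  refine ContDiffAt.contDiffWithinAt ?_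
  have hpos : (0:ℝ) < p.2 ^ 2 + 4 * p.1 := by have := hp.1; positivity
  have hpos' : (0:ℝ) < (-p.2) ^ 2 + 4 * p.1 := by rw [neg_sq]; exact hpos
  have hs : ContDiffAt ℝ ((⊤ : ℕ∞) : WithTop ℕ∞) (fun q : ℝ × ℝ => √(q.2 ^ 2 + 4 * q.1)) p :=
    ContDiffAt.sqrt (by fun_prop) hpos.ne'
  have hs' : ContDiffAt ℝ ((⊤ : ℕ∞) : WithTop ℕ∞) (fun q : ℝ × ℝ => √((-q.2) ^ 2 + 4 * q.1)) p :=
    ContDiffAt.sqrt (by fun_prop) hpos'.ne'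
  have hr := (Real.sqrt_pos.2 hpos).ne'
  have hr' := (Real.sqrt_pos.2 hpos').ne'
  have h1 : ContDiffAt ℝ ((⊤ : ℕ∞) : WithTop ℕ∞) (fun q : ℝ × ℝ => q.2) p := by fun_prop
  unfold subP subH subY
  refine ((ContDiffAt.mul ?_ ?_).add (ContDiffAt.mul ?_ ?_)).sub ?_
  · exact contDiff_cutY.contDiffAt.comp p ((h1.add hs).div_const 2)
  · exact (contDiffAt_const.add (contDiffAt_const.mul (h1.div hs hr))).div_const 2
  · exact contDiff_cutY.contDiffAt.comp p ((h1.neg.add hs').div_const 2)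
  · exact (contDiffAt_const.add (contDiffAt_const.mul (h1.neg.div hs' hr'))).div_const 2
  · exact contDiff_cutV.contDiffAt.comp p h1

lemma subY_pos {b : ℝ} (hb : 0 < b) (v : ℝ) : 0 < subY b v := by
  have h : |v| < √(v ^ 2 + 4 * b) := by
    rw [← Real.sqrt_sq_eq_abs]; exact Real.sqrt_lt_sqrt (sq_nonneg v) (by linarith)
  have := neg_abs_le v
  rw [subY]; linarith

lemma subY_sub {b : ℝ} (hb : 0 < b) (v : ℝ) : subY b v - b / subY b v = v := by
  have h := subY_pos hb v
  have hs : √(v ^ 2 + 4 * b) ^ 2 = v ^ 2 + 4 * b := Real.sq_sqrt (by positivity)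
  have e : subY b v ^ 2 - v * subY b v = b := by
    rw [subY]; linear_combination (1/4) * hs
  field_simp
  linear_combination e

lemma subY_add {b : ℝ} (hb : 0 < b) (v : ℝ) : subY b v + b / subY b v = √(v ^ 2 + 4 * b) := by
  have h1 := subY_sub hb v
  have : 2 * subY b v = v + √(v ^ 2 + 4 * b) := by rw [subY]; ring
  linarith

lemma hasDerivAt_subY {b : ℝ} (hb : 0 < b) (v : ℝ) :
    HasDerivAt (subY b) ((1 + v / √(v ^ 2 + 4 * b)) / 2) v := by
  have hpos : (0:ℝ) < v ^ 2 + 4 * b := by positivity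
  have h1 : HasDerivAt (fun v => v ^ 2 + 4 * b) (2 * v) v := by
    simpa using (hasDerivAt_pow 2 v).add_const (4 * b)
  refine (((hasDerivAt_id v).fun_add (h1.sqrt hpos.ne')).div_const 2).congr_deriv ?_
  have := Real.sqrt_pos.2 hpos
  field_simp

lemma subY_neg {b : ℝ} (hb : 0 < b) (v : ℝ) : subY b (-v) = b / subY b v := by
  have h1 := subY_sub hb v
  have : 2 * subY b (-v) = -v + √(v ^ 2 + 4 * b) := by rw [subY, neg_sq]; ring
  have := subY_add hb v
  linarith

lemma cutY_subY_eq_one {b v : ℝ} (hb : b ∈ Set.Icc (1/2 : ℝ) (5/2)) (hv : |v| ≤ 1/4) :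
    cutY (subY b v) = 1 := by
  obtain ⟨h1, h2⟩ := abs_le.1 hv
  have hv2 : v ^ 2 ≤ 1/16 := by nlinarith
  have ha : (5/4 : ℝ) ≤ √(v ^ 2 + 4 * b) :=
    Real.le_sqrt_of_sq_le (by nlinarith [sq_nonneg v, hb.1])
  have hc : √(v ^ 2 + 4 * b) ≤ 15/4 := Real.sqrt_le_iff.2 ⟨by norm_num, by nlinarith [hb.2]⟩
  exact cutY_eq_one (by rw [subY]; linarith) (by rw [subY]; linarith)

lemma cutY_subY_eq_zero {b v : ℝ} (hb : b ∈ Set.Icc (1/2 : ℝ) (5/2)) (hv : 10 ≤ v) :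
    cutY (subY b v) = 0 ∧ cutY (subY b (-v)) = 0 := by
  have hb0 : 0 < b := by linarith [hb.1]
  have h1 : v ≤ subY b v := by
    have := subY_sub hb0 v
    have : 0 < b / subY b v := div_pos hb0 (subY_pos hb0 v)
    linarith
  refine ⟨cutY_eq_zero (Or.inr (by linarith)), cutY_eq_zero (Or.inl ?_)⟩
  rw [subY_neg hb0, div_le_iff₀ (subY_pos hb0 v)]
  linarith [hb.2]

lemma subP_eq_zero_of_le {e b v : ℝ} (hb : b ∈ Set.Icc (1/2 : ℝ) (5/2)) (hv : |v| ≤ 1/4) :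
    subP e (b, v) = 0 := by
  rw [subP, subH, subH, cutY_subY_eq_one hb hv, cutY_subY_eq_one hb (by rwa [abs_neg]),
    cutV_eq_one ((abs_le.1 hv).2)]
  simp only [neg_sq, neg_div]
  ring

lemma subP_eq_zero_of_ge {e b v : ℝ} (hb : b ∈ Set.Icc (1/2 : ℝ) (5/2)) (hv : 10 ≤ v) :
    subP e (b, v) = 0 := by
  rw [subP, subH, subH, (cutY_subY_eq_zero hb hv).1, (cutY_subY_eq_zero hb hv).2,
    cutV_eq_zero (by simp only; linarith)]
  ring

/-- The reference oscillatory integral. -/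
def subD (t : ℝ) : ℂ :=
  ∫ v in (0:ℝ)..11, (cutV v : ℂ) * Complex.exp (Complex.I * ((-t * v ^ 2 : ℝ) : ℂ))

lemma continuous_subH (e : ℝ) {b : ℝ} (hb : 0 < b) : Continuous (subH e b) := by
  have h1 : Continuous fun v : ℝ => √(v ^ 2 + 4 * b) := by fun_prop
  have h2 : ∀ v : ℝ, √(v ^ 2 + 4 * b) ≠ 0 := fun v => (Real.sqrt_pos.2 (by positivity)).ne'
  unfold subH
  refine Continuous.mul (contDiff_cutY.continuous.comp ?_) ?_
  · unfold subY; fun_prop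
  · exact (continuous_const.add (continuous_const.mul (continuous_id.div h1 h2))).div_const 2

lemma exists_norm_subH_sub_subD_le (e : ℝ) : ∃ C, ∀ b ∈ Set.Icc (1/2 : ℝ) (5/2), ∀ t > 0,
    ‖(∫ v in (-11:ℝ)..11, (subH e b v : ℂ) * Complex.exp (Complex.I * ((-t * v ^ 2 : ℝ) : ℂ))) -
      subD t‖ ≤ C / t ^ 2 := by
  have hU : IsOpen {p : ℝ × ℝ | 0 < p.1 ∧ 0 < p.2} :=
    (isOpen_lt continuous_const continuous_fst).inter (isOpen_lt continuous_const continuous_snd)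
  obtain ⟨C, hC⟩ := exists_norm_integral_nonstationary_le hU (fun p hp => hp.2)
    (contDiffOn_subP e) (isCompact_Icc (a := (1/2 : ℝ)) (b := 5/2)) (v₀ := 1/8) (v₁ := 11)
    (by norm_num) (fun b hb v hv => ⟨by linarith [hb.1], by linarith [hv.1]⟩)
    (fun b hb => by
      filter_upwards [Ioo_mem_nhds (show (0:ℝ) < 1/8 by norm_num) (show (1/8:ℝ) < 1/4 by norm_num)]
        with v hv
      exact subP_eq_zero_of_le hb (abs_le.2 ⟨by linarith [hv.1], by linarith [hv.2]⟩))
    (fun b hb => by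
      filter_upwards [Ioi_mem_nhds (show (10:ℝ) < 11 by norm_num)] with v hv
      exact subP_eq_zero_of_ge hb hv.le)
  refine ⟨C, fun b hb t ht => ?_⟩
  have hb0 : 0 < b := by linarith [hb.1]
  refine le_of_eq_of_le ?_ (hC b hb t ht)
  congr 1
  set E : ℝ → ℂ := fun v => Complex.exp (Complex.I * ((-t * v ^ 2 : ℝ) : ℂ)) with hE
  have hEc : Continuous E := by fun_prop
  have hHc : Continuous fun v => (subH e b v : ℂ) :=
    Complex.continuous_ofReal.comp (continuous_subH e hb0)
  have hVc : Continuous fun v => (cutV v : ℂ) :=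
    Complex.continuous_ofReal.comp contDiff_cutV.continuous
  have hi : ∀ x y, IntervalIntegrable (fun v => (subH e b v : ℂ) * E v) volume x y :=
    fun x y => (hHc.mul hEc).intervalIntegrable _ _
  have hi' : ∀ x y, IntervalIntegrable (fun v => (subH e b (-v) : ℂ) * E v) volume x y :=
    fun x y => ((hHc.comp continuous_neg).mul hEc).intervalIntegrable _ _
  have hiV : ∀ x y, IntervalIntegrable (fun v => (cutV v : ℂ) * E v) volume x y :=
    fun x y => (hVc.mul hEc).intervalIntegrable _ _
  have e1 : ∫ v in (-11:ℝ)..0, (subH e b v : ℂ) * E v = ∫ v in (0:ℝ)..11,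
      (subH e b (-v) : ℂ) * E v := by
    have := intervalIntegral.integral_comp_neg (a := (0:ℝ)) (b := 11)
      (fun v => (subH e b v : ℂ) * E v)
    rw [neg_zero] at this
    rw [← this]
    refine intervalIntegral.integral_congr fun v _ => ?_
    simp [hE]
  rw [subD, ← intervalIntegral.integral_add_adjacent_intervals (hi (-11) 0) (hi 0 11), e1,
    ← intervalIntegral.integral_add (hi' 0 11) (hi 0 11),
    ← intervalIntegral.integral_sub ((hi' 0 11).add (hi 0 11)) (hiV 0 11)]
  have e2 : ∀ v, (subH e b (-v) : ℂ) * E v + (subH e b v : ℂ) * E v - (cutV v : ℂ) * E v =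
      (subP e (b, v) : ℂ) * E v := by
    intro v; rw [subP]; push_cast; ring
  simp only [e2]
  have hi2 : ∀ x y, IntervalIntegrable (fun v => (subP e (b, v) : ℂ) * E v) volume x y := by
    intro x y
    simp only [← e2]
    exact ((hi' x y).add (hi x y)).sub (hiV x y)
  rw [← intervalIntegral.integral_add_adjacent_intervals (hi2 0 (1/8)) (hi2 (1/8) 11)]
  have e3 : ∫ v in (0:ℝ)..(1/8), (subP e (b, v) : ℂ) * E v = 0 := by
    rw [intervalIntegral.integral_congr (g := fun _ => (0:ℂ)), intervalIntegral.integral_zero]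
    intro v hv
    rw [Set.uIcc_of_le (by norm_num)] at hv
    simp only
    rw [subP_eq_zero_of_le hb (abs_le.2 ⟨by linarith [hv.1], by linarith [hv.2]⟩)]
    simp
  rw [e3, zero_add]

/-- The amplitudes of the subordination formulas in the variable `w = y⁴`. -/
def ampW (k : ℕ) (w : ℝ) : ℝ := cutY √√w / (4 * √√w ^ k)

lemma ampW_eq_zero (k : ℕ) {w : ℝ} (h : w ≤ 1/256 ∨ 256 ≤ w) : ampW k w = 0 := by
  rw [ampW, cutY_eq_zero, zero_div]
  rcases h with h | h
  · left
    refine Real.sqrt_le_iff.2 ⟨by norm_num, Real.sqrt_le_iff.2 ⟨by norm_num, by linarith⟩⟩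
  · right
    exact Real.le_sqrt_of_sq_le (Real.le_sqrt_of_sq_le (by linarith))

lemma contDiffOn_ampW (k : ℕ) : ContDiffOn ℝ ((⊤ : ℕ∞) : WithTop ℕ∞) (ampW k) (Set.Ioi 0) := by
  intro w hw
  refine ContDiffAt.contDiffWithinAt ?_
  have h0 : 0 < √w := Real.sqrt_pos.2 hw
  have h1 : 0 < √√w := Real.sqrt_pos.2 h0
  have hs : ContDiffAt ℝ ((⊤ : ℕ∞) : WithTop ℕ∞) (fun w : ℝ => √√w) w :=
    (contDiffAt_id.sqrt hw.ne').sqrt h0.ne'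
  exact (contDiff_cutY.contDiffAt.comp w hs).div (contDiffAt_const.mul (hs.pow k)) (by positivity)

lemma integral_ampW_eq (k : ℕ) {b t : ℝ} (hb : b ∈ Set.Icc (1/2 : ℝ) (5/2)) :
    ∫ w in (1/256 : ℝ)..256, (ampW k w : ℂ) *
      Complex.exp (Complex.I * ((-t * (√w + b ^ 2 / √w) : ℝ) : ℂ)) =
    Complex.exp (Complex.I * ((-t * (2 * b) : ℝ) : ℂ)) * ∫ v in (-11:ℝ)..11,
      (cutY (subY b v) / subY b v ^ k * subY b v ^ 3 * ((1 + v / √(v ^ 2 + 4 * b)) / 2) : ℝ) *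
        Complex.exp (Complex.I * ((-t * v ^ 2 : ℝ) : ℂ)) := by
  have hb0 : 0 < b := by linarith [hb.1]
  set F : ℝ → ℂ := fun w => (ampW k w : ℂ) *
      Complex.exp (Complex.I * ((-t * (√w + b ^ 2 / √w) : ℝ) : ℂ)) with hF
  have hFz : ∀ w, w ≤ 1/256 ∨ 256 ≤ w → F w = 0 := fun w h => by
    rw [hF]; simp only; rw [ampW_eq_zero k h]; simp
  have hsupp : Function.support F ⊆ Set.Ioc (1/256) 256 := by
    intro w hw
    by_contra hc
    refine hw (hFz w ?_)
    rw [Set.mem_Ioc, not_and_or, not_lt, not_le] at hc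
    exact hc.imp id le_of_lt
  have hsmall : subY b (-11) ≤ 1/4 := by
    rw [subY_neg hb0]
    have h1 : 11 ≤ subY b 11 := by
      have := subY_sub hb0 11
      have : 0 < b / subY b 11 := div_pos hb0 (subY_pos hb0 11)
      linarith
    rw [div_le_iff₀ (by linarith)]; linarith [hb.2]
  have hbig : 4 ≤ subY b 11 := by
    have := subY_sub hb0 11
    have : 0 < b / subY b 11 := div_pos hb0 (subY_pos hb0 11)
    linarith
  have hsupp' : Function.support F ⊆ Set.Ioc (subY b (-11) ^ 4) (subY b 11 ^ 4) := by
    refine hsupp.trans (Set.Ioc_subset_Ioc ?_ ?_)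
    · calc subY b (-11) ^ 4 ≤ (1/4) ^ 4 := by
            gcongr; exact (subY_pos hb0 _).le
        _ ≤ _ := by norm_num
    · calc (256:ℝ) ≤ 4 ^ 4 := by norm_num
        _ ≤ _ := by gcongr
  rw [intervalIntegral.integral_eq_integral_of_support_subset hsupp,
    ← intervalIntegral.integral_eq_integral_of_support_subset hsupp']
  have hFc : ContinuousOn F (Set.Ioi 0) := by
    refine (Complex.continuous_ofReal.comp_continuousOn (contDiffOn_ampW k).continuousOn).mul ?_
    refine Complex.continuous_exp.comp_continuousOn (continuousOn_const.mul
      (Complex.continuous_ofReal.comp_continuousOn (continuousOn_const.mul ?_)))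
    refine ContinuousOn.add (by fun_prop) (ContinuousOn.div (by fun_prop) (by fun_prop) ?_)
    intro w hw
    exact (Real.sqrt_pos.2 hw).ne'
  have hYc : Continuous (subY b) := by unfold subY; fun_prop
  have hsub := intervalIntegral.integral_deriv_smul_comp' (a := -11) (b := 11)
    (f := fun v => subY b v ^ 4) (g := F)
    (f' := fun v => 4 * subY b v ^ 3 * ((1 + v / √(v ^ 2 + 4 * b)) / 2))
    (fun v _ => by simpa using (hasDerivAt_subY hb0 v).fun_pow 4)
    (by
      refine Continuous.continuousOn ((continuous_const.mul (hYc.pow 3)).mul ?_)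
      refine (continuous_const.add (continuous_id.div (by fun_prop) fun v => ?_)).div_const 2
      exact (Real.sqrt_pos.2 (by positivity)).ne')
    (hFc.mono (by
      rintro _ ⟨v, _, rfl⟩
      exact pow_pos (subY_pos hb0 v) 4))
  rw [← hsub, ← intervalIntegral.integral_const_mul]
  refine intervalIntegral.integral_congr fun v _ => ?_
  have hy := subY_pos hb0 v
  have e1 : √(subY b v ^ 4) = subY b v ^ 2 := by
    rw [show subY b v ^ 4 = (subY b v ^ 2) ^ 2 by ring, Real.sqrt_sq (by positivity)]
  have e2 : √√(subY b v ^ 4) = subY b v := by rw [e1, Real.sqrt_sq hy.le]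
  have e3 : subY b v ^ 2 + b ^ 2 / subY b v ^ 2 = 2 * b + v ^ 2 := by
    have := subY_sub hb0 v
    have h2 : v ^ 2 = (subY b v - b / subY b v) ^ 2 := by rw [this]
    rw [h2]; field_simp; ring
  simp only [Function.comp_apply, hF, ampW]
  rw [e2, e1, e3, mul_add, Complex.ofReal_add, mul_add, Complex.exp_add, Complex.real_smul]
  push_cast
  field_simp

lemma exists_subordination : ∃ C, 0 < C ∧ ∀ ω ∈ Set.Icc (1 : ℝ) 5, ∀ t > 0,
    ‖(∫ w in (1/256 : ℝ)..256, (ampW 3 w : ℂ) *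
      Complex.exp (Complex.I * ((-t * (√w + ω ^ 2 / 4 / √w) : ℝ) : ℂ))) -
      Complex.exp (Complex.I * ((-t * ω : ℝ) : ℂ)) * subD t‖ ≤ C / t ^ 2 ∧
    ‖(∫ w in (1/256 : ℝ)..256, (ampW 5 w : ℂ) *
      Complex.exp (Complex.I * ((-t * (√w + ω ^ 2 / 4 / √w) : ℝ) : ℂ))) * ((ω / 2 : ℝ) : ℂ) -
      Complex.exp (Complex.I * ((-t * ω : ℝ) : ℂ)) * subD t‖ ≤ C / t ^ 2 := by
  obtain ⟨C₁, h₁⟩ := exists_norm_subH_sub_subD_le 1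
  obtain ⟨C₂, h₂⟩ := exists_norm_subH_sub_subD_le (-1)
  refine ⟨max (max C₁ C₂) 1, by positivity, fun ω hω t ht => ?_⟩
  have hb : ω / 2 ∈ Set.Icc (1/2 : ℝ) (5/2) := ⟨by linarith [hω.1], by linarith [hω.2]⟩
  have hb0 : 0 < ω / 2 := by linarith [hω.1]
  have e : ω ^ 2 / 4 = (ω / 2) ^ 2 := by ring
  have e2 : -t * (2 * (ω / 2)) = -t * ω := by ring
  constructor
  · rw [e, integral_ampW_eq 3 hb, e2, ← mul_sub, norm_mul, norm_cexp_I_mul, one_mul]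
    refine le_trans (le_of_eq ?_) ((h₁ _ hb t ht).trans ?_)
    · congr 2
      refine intervalIntegral.integral_congr fun v _ => ?_
      have hy := subY_pos hb0 v
      simp only [subH, one_mul]
      rw [div_mul_cancel₀ _ (by positivity)]
    · gcongr
      exact (le_max_left _ _).trans (le_max_left _ _)
  · rw [e, integral_ampW_eq 5 hb, e2, mul_assoc, ← mul_sub, norm_mul, norm_cexp_I_mul, one_mul,
      mul_comm, ← intervalIntegral.integral_const_mul]
    refine le_trans (le_of_eq ?_) ((h₂ _ hb t ht).trans ?_)
    · congr 2
      refine intervalIntegral.integral_congr fun v _ => ?_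
      have hy := subY_pos hb0 v
      simp only [subH]
      rw [← mul_assoc, ← Complex.ofReal_mul]
      congr 2
      have h1 := subY_sub hb0 v
      rw [← subY_add hb0 v]
      generalize subY (ω / 2) v = y at *
      subst h1
      generalize ω / 2 = b at *
      have : y + b / y ≠ 0 := by positivity
      field_simp
      ring
    · gcongr
      exact (le_max_right _ _).trans (le_max_left _ _)

lemma norm_subD_ge {t : ℝ} (ht : 16 ≤ t) : 1 / 40 / √t ≤ ‖subD t‖ := by
  have ht0 : 0 < t := by linarith
  set r := √t with hr
  have hr4 : 4 ≤ r := Real.le_sqrt_of_sq_le (by linarith)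
  have hr2 : r ^ 2 = t := Real.sq_sqrt ht0.le
  set v₀ : ℝ := 1 / (4 * r) with hv₀
  set v₁ : ℝ := 1 / r with hv₁
  have h0 : 0 < v₀ := by positivity
  have h01 : v₀ ≤ v₁ := by rw [hv₀, hv₁]; gcongr; linarith
  have h1 : v₁ ≤ 1/4 := by rw [hv₁]; gcongr
  have htv0 : t * v₀ ^ 2 = 1/16 := by rw [hv₀, ← hr2]; field_simp; norm_num
  have htv1 : t * v₁ ^ 2 = 1 := by rw [hv₁, ← hr2]; field_simp
  have hcc : Continuous cutV := contDiff_cutV.continuous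
  have hc0 : ∀ v, 0 ≤ cutV v := fun v => Real.smoothTransition.nonneg _
  have hanti : Antitone cutV := fun x y hxy => Real.smoothTransition.monotone (by linarith)
  have hd : ∀ v, HasDerivAt cutV (deriv cutV v) v := fun v =>
    (contDiff_cutV.differentiable (by simp) v).hasDerivAt
  have hdc : Continuous (deriv cutV) := contDiff_cutV.continuous_deriv (by simp)
  have hdn : ∀ v, deriv cutV v ≤ 0 := fun v => hanti.deriv_nonpos
  have hi : ∀ x y, IntervalIntegrable (fun v => cutV v * Real.sin (t * v ^ 2)) volume x y :=
    fun x y => (by fun_prop : Continuous _).intervalIntegrable _ _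
  have him : (subD t).im = -∫ v in (0:ℝ)..11, cutV v * Real.sin (t * v ^ 2) := by
    rw [subD, ← Complex.imCLM_apply, ← ContinuousLinearMap.intervalIntegral_comp_comm,
      ← intervalIntegral.integral_neg]
    · refine intervalIntegral.integral_congr fun v _ => ?_
      simp only [Complex.imCLM_apply]
      rw [mul_comm Complex.I, Complex.im_ofReal_mul, Complex.exp_ofReal_mul_I_im,
        show -t * v ^ 2 = -(t * v ^ 2) by ring, Real.sin_neg]
      ring
    · have : Continuous fun v => (cutV v : ℂ) := Complex.continuous_ofReal.comp hcc
      exact (by fun_prop : Continuous _).intervalIntegrable _ _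
  have hA : 0 ≤ ∫ v in (0:ℝ)..v₀, cutV v * Real.sin (t * v ^ 2) := by
    refine intervalIntegral.integral_nonneg h0.le fun v hv => mul_nonneg (hc0 v) ?_
    refine Real.sin_nonneg_of_nonneg_of_le_pi (by positivity) ?_
    have : t * v ^ 2 ≤ t * v₀ ^ 2 := by
      have := hv.1; have := hv.2; gcongr
    linarith [Real.pi_gt_three]
  -- integrate by parts on the rest
  have hv11 : v₀ ≤ 11 := by linarith
  have hI : Set.uIcc v₀ 11 = Set.Icc v₀ 11 := Set.uIcc_of_le hv11
  have hpos : ∀ v ∈ Set.Icc v₀ 11, 0 < v := fun v hv => h0.trans_le hv.1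
  set w : ℝ → ℝ := fun v => cutV v / (2 * t * v ^ 2) - deriv cutV v / (2 * t * v) with hw
  have hwc : ContinuousOn w (Set.Icc v₀ 11) := by
    refine ContinuousOn.sub (ContinuousOn.div (by fun_prop) (by fun_prop) ?_)
      (ContinuousOn.div (by fun_prop) (by fun_prop) ?_) <;>
    · intro v hv; have := hpos v hv; positivity
  have key := intervalIntegral.integral_mul_deriv_eq_deriv_mul (a := v₀) (b := 11)
    (u := fun v => cutV v / (2 * t * v)) (u' := fun v => -w v)
    (v := fun v => 1 - Real.cos (t * v ^ 2)) (v' := fun v => Real.sin (t * v ^ 2) * (t * (2 * v)))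
    (fun v hv => by
      have hv' := hpos v (hI ▸ hv)
      refine ((hd v).fun_div ((hasDerivAt_id v).const_mul (2 * t)) (by simp; constructor <;> linarith)).congr_deriv ?_
      simp only [hw, id]
      field_simp
      ring)
    (fun v _ => by
      have h : HasDerivAt (fun v : ℝ => t * v ^ 2) (t * (2 * v)) v := by
        simpa using (hasDerivAt_pow 2 v).const_mul t
      simpa using h.cos.const_sub 1)
    (ContinuousOn.intervalIntegrable (by rw [hI]; exact hwc.neg))
    ((by fun_prop : Continuous _).intervalIntegrable _ _)
  have e1 : ∫ v in v₀..11, cutV v / (2 * t * v) * (Real.sin (t * v ^ 2) * (t * (2 * v))) =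
      ∫ v in v₀..11, cutV v * Real.sin (t * v ^ 2) := by
    refine intervalIntegral.integral_congr fun v hv => ?_
    have := hpos v (hI ▸ hv)
    field_simp
  have e2 : ∫ v in v₀..11, -w v * (1 - Real.cos (t * v ^ 2)) =
      -∫ v in v₀..11, w v * (1 - Real.cos (t * v ^ 2)) := by
    rw [← intervalIntegral.integral_neg]; simp only [neg_mul]
  rw [e1, e2, cutV_eq_zero (v := 11) (by norm_num), cutV_eq_one (h01.trans h1), htv0] at key
  have hcos0 : 1 - Real.cos (1/16) ≤ 1/512 := by
    have := Real.one_sub_sq_div_two_le_cos (x := 1/16)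
    norm_num at this ⊢
    linarith
  have hwi : ∀ x ∈ Set.Icc v₀ 11, ∀ y ∈ Set.Icc v₀ 11,
      IntervalIntegrable (fun v => w v * (1 - Real.cos (t * v ^ 2))) volume x y := by
    intro x hx y hy
    refine ContinuousOn.intervalIntegrable ?_
    exact (hwc.mono (Set.uIcc_subset_Icc hx hy)).mul (by fun_prop)
  have hw0 : ∀ v ∈ Set.Icc v₀ 11, cutV v / (2 * t * v ^ 2) ≤ w v := by
    intro v hv
    have := hpos v hv
    have : deriv cutV v / (2 * t * v) ≤ 0 := div_nonpos_of_nonpos_of_nonneg (hdn v) (by positivity)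
    rw [hw]; simp only; linarith
  have hw00 : ∀ v ∈ Set.Icc v₀ 11, 0 ≤ w v := fun v hv =>
    le_trans (div_nonneg (hc0 v) (by positivity)) (hw0 v hv)
  have m1 : v₁ ∈ Set.Icc v₀ 11 := ⟨h01, by linarith⟩
  have hB : 0 ≤ ∫ v in v₁..11, w v * (1 - Real.cos (t * v ^ 2)) := by
    refine intervalIntegral.integral_nonneg m1.2 fun v hv => mul_nonneg
      (hw00 v ⟨h01.trans hv.1, hv.2⟩) ?_
    linarith [Real.cos_le_one (t * v ^ 2)]
  have hC : ∫ v in v₀..v₁, t / 10 * v ^ 2 ≤ ∫ v in v₀..v₁, w v * (1 - Real.cos (t * v ^ 2)) := by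
    refine intervalIntegral.integral_mono_on h01
      ((by fun_prop : Continuous _).intervalIntegrable _ _)
      (hwi v₀ ⟨le_rfl, hv11⟩ v₁ m1) fun v hv => ?_
    have hv' : v ∈ Set.Icc v₀ 11 := ⟨hv.1, hv.2.trans m1.2⟩
    have hvp := hpos v hv'
    have ha := hw0 v hv'
    rw [cutV_eq_one (hv.2.trans h1)] at ha
    have hx1 : t * v ^ 2 ≤ 1 := by
      rw [← htv1]; have := hv.2; gcongr
    have hx0 : 0 ≤ t * v ^ 2 := by positivity
    have hb := Real.cos_le_one_sub_mul_cos_sq (x := t * v ^ 2)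
      (by rw [abs_of_nonneg hx0]; linarith [Real.pi_gt_three])
    have hc : (t * v ^ 2) ^ 2 / 5 ≤ 1 - Real.cos (t * v ^ 2) := by
      have h3 : π ^ 2 ≤ 10 := by nlinarith [Real.pi_lt_d2, Real.pi_pos]
      have : (t * v ^ 2) ^ 2 / 5 ≤ 2 / π ^ 2 * (t * v ^ 2) ^ 2 := by
        rw [div_mul_eq_mul_div, div_le_div_iff₀ (by norm_num) (by positivity)]
        nlinarith [sq_nonneg (t * v ^ 2)]
      linarith
    calc t / 10 * v ^ 2 = 1 / (2 * t * v ^ 2) * ((t * v ^ 2) ^ 2 / 5) := by field_simp; norm_num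
      _ ≤ _ := by
        refine mul_le_mul ha hc (by positivity) (hw00 v hv')
  have e3 : ∫ v in v₀..v₁, t / 10 * v ^ 2 = (1 - 1/64) / 30 / r := by
    rw [intervalIntegral.integral_const_mul, integral_pow]
    rw [hv₀, hv₁, ← hr2]
    norm_num
    field_simp
    norm_num
  rw [← intervalIntegral.integral_add_adjacent_intervals
    (hwi v₀ ⟨le_rfl, hv11⟩ v₁ m1) (hwi v₁ m1 11 ⟨hv11, le_rfl⟩)] at key
  have e4 : 1 / (2 * t * v₀) = 2 / r := by rw [hv₀, ← hr2]; field_simp; norm_num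
  rw [e4] at key
  have hsum := intervalIntegral.integral_add_adjacent_intervals (hi 0 v₀) (hi v₀ 11)
  have hrpos : 0 < r := by linarith
  have h5 : 2 / r * (1 - Real.cos (1/16)) ≤ 2 / r * (1/512) := by gcongr
  have h6 : (1 - 1/64) / 30 / r - 2 / r * (1/512) ≥ 1 / 40 / r := by
    rw [ge_iff_le, ← sub_nonneg]
    have : (1 - 1/64) / 30 / r - 2 / r * (1/512) - 1 / 40 / r =
      ((1 - 1/64) / 30 - 1/256 - 1/40) / r := by ring
    rw [this]
    apply div_nonneg _ hrpos.le
    norm_num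
  have hfin : 1 / 40 / r ≤ |(subD t).im| := by
    rw [him, abs_neg]
    refine le_trans ?_ (le_abs_self _)
    rw [← hsum]
    simp only [zero_div, zero_mul, zero_sub] at key
    linarith
  exact hfin.trans (Complex.abs_im_le_norm _)

/-- The radical `√(1 - c w)`. -/
def oscR (c w : ℝ) : ℝ := √(1 - c * w)

lemma oscR_pos {c w : ℝ} (h : c * w < 1) : 0 < oscR c w := Real.sqrt_pos.2 (by linarith)

lemma oscR_sq {c w : ℝ} (h : c * w < 1) : oscR c w ^ 2 = 1 - c * w := Real.sq_sqrt (by linarith)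

lemma hasDerivAt_oscR {c w : ℝ} (h : c * w < 1) :
    HasDerivAt (oscR c) (-(c / oscR c w) / 2) w := by
  have h1 : HasDerivAt (fun w => 1 - c * w) (-c) w := by
    simpa using ((hasDerivAt_id w).const_mul c).const_sub 1
  refine (h1.sqrt (by linarith)).congr_deriv ?_
  have := oscR_pos h
  simp only [oscR] at *
  field_simp

lemma hasDerivAt_oscR_inv_pow {c w : ℝ} (h : c * w < 1) (a : ℝ) (k : ℕ) :
    HasDerivAt (fun w => a / oscR c w ^ k) (k / 2 * (a * c / oscR c w ^ (k + 2))) w := by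
  have h0 := oscR_pos h
  have h1 := (hasDerivAt_const w a).fun_div ((hasDerivAt_oscR h).fun_pow k) (pow_pos h0 k).ne'
  refine h1.congr_deriv ?_
  rcases k with _ | k
  · simp
  · simp only [Nat.add_sub_cancel]
    field_simp
    push_cast
    ring

section Phase

variable {c₁ c₂ c₃ e₁ e₂ e₃ t κ α β h R : ℝ} {Φ ρ : ℝ → ℝ}

/-- The reduced phase and its derivatives. -/
def oscG (c₁ c₂ c₃ e₁ e₂ e₃ t κ w : ℝ) : ℝ :=
  t * (w - κ + (e₁ * oscR c₁ w + e₂ * oscR c₂ w + e₃ * oscR c₃ w) / 2)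

/-- First derivative of the reduced phase. -/
def oscG₁ (c₁ c₂ c₃ e₁ e₂ e₃ t w : ℝ) : ℝ :=
  t * (1 - (e₁ * (c₁ / oscR c₁ w) + e₂ * (c₂ / oscR c₂ w) + e₃ * (c₃ / oscR c₃ w)) / 4)

/-- Second derivative of the reduced phase. -/
def oscG₂ (c₁ c₂ c₃ e₁ e₂ e₃ t w : ℝ) : ℝ :=
  -(t / 8) * (e₁ * (c₁ ^ 2 / oscR c₁ w ^ 3) + e₂ * (c₂ ^ 2 / oscR c₂ w ^ 3) +
    e₃ * (c₃ ^ 2 / oscR c₃ w ^ 3))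

/-- Third derivative of the reduced phase. -/
def oscG₃ (c₁ c₂ c₃ e₁ e₂ e₃ t w : ℝ) : ℝ :=
  -(3 * t / 16) * (e₁ * (c₁ ^ 3 / oscR c₁ w ^ 5) + e₂ * (c₂ ^ 3 / oscR c₂ w ^ 5) +
    e₃ * (c₃ ^ 3 / oscR c₃ w ^ 5))

lemma hasDerivAt_oscG {w : ℝ} (h₁ : c₁ * w < 1) (h₂ : c₂ * w < 1) (h₃ : c₃ * w < 1) :
    HasDerivAt (oscG c₁ c₂ c₃ e₁ e₂ e₃ t κ) (oscG₁ c₁ c₂ c₃ e₁ e₂ e₃ t w) w := by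
  refine ((((hasDerivAt_id w).sub_const κ).fun_add (((((hasDerivAt_oscR h₁).const_mul e₁).fun_add
    ((hasDerivAt_oscR h₂).const_mul e₂)).fun_add ((hasDerivAt_oscR h₃).const_mul e₃)).div_const
      2)).const_mul t).congr_deriv ?_
  rw [oscG₁]; ring

lemma hasDerivAt_oscG₁ {w : ℝ} (h₁ : c₁ * w < 1) (h₂ : c₂ * w < 1) (h₃ : c₃ * w < 1) :
    HasDerivAt (oscG₁ c₁ c₂ c₃ e₁ e₂ e₃ t) (oscG₂ c₁ c₂ c₃ e₁ e₂ e₃ t w) w := by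
  have D : ∀ {c : ℝ}, c * w < 1 → HasDerivAt (fun w => c / oscR c w)
      (c ^ 2 / oscR c w ^ 3 / 2) w := fun {c} hc => by
    have := hasDerivAt_oscR_inv_pow hc c 1
    simp only [pow_one] at this
    refine this.congr_deriv ?_
    push_cast; ring
  refine ((((((D h₁).const_mul e₁).fun_add ((D h₂).const_mul e₂)).fun_add
    ((D h₃).const_mul e₃)).div_const 4).const_sub 1 |>.const_mul t).congr_deriv ?_
  rw [oscG₂]; ring

lemma hasDerivAt_oscG₂ {w : ℝ} (h₁ : c₁ * w < 1) (h₂ : c₂ * w < 1) (h₃ : c₃ * w < 1) :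
    HasDerivAt (oscG₂ c₁ c₂ c₃ e₁ e₂ e₃ t) (oscG₃ c₁ c₂ c₃ e₁ e₂ e₃ t w) w := by
  have D : ∀ {c : ℝ}, c * w < 1 → HasDerivAt (fun w => c ^ 2 / oscR c w ^ 3)
      (3 / 2 * (c ^ 3 / oscR c w ^ 5)) w := fun {c} hc => by
    refine (hasDerivAt_oscR_inv_pow hc (c ^ 2) 3).congr_deriv ?_
    push_cast; ring
  refine ((((D h₁).const_mul e₁).fun_add ((D h₂).const_mul e₂)).fun_add
    ((D h₃).const_mul e₃) |>.const_mul (-(t / 8))).congr_deriv ?_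
  rw [oscG₃]; ring

lemma oscR_anti_left {c c' w : ℝ} (hw : 0 ≤ w) (hc : c' ≤ c) : oscR c w ≤ oscR c' w :=
  Real.sqrt_le_sqrt (by nlinarith)

lemma oscR_anti_right {c w w' : ℝ} (hc : 0 ≤ c) (hw : w ≤ w') : oscR c w' ≤ oscR c w :=
  Real.sqrt_le_sqrt (by nlinarith)

lemma oscR_cross {c c' w w' : ℝ} (hw : w ≤ w') (hc : c' ≤ c) (h : c * w < 1) (h' : c' * w' < 1) :
    oscR c w' * oscR c' w ≤ oscR c w * oscR c' w' := by
  rw [oscR, oscR, oscR, oscR]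
  by_cases h1 : 0 ≤ 1 - c * w'
  · rw [← Real.sqrt_mul h1, ← Real.sqrt_mul (by linarith)]
    exact Real.sqrt_le_sqrt (by nlinarith [mul_nonneg (sub_nonneg.2 hc) (sub_nonneg.2 hw)])
  · rw [Real.sqrt_eq_zero_of_nonpos (by linarith), zero_mul]; positivity

lemma ge_of_one_le_div {c w : ℝ} (hc : 0 ≤ c) (hw' : w ≤ 256) (h : c * w < 1)
    (h1 : 1 ≤ c / oscR c w) : 1 / 257 ≤ c := by
  have h0 := oscR_pos h
  rw [one_le_div h0] at h1
  have h2 := oscR_sq h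
  have h3 : 1 - c * w ≤ c ^ 2 := by rw [← h2]; gcongr
  nlinarith

lemma ge_of_div_le_one {c w : ℝ} (hc : 0 ≤ c) (hw : 0 ≤ w) (hw' : w ≤ 256) (h : c * w < 1)
    (h1 : c / oscR c w ≤ 1) : 1 / 257 ≤ oscR c w := by
  have h0 := oscR_pos h
  rw [div_le_one h0] at h1
  have h2 := oscR_sq h
  by_contra hcon
  push Not at hcon
  nlinarith [mul_nonneg hc hw]

/-- Oscillatory integral bound on an interval where the smallest slope is at most one. -/
lemma norm_integral_osc_le_A (hαβ : α ≤ β) (hα : 0 ≤ α) (hβ : β ≤ 256) (ht : 0 < t) (hh : 0 < h)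
    (hc12 : c₂ ≤ c₁) (hc23 : c₃ ≤ c₂) (hc3 : 0 ≤ c₃)
    (he₁ : e₁ = 1 ∨ e₁ = -1) (he₂ : e₂ = 1 ∨ e₂ = -1) (he₃ : e₃ = 1 ∨ e₃ = -1)
    (h1 : ∀ w ∈ Set.Icc α β, c₁ * w < 1) (hlh : ∀ w ∈ Set.Icc α β, 1 - c₁ * w ≤ h)
    (hΦ : ∀ w ∈ Set.Icc α β, HasDerivAt Φ (ρ w * oscG c₁ c₂ c₃ e₁ e₂ e₃ t κ w) w)
    (hρ : ContinuousOn ρ (Set.Icc α β)) (hR : ∀ w ∈ Set.Icc α β, |ρ w| ≤ R)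
    (hy : ∀ w ∈ Set.Ioo α β, c₃ / oscR c₃ w ≤ 1)
    {μ₁ μ₂ : ℝ} (hμ₁ : 0 < μ₁) (hμ₂ : 0 < μ₂) (hm₁ : 4 ≤ t * μ₁ ^ 2) (hm₂ : 2056 * h ≤ t * μ₂ ^ 3) :
    ‖∫ w in α..β, (ρ w : ℂ) * Complex.exp (Complex.I * (Φ w : ℂ))‖ ≤
      (8 + 2 * R) * μ₁ + (16 + 6 * R) * μ₂ := by
  have hc2 : 0 ≤ c₂ := hc3.trans hc23
  have hc1 : 0 ≤ c₁ := hc2.trans hc12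
  have w0 : ∀ w ∈ Set.Icc α β, 0 ≤ w := fun w hw => hα.trans hw.1
  have h2 : ∀ w ∈ Set.Icc α β, c₂ * w < 1 := fun w hw => by nlinarith [h1 w hw, w0 w hw]
  have h3 : ∀ w ∈ Set.Icc α β, c₃ * w < 1 := fun w hw => by nlinarith [h2 w hw, w0 w hw]
  set S : ℝ → ℝ := fun w => c₁ / oscR c₁ w + e₁ * e₂ * (c₂ / oscR c₂ w) with hS
  have hSd : ∀ w ∈ Set.Icc α β, HasDerivAt S (c₁ ^ 2 / oscR c₁ w ^ 3 / 2 +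
      e₁ * e₂ * (c₂ ^ 2 / oscR c₂ w ^ 3 / 2)) w := by
    intro w hw
    have D : ∀ {c : ℝ}, c * w < 1 → HasDerivAt (fun w => c / oscR c w)
        (c ^ 2 / oscR c w ^ 3 / 2) w := fun {c} hc => by
      have := hasDerivAt_oscR_inv_pow hc c 1
      simp only [pow_one] at this
      refine this.congr_deriv ?_
      push_cast; ring
    exact (D (h1 w hw)).fun_add ((D (h2 w hw)).const_mul _)
  have hee : e₁ * e₂ = 1 ∨ e₁ * e₂ = -1 := by
    rcases he₁ with rfl | rfl <;> rcases he₂ with rfl | rfl <;> norm_num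
  -- orderings
  have ord : ∀ w ∈ Set.Icc α β, 0 < oscR c₁ w ∧ oscR c₁ w ≤ oscR c₂ w ∧ oscR c₂ w ≤ oscR c₃ w :=
    fun w hw => ⟨oscR_pos (h1 w hw), oscR_anti_left (w0 w hw) hc12, oscR_anti_left (w0 w hw) hc23⟩
  have hm12 : ∀ w ∈ Set.Icc α β, c₂ ^ 2 / oscR c₂ w ^ 3 ≤ c₁ ^ 2 / oscR c₁ w ^ 3 := by
    intro w hw; obtain ⟨a, b, c⟩ := ord w hw; gcongr
  have hm23 : ∀ w ∈ Set.Icc α β, c₃ ^ 2 / oscR c₃ w ^ 3 ≤ c₂ ^ 2 / oscR c₂ w ^ 3 := by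
    intro w hw; obtain ⟨a, b, c⟩ := ord w hw
    have := a.trans_le b
    gcongr
  have hy12 : ∀ w ∈ Set.Icc α β, c₂ / oscR c₂ w ≤ c₁ / oscR c₁ w := by
    intro w hw; obtain ⟨a, b, c⟩ := ord w hw; gcongr
  have hmono : MonotoneOn S (Set.Icc α β) := by
    refine monotoneOn_of_hasDerivWithinAt_nonneg (convex_Icc α β) (continuousOn_of_hasDerivAt hSd)
      (fun w hw => (hSd w (interior_subset hw)).hasDerivWithinAt) fun w hw => ?_
    have hw' := interior_subset hw
    have := hm12 w hw'
    obtain ⟨a, b, c⟩ := ord w hw'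
    have : 0 ≤ c₂ ^ 2 / oscR c₂ w ^ 3 := by have := a.trans_le b; positivity
    rcases hee with e | e <;> rw [e] <;> linarith
  obtain ⟨γ, hγ, hlow, hhigh⟩ := exists_threshold hαβ (continuousOn_of_hasDerivAt hSd) hmono 2
  have sub1 : Set.Icc α γ ⊆ Set.Icc α β := Set.Icc_subset_Icc le_rfl hγ.2
  have sub2 : Set.Icc γ β ⊆ Set.Icc α β := Set.Icc_subset_Icc hγ.1 le_rfl
  have hfc := continuousOn_phase hΦ hρ
  have hsum : ∀ w, e₁ * (c₁ / oscR c₁ w) + e₂ * (c₂ / oscR c₂ w) = e₁ * S w := by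
    intro w; rcases he₁ with rfl | rfl <;> simp only [hS] <;> ring
  have G2c : ContinuousOn (oscG₂ c₁ c₂ c₃ e₁ e₂ e₃ t) (Set.Icc α β) :=
    continuousOn_of_hasDerivAt fun w hw => hasDerivAt_oscG₂ (h1 w hw) (h2 w hw) (h3 w hw)
  have G1c : ContinuousOn (oscG₁ c₁ c₂ c₃ e₁ e₂ e₃ t) (Set.Icc α β) :=
    continuousOn_of_hasDerivAt fun w hw => hasDerivAt_oscG₁ (h1 w hw) (h2 w hw) (h3 w hw)
  have b1 : ‖∫ w in α..γ, (ρ w : ℂ) * Complex.exp (Complex.I * (Φ w : ℂ))‖ ≤ (8 + 2 * R) * μ₁ := by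
    refine vanDerCorput_one hγ.1 hμ₁ (fun w hw => hΦ w (sub1 hw)) (hρ.mono sub1)
      (fun w hw => hR w (sub1 hw))
      (fun w hw => hasDerivAt_oscG (h1 w (sub1 hw)) (h2 w (sub1 hw)) (h3 w (sub1 hw)))
      (G1c.mono sub1) (Or.inl fun w hw => ?_)
    have hw' : w ∈ Set.Ioo α β := ⟨hw.1, hw.2.trans_le hγ.2⟩
    have hwI := Set.Ioo_subset_Icc_self hw'
    obtain ⟨a, b, c⟩ := ord w hwI
    have hs := hlow w hw
    have hy3 := hy w hw'
    have hy30 : 0 ≤ c₃ / oscR c₃ w := by have := a.trans_le (b.trans c); positivity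
    have hS0 : 0 ≤ S w := by
      have := hy12 w hwI
      have : 0 ≤ c₂ / oscR c₂ w := by have := a.trans_le b; positivity
      simp only [hS]; rcases hee with e | e <;> rw [e] <;> linarith
    have hle : e₁ * (c₁ / oscR c₁ w) + e₂ * (c₂ / oscR c₂ w) + e₃ * (c₃ / oscR c₃ w) ≤ 3 := by
      rw [hsum]
      rcases he₁ with e | e <;> rcases he₃ with e' | e' <;> rw [e, e'] <;> linarith
    have : (μ₁ ^ 2)⁻¹ ≤ t / 4 := by
      rw [inv_le_comm₀ (by positivity) (by positivity), inv_div, div_le_iff₀ ht]; linarith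
    rw [oscG₁]
    nlinarith
  have b2 : ‖∫ w in γ..β, (ρ w : ℂ) * Complex.exp (Complex.I * (Φ w : ℂ))‖ ≤
      (16 + 6 * R) * μ₂ := by
    have hlow2 : ∀ w ∈ Set.Ioo γ β, (μ₂ ^ 3)⁻¹ ≤ t / 8 * (e₁ * (e₁ * (c₁ ^ 2 / oscR c₁ w ^ 3) +
        e₂ * (c₂ ^ 2 / oscR c₂ w ^ 3) + e₃ * (c₃ ^ 2 / oscR c₃ w ^ 3))) := by
      intro w hw
      have hw' : w ∈ Set.Ioo α β := ⟨hγ.1.trans_lt hw.1, hw.2⟩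
      have hwI := Set.Ioo_subset_Icc_self hw'
      obtain ⟨a, b, c⟩ := ord w hwI
      have hs := hhigh w hw
      have hy3 := hy w hw'
      have r2 := a.trans_le b
      have r3 := r2.trans_le c
      have hy1 : 1 ≤ c₁ / oscR c₁ w := by
        have := hy12 w hwI
        simp only [hS] at hs
        have : 0 ≤ c₂ / oscR c₂ w := by positivity
        rcases hee with e | e <;> rw [e] at hs <;> linarith
      have hc1' := ge_of_one_le_div hc1 (hwI.2.trans hβ) (h1 w hwI) hy1
      set Y := c₁ / oscR c₁ w ^ 2 with hY
      have hY2 : c₂ / oscR c₂ w ^ 2 ≤ Y := by rw [hY]; gcongr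
      have hY3 : c₃ / oscR c₃ w ^ 2 ≤ Y := le_trans (by gcongr) hY2
      have m1 : c₁ ^ 2 / oscR c₁ w ^ 3 = c₁ / oscR c₁ w * Y := by rw [hY]; field_simp
      have m2 : c₂ ^ 2 / oscR c₂ w ^ 3 = c₂ / oscR c₂ w * (c₂ / oscR c₂ w ^ 2) := by field_simp
      have m3 : c₃ ^ 2 / oscR c₃ w ^ 3 = c₃ / oscR c₃ w * (c₃ / oscR c₃ w ^ 2) := by field_simp
      have hY0 : 0 ≤ Y := by positivity
      have hP : Y ≤ e₁ * (e₁ * (c₁ ^ 2 / oscR c₁ w ^ 3) +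
        e₂ * (c₂ ^ 2 / oscR c₂ w ^ 3) + e₃ * (c₃ ^ 2 / oscR c₃ w ^ 3)) := by
        have e1 : e₁ * (e₁ * (c₁ ^ 2 / oscR c₁ w ^ 3) +
          e₂ * (c₂ ^ 2 / oscR c₂ w ^ 3) + e₃ * (c₃ ^ 2 / oscR c₃ w ^ 3)) =
          c₁ ^ 2 / oscR c₁ w ^ 3 + e₁ * e₂ * (c₂ ^ 2 / oscR c₂ w ^ 3) +
            e₁ * e₃ * (c₃ ^ 2 / oscR c₃ w ^ 3) := by
          rcases he₁ with rfl | rfl <;> ring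
        rw [e1]
        have hm3 : c₃ ^ 2 / oscR c₃ w ^ 3 ≤ Y := by
          rw [m3]
          calc _ ≤ 1 * Y := by gcongr
            _ = Y := one_mul Y
        have hm30 : 0 ≤ c₃ ^ 2 / oscR c₃ w ^ 3 := by positivity
        have h13 : -(c₃ ^ 2 / oscR c₃ w ^ 3) ≤ e₁ * e₃ * (c₃ ^ 2 / oscR c₃ w ^ 3) := by
          rcases he₁ with rfl | rfl <;> rcases he₃ with rfl | rfl <;> linarith
        have hmm := hm23 w hwI
        have hm1 : Y ≤ c₁ ^ 2 / oscR c₁ w ^ 3 := by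
          rw [m1]
          calc Y = 1 * Y := (one_mul Y).symm
            _ ≤ _ := by gcongr
        rcases hee with e | e
        · rw [e]; linarith
        · rw [e]
          simp only [hS, e] at hs
          have hm2 : c₂ ^ 2 / oscR c₂ w ^ 3 ≤ c₂ / oscR c₂ w * Y := by rw [m2]; gcongr
          have : 2 * Y ≤ (c₁ / oscR c₁ w - c₂ / oscR c₂ w) * Y := by
            apply mul_le_mul_of_nonneg_right _ hY0; linarith
          rw [m1]; nlinarith
      have hYlow : 1 / 257 / h ≤ Y := by
        rw [hY, oscR_sq (h1 w hwI)]
        have : 0 < 1 - c₁ * w := by linarith [h1 w hwI]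
        have := hlh w hwI
        gcongr
      have h7 : (μ₂ ^ 3)⁻¹ ≤ t / 8 * (1 / 257 / h) := by
        rw [inv_le_iff_one_le_mul₀ (by positivity)]
        have : t / 8 * (1 / 257 / h) * μ₂ ^ 3 = t * μ₂ ^ 3 / (2056 * h) := by
          field_simp; norm_num
        rw [this, one_le_div (by positivity)]; exact hm₂
      refine h7.trans ?_
      have := hYlow.trans hP
      gcongr
    refine vanDerCorput_two hγ.2 hμ₂ (fun w hw => hΦ w (sub2 hw)) (hρ.mono sub2)
      (fun w hw => hR w (sub2 hw))
      (fun w hw => hasDerivAt_oscG (h1 w (sub2 hw)) (h2 w (sub2 hw)) (h3 w (sub2 hw)))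
      (fun w hw => hasDerivAt_oscG₁ (h1 w (sub2 hw)) (h2 w (sub2 hw)) (h3 w (sub2 hw))) ?_
    rcases he₁ with e | e
    · right; intro w hw
      have := hlow2 w hw
      rw [e] at this
      rw [e, oscG₂]; linarith
    · left; intro w hw
      have := hlow2 w hw
      rw [e] at this
      rw [e, oscG₂]; linarith
  rw [← intervalIntegral.integral_add_adjacent_intervals (b := γ)
    (ContinuousOn.intervalIntegrable (by rw [Set.uIcc_of_le hγ.1]; exact hfc.mono sub1))
    (ContinuousOn.intervalIntegrable (by rw [Set.uIcc_of_le hγ.2]; exact hfc.mono sub2))]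
  exact (norm_add_le _ _).trans (add_le_add b1 b2)

end Phase

section Phase

variable {c₁ c₂ c₃ e₁ e₂ e₃ t κ α β h R r : ℝ} {Φ ρ : ℝ → ℝ}

lemma monotoneOn_oscR_ratio {c c' : ℝ} (hcc : c' ≤ c) (h : ∀ w ∈ Set.Icc α β, c * w < 1)
    (h' : ∀ w ∈ Set.Icc α β, c' * w < 1) :
    MonotoneOn (fun w => (c ^ 2 / oscR c w ^ 3) / (c' ^ 2 / oscR c' w ^ 3)) (Set.Icc α β) := by
  have e : ∀ w, (c ^ 2 / oscR c w ^ 3) / (c' ^ 2 / oscR c' w ^ 3) =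
      (c / c') ^ 2 * (oscR c' w / oscR c w) ^ 3 := fun w => by
    rw [div_div_div_eq, div_pow, div_pow, div_mul_div_comm, mul_comm (oscR c w ^ 3)]
  intro w hw w' hw' hww
  simp only [e]
  have := oscR_pos (h w hw)
  have := oscR_pos (h w' hw')
  have := oscR_pos (h' w hw)
  have hx := oscR_cross hww hcc (h w hw) (h' w' hw')
  have : oscR c' w / oscR c w ≤ oscR c' w' / oscR c w' := by
    rw [div_le_div_iff₀ (by assumption) (by assumption)]; linarith
  gcongr

/-- Lower bound for the third-order term where the second-order term degenerates. -/
lemma osc_third_ge {m₁ m₂ m₃ Y₁ Y₂ Y₃ : ℝ} (hm3 : 0 < m₃) (hm23 : m₃ ≤ m₂)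
    (hY3 : 0 < Y₃) (hY21 : Y₂ ≤ Y₁) (hc3 : 0 < c₃) (hcY : c₁ * Y₃ ≤ c₃ * Y₁)
    (hY1 : 0 < Y₁) (e₁m : m₁ ^ 2 = Y₁ ^ 3 * c₁) (e₃m : m₃ ^ 2 = Y₃ ^ 3 * c₃)
    (hlo : -(m₃ / 8) ≤ m₁ - m₂ - m₃) :
    13 / 100 * Y₁ * m₃ ≤ m₁ * Y₁ - m₂ * Y₂ - m₃ * Y₃ := by
  have h1 : 15 / 8 * m₃ ≤ m₁ := by linarith
  have h2 : 7 / 2 * m₃ ^ 2 ≤ m₁ ^ 2 := by nlinarith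
  rw [e₁m, e₃m] at h2
  have h3 : 7 / 2 * Y₃ ^ 4 ≤ Y₁ ^ 4 := by
    have : 7 / 2 * Y₃ ^ 4 * c₃ ≤ Y₁ ^ 4 * c₃ := by
      calc 7 / 2 * Y₃ ^ 4 * c₃ = (7 / 2 * (Y₃ ^ 3 * c₃)) * Y₃ := by ring
        _ ≤ (Y₁ ^ 3 * c₁) * Y₃ := by gcongr
        _ = Y₁ ^ 3 * (c₁ * Y₃) := by ring
        _ ≤ Y₁ ^ 3 * (c₃ * Y₁) := by gcongr
        _ = Y₁ ^ 4 * c₃ := by ring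
    exact le_of_mul_le_mul_right this hc3
  have h4 : Y₃ ≤ 74 / 100 * Y₁ := by
    by_contra hcon
    push Not at hcon
    have : (74 / 100 * Y₁) ^ 4 < Y₃ ^ 4 := by gcongr
    nlinarith [pow_pos hY1 4]
  nlinarith [mul_nonneg (hm3.le.trans hm23) (sub_nonneg.2 hY21), mul_nonneg hm3.le (sub_nonneg.2 h4),
    mul_nonneg hY1.le (by linarith : 0 ≤ m₁ - m₂ - m₃ + m₃ / 8)]

/-- Oscillatory integral bound on an interval where no slope degenerates to zero. -/
lemma norm_integral_osc_le_B (hαβ : α ≤ β) (hα : 0 ≤ α) (ht : 0 < t) (hh : 0 < h) (hr : 0 < r)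
    (hc12 : c₂ ≤ c₁) (hc23 : c₃ ≤ c₂) (hc3 : 1 / 257 ≤ c₃)
    (he₁ : e₁ = 1 ∨ e₁ = -1) (he₂ : e₂ = 1 ∨ e₂ = -1) (he₃ : e₃ = 1 ∨ e₃ = -1)
    (h1 : ∀ w ∈ Set.Icc α β, c₁ * w < 1) (hlh : ∀ w ∈ Set.Icc α β, 1 - c₁ * w ≤ h)
    (hlr : ∀ w ∈ Set.Icc α β, oscR c₃ w ≤ r)
    (hΦ : ∀ w ∈ Set.Icc α β, HasDerivAt Φ (ρ w * oscG c₁ c₂ c₃ e₁ e₂ e₃ t κ w) w)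
    (hρ : ContinuousOn ρ (Set.Icc α β)) (hR : ∀ w ∈ Set.Icc α β, |ρ w| ≤ R)
    {μ₃ μ₄ : ℝ} (hμ₃ : 0 < μ₃) (hμ₄ : 0 < μ₄) (hm₃ : 64 * 257 ^ 2 * r ^ 3 ≤ t * μ₃ ^ 3)
    (hm₄ : 42 * 257 ^ 3 * h * r ^ 3 ≤ t * μ₄ ^ 4) :
    ‖∫ w in α..β, (ρ w : ℂ) * Complex.exp (Complex.I * (Φ w : ℂ))‖ ≤
      2 * ((16 + 6 * R) * μ₃) + (32 + 14 * R) * μ₄ := by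
  have hc3' : 0 < c₃ := lt_of_lt_of_le (by norm_num) hc3
  have hc2 : 0 < c₂ := hc3'.trans_le hc23
  have hc1 : 0 < c₁ := hc2.trans_le hc12
  have w0 : ∀ w ∈ Set.Icc α β, 0 ≤ w := fun w hw => hα.trans hw.1
  have h2 : ∀ w ∈ Set.Icc α β, c₂ * w < 1 := fun w hw => by nlinarith [h1 w hw, w0 w hw]
  have h3 : ∀ w ∈ Set.Icc α β, c₃ * w < 1 := fun w hw => by nlinarith [h2 w hw, w0 w hw]
  have ord : ∀ w ∈ Set.Icc α β, 0 < oscR c₁ w ∧ oscR c₁ w ≤ oscR c₂ w ∧ oscR c₂ w ≤ oscR c₃ w :=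
    fun w hw => ⟨oscR_pos (h1 w hw), oscR_anti_left (w0 w hw) hc12, oscR_anti_left (w0 w hw) hc23⟩
  set m : ℝ → ℝ → ℝ := fun c w => c ^ 2 / oscR c w ^ 3 with hm
  have mpos : ∀ w ∈ Set.Icc α β, 0 < m c₃ w ∧ m c₃ w ≤ m c₂ w ∧ m c₂ w ≤ m c₁ w := by
    intro w hw
    obtain ⟨a, b, c⟩ := ord w hw
    have r2 := a.trans_le b
    have r3 := r2.trans_le c
    refine ⟨by simp only [hm]; positivity, ?_, ?_⟩ <;> simp only [hm] <;> gcongr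
  have hee : e₁ * e₂ = 1 ∨ e₁ * e₂ = -1 := by
    rcases he₁ with rfl | rfl <;> rcases he₂ with rfl | rfl <;> norm_num
  have hee3 : e₁ * e₃ = 1 ∨ e₁ * e₃ = -1 := by
    rcases he₁ with rfl | rfl <;> rcases he₃ with rfl | rfl <;> norm_num
  set S : ℝ → ℝ := fun w => m c₁ w / m c₃ w + e₁ * e₂ * (m c₂ w / m c₃ w) + e₁ * e₃ with hS
  have M13 := monotoneOn_oscR_ratio (hc23.trans hc12) h1 h3
  have M12 := monotoneOn_oscR_ratio hc12 h1 h2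
  have M23 := monotoneOn_oscR_ratio hc23 h2 h3
  have hmono : MonotoneOn S (Set.Icc α β) := by
    intro w hw w' hw' hww
    have a13 := M13 hw hw' hww
    have a12 := M12 hw hw' hww
    have a23 := M23 hw hw' hww
    simp only at a13 a12 a23
    obtain ⟨p3, p2, p1⟩ := mpos w hw
    obtain ⟨q3, q2, q1⟩ := mpos w' hw'
    change m c₁ w / m c₃ w ≤ m c₁ w' / m c₃ w' at a13
    change m c₁ w / m c₂ w ≤ m c₁ w' / m c₂ w' at a12
    change m c₂ w / m c₃ w ≤ m c₂ w' / m c₃ w' at a23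
    rcases hee with e | e
    · simp only [hS, e]; linarith
    · simp only [hS, e]
      have f : ∀ w ∈ Set.Icc α β, m c₁ w / m c₃ w + -1 * (m c₂ w / m c₃ w) =
          m c₂ w / m c₃ w * (m c₁ w / m c₂ w - 1) := by
        intro w hw
        obtain ⟨p3, p2, p1⟩ := mpos w hw
        have := p3.trans_le p2
        field_simp
        ring
      rw [f w hw, f w' hw']
      have : 1 ≤ m c₁ w / m c₂ w := by rw [one_le_div (p3.trans_le p2)]; exact p1
      have : 0 ≤ m c₂ w' / m c₃ w' := div_nonneg (q3.le.trans q2) q3.le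
      gcongr
  have mcont : ∀ c, (∀ w ∈ Set.Icc α β, c * w < 1) → ContinuousOn (m c) (Set.Icc α β) :=
    fun c hc => continuousOn_of_hasDerivAt fun w hw => hasDerivAt_oscR_inv_pow (hc w hw) (c ^ 2) 3
  have hScont : ContinuousOn S (Set.Icc α β) := by
    have n3 : ∀ w ∈ Set.Icc α β, m c₃ w ≠ 0 := fun w hw => (mpos w hw).1.ne'
    exact (((mcont c₁ h1).div (mcont c₃ h3) n3).add
      (continuousOn_const.mul ((mcont c₂ h2).div (mcont c₃ h3) n3))).add continuousOn_const
  obtain ⟨a, ha, haL, haR⟩ := exists_threshold hαβ hScont hmono (-(1 / 8))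
  have suba : Set.Icc a β ⊆ Set.Icc α β := Set.Icc_subset_Icc ha.1 le_rfl
  obtain ⟨b, hb, hbL, hbR⟩ := exists_threshold ha.2 (hScont.mono suba) (hmono.mono suba) (1 / 8)
  have sub1 : Set.Icc α a ⊆ Set.Icc α β := Set.Icc_subset_Icc le_rfl ha.2
  have sub2 : Set.Icc a b ⊆ Set.Icc α β := Set.Icc_subset_Icc ha.1 hb.2
  have sub3 : Set.Icc b β ⊆ Set.Icc α β := Set.Icc_subset_Icc (ha.1.trans hb.1) le_rfl
  have hfc := continuousOn_phase hΦ hρ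
  have G2 : ∀ w ∈ Set.Icc α β, oscG₂ c₁ c₂ c₃ e₁ e₂ e₃ t w = -(t / 8) * e₁ * (m c₃ w * S w) := by
    intro w hw
    have := (mpos w hw).1
    have e : m c₃ w * S w = m c₁ w + e₁ * e₂ * m c₂ w + e₁ * e₃ * m c₃ w := by
      simp only [hS]; field_simp
    rw [e, oscG₂]
    simp only [hm]
    rcases he₁ with rfl | rfl <;> ring
  have hmr : ∀ w ∈ Set.Icc α β, 1 / 257 ^ 2 / r ^ 3 ≤ m c₃ w := by
    intro w hw
    have := hlr w hw
    have r3 := oscR_pos (h3 w hw)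
    have : (1 / 257 : ℝ) ^ 2 ≤ c₃ ^ 2 := by gcongr
    simp only [hm]
    gcongr
    linarith
  have h7 : (μ₃ ^ 3)⁻¹ ≤ t / 64 * (1 / 257 ^ 2 / r ^ 3) := by
    rw [inv_le_iff_one_le_mul₀ (by positivity)]
    have : t / 64 * (1 / 257 ^ 2 / r ^ 3) * μ₃ ^ 3 = t * μ₃ ^ 3 / (64 * 257 ^ 2 * r ^ 3) := by
      field_simp
    rw [this, one_le_div (by positivity)]; exact hm₃
  have h7' : ∀ w ∈ Set.Icc α β, (μ₃ ^ 3)⁻¹ ≤ t / 64 * m c₃ w := fun w hw =>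
    h7.trans (by have := hmr w hw; gcongr)
  have b1 : ‖∫ w in α..a, (ρ w : ℂ) * Complex.exp (Complex.I * (Φ w : ℂ))‖ ≤
      (16 + 6 * R) * μ₃ := by
    refine vanDerCorput_two ha.1 hμ₃ (fun w hw => hΦ w (sub1 hw)) (hρ.mono sub1)
      (fun w hw => hR w (sub1 hw))
      (fun w hw => hasDerivAt_oscG (h1 w (sub1 hw)) (h2 w (sub1 hw)) (h3 w (sub1 hw)))
      (fun w hw => hasDerivAt_oscG₁ (h1 w (sub1 hw)) (h2 w (sub1 hw)) (h3 w (sub1 hw))) ?_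
    have key : ∀ w ∈ Set.Ioo α a, (μ₃ ^ 3)⁻¹ ≤ -(t / 8 * (m c₃ w * S w)) := by
      intro w hw
      have hwI := sub1 (Set.Ioo_subset_Icc_self hw)
      have q := h7' w hwI
      have : m c₃ w * S w ≤ m c₃ w * -(1 / 8) :=
        mul_le_mul_of_nonneg_left (haL w hw) (mpos w hwI).1.le
      nlinarith
    rcases he₁ with e | e
    · left; intro w hw
      rw [G2 w (sub1 (Set.Ioo_subset_Icc_self hw)), e]; linarith [key w hw]
    · right; intro w hw
      rw [G2 w (sub1 (Set.Ioo_subset_Icc_self hw)), e]; linarith [key w hw]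
  have b3 : ‖∫ w in b..β, (ρ w : ℂ) * Complex.exp (Complex.I * (Φ w : ℂ))‖ ≤
      (16 + 6 * R) * μ₃ := by
    refine vanDerCorput_two hb.2 hμ₃ (fun w hw => hΦ w (sub3 hw)) (hρ.mono sub3)
      (fun w hw => hR w (sub3 hw))
      (fun w hw => hasDerivAt_oscG (h1 w (sub3 hw)) (h2 w (sub3 hw)) (h3 w (sub3 hw)))
      (fun w hw => hasDerivAt_oscG₁ (h1 w (sub3 hw)) (h2 w (sub3 hw)) (h3 w (sub3 hw))) ?_
    have key : ∀ w ∈ Set.Ioo b β, (μ₃ ^ 3)⁻¹ ≤ t / 8 * (m c₃ w * S w) := by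
      intro w hw
      have hwI := sub3 (Set.Ioo_subset_Icc_self hw)
      have q := h7' w hwI
      have : m c₃ w * (1 / 8) ≤ m c₃ w * S w :=
        mul_le_mul_of_nonneg_left (hbR w hw) (mpos w hwI).1.le
      nlinarith
    rcases he₁ with e | e
    · right; intro w hw
      rw [G2 w (sub3 (Set.Ioo_subset_Icc_self hw)), e]; linarith [key w hw]
    · left; intro w hw
      rw [G2 w (sub3 (Set.Ioo_subset_Icc_self hw)), e]; linarith [key w hw]
  have b2 : ‖∫ w in a..b, (ρ w : ℂ) * Complex.exp (Complex.I * (Φ w : ℂ))‖ ≤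
      (32 + 14 * R) * μ₄ := by
    refine vanDerCorput_three hb.1 hμ₄ (fun w hw => hΦ w (sub2 hw)) (hρ.mono sub2)
      (fun w hw => hR w (sub2 hw))
      (fun w hw => hasDerivAt_oscG (h1 w (sub2 hw)) (h2 w (sub2 hw)) (h3 w (sub2 hw)))
      (fun w hw => hasDerivAt_oscG₁ (h1 w (sub2 hw)) (h2 w (sub2 hw)) (h3 w (sub2 hw)))
      (fun w hw => hasDerivAt_oscG₂ (h1 w (sub2 hw)) (h2 w (sub2 hw)) (h3 w (sub2 hw))) ?_
    have key : ∀ w ∈ Set.Ioo a b, (μ₄ ^ 4)⁻¹ ≤ 3 * t / 16 * (e₁ * (e₁ * (c₁ ^ 3 / oscR c₁ w ^ 5) +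
        e₂ * (c₂ ^ 3 / oscR c₂ w ^ 5) + e₃ * (c₃ ^ 3 / oscR c₃ w ^ 5))) := by
      intro w hw
      have hwI := sub2 (Set.Ioo_subset_Icc_self hw)
      obtain ⟨p3, p2, p1⟩ := mpos w hwI
      obtain ⟨k1, k2, k3⟩ := ord w hwI
      have r2 := k1.trans_le k2
      have r3 := r2.trans_le k3
      have lo := haR w ⟨hw.1, hw.2.trans_le hb.2⟩
      have hi := hbL w hw
      have e : m c₃ w * S w = m c₁ w + e₁ * e₂ * m c₂ w + e₁ * e₃ * m c₃ w := by
        simp only [hS]; field_simp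
      have lo' : m c₃ w * -(1 / 8) ≤ m c₃ w * S w := mul_le_mul_of_nonneg_left lo p3.le
      have hi' : m c₃ w * S w ≤ m c₃ w * (1 / 8) := mul_le_mul_of_nonneg_left hi p3.le
      rw [e] at lo' hi'
      have s2 : e₁ * e₂ = -1 := by
        rcases hee with q | q
        · exfalso
          rw [q] at hi'
          rcases hee3 with q' | q' <;> rw [q'] at hi' <;> linarith
        · exact q
      have s3 : e₁ * e₃ = -1 := by
        rcases hee3 with q | q
        · exfalso
          rw [q, s2] at hi'
          linarith
        · exact q
      rw [s2, s3] at lo'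
      have T := osc_third_ge (c₁ := c₁) (c₃ := c₃) (m₁ := m c₁ w) (m₂ := m c₂ w) (m₃ := m c₃ w)
        (Y₁ := c₁ / oscR c₁ w ^ 2) (Y₂ := c₂ / oscR c₂ w ^ 2) (Y₃ := c₃ / oscR c₃ w ^ 2)
        p3 p2 (by positivity) (by gcongr) hc3'
        (by
          have : c₁ * c₃ / oscR c₃ w ^ 2 ≤ c₁ * c₃ / oscR c₁ w ^ 2 := by
            have := k2.trans k3
            gcongr
          calc _ = c₁ * c₃ / oscR c₃ w ^ 2 := by ring
            _ ≤ _ := this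
            _ = _ := by ring) (by positivity)
        (by simp only [hm]; field_simp) (by simp only [hm]; field_simp) (by linarith)
      have E : e₁ * (e₁ * (c₁ ^ 3 / oscR c₁ w ^ 5) +
          e₂ * (c₂ ^ 3 / oscR c₂ w ^ 5) + e₃ * (c₃ ^ 3 / oscR c₃ w ^ 5)) =
          m c₁ w * (c₁ / oscR c₁ w ^ 2) - m c₂ w * (c₂ / oscR c₂ w ^ 2) -
          m c₃ w * (c₃ / oscR c₃ w ^ 2) := by
        have z : ∀ c, 0 < oscR c w → m c w * (c / oscR c w ^ 2) = c ^ 3 / oscR c w ^ 5 :=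
          fun c hc => by simp only [hm]; field_simp
        rw [z c₁ k1, z c₂ r2, z c₃ r3]
        have : e₁ * e₁ = 1 := by rcases he₁ with rfl | rfl <;> norm_num
        linear_combination (c₁ ^ 3 / oscR c₁ w ^ 5) * this + (c₂ ^ 3 / oscR c₂ w ^ 5) * s2 +
          (c₃ ^ 3 / oscR c₃ w ^ 5) * s3
      rw [E]
      have hYlow : 1 / 257 / h ≤ c₁ / oscR c₁ w ^ 2 := by
        rw [oscR_sq (h1 w hwI)]
        have : 0 < 1 - c₁ * w := by linarith [h1 w hwI]
        have := hlh w hwI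
        have : (1 : ℝ) / 257 ≤ c₁ := by linarith
        gcongr
      have hmlow := hmr w hwI
      have h8 : (μ₄ ^ 4)⁻¹ ≤ 3 * t / 16 * (13 / 100 * (1 / 257 / h) * (1 / 257 ^ 2 / r ^ 3)) := by
        rw [inv_le_iff_one_le_mul₀ (by positivity)]
        have : 3 * t / 16 * (13 / 100 * (1 / 257 / h) * (1 / 257 ^ 2 / r ^ 3)) * μ₄ ^ 4 =
          t * μ₄ ^ 4 * (39 * 42 / 1600) / (42 * 257 ^ 3 * h * r ^ 3) := by
          field_simp; norm_num
        rw [this, one_le_div (by positivity)]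
        refine hm₄.trans ?_
        have : 0 ≤ t * μ₄ ^ 4 := by positivity
        linarith
      refine h8.trans ?_
      refine mul_le_mul_of_nonneg_left (le_trans ?_ T) (by positivity)
      gcongr
    rcases he₁ with e | e
    · right; intro w hw
      have := key w hw
      rw [e] at this
      rw [e, oscG₃]; linarith
    · left; intro w hw
      have := key w hw
      rw [e] at this
      rw [e, oscG₃]; linarith
  have hI1 : IntervalIntegrable (fun w => (ρ w : ℂ) * Complex.exp (Complex.I * (Φ w : ℂ)))
      volume α a := ContinuousOn.intervalIntegrable (by rw [Set.uIcc_of_le ha.1]; exact hfc.mono sub1)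
  have hI2 : IntervalIntegrable (fun w => (ρ w : ℂ) * Complex.exp (Complex.I * (Φ w : ℂ)))
      volume a b := ContinuousOn.intervalIntegrable (by rw [Set.uIcc_of_le hb.1]; exact hfc.mono sub2)
  have hI3 : IntervalIntegrable (fun w => (ρ w : ℂ) * Complex.exp (Complex.I * (Φ w : ℂ)))
      volume b β := ContinuousOn.intervalIntegrable (by rw [Set.uIcc_of_le hb.2]; exact hfc.mono sub3)
  rw [← intervalIntegral.integral_add_adjacent_intervals hI1 (hI2.trans hI3),
    ← intervalIntegral.integral_add_adjacent_intervals hI2 hI3]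
  calc _ ≤ (16 + 6 * R) * μ₃ + ((32 + 14 * R) * μ₄ + (16 + 6 * R) * μ₃) :=
        (norm_add_le _ _).trans (add_le_add b1 ((norm_add_le _ _).trans (add_le_add b2 b3)))
    _ = _ := by ring

end Phase

/-- The argument of the Bessel functions after subordination. -/
def oscX (t w : ℝ) : ℝ := t / (2 * √w)

/-- The squared inverse turning point. -/
def oscC (t : ℝ) (n : ℕ) : ℝ := 4 * (n:ℝ) ^ 2 / t ^ 2

/-- The Jacobian factor of the reduced phase. -/
def oscρ (w : ℝ) : ℝ := -(1 / (2 * (w * √w)))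

/-- The full phase. -/
def oscΦ (t κ : ℝ) (n₁ n₂ n₃ : ℕ) (e₁ e₂ e₃ w : ℝ) : ℝ :=
  -t * (√w + κ / 4 / √w) + (e₁ * besselθ n₁ (oscX t w) + e₂ * besselθ n₂ (oscX t w) +
    e₃ * besselθ n₃ (oscX t w))

lemma oscX_pos {t w : ℝ} (ht : 0 < t) (hw : 0 < w) : 0 < oscX t w := by
  have := Real.sqrt_pos.2 hw
  rw [oscX]; positivity

lemma hasDerivAt_oscX {t w : ℝ} (hw : 0 < w) :
    HasDerivAt (oscX t) (-(t / (4 * (w * √w)))) w := by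
  have h0 := Real.sqrt_pos.2 hw
  have h1 := ((hasDerivAt_const w t).fun_div ((Real.hasDerivAt_sqrt hw.ne').const_mul 2)
    (by positivity))
  refine h1.congr_deriv ?_
  have : √w ^ 2 = w := Real.sq_sqrt hw.le
  field_simp
  rw [this]; ring

lemma oscX_ratio {t w : ℝ} (ht : 0 < t) (hw : 0 < w) (n : ℕ) :
    ((n:ℝ) / oscX t w) ^ 2 = oscC t n * w := by
  have h0 := Real.sqrt_pos.2 hw
  have : √w ^ 2 = w := Real.sq_sqrt hw.le
  rw [oscX, oscC]
  field_simp
  rw [this]; ring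

lemma lt_oscX {t w : ℝ} (ht : 0 < t) (hw : 0 < w) {n : ℕ} (h : oscC t n * w < 1) :
    (n:ℝ) < oscX t w := by
  have h0 := oscX_pos ht hw
  rw [← oscX_ratio ht hw] at h
  have : (n:ℝ) / oscX t w < 1 := by
    by_contra hcon
    push Not at hcon
    nlinarith
  rwa [div_lt_one h0] at this

lemma oscC_nonneg (t : ℝ) (n : ℕ) : 0 ≤ oscC t n := by rw [oscC]; positivity

lemma oscC_mono (t : ℝ) {m n : ℕ} (h : m ≤ n) : oscC t m ≤ oscC t n := by
  rw [oscC, oscC]; gcongr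

lemma hasDerivAt_besselθ_oscX {t w : ℝ} (ht : 0 < t) (hw : 0 < w) {n : ℕ}
    (h : oscC t n * w < 1) :
    HasDerivAt (fun w => besselθ n (oscX t w))
      (oscR (oscC t n) w * -(t / (4 * (w * √w)))) w := by
  refine ((hasDerivAt_besselθ n (lt_oscX ht hw h)).comp w (hasDerivAt_oscX hw)).congr_deriv ?_
  rw [oscX_ratio ht hw, oscR]

lemma hasDerivAt_oscΦ {t κ w : ℝ} (ht : 0 < t) (hw : 0 < w) {n₁ n₂ n₃ : ℕ} (e₁ e₂ e₃ : ℝ)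
    (h₁ : oscC t n₁ * w < 1) (h₂ : oscC t n₂ * w < 1) (h₃ : oscC t n₃ * w < 1) :
    HasDerivAt (oscΦ t κ n₁ n₂ n₃ e₁ e₂ e₃)
      (oscρ w * oscG (oscC t n₁) (oscC t n₂) (oscC t n₃) e₁ e₂ e₃ t (κ / 4) w) w := by
  have h0 := Real.sqrt_pos.2 hw
  have hs := Real.hasDerivAt_sqrt hw.ne'
  have d0 := (hs.fun_add ((hasDerivAt_const w (κ / 4)).fun_div hs h0.ne')).const_mul (-t)
  refine (d0.fun_add ((((hasDerivAt_besselθ_oscX ht hw h₁).const_mul e₁).fun_add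
    ((hasDerivAt_besselθ_oscX ht hw h₂).const_mul e₂)).fun_add
    ((hasDerivAt_besselθ_oscX ht hw h₃).const_mul e₃))).congr_deriv ?_
  have h2 : √w ^ 2 = w := Real.sq_sqrt hw.le
  rw [oscρ, oscG, h2]
  field_simp
  ring

lemma continuousOn_oscρ {α β : ℝ} (hα : 1 / 256 ≤ α) : ContinuousOn oscρ (Set.Icc α β) := by
  refine (continuousOn_const.div (by fun_prop) fun w hw => ?_).neg
  have hw0 : 0 < w := lt_of_lt_of_le (by norm_num) (hα.trans hw.1)
  have := Real.sqrt_pos.2 hw0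
  positivity

lemma oscρ_bounds {w : ℝ} (hw : 1 / 256 ≤ w) : |oscρ w| ≤ 2048 := by
  have hw0 : 0 < w := lt_of_lt_of_le (by norm_num) hw
  have h1 : 1 / 16 ≤ √w := Real.le_sqrt_of_sq_le (by norm_num; linarith)
  rw [oscρ, abs_neg, abs_of_nonneg (by positivity), div_le_iff₀ (by positivity)]
  nlinarith [mul_le_mul hw h1 (by norm_num) hw0.le]

/-- An amplitude of size `M` varying at scale `h / K`. -/
def AmpBd (A A' : ℝ → ℂ) (α β M h K : ℝ) : Prop :=
  ContinuousOn A' (Set.Icc α β) ∧ ∀ w ∈ Set.Icc α β,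
    HasDerivAt A (A' w) w ∧ ‖A w‖ ≤ M ∧ ‖A' w‖ ≤ K * M / h

lemma AmpBd.continuousOn {A A' : ℝ → ℂ} {α β M h K : ℝ} (H : AmpBd A A' α β M h K) :
    ContinuousOn A (Set.Icc α β) := fun w hw => (H.2 w hw).1.continuousAt.continuousWithinAt

lemma AmpBd.mul {A A' B B' : ℝ → ℂ} {α β M M' h K K' : ℝ} (H : AmpBd A A' α β M h K)
    (H' : AmpBd B B' α β M' h K') :
    AmpBd (fun w => A w * B w) (fun w => A' w * B w + A w * B' w) α β (M * M') h (K + K') := by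
  refine ⟨(H.1.mul H'.continuousOn).add (H.continuousOn.mul H'.1), fun w hw => ?_⟩
  obtain ⟨a, b, c⟩ := H.2 w hw
  obtain ⟨a', b', c'⟩ := H'.2 w hw
  have M0 := (norm_nonneg _).trans b
  have M0' := (norm_nonneg _).trans b'
  refine ⟨a.fun_mul a', by rw [norm_mul]; gcongr, ?_⟩
  have K0 := (norm_nonneg _).trans c
  calc _ ≤ ‖A' w‖ * ‖B w‖ + ‖A w‖ * ‖B' w‖ := by
        rw [← norm_mul, ← norm_mul]; exact norm_add_le _ _
    _ ≤ K * M / h * M' + M * (K' * M' / h) := by gcongr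
    _ = _ := by ring

lemma AmpBd.conj {A A' : ℝ → ℂ} {α β M h K : ℝ} (H : AmpBd A A' α β M h K) :
    AmpBd (fun w => (starRingEnd ℂ) (A w)) (fun w => (starRingEnd ℂ) (A' w)) α β M h K := by
  refine ⟨Complex.continuous_conj.comp_continuousOn H.1, fun w hw => ?_⟩
  obtain ⟨a, b, c⟩ := H.2 w hw
  exact ⟨a.star, by simpa using b, by simpa using c⟩

lemma continuousOn_besselA' (n : ℕ) : ContinuousOn (besselA' n) (Set.Ioi (n:ℝ)) := by
  have hθ : ContinuousOn (besselθ n) (Set.Ioi (n:ℝ)) :=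
    fun x hx => (hasDerivAt_besselθ n hx).continuousAt.continuousWithinAt
  have hY : ContinuousOn (besselY' n) (Set.Ioi (n:ℝ)) :=
    fun x _ => (hasDerivAt_besselY' n x).continuousAt.continuousWithinAt
  have x0 : ∀ x ∈ Set.Ioi (n:ℝ), x ≠ 0 := fun x hx =>
    (lt_of_le_of_lt (Nat.cast_nonneg n) hx).ne'
  have hr : ContinuousOn (fun x => x * √(1 - ((n:ℝ) / x) ^ 2) ^ 3) (Set.Ioi (n:ℝ)) := by
    refine continuousOn_id.mul (ContinuousOn.pow (ContinuousOn.sqrt ?_) 3)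
    exact continuousOn_const.sub ((continuousOn_const.div continuousOn_id x0).pow 2)
  have hd : ContinuousOn (fun x => -besselY' n x / (x * √(1 - ((n:ℝ) / x) ^ 2) ^ 3))
      (Set.Ioi (n:ℝ)) := by
    refine hY.neg.div hr fun x hx => ?_
    have hx' : (n:ℝ) < x := hx
    have hx0 : 0 < x := lt_of_le_of_lt (Nat.cast_nonneg n) hx
    have : (n:ℝ) / x < 1 := by rwa [div_lt_one hx0]
    have h0 : 0 ≤ (n:ℝ) / x := by positivity
    have : 0 < √(1 - ((n:ℝ) / x) ^ 2) := Real.sqrt_pos.2 (by nlinarith)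
    positivity
  refine (((Complex.continuous_exp.comp_continuousOn (continuousOn_const.mul
    (Complex.continuous_ofReal.comp_continuousOn hθ.neg))).mul
    ((Complex.continuous_ofReal.comp_continuousOn hd).div_const _)).div_const _)

lemma oscX_ge {t w : ℝ} (ht : 0 < t) (hw : 0 < w) (hw' : w ≤ 256) : t / 32 ≤ oscX t w := by
  have h0 := Real.sqrt_pos.2 hw
  have h1 : √w ≤ 16 := by
    rw [show (16:ℝ) = √(16 ^ 2) by rw [Real.sqrt_sq (by norm_num)]]
    exact Real.sqrt_le_sqrt (by norm_num; linarith)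
  rw [oscX]
  apply div_le_div_of_nonneg_left ht.le (by positivity); linarith

/-- The Bessel amplitudes vary at the scale of the distance to the turning point. -/
lemma AmpBd.bessel {t α β h r : ℝ} (ht : 0 < t) (hα : 1 / 256 ≤ α) (hβ : β ≤ 256) (hh : 0 < h)
    (hr : 0 < r) {n : ℕ} (h1 : ∀ w ∈ Set.Icc α β, h / 2 ≤ 1 - oscC t n * w)
    (hlr : ∀ w ∈ Set.Icc α β, r ≤ oscR (oscC t n) w) (hth : (32:ℝ) ^ 2 ≤ t ^ 2 * (h / 2) ^ 3) :
    AmpBd (fun w => besselA n (oscX t w))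
      (fun w => -(t / (4 * (w * √w)) : ℝ) * besselA' n (oscX t w)) α β
      (100 / √(t / 32 * r)) h 256 := by
  have w0 : ∀ w ∈ Set.Icc α β, 0 < w := fun w hw => lt_of_lt_of_le (by norm_num) (hα.trans hw.1)
  have hlt : ∀ w ∈ Set.Icc α β, oscC t n * w < 1 := fun w hw => by linarith [h1 w hw]
  have Xc : ContinuousOn (oscX t) (Set.Icc α β) := fun w hw =>
    (hasDerivAt_oscX (w0 w hw)).continuousAt.continuousWithinAt
  constructor
  · refine ContinuousOn.mul (ContinuousOn.neg (Complex.continuous_ofReal.comp_continuousOn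
      (continuousOn_const.div (by fun_prop) fun w hw => ?_)))
      ((continuousOn_besselA' n).comp Xc fun w hw => lt_oscX ht (w0 w hw) (hlt w hw))
    have := w0 w hw
    have := Real.sqrt_pos.2 this
    positivity
  intro w hw
  have hw0 := w0 w hw
  have hX := oscX_pos ht hw0
  have hXge := oscX_ge ht hw0 (hw.2.trans hβ)
  have hR := oscR_pos (hlt w hw)
  have hR2 := oscR_sq (hlt w hw)
  have hrR := hlr w hw
  have hcond : 1 ≤ oscX t w * oscR (oscC t n) w ^ 3 := by
    have : 1 ^ 2 ≤ (oscX t w * oscR (oscC t n) w ^ 3) ^ 2 := by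
      calc (1:ℝ) ^ 2 ≤ (t / 32) ^ 2 * (h / 2) ^ 3 := by
            rw [div_pow]; norm_num at hth ⊢; linarith
        _ ≤ (oscX t w) ^ 2 * (oscR (oscC t n) w ^ 2) ^ 3 := by
            have := h1 w hw
            rw [hR2]; gcongr
        _ = _ := by ring
    exact (pow_le_pow_iff_left₀ (by norm_num) (by positivity) (by norm_num)).1 this
  obtain ⟨b, c⟩ := norm_besselA_le n hX hR (by rw [hR2, oscX_ratio ht hw0]) hcond
  have hM : 100 / √(oscX t w * oscR (oscC t n) w) ≤ 100 / √(t / 32 * r) := by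
    gcongr
  refine ⟨?_, b.trans hM, ?_⟩
  · have := (hasDerivAt_besselA n (lt_oscX ht hw0 (hlt w hw))).scomp w (hasDerivAt_oscX (t := t) hw0)
    refine this.congr_deriv ?_
    simp
  · have hs := Real.sqrt_pos.2 hw0
    have e : t / (4 * (w * √w)) = oscX t w / (2 * w) := by rw [oscX]; field_simp; norm_num
    rw [norm_mul, norm_neg, Complex.norm_real, Real.norm_of_nonneg (by positivity), e]
    have hw1 : 1 / 256 ≤ w := hα.trans hw.1
    calc _ ≤ oscX t w / (2 * w) * (100 / √(t / 32 * r) / (oscX t w * (h / 2))) := by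
          refine mul_le_mul_of_nonneg_left (c.trans ?_) (by positivity)
          have := h1 w hw
          rw [hR2]
          gcongr
      _ = (100 / √(t / 32 * r) / h) / w := by field_simp
      _ ≤ (100 / √(t / 32 * r) / h) / (1 / 256) := by gcongr
      _ = _ := by ring

/-- Stationary phase estimate on a block with a slowly varying amplitude. -/
lemma norm_integral_block_le {Φ : ℝ → ℝ} {A A' : ℝ → ℂ} {α β M h K V : ℝ} (hα : 1 / 256 ≤ α)
    (hαβ : α ≤ β) (hβ : β ≤ 256) (hh : 0 < h) (hh1 : h ≤ 1) (hM : 0 ≤ M) (hK : 0 ≤ K)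
    (hlen : β - α ≤ 512 * h)
    (H : AmpBd A A' α β M h K) (hΦ : ContinuousOn Φ (Set.Icc α β))
    (hV : ∀ x ∈ Set.Icc α β, ‖∫ w in α..x, (oscρ w : ℂ) * Complex.exp (Complex.I * (Φ w : ℂ))‖ ≤ V) :
    ‖∫ w in α..β, A w * Complex.exp (Complex.I * (Φ w : ℂ))‖ ≤ (10 ^ 5 + 10 ^ 7 * K) * M * V := by
  have w0 : ∀ w ∈ Set.Icc α β, 0 < w := fun w hw => lt_of_lt_of_le (by norm_num) (hα.trans hw.1)
  set B : ℝ → ℂ := fun w => A w * ((-2 * (w * √w) : ℝ) : ℂ) with hB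
  set B' : ℝ → ℂ := fun w => A' w * ((-2 * (w * √w) : ℝ) : ℂ) + A w * ((-3 * √w : ℝ) : ℂ) with hB'
  have hdB : ∀ w ∈ Set.Icc α β, HasDerivAt B (B' w) w := by
    intro w hw
    have hw0 := w0 w hw
    have hs := Real.sqrt_pos.2 hw0
    have e : HasDerivAt (fun w => -2 * (w * √w)) (-3 * √w) w := by
      refine (((hasDerivAt_id w).fun_mul (Real.hasDerivAt_sqrt hw0.ne')).const_mul (-2)).congr_deriv ?_
      have : √w ^ 2 = w := Real.sq_sqrt hw0.le
      simp only [id]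
      field_simp
      rw [this]; ring
    exact (H.2 w hw).1.fun_mul e.ofReal_comp
  have hcB : ContinuousOn B' (Set.Icc α β) := by
    refine (H.1.mul (Complex.continuous_ofReal.comp_continuousOn (by fun_prop))).add
      (H.continuousOn.mul (Complex.continuous_ofReal.comp_continuousOn (by fun_prop)))
  have hV0 : 0 ≤ V := (norm_nonneg _).trans (hV α ⟨le_rfl, hαβ⟩)
  have sq16 : ∀ w ∈ Set.Icc α β, √w ≤ 16 := fun w hw => by
    rw [show (16:ℝ) = √(16 ^ 2) by rw [Real.sqrt_sq (by norm_num)]]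
    exact Real.sqrt_le_sqrt (by norm_num; linarith [hw.2])
  have nB : ∀ w ∈ Set.Icc α β, ‖((-2 * (w * √w) : ℝ) : ℂ)‖ ≤ 8192 := by
    intro w hw
    have hw0 := w0 w hw
    rw [Complex.norm_real, Real.norm_eq_abs, abs_mul, abs_of_nonneg (by positivity : 0 ≤ w * √w)]
    norm_num
    nlinarith [sq16 w hw, hw.2, Real.sqrt_nonneg w, mul_le_mul (hw.2.trans hβ) (sq16 w hw)
      (Real.sqrt_nonneg w) (by norm_num)]
  have nB' : ∀ w ∈ Set.Icc α β, ‖((-3 * √w : ℝ) : ℂ)‖ ≤ 48 := by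
    intro w hw
    rw [Complex.norm_real, Real.norm_eq_abs, abs_mul, abs_of_nonneg (Real.sqrt_nonneg w)]
    norm_num
    linarith [sq16 w hw]
  have hVar : ∫ w in α..β, ‖B' w‖ ≤ 512 * h * (K * M / h * 8192 + M * 48) := by
    have : ∫ w in α..β, ‖B' w‖ ≤ ∫ w in α..β, (K * M / h * 8192 + M * 48) := by
      refine intervalIntegral.integral_mono_on hαβ
        (ContinuousOn.intervalIntegrable (by rw [Set.uIcc_of_le hαβ]; exact hcB.norm))
        intervalIntegrable_const fun w hw => ?_
      obtain ⟨a, b, c⟩ := H.2 w hw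
      calc _ ≤ ‖A' w‖ * ‖((-2 * (w * √w) : ℝ) : ℂ)‖ + ‖A w‖ * ‖((-3 * √w : ℝ) : ℂ)‖ := by
            rw [← norm_mul, ← norm_mul]; exact norm_add_le _ _
        _ ≤ _ := by
            have := nB w hw
            have := nB' w hw
            gcongr
    refine this.trans ?_
    rw [intervalIntegral.integral_const, smul_eq_mul]
    gcongr
  have e : ∫ w in α..β, A w * Complex.exp (Complex.I * (Φ w : ℂ)) =
      ∫ w in α..β, B w * ((oscρ w : ℂ) * Complex.exp (Complex.I * (Φ w : ℂ))) := by
    refine intervalIntegral.integral_congr fun w hw => ?_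
    rw [Set.uIcc_of_le hαβ] at hw
    have hw0 := w0 w hw
    have hs := Real.sqrt_pos.2 hw0
    have : ((-2 * (w * √w) : ℝ) : ℂ) * (oscρ w : ℂ) = 1 := by
      have : -2 * (w * √w) * oscρ w = 1 := by rw [oscρ]; field_simp
      rw [← Complex.ofReal_mul, this, Complex.ofReal_one]
    simp only [hB]
    linear_combination (-(A w * Complex.exp (Complex.I * (Φ w : ℂ)))) * this
  rw [e]
  have hend : β ∈ Set.Icc α β := ⟨hαβ, le_rfl⟩
  have hfin := norm_integral_amplitude_le hαβ (A := B) (A' := B') (M := M * 8192)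
    (((Complex.continuous_ofReal.comp_continuousOn (continuousOn_oscρ hα)).mul
      (Complex.continuous_exp.comp_continuousOn (continuousOn_const.mul
        (Complex.continuous_ofReal.comp_continuousOn hΦ))))) hV hdB hcB
    (by
      simp only [hB]; rw [norm_mul]
      have := nB β hend
      have := (H.2 β hend).2.1
      gcongr) hVar
  refine hfin.trans ?_
  have : 512 * h * (K * M / h * 8192 + M * 48) = 512 * 8192 * K * M + 512 * 48 * M * h := by
    field_simp
  rw [this]
  have h5 : M * h ≤ M * 1 := by gcongr
  have : M * 8192 + (512 * 8192 * K * M + 512 * 48 * M * h) ≤ (10 ^ 5 + 10 ^ 7 * K) * M := by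
    nlinarith [mul_nonneg hK hM]
  nlinarith [mul_le_mul_of_nonneg_left this hV0]

/-- Trivial estimate on a block. -/
lemma norm_integral_block_le_trivial {Φ : ℝ → ℝ} {A : ℝ → ℂ} {α β M h : ℝ}
    (hαβ : α ≤ β) (hlen : β - α ≤ 512 * h) (hM : 0 ≤ M) (H : ∀ w ∈ Set.Icc α β, ‖A w‖ ≤ M) :
    ‖∫ w in α..β, A w * Complex.exp (Complex.I * (Φ w : ℂ))‖ ≤ 512 * h * M := by
  have := intervalIntegral.norm_integral_le_of_norm_le_const (a := α) (b := β) (C := M)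
    (f := fun w => A w * Complex.exp (Complex.I * (Φ w : ℂ))) fun w hw => by
      rw [norm_mul, norm_cexp_I_mul, mul_one]
      rw [Set.uIoc_of_le hαβ] at hw
      exact H w ⟨hw.1.le, hw.2⟩
  refine this.trans ?_
  rw [abs_of_nonneg (by linarith)]
  nlinarith

/-- Summability of a geometric sequence through the function `min u u⁻¹`. -/
lemma sum_min_inv_le {u : ℕ → ℝ} {q : ℝ} (hq : 0 < q) (hq1 : q < 1) (hu : ∀ k, 0 < u k)
    (huq : ∀ k, u (k + 1) ≤ q * u k) (N : ℕ) :
    ∑ k ∈ Finset.range N, min (u k) (u k)⁻¹ ≤ 4 / (1 - q) := by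
  have key : ∀ k, min (u k) (u k)⁻¹ ≤
      4 / (1 - q) * (u k / (1 + u k) - u (k + 1) / (1 + u (k + 1))) := by
    intro k
    have h0 := hu k
    have h1 := hu (k + 1)
    have h2 := huq k
    have hm : u (k + 1) / (1 + u (k + 1)) ≤ q * u k / (1 + q * u k) := by
      rw [div_le_div_iff₀ (by positivity) (by positivity)]; nlinarith
    have h3 : min (u k) (u k)⁻¹ ≤ 4 * u k / (1 + u k) ^ 2 := by
      rcases le_total (u k) 1 with h | h
      · refine (min_le_left _ _).trans ?_
        rw [le_div_iff₀ (by positivity)]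
        have : (1 + u k) ^ 2 ≤ 4 := by nlinarith
        nlinarith
      · refine (min_le_right _ _).trans ?_
        rw [inv_le_iff_one_le_mul₀ h0, div_mul_eq_mul_div, one_le_div (by positivity)]; nlinarith
    have h4 : (1 - q) * (u k / (1 + u k) ^ 2) ≤ u k / (1 + u k) - q * u k / (1 + q * u k) := by
      have e : u k / (1 + u k) - q * u k / (1 + q * u k) =
          (1 - q) * (u k / ((1 + u k) * (1 + q * u k))) := by field_simp; ring
      rw [e]
      have : 0 ≤ 1 - q := by linarith
      gcongr
      rw [pow_two]
      gcongr
      nlinarith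
    rw [div_mul_eq_mul_div, le_div_iff₀ (by linarith)]
    have h5 : min (u k) (u k)⁻¹ * (1 - q) ≤ 4 * u k / (1 + u k) ^ 2 * (1 - q) := by
      gcongr
    have : 4 * u k / (1 + u k) ^ 2 * (1 - q) = 4 * ((1 - q) * (u k / (1 + u k) ^ 2)) := by ring
    linarith
  refine (Finset.sum_le_sum fun k _ => key k).trans ?_
  rw [← Finset.mul_sum, Finset.sum_range_sub']
  have h0 := hu 0
  have hN := hu N
  have : 0 ≤ u N / (1 + u N) := by positivity
  have : u 0 / (1 + u 0) ≤ 1 := by rw [div_le_one (by positivity)]; linarith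
  have : 0 < 4 / (1 - q) := div_pos (by norm_num) (by linarith)
  nlinarith

/-- The Bessel amplitude or its conjugate, according to a sign. -/
def oscA (t e : ℝ) (n : ℕ) (w : ℝ) : ℂ :=
  if e = 1 then besselA n (oscX t w) else (starRingEnd ℂ) (besselA n (oscX t w))

lemma exists_ampBd_oscA {t α β h r : ℝ} (ht : 0 < t) (hα : 1 / 256 ≤ α) (hβ : β ≤ 256) (hh : 0 < h)
    (hr : 0 < r) {n : ℕ} (h1 : ∀ w ∈ Set.Icc α β, h / 2 ≤ 1 - oscC t n * w)
    (hlr : ∀ w ∈ Set.Icc α β, r ≤ oscR (oscC t n) w) (hth : (32:ℝ) ^ 2 ≤ t ^ 2 * (h / 2) ^ 3)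
    (e : ℝ) : ∃ A', AmpBd (oscA t e n) A' α β (100 / √(t / 32 * r)) h 256 := by
  have H := AmpBd.bessel ht hα hβ hh hr h1 hlr hth
  by_cases he : e = 1
  · exact ⟨_, by unfold oscA; simp only [he, if_true]; exact H⟩
  · exact ⟨_, by unfold oscA; simp only [he, if_false]; exact H.conj⟩

lemma besselY_eq_oscA (t w : ℝ) (n : ℕ) :
    (besselY n (oscX t w) : ℂ) =
      oscA t 1 n w * Complex.exp (Complex.I * ((1 * besselθ n (oscX t w) : ℝ) : ℂ)) +
      oscA t (-1) n w * Complex.exp (Complex.I * ((-1 * besselθ n (oscX t w) : ℝ) : ℂ)) := by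
  rw [besselY_eq_besselA, oscA, oscA, if_pos rfl, if_neg (by norm_num)]
  simp

lemma continuousOn_oscA {t : ℝ} (ht : 0 < t) (e : ℝ) (n : ℕ) {S : Set ℝ} (hS : ∀ w ∈ S, 0 < w)
    (h : ∀ w ∈ S, oscC t n * w < 1) : ContinuousOn (oscA t e n) S := by
  have : ContinuousOn (fun w => besselA n (oscX t w)) S := fun w hw =>
    ((hasDerivAt_besselA n (lt_oscX ht (hS w hw) (h w hw))).continuousAt.comp
      (hasDerivAt_oscX (t := t) (hS w hw)).continuousAt).continuousWithinAt
  by_cases he : e = 1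
  · unfold oscA; simp only [he, if_true]; exact this
  · unfold oscA; simp only [he, if_false]; exact Complex.continuous_conj.comp_continuousOn this

/-- Block estimate for a product of three Bessel functions. -/
lemma norm_integral_block₃_le {l η ϱ κ α β e₁ e₂ e₃ : ℝ} {n₁ n₂ n₃ : ℕ} (hl : 1 ≤ l) (hη : 0 < η)
    (hη1 : η ≤ 1) (hϱ : 0 < ϱ) (hα : 1 / 256 ≤ α) (hαβ : α ≤ β) (hβ : β ≤ 256)
    (hlen : β - α ≤ 512 * η ^ 12) (hn12 : n₂ ≤ n₁) (hn23 : n₃ ≤ n₂)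
    (he₁ : e₁ = 1 ∨ e₁ = -1) (he₂ : e₂ = 1 ∨ e₂ = -1) (he₃ : e₃ = 1 ∨ e₃ = -1)
    (h1 : ∀ w ∈ Set.Icc α β, η ^ 12 / 2 ≤ 1 - oscC (l ^ 12) n₁ * w)
    (hlh : ∀ w ∈ Set.Icc α β, 1 - oscC (l ^ 12) n₁ * w ≤ η ^ 12)
    (hϱα : ϱ ^ 4 = oscR (oscC (l ^ 12) n₃) α)
    (hth : (32:ℝ) ^ 2 ≤ (l ^ 12) ^ 2 * (η ^ 12 / 2) ^ 3) :
    ‖∫ w in α..β, oscA (l ^ 12) e₁ n₁ w * oscA (l ^ 12) e₂ n₂ w * oscA (l ^ 12) e₃ n₃ w *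
      Complex.exp (Complex.I * (oscΦ (l ^ 12) κ n₁ n₂ n₃ e₁ e₂ e₃ w : ℂ))‖ ≤
      10 ^ 27 / l ^ 20 * min (l * η ^ 3 / ϱ) (l * η ^ 3 / ϱ)⁻¹ := by
  set t := l ^ 12 with ht_def
  have hl0 : 0 < l := by linarith
  have ht : 0 < t := by positivity
  have hc12 := oscC_mono t hn12
  have hc23 := oscC_mono t hn23
  have hc3 := oscC_nonneg t n₃
  set c₁ := oscC t n₁
  set c₂ := oscC t n₂
  set c₃ := oscC t n₃
  have w0 : ∀ w ∈ Set.Icc α β, 0 < w := fun w hw => lt_of_lt_of_le (by norm_num) (hα.trans hw.1)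
  have hpos : 0 < η ^ 12 / 2 := by positivity
  have lt1 : ∀ w ∈ Set.Icc α β, c₁ * w < 1 := fun w hw => by linarith [h1 w hw]
  have h2 : ∀ w ∈ Set.Icc α β, η ^ 12 / 2 ≤ 1 - c₂ * w := fun w hw => by
    have := h1 w hw; have := w0 w hw; nlinarith
  have h3 : ∀ w ∈ Set.Icc α β, η ^ 12 / 2 ≤ 1 - c₃ * w := fun w hw => by
    have := h2 w hw; have := w0 w hw; nlinarith
  have lt2 : ∀ w ∈ Set.Icc α β, c₂ * w < 1 := fun w hw => by linarith [h2 w hw]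
  have lt3 : ∀ w ∈ Set.Icc α β, c₃ * w < 1 := fun w hw => by linarith [h3 w hw]
  have rlow : ∀ c w, η ^ 12 / 2 ≤ 1 - c * w → η ^ 6 / 2 ≤ oscR c w := fun c w hc => by
    refine Real.le_sqrt_of_sq_le (le_trans ?_ hc)
    have : (η ^ 6 / 2) ^ 2 = η ^ 12 / 4 := by ring
    rw [this]; linarith
  have hαm : α ∈ Set.Icc α β := ⟨le_rfl, hαβ⟩
  have r3low : ∀ w ∈ Set.Icc α β, ϱ ^ 4 / 2 ≤ oscR c₃ w := by
    intro w hw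
    have p1 := oscR_pos (lt1 α hαm)
    have hx := oscR_cross hw.1 (hc23.trans hc12) (lt1 α hαm) (lt3 w hw)
    have hr : oscR c₁ α / 2 ≤ oscR c₁ w := by
      refine Real.le_sqrt_of_sq_le ?_
      rw [div_pow, oscR_sq (lt1 α hαm)]
      have := h1 w hw
      have := hlh α hαm
      linarith
    have p3 := oscR_pos (lt3 α hαm)
    rw [hϱα]
    have : oscR c₁ α * (oscR c₃ α / 2) ≤ oscR c₁ α * oscR c₃ w := by nlinarith
    exact le_of_mul_le_mul_left this p1
  obtain ⟨A₁, H₁⟩ := exists_ampBd_oscA ht hα hβ (by positivity) (by positivity : 0 < η ^ 6 / 2) h1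
    (fun w hw => rlow _ w (h1 w hw)) hth e₁
  obtain ⟨A₂, H₂⟩ := exists_ampBd_oscA ht hα hβ (by positivity) (by positivity : 0 < η ^ 6 / 2) h2
    (fun w hw => rlow _ w (h2 w hw)) hth e₂
  obtain ⟨A₃, H₃⟩ := exists_ampBd_oscA ht hα hβ (by positivity) (by positivity : 0 < ϱ ^ 4 / 2) h3
    r3low hth e₃
  have s1 : √(t / 32 * (η ^ 6 / 2)) = l ^ 6 * η ^ 3 / 8 := by
    rw [show t / 32 * (η ^ 6 / 2) = (l ^ 6 * η ^ 3 / 8) ^ 2 by rw [ht_def]; ring]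
    exact Real.sqrt_sq (by positivity)
  have s3 : √(t / 32 * (ϱ ^ 4 / 2)) = l ^ 6 * ϱ ^ 2 / 8 := by
    rw [show t / 32 * (ϱ ^ 4 / 2) = (l ^ 6 * ϱ ^ 2 / 8) ^ 2 by rw [ht_def]; ring]
    exact Real.sqrt_sq (by positivity)
  have H := (H₁.mul H₂).mul H₃
  rw [s1, s3] at H
  have eM : 100 / (l ^ 6 * η ^ 3 / 8) * (100 / (l ^ 6 * η ^ 3 / 8)) * (100 / (l ^ 6 * ϱ ^ 2 / 8)) =
      512 * 10 ^ 6 / (l ^ 18 * η ^ 6 * ϱ ^ 2) := by field_simp; norm_num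
  rw [eM] at H
  set u := l * η ^ 3 / ϱ with hu
  have hu0 : 0 < u := by positivity
  have hΦd : ∀ w ∈ Set.Icc α β, HasDerivAt (oscΦ t κ n₁ n₂ n₃ e₁ e₂ e₃)
      (oscρ w * oscG c₁ c₂ c₃ e₁ e₂ e₃ t (κ / 4) w) w := fun w hw =>
    hasDerivAt_oscΦ ht (w0 w hw) e₁ e₂ e₃ (lt1 w hw) (lt2 w hw) (lt3 w hw)
  have hV : ∀ x ∈ Set.Icc α β, ‖∫ w in α..x, (oscρ w : ℂ) *
      Complex.exp (Complex.I * (oscΦ t κ n₁ n₂ n₃ e₁ e₂ e₃ w : ℂ))‖ ≤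
      5 * 10 ^ 7 * (ϱ ^ 4 / l ^ 4 + η ^ 3 * ϱ ^ 3 / l ^ 3) := by
    intro x hx
    have sub : Set.Icc α x ⊆ Set.Icc α β := Set.Icc_subset_Icc le_rfl hx.2
    rcases le_or_gt (1 / 257) c₃ with hc | hc
    · have := norm_integral_osc_le_B (R := 2048) (κ := κ / 4) (r := ϱ ^ 4) (h := η ^ 12)
        (μ₃ := 162 * (ϱ ^ 4 / l ^ 4)) (μ₄ := 164 * (η ^ 3 * ϱ ^ 3 / l ^ 3)) hx.1 (by linarith) ht
        (by positivity) (by positivity) hc12 hc23 hc he₁ he₂ he₃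
        (fun w hw => lt1 w (sub hw)) (fun w hw => hlh w (sub hw))
        (fun w hw => by rw [hϱα]; exact oscR_anti_right hc3 hw.1)
        (fun w hw => hΦd w (sub hw)) (continuousOn_oscρ hα)
        (fun w hw => oscρ_bounds (hα.trans hw.1)) (by positivity) (by positivity)
        (by
          have : t * (162 * (ϱ ^ 4 / l ^ 4)) ^ 3 = 162 ^ 3 * (ϱ ^ 4) ^ 3 := by
            rw [ht_def]; field_simp
          rw [this]; gcongr; norm_num)
        (by
          have : t * (164 * (η ^ 3 * ϱ ^ 3 / l ^ 3)) ^ 4 = 164 ^ 4 * η ^ 12 * (ϱ ^ 4) ^ 3 := by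
            rw [ht_def]; field_simp
          rw [this]; gcongr; norm_num)
      refine this.trans ?_
      have a : 0 < ϱ ^ 4 / l ^ 4 := by positivity
      have b : 0 < η ^ 3 * ϱ ^ 3 / l ^ 3 := by positivity
      linarith
    · have hy : ∀ w ∈ Set.Icc α β, c₃ / oscR c₃ w ≤ 1 := by
        intro w hw
        by_contra hcon
        push Not at hcon
        have := ge_of_one_le_div hc3 (hw.2.trans hβ) (lt3 w hw) hcon.le
        linarith
      have hr257 := ge_of_div_le_one hc3 (w0 α hαm).le (hαβ.trans hβ) (lt3 α hαm) (hy α hαm)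
      rw [← hϱα] at hr257
      have := norm_integral_osc_le_A (R := 2048) (κ := κ / 4) (h := η ^ 12)
        (μ₁ := 2 / l ^ 6) (μ₂ := 13 * η ^ 4 / l ^ 4) hx.1 (by linarith) (hx.2.trans hβ) ht
        (by positivity) hc12 hc23 hc3 he₁ he₂ he₃
        (fun w hw => lt1 w (sub hw)) (fun w hw => hlh w (sub hw))
        (fun w hw => hΦd w (sub hw)) (continuousOn_oscρ hα)
        (fun w hw => oscρ_bounds (hα.trans hw.1))
        (fun w hw => hy w (sub (Set.Ioo_subset_Icc_self hw))) (by positivity) (by positivity)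
        (by rw [ht_def]; apply le_of_eq; field_simp; norm_num)
        (by
          have : t * (13 * η ^ 4 / l ^ 4) ^ 3 = 13 ^ 3 * η ^ 12 := by
            rw [ht_def]; field_simp
          rw [this]; gcongr; norm_num)
      refine this.trans ?_
      have a : 1 / l ^ 4 ≤ 257 * (ϱ ^ 4 / l ^ 4) := by
        rw [← mul_div_assoc]; gcongr; linarith
      have b : 0 < η ^ 3 * ϱ ^ 3 / l ^ 3 := by positivity
      have c : 2 / l ^ 6 ≤ 2 * (1 / l ^ 4) := by
        rw [mul_one_div]; gcongr
        norm_num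
      have d : 13 * η ^ 4 / l ^ 4 ≤ 13 * (1 / l ^ 4) := by
        rw [mul_one_div]; gcongr
        nlinarith [pow_le_one₀ hη.le hη1 (n := 4)]
      have : 0 < ϱ ^ 4 / l ^ 4 := by positivity
      linarith
  have bV := norm_integral_block_le hα hαβ hβ (by positivity) (pow_le_one₀ hη.le hη1)
    (by positivity) (by norm_num) hlen H (continuousOn_of_hasDerivAt hΦd) hV
  have bT := norm_integral_block_le_trivial (Φ := oscΦ t κ n₁ n₂ n₃ e₁ e₂ e₃) hαβ hlen
    (by positivity) (fun w hw => (H.2 w hw).2.1)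
  rcases le_total u 1 with h | h
  · rw [min_eq_left (h.trans (by rw [one_le_inv₀ hu0]; exact h))]
    refine bT.trans ?_
    have : 512 * η ^ 12 * (512 * 10 ^ 6 / (l ^ 18 * η ^ 6 * ϱ ^ 2)) =
        512 * 512 * 10 ^ 6 / l ^ 20 * (u * u) := by rw [hu]; field_simp
    rw [this]
    gcongr
    · norm_num
    · nlinarith
  · rw [min_eq_right (le_trans (by rw [inv_le_one₀ hu0]; exact h) h)]
    refine bV.trans ?_
    have hui : u⁻¹ ≤ 1 := by rw [inv_le_one₀ hu0]; exact h
    have hui0 : 0 < u⁻¹ := by positivity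
    have key : ∀ a b c : ℝ, a * (b / (l ^ 18 * η ^ 6 * ϱ ^ 2)) *
        (c * (ϱ ^ 4 / l ^ 4 + η ^ 3 * ϱ ^ 3 / l ^ 3)) =
        a * b * c / l ^ 20 * (u⁻¹ * u⁻¹ + u⁻¹) := by
      intro a b c; rw [hu]; field_simp
    rw [key]
    calc _ ≤ (10 ^ 5 + 10 ^ 7 * (256 + 256 + 256)) * (512 * 10 ^ 6) * (5 * 10 ^ 7) / l ^ 20 * (2 * u⁻¹) := by
          gcongr; nlinarith
      _ ≤ _ := by
          rw [div_mul_eq_mul_div, div_mul_eq_mul_div]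
          gcongr ?_ / _
          nlinarith

/-- Block estimate for a product of two Bessel functions. -/
lemma norm_integral_block₂_le {l η κ α β e₁ e₂ : ℝ} {n₁ n₂ : ℕ} (hl : 1 ≤ l) (hη : 0 < η)
    (hη1 : η ≤ 1) (hα : 1 / 256 ≤ α) (hαβ : α ≤ β) (hβ : β ≤ 256)
    (hlen : β - α ≤ 512 * η ^ 12) (hn12 : n₂ ≤ n₁)
    (he₁ : e₁ = 1 ∨ e₁ = -1) (he₂ : e₂ = 1 ∨ e₂ = -1)
    (h1 : ∀ w ∈ Set.Icc α β, η ^ 12 / 2 ≤ 1 - oscC (l ^ 12) n₁ * w)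
    (hlh : ∀ w ∈ Set.Icc α β, 1 - oscC (l ^ 12) n₁ * w ≤ η ^ 12)
    (hth : (32:ℝ) ^ 2 ≤ (l ^ 12) ^ 2 * (η ^ 12 / 2) ^ 3) :
    ‖∫ w in α..β, oscA (l ^ 12) e₁ n₁ w * oscA (l ^ 12) e₂ n₂ w *
      Complex.exp (Complex.I * (oscΦ (l ^ 12) κ n₁ n₂ 0 e₁ e₂ 1 w : ℂ))‖ ≤
      10 ^ 27 / l ^ 15 * min (l * η ^ 2) (l * η ^ 2)⁻¹ := by
  set t := l ^ 12 with ht_def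
  have hl0 : 0 < l := by linarith
  have ht : 0 < t := by positivity
  have hc12 := oscC_mono t hn12
  have hc23 := oscC_mono t (Nat.zero_le n₂)
  have hc3 : oscC t 0 = 0 := by simp [oscC]
  rw [hc3] at hc23
  set c₁ := oscC t n₁
  set c₂ := oscC t n₂
  have w0 : ∀ w ∈ Set.Icc α β, 0 < w := fun w hw => lt_of_lt_of_le (by norm_num) (hα.trans hw.1)
  have hpos : 0 < η ^ 12 / 2 := by positivity
  have lt1 : ∀ w ∈ Set.Icc α β, c₁ * w < 1 := fun w hw => by linarith [h1 w hw]
  have h2 : ∀ w ∈ Set.Icc α β, η ^ 12 / 2 ≤ 1 - c₂ * w := fun w hw => by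
    have := h1 w hw; have := w0 w hw; nlinarith
  have lt2 : ∀ w ∈ Set.Icc α β, c₂ * w < 1 := fun w hw => by linarith [h2 w hw]
  have rlow : ∀ c w, η ^ 12 / 2 ≤ 1 - c * w → η ^ 6 / 2 ≤ oscR c w := fun c w hc => by
    refine Real.le_sqrt_of_sq_le (le_trans ?_ hc)
    have : (η ^ 6 / 2) ^ 2 = η ^ 12 / 4 := by ring
    rw [this]; linarith
  obtain ⟨A₁, H₁⟩ := exists_ampBd_oscA ht hα hβ (by positivity) (by positivity : 0 < η ^ 6 / 2) h1
    (fun w hw => rlow _ w (h1 w hw)) hth e₁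
  obtain ⟨A₂, H₂⟩ := exists_ampBd_oscA ht hα hβ (by positivity) (by positivity : 0 < η ^ 6 / 2) h2
    (fun w hw => rlow _ w (h2 w hw)) hth e₂
  have s1 : √(t / 32 * (η ^ 6 / 2)) = l ^ 6 * η ^ 3 / 8 := by
    rw [show t / 32 * (η ^ 6 / 2) = (l ^ 6 * η ^ 3 / 8) ^ 2 by rw [ht_def]; ring]
    exact Real.sqrt_sq (by positivity)
  have H := H₁.mul H₂
  rw [s1] at H
  have eM : 100 / (l ^ 6 * η ^ 3 / 8) * (100 / (l ^ 6 * η ^ 3 / 8)) =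
      64 * 10 ^ 4 / (l ^ 12 * η ^ 6) := by field_simp; norm_num
  rw [eM] at H
  set u := l * η ^ 2 with hu
  have hu0 : 0 < u := by positivity
  have hΦd : ∀ w ∈ Set.Icc α β, HasDerivAt (oscΦ t κ n₁ n₂ 0 e₁ e₂ 1)
      (oscρ w * oscG c₁ c₂ 0 e₁ e₂ 1 t (κ / 4) w) w := fun w hw => by
    have := hasDerivAt_oscΦ (κ := κ) ht (w0 w hw) (n₃ := 0) e₁ e₂ 1 (lt1 w hw) (lt2 w hw)
      (by rw [hc3]; norm_num)
    rwa [hc3] at this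
  have hV : ∀ x ∈ Set.Icc α β, ‖∫ w in α..x, (oscρ w : ℂ) *
      Complex.exp (Complex.I * (oscΦ t κ n₁ n₂ 0 e₁ e₂ 1 w : ℂ))‖ ≤
      2 * 10 ^ 5 * (1 / l ^ 6 + η ^ 4 / l ^ 4) := by
    intro x hx
    have sub : Set.Icc α x ⊆ Set.Icc α β := Set.Icc_subset_Icc le_rfl hx.2
    have := norm_integral_osc_le_A (R := 2048) (κ := κ / 4) (h := η ^ 12)
      (μ₁ := 2 / l ^ 6) (μ₂ := 13 * η ^ 4 / l ^ 4) hx.1 (by linarith) (hx.2.trans hβ) ht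
      (by positivity) hc12 hc23 le_rfl he₁ he₂ (Or.inl rfl)
      (fun w hw => lt1 w (sub hw)) (fun w hw => hlh w (sub hw))
      (fun w hw => hΦd w (sub hw)) (continuousOn_oscρ hα)
      (fun w hw => oscρ_bounds (hα.trans hw.1))
      (fun w _ => by simp) (by positivity) (by positivity)
      (by rw [ht_def]; apply le_of_eq; field_simp; norm_num)
      (by
        have : t * (13 * η ^ 4 / l ^ 4) ^ 3 = 13 ^ 3 * η ^ 12 := by
          rw [ht_def]; field_simp
        rw [this]; gcongr; norm_num)
    refine this.trans ?_
    have b : 0 < 1 / l ^ 6 := by positivity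
    have c : 0 < η ^ 4 / l ^ 4 := by positivity
    have d : 13 * η ^ 4 / l ^ 4 = 13 * (η ^ 4 / l ^ 4) := by ring
    have e : 2 / l ^ 6 = 2 * (1 / l ^ 6) := by ring
    rw [d, e]
    linarith
  have bV := norm_integral_block_le hα hαβ hβ (by positivity) (pow_le_one₀ hη.le hη1)
    (by positivity) (by norm_num) hlen H (continuousOn_of_hasDerivAt hΦd) hV
  have bT := norm_integral_block_le_trivial (Φ := oscΦ t κ n₁ n₂ 0 e₁ e₂ 1) hαβ hlen
    (by positivity) (fun w hw => (H.2 w hw).2.1)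
  rcases le_total u 1 with h | h
  · rw [min_eq_left (h.trans (by rw [one_le_inv₀ hu0]; exact h))]
    refine bT.trans ?_
    have : 512 * η ^ 12 * (64 * 10 ^ 4 / (l ^ 12 * η ^ 6)) =
        512 * 64 * 10 ^ 4 / l ^ 15 * (u * (u * u)) := by rw [hu]; field_simp
    rw [this]
    have : u * (u * u) ≤ u * 1 := by gcongr; nlinarith
    rw [mul_one] at this
    gcongr
    norm_num
  · rw [min_eq_right (le_trans (by rw [inv_le_one₀ hu0]; exact h) h)]
    refine bV.trans ?_
    have hui : u⁻¹ ≤ 1 := by rw [inv_le_one₀ hu0]; exact h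
    have hui0 : 0 < u⁻¹ := by positivity
    have key : ∀ a b c : ℝ, a * (b / (l ^ 12 * η ^ 6)) *
        (c * (1 / l ^ 6 + η ^ 4 / l ^ 4)) =
        a * b * c / l ^ 15 * (u⁻¹ * (u⁻¹ * u⁻¹) + u⁻¹) := by
      intro a b c; rw [hu]; field_simp
    rw [key]
    have : u⁻¹ * (u⁻¹ * u⁻¹) ≤ u⁻¹ * 1 := by gcongr; nlinarith
    calc _ ≤ (10 ^ 5 + 10 ^ 7 * (256 + 256)) * (64 * 10 ^ 4) * (2 * 10 ^ 5) / l ^ 15 * (2 * u⁻¹) := by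
          gcongr; linarith
      _ ≤ _ := by
          rw [div_mul_eq_mul_div, div_mul_eq_mul_div]
          gcongr ?_ / _
          nlinarith

/-- Summation of dyadic block estimates approaching the turning point `1 / c`. -/
lemma exists_dyadic_chain {F : ℝ → ℂ} {c w₀ x m D q : ℝ} {u : ℕ → ℝ → ℝ} (hwx : w₀ ≤ x)
    (hc : 0 < c) (hw₀ : c * w₀ < 1) (hcw₀ : 0 ≤ w₀) (hm : 0 < m) (hD : 0 ≤ D)
    (hq : 0 < q) (hq1 : q < 1)
    (hF : ContinuousOn F (Set.Icc w₀ x))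
    (hblock : ∀ (k : ℕ) (α β : ℝ), w₀ ≤ α → α ≤ β → β ≤ x → m < (1 / 2) ^ k →
      (∀ w ∈ Set.Icc α β, (1 / 2) ^ k / 2 ≤ 1 - c * w ∧ 1 - c * w ≤ (1 / 2) ^ k) →
      ‖∫ w in α..β, F w‖ ≤ D * min (u k α) (u k α)⁻¹)
    (hu : ∀ k α, w₀ ≤ α → c * α < 1 → 0 < u k α)
    (huq : ∀ k α β, w₀ ≤ α → α ≤ β → c * β < 1 → (1 - c * α) / 2 ≤ 1 - c * β →
      u (k + 1) β ≤ q * u k α) :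
    ∃ b ∈ Set.Icc w₀ x, ‖∫ w in w₀..b, F w‖ ≤ D * (4 / (1 - q)) ∧
      ∀ w ∈ Set.Ioc b x, 1 - c * w ≤ m := by
  set a : ℕ → ℝ := fun k => max w₀ (min x ((1 - (1 / 2) ^ k) / c)) with ha
  have ha0 : a 0 = w₀ := by
    simp only [ha, pow_zero, sub_self, zero_div]
    exact max_eq_left ((min_le_right _ _).trans hcw₀)
  have hw₀a : ∀ k, w₀ ≤ a k := fun k => le_max_left _ _
  have hax : ∀ k, a k ≤ x := fun k => max_le hwx (min_le_left _ _)
  have hmono : Monotone a := by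
    refine monotone_nat_of_le_succ fun k => ?_
    simp only [ha]
    refine max_le_max le_rfl (min_le_min le_rfl ?_)
    have : (1 / 2 : ℝ) ^ (k + 1) ≤ (1 / 2) ^ k := by
      rw [pow_succ]; nlinarith [pow_pos (by norm_num : (0:ℝ) < 1 / 2) k]
    gcongr
  have hlo : ∀ k w, a k < w → w ≤ x → 1 - c * w ≤ (1 / 2) ^ k := by
    intro k w h1 h2
    have : (1 - (1 / 2) ^ k) / c ≤ w := by
      by_contra hcon
      push Not at hcon
      have : w ≤ min x ((1 - (1 / 2) ^ k) / c) := le_min h2 hcon.le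
      have := this.trans (le_max_right w₀ _)
      linarith
    rw [div_le_iff₀ hc] at this
    linarith
  have hlt : ∀ k, c * a k < 1 := by
    intro k
    rcases le_total (min x ((1 - (1 / 2) ^ k) / c)) w₀ with h | h
    · simp only [ha]; rw [max_eq_left h]; exact hw₀
    · simp only [ha]; rw [max_eq_right h]
      have := min_le_right x ((1 - (1 / 2) ^ k) / c)
      rw [le_div_iff₀ hc] at this
      nlinarith [pow_pos (by norm_num : (0:ℝ) < 1 / 2) k]
  have hblk : ∀ k, a k < a (k + 1) → ∀ w ∈ Set.Icc (a k) (a (k + 1)),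
      (1 / 2) ^ k / 2 ≤ 1 - c * w ∧ 1 - c * w ≤ (1 / 2) ^ k := by
    intro k hk w hw
    constructor
    · have h1 : w₀ < a (k + 1) := (hw₀a k).trans_lt hk
      have h2 : a (k + 1) = min x ((1 - (1 / 2) ^ (k + 1)) / c) := by
        simp only [ha] at h1 ⊢
        rcases max_choice w₀ (min x ((1 - (1 / 2) ^ (k + 1)) / c)) with e | e
        · rw [e] at h1; exact absurd h1 (lt_irrefl _)
        · exact e
      have h3 := min_le_right x ((1 - (1 / 2) ^ (k + 1)) / c)
      rw [← h2, le_div_iff₀ hc, pow_succ] at h3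
      have := hw.2
      nlinarith
    · have h1 : (1 - (1 / 2) ^ k) / c ≤ a k := by
        have h2 : min x ((1 - (1 / 2) ^ k) / c) ≤ a k := le_max_right _ _
        rcases min_choice x ((1 - (1 / 2) ^ k) / c) with e | e
        · rw [e] at h2
          exact absurd (hk.trans_le (hax (k + 1))) (not_lt.2 h2)
        · rwa [e] at h2
      rw [div_le_iff₀ hc] at h1
      have := hw.1
      nlinarith
  have hratio : ∀ k, (1 - c * a k) / 2 ≤ 1 - c * a (k + 1) := by
    intro k
    rcases (hmono (Nat.le_succ k)).lt_or_eq with h | h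
    · have h1 := (hblk k h _ ⟨h.le, le_rfl⟩).1
      have h2 := (hblk k h _ ⟨le_rfl, h.le⟩).2
      simp only [Nat.succ_eq_add_one] at *
      linarith
    · simp only [Nat.succ_eq_add_one] at h
      rw [← h]; linarith [hlt k]
  have hex : ∃ N : ℕ, (1 / 2 : ℝ) ^ N ≤ m := by
    obtain ⟨N, hN⟩ := exists_pow_lt_of_lt_one hm (by norm_num : (1 / 2 : ℝ) < 1)
    exact ⟨N, hN.le⟩
  classical
  obtain ⟨hN, hNmin⟩ := Nat.find_spec hex, fun k (hk : k < Nat.find hex) => Nat.find_min hex hk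
  set N := Nat.find hex
  refine ⟨a N, ⟨hw₀a N, hax N⟩, ?_, fun w hw => (hlo N w hw.1 hw.2).trans hN⟩
  have hint : ∀ k, IntervalIntegrable F volume (a k) (a (k + 1)) := fun k =>
    ContinuousOn.intervalIntegrable (by
      rw [Set.uIcc_of_le (hmono (Nat.le_succ k))]
      exact hF.mono (Set.Icc_subset_Icc (hw₀a k) (hax (k + 1))))
  have hsum := intervalIntegral.sum_integral_adjacent_intervals (f := F) (μ := volume) (a := a)
    (n := N) fun k _ => hint k
  rw [ha0] at hsum
  rw [← hsum]
  have hstep : ∀ k ∈ Finset.range N, ‖∫ w in a k..a (k + 1), F w‖ ≤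
      D * min (u k (a k)) (u k (a k))⁻¹ := by
    intro k hk
    rcases (hmono (Nat.le_succ k)).lt_or_eq with h | h
    · exact hblock k _ _ (hw₀a k) h.le (hax (k + 1))
        (not_le.1 (hNmin k (Finset.mem_range.1 hk))) (hblk k h)
    · simp only [Nat.succ_eq_add_one] at h
      rw [← h, intervalIntegral.integral_same, norm_zero]
      have := hu k (a k) (hw₀a k) (hlt k)
      positivity
  refine (norm_sum_le _ _).trans ((Finset.sum_le_sum hstep).trans ?_)
  rw [← Finset.mul_sum]
  refine mul_le_mul_of_nonneg_left ?_ hD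
  exact sum_min_inv_le (u := fun k => u k (a k)) hq hq1 (fun k => hu k _ (hw₀a k) (hlt k))
    (fun k => huq k _ _ (hw₀a k) (hmono (Nat.le_succ k)) (hlt (k + 1)) (hratio k)) N

lemma abs_besselY_oscX_le {l w : ℝ} (hl : 0 < l) (hw : 1 / 256 ≤ w) (hw' : w ≤ 256) (n : ℕ) :
    |besselY n (oscX (l ^ 12) w)| ≤ 440 / l ^ 4 := by
  have hw0 : 0 < w := lt_of_lt_of_le (by norm_num) hw
  have := abs_besselY_le_cubeRoot n (μ := 4 / l ^ 4) (by positivity)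
    (le_trans (by
      have : ((4 / l ^ 4) ^ 3)⁻¹ = l ^ 12 / 64 := by field_simp; norm_num
      rw [this]; gcongr; norm_num) (oscX_ge (by positivity : 0 < l ^ 12) hw0 hw'))
  exact this.trans (le_of_eq (by ring))

/-- Decay of the Bessel function past the turning point. -/
lemma abs_besselY_bottom_le {l w : ℝ} (hl : 1 ≤ l) (hw : 1 / 256 ≤ w) (hw' : w ≤ 256) (n : ℕ)
    (h : 1 - oscC (l ^ 12) n * w ≤ 22 / l ^ 8) :
    |besselY n (oscX (l ^ 12) w)| ≤
      10 ^ 6 * (1 / l ^ 4 * (1 + (l ^ 8 * (oscC (l ^ 12) n * w - 1)) ^ 2)⁻¹ + 1 / l ^ 24) := by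
  have hl0 : 0 < l := by linarith
  have hw0 : 0 < w := lt_of_lt_of_le (by norm_num) hw
  have ht : 0 < l ^ 12 := by positivity
  have hX := oscX_pos ht hw0
  have hXge := oscX_ge ht hw0 hw'
  set v := oscC (l ^ 12) n * w - 1 with hv
  rcases le_or_gt v (22 / l ^ 8) with h1 | h1
  · have h2 : |l ^ 8 * v| ≤ 22 := by
      have : |v| ≤ 22 / l ^ 8 := abs_le.2 ⟨by linarith, h1⟩
      rw [abs_mul, abs_of_pos (by positivity)]
      calc _ ≤ l ^ 8 * (22 / l ^ 8) := by gcongr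
        _ = 22 := by field_simp
    have h3 : (l ^ 8 * v) ^ 2 ≤ 22 ^ 2 := by rw [← sq_abs]; gcongr
    have h4 : (485:ℝ)⁻¹ ≤ (1 + (l ^ 8 * v) ^ 2)⁻¹ := by gcongr; linarith
    refine (abs_besselY_oscX_le hl0 hw hw' n).trans ?_
    calc 440 / l ^ 4 ≤ 10 ^ 6 * (1 / l ^ 4 * (485:ℝ)⁻¹ + 0) := by
          rw [div_le_iff₀ (by positivity)]; field_simp; norm_num
      _ ≤ _ := by gcongr; positivity
  · have hv0 : 0 < v := lt_trans (by positivity) h1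
    set z := (n:ℝ) / oscX (l ^ 12) w with hz
    have hz2 : z ^ 2 = 1 + v := by rw [hz, oscX_ratio ht hw0, hv]; ring
    have hz0 : 0 ≤ z := by positivity
    have hz1 : 1 < z := by nlinarith
    have hB := abs_besselY_le_of_lt n hX (δ := z - 1) (by linarith) (by rw [hz]; field_simp; ring)
    refine hB.trans ?_
    have hX2 : (l ^ 12 / 32) ^ 2 ≤ oscX (l ^ 12) w ^ 2 := by gcongr
    have hX3 : l ^ 24 / 1024 ≤ oscX (l ^ 12) w ^ 2 := by
      refine le_trans (le_of_eq ?_) hX2; ring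
    rcases le_or_gt v 3 with h3 | h3
    · have hδ : v / 3 ≤ z - 1 := by nlinarith
      have hs : 1 / l ^ 4 ≤ √(z - 1) := by
        refine Real.le_sqrt_of_sq_le (le_trans ?_ hδ)
        rw [le_div_iff₀ (by norm_num)]
        refine le_trans ?_ h1.le
        have : (1 / l ^ 4) ^ 2 * 3 = 3 / l ^ 8 := by ring
        rw [this]; gcongr; norm_num
      have h5 : 28 / (oscX (l ^ 12) w ^ 2 * (z - 1) ^ 2 * √(z - 1)) ≤
          28 / (l ^ 24 / 1024 * (v / 3) ^ 2 * (1 / l ^ 4)) := by gcongr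
      refine h5.trans ?_
      have h6 : 1 + (l ^ 8 * v) ^ 2 ≤ 2 * (l ^ 8 * v) ^ 2 := by
        have : 22 ≤ l ^ 8 * v := by
          rw [div_lt_iff₀ (by positivity)] at h1; linarith
        nlinarith
      have h7 : (2 * (l ^ 8 * v) ^ 2)⁻¹ ≤ (1 + (l ^ 8 * v) ^ 2)⁻¹ := by gcongr
      calc _ = 258048 * (1 / l ^ 4 * ((l ^ 8 * v) ^ 2)⁻¹) := by field_simp; norm_num
        _ ≤ 10 ^ 6 * (1 / l ^ 4 * (2 * (l ^ 8 * v) ^ 2)⁻¹ + 0) := by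
            rw [add_zero, mul_inv]
            have : 0 ≤ 1 / l ^ 4 * ((l ^ 8 * v) ^ 2)⁻¹ := by positivity
            nlinarith
        _ ≤ _ := by gcongr; positivity
    · have hδ : 1 ≤ z - 1 := by nlinarith
      have hs : 1 ≤ √(z - 1) := Real.le_sqrt_of_sq_le (by linarith)
      have h5 : 28 / (oscX (l ^ 12) w ^ 2 * (z - 1) ^ 2 * √(z - 1)) ≤
          28 / (l ^ 24 / 1024 * 1 ^ 2 * 1) := by gcongr
      refine h5.trans ?_
      have : 28 / (l ^ 24 / 1024 * 1 ^ 2 * 1) = 28672 * (1 / l ^ 24) := by field_simp; norm_num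
      rw [this]
      have : 0 ≤ 1 / l ^ 4 * (1 + (l ^ 8 * v) ^ 2)⁻¹ := by positivity
      have : 0 ≤ 1 / l ^ 24 := by positivity
      nlinarith

lemma integral_inv_one_add_sq_le {k a b x : ℝ} (hk : 0 < k) :
    ∫ w in b..x, (1 + (k * w - a) ^ 2)⁻¹ ≤ 4 / k := by
  rw [intervalIntegral.integral_comp_mul_sub (fun y => (1 + y ^ 2)⁻¹) hk.ne' a,
    integral_inv_one_add_sq, smul_eq_mul, div_eq_inv_mul]
  have := Real.arctan_lt_pi_div_two (k * x - a)
  have := Real.neg_pi_div_two_lt_arctan (k * b - a)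
  have := Real.pi_lt_four
  gcongr
  linarith

lemma continuous_besselY (n : ℕ) : Continuous (besselY n) :=
  continuous_iff_continuousAt.2 fun x => (hasDerivAt_besselY n x).continuousAt

lemma continuousOn_besselY_oscX (t : ℝ) (n : ℕ) {S : Set ℝ} (hS : ∀ w ∈ S, 0 < w) :
    ContinuousOn (fun w => besselY n (oscX t w)) S :=
  (continuous_besselY n).comp_continuousOn fun w hw =>
    (hasDerivAt_oscX (hS w hw)).continuousAt.continuousWithinAt

lemma integral_abs_besselY_bottom_le {l b x : ℝ} (hl : 1 ≤ l) (hb : 1 / 256 ≤ b) (hbx : b ≤ x)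
    (hx : x ≤ 256) (n : ℕ) (hc : 1 / 512 ≤ oscC (l ^ 12) n)
    (h : ∀ w ∈ Set.Ioc b x, 1 - oscC (l ^ 12) n * w ≤ 22 / l ^ 8) :
    ∫ w in b..x, |besselY n (oscX (l ^ 12) w)| ≤ 3 * 10 ^ 9 / l ^ 12 := by
  have hl0 : 0 < l := by linarith
  set c := oscC (l ^ 12) n
  have hc0 : 0 < c := by linarith
  have w0 : ∀ w ∈ Set.Icc b x, 0 < w := fun w hw => lt_of_lt_of_le (by norm_num) (hb.trans hw.1)
  have c1 : Continuous fun w : ℝ => (1 + (l ^ 8 * (c * w - 1)) ^ 2)⁻¹ := by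
    refine Continuous.inv₀ (by fun_prop) fun w => ?_
    positivity
  have h1 : ∫ w in b..x, |besselY n (oscX (l ^ 12) w)| ≤
      ∫ w in b..x, 10 ^ 6 * (1 / l ^ 4 * (1 + (l ^ 8 * (c * w - 1)) ^ 2)⁻¹ + 1 / l ^ 24) := by
    refine intervalIntegral.integral_mono_on_of_le_Ioo hbx
      (ContinuousOn.intervalIntegrable (by
        rw [Set.uIcc_of_le hbx]; exact (continuousOn_besselY_oscX _ n w0).abs))
      (Continuous.intervalIntegrable (by fun_prop) _ _) fun w hw =>
      abs_besselY_bottom_le hl (hb.trans hw.1.le) (hw.2.le.trans hx) n (h w ⟨hw.1, hw.2.le⟩)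
  refine h1.trans ?_
  have h2 : ∫ w in b..x, (1 + (l ^ 8 * (c * w - 1)) ^ 2)⁻¹ ≤ 4 / (l ^ 8 * c) := by
    have := integral_inv_one_add_sq_le (k := l ^ 8 * c) (a := l ^ 8) (b := b) (x := x)
      (by positivity)
    refine le_trans (le_of_eq ?_) this
    refine intervalIntegral.integral_congr fun w _ => ?_
    ring_nf
  rw [intervalIntegral.integral_const_mul, intervalIntegral.integral_add
    (Continuous.intervalIntegrable (by fun_prop) _ _) intervalIntegrable_const,
    intervalIntegral.integral_const_mul, intervalIntegral.integral_const, smul_eq_mul]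
  have h3 : 4 / (l ^ 8 * c) ≤ 2048 / l ^ 8 := by
    rw [div_le_div_iff₀ (by positivity) (by positivity)]
    nlinarith [pow_pos hl0 8]
  have h4 : (x - b) * (1 / l ^ 24) ≤ 256 * (1 / l ^ 12) := by
    have : 1 / l ^ 24 ≤ 1 / l ^ 12 := by gcongr; norm_num
    gcongr
    linarith
  calc _ ≤ 10 ^ 6 * (1 / l ^ 4 * (2048 / l ^ 8) + 256 * (1 / l ^ 12)) := by
        gcongr; exact h2.trans h3
    _ = 10 ^ 6 * 2304 / l ^ 12 := by field_simp; norm_num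
    _ ≤ _ := div_le_div_of_nonneg_right (by norm_num) (by positivity)

/-- The oscillatory factor left after removing the Bessel functions. -/
def oscE (t κ w : ℝ) : ℂ := Complex.exp (Complex.I * ((-t * (√w + κ / 4 / √w) : ℝ) : ℂ))

lemma norm_oscE (t κ w : ℝ) : ‖oscE t κ w‖ = 1 := norm_cexp_I_mul _

lemma continuousOn_oscE (t κ : ℝ) {S : Set ℝ} (hS : ∀ w ∈ S, 0 < w) :
    ContinuousOn (oscE t κ) S := by
  refine Complex.continuous_exp.comp_continuousOn (continuousOn_const.mul
    (Complex.continuous_ofReal.comp_continuousOn (continuousOn_const.mul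
      (ContinuousOn.add (by fun_prop) (continuousOn_const.div (by fun_prop) fun w hw => ?_)))))
  exact (Real.sqrt_pos.2 (hS w hw)).ne'

lemma norm_integral_besselY₃_block_le {l η ϱ κ α β : ℝ} {n₁ n₂ n₃ : ℕ} (hl : 1 ≤ l) (hη : 0 < η)
    (hη1 : η ≤ 1) (hϱ : 0 < ϱ) (hα : 1 / 256 ≤ α) (hαβ : α ≤ β) (hβ : β ≤ 256)
    (hlen : β - α ≤ 512 * η ^ 12) (hn12 : n₂ ≤ n₁) (hn23 : n₃ ≤ n₂)
    (h1 : ∀ w ∈ Set.Icc α β, η ^ 12 / 2 ≤ 1 - oscC (l ^ 12) n₁ * w)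
    (hlh : ∀ w ∈ Set.Icc α β, 1 - oscC (l ^ 12) n₁ * w ≤ η ^ 12)
    (hϱα : ϱ ^ 4 = oscR (oscC (l ^ 12) n₃) α)
    (hth : (32:ℝ) ^ 2 ≤ (l ^ 12) ^ 2 * (η ^ 12 / 2) ^ 3) :
    ‖∫ w in α..β, oscE (l ^ 12) κ w * (besselY n₁ (oscX (l ^ 12) w) *
      besselY n₂ (oscX (l ^ 12) w) * besselY n₃ (oscX (l ^ 12) w) : ℂ)‖ ≤
      8 * 10 ^ 27 / l ^ 20 * min (l * η ^ 3 / ϱ) (l * η ^ 3 / ϱ)⁻¹ := by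
  set t := l ^ 12 with ht_def
  have hl0 : 0 < l := by linarith
  have ht : 0 < t := by positivity
  have w0 : ∀ w ∈ Set.Icc α β, 0 < w := fun w hw => lt_of_lt_of_le (by norm_num) (hα.trans hw.1)
  have hpos : 0 < η ^ 12 / 2 := by positivity
  have lt1 : ∀ w ∈ Set.Icc α β, oscC t n₁ * w < 1 := fun w hw => by linarith [h1 w hw]
  have lt2 : ∀ w ∈ Set.Icc α β, oscC t n₂ * w < 1 := fun w hw =>
    (mul_le_mul_of_nonneg_right (oscC_mono t hn12) (w0 w hw).le).trans_lt (lt1 w hw)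
  have lt3 : ∀ w ∈ Set.Icc α β, oscC t n₃ * w < 1 := fun w hw =>
    (mul_le_mul_of_nonneg_right (oscC_mono t hn23) (w0 w hw).le).trans_lt (lt2 w hw)
  let sg : Bool → ℝ := fun b => if b then 1 else -1
  have hsg : ∀ b, sg b = 1 ∨ sg b = -1 := fun b => by cases b <;> simp [sg]
  let P : Bool × Bool × Bool → ℝ → ℂ := fun p w =>
    oscA t (sg p.1) n₁ w * oscA t (sg p.2.1) n₂ w * oscA t (sg p.2.2) n₃ w *
      Complex.exp (Complex.I * (oscΦ t κ n₁ n₂ n₃ (sg p.1) (sg p.2.1) (sg p.2.2) w : ℂ))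
  have hpt : ∀ w ∈ Set.Icc α β, oscE t κ w * (besselY n₁ (oscX t w) *
      besselY n₂ (oscX t w) * besselY n₃ (oscX t w) : ℂ) = ∑ p, P p w := fun w hw => by
    have key : ∀ e₁ e₂ e₃ : ℝ, Complex.exp (Complex.I * (oscΦ t κ n₁ n₂ n₃ e₁ e₂ e₃ w : ℂ)) =
        oscE t κ w * Complex.exp (Complex.I * ((e₁ * besselθ n₁ (oscX t w) : ℝ) : ℂ)) *
        Complex.exp (Complex.I * ((e₂ * besselθ n₂ (oscX t w) : ℝ) : ℂ)) *
        Complex.exp (Complex.I * ((e₃ * besselθ n₃ (oscX t w) : ℝ) : ℂ)) := fun e₁ e₂ e₃ => by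
      rw [oscE, ← Complex.exp_add, ← Complex.exp_add, ← Complex.exp_add, oscΦ]
      congr 1; push_cast; ring
    rw [besselY_eq_oscA, besselY_eq_oscA,
      besselY_eq_oscA]
    simp only [P, key, Fintype.sum_prod_type, Fintype.sum_bool, sg, if_true, Bool.false_eq_true,
      if_false]
    ring
  have hint : ∀ p, IntervalIntegrable (P p) volume α β := fun p => by
    refine ContinuousOn.intervalIntegrable_of_Icc hαβ ?_
    refine (((continuousOn_oscA ht _ _ w0 lt1).mul (continuousOn_oscA ht _ _ w0 lt2)).mul
      (continuousOn_oscA ht _ _ w0 lt3)).mul (Complex.continuous_exp.comp_continuousOn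
        (continuousOn_const.mul (Complex.continuous_ofReal.comp_continuousOn fun w hw => ?_)))
    exact (hasDerivAt_oscΦ ht (w0 w hw) _ _ _ (lt1 w hw) (lt2 w hw)
      (lt3 w hw)).continuousAt.continuousWithinAt
  rw [intervalIntegral.integral_congr (g := fun w => ∑ p, P p w) (fun w hw => hpt w
    (by rwa [Set.uIcc_of_le hαβ] at hw)), intervalIntegral.integral_finsetSum fun p _ => hint p]
  refine (norm_sum_le_of_le _ fun p _ => norm_integral_block₃_le (κ := κ) hl hη hη1 hϱ hα hαβ hβ
    hlen hn12 hn23 (hsg p.1) (hsg p.2.1) (hsg p.2.2) h1 hlh hϱα hth).trans (le_of_eq ?_)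
  simp
  ring

lemma norm_integral_besselY₂_block_le {l η κ α β : ℝ} {n₁ n₂ : ℕ} (hl : 1 ≤ l) (hη : 0 < η)
    (hη1 : η ≤ 1) (hα : 1 / 256 ≤ α) (hαβ : α ≤ β) (hβ : β ≤ 256)
    (hlen : β - α ≤ 512 * η ^ 12) (hn12 : n₂ ≤ n₁)
    (h1 : ∀ w ∈ Set.Icc α β, η ^ 12 / 2 ≤ 1 - oscC (l ^ 12) n₁ * w)
    (hlh : ∀ w ∈ Set.Icc α β, 1 - oscC (l ^ 12) n₁ * w ≤ η ^ 12)
    (hth : (32:ℝ) ^ 2 ≤ (l ^ 12) ^ 2 * (η ^ 12 / 2) ^ 3) :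
    ‖∫ w in α..β, oscE (l ^ 12) κ w * (besselY n₁ (oscX (l ^ 12) w) *
      besselY n₂ (oscX (l ^ 12) w) : ℂ)‖ ≤
      4 * 10 ^ 27 / l ^ 15 * min (l * η ^ 2) (l * η ^ 2)⁻¹ := by
  set t := l ^ 12 with ht_def
  have hl0 : 0 < l := by linarith
  have ht : 0 < t := by positivity
  have w0 : ∀ w ∈ Set.Icc α β, 0 < w := fun w hw => lt_of_lt_of_le (by norm_num) (hα.trans hw.1)
  have hpos : 0 < η ^ 12 / 2 := by positivity
  have lt1 : ∀ w ∈ Set.Icc α β, oscC t n₁ * w < 1 := fun w hw => by linarith [h1 w hw]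
  have lt2 : ∀ w ∈ Set.Icc α β, oscC t n₂ * w < 1 := fun w hw =>
    (mul_le_mul_of_nonneg_right (oscC_mono t hn12) (w0 w hw).le).trans_lt (lt1 w hw)
  have lt3 : ∀ w ∈ Set.Icc α β, oscC t 0 * w < 1 := fun w hw => by simp [oscC]
  let sg : Bool → ℝ := fun b => if b then 1 else -1
  have hsg : ∀ b, sg b = 1 ∨ sg b = -1 := fun b => by cases b <;> simp [sg]
  let P : Bool × Bool → ℝ → ℂ := fun p w =>
    oscA t (sg p.1) n₁ w * oscA t (sg p.2) n₂ w *
      Complex.exp (Complex.I * (oscΦ t (κ + 2) n₁ n₂ 0 (sg p.1) (sg p.2) 1 w : ℂ))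
  have hpt : ∀ w ∈ Set.Icc α β, oscE t κ w * (besselY n₁ (oscX t w) *
      besselY n₂ (oscX t w) : ℂ) = ∑ p, P p w := fun w hw => by
    have hθ : besselθ 0 (oscX t w) = oscX t w := by
      have := oscX_pos ht (w0 w hw)
      simp [besselθ, Real.sqrt_sq this.le]
    have key : ∀ e₁ e₂ : ℝ, Complex.exp (Complex.I * (oscΦ t (κ + 2) n₁ n₂ 0 e₁ e₂ 1 w : ℂ)) =
        oscE t κ w * Complex.exp (Complex.I * ((e₁ * besselθ n₁ (oscX t w) : ℝ) : ℂ)) *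
        Complex.exp (Complex.I * ((e₂ * besselθ n₂ (oscX t w) : ℝ) : ℂ)) := fun e₁ e₂ => by
      rw [oscE, ← Complex.exp_add, ← Complex.exp_add, oscΦ, hθ, oscX]
      congr 1; push_cast; ring
    rw [besselY_eq_oscA, besselY_eq_oscA]
    simp only [P, key, Fintype.sum_prod_type, Fintype.sum_bool, sg, if_true, Bool.false_eq_true,
      if_false]
    ring
  have hint : ∀ p, IntervalIntegrable (P p) volume α β := fun p => by
    refine ContinuousOn.intervalIntegrable_of_Icc hαβ ?_
    refine ((continuousOn_oscA ht _ _ w0 lt1).mul (continuousOn_oscA ht _ _ w0 lt2)).mul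
      (Complex.continuous_exp.comp_continuousOn
        (continuousOn_const.mul (Complex.continuous_ofReal.comp_continuousOn fun w hw => ?_)))
    exact (hasDerivAt_oscΦ ht (w0 w hw) _ _ _ (lt1 w hw) (lt2 w hw)
      (lt3 w hw)).continuousAt.continuousWithinAt
  rw [intervalIntegral.integral_congr (g := fun w => ∑ p, P p w) (fun w hw => hpt w
    (by rwa [Set.uIcc_of_le hαβ] at hw)), intervalIntegral.integral_finsetSum fun p _ => hint p]
  refine (norm_sum_le_of_le _ fun p _ => norm_integral_block₂_le (κ := κ + 2) hl hη hη1 hα hαβ hβ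
    hlen hn12 (hsg p.1) (hsg p.2) h1 hlh hth).trans (le_of_eq ?_)
  simp
  ring

/-- Base of the dyadic scales in the estimates below. -/
def dyZ : ℝ := (1 / 2 : ℝ) ^ (1 / 24 : ℝ)

lemma dyZ_pos : 0 < dyZ := by rw [dyZ]; positivity

lemma dyZ_lt_one : dyZ < 1 := Real.rpow_lt_one (by norm_num) (by norm_num) (by norm_num)

lemma dyZ_pow : dyZ ^ 24 = 1 / 2 := by
  rw [dyZ, ← Real.rpow_natCast, ← Real.rpow_mul (by norm_num)]
  norm_num

lemma dyZ_scale (k : ℕ) : (dyZ ^ (2 * k)) ^ 12 = (1 / 2) ^ k := by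
  rw [← pow_mul, ← dyZ_pow, ← pow_mul]; ring_nf

lemma sqrt_sqrt_pow_four {r : ℝ} (hr : 0 ≤ r) : (√√r) ^ 4 = r := by
  rw [show (√√r) ^ 4 = ((√√r) ^ 2) ^ 2 by ring, Real.sq_sqrt (Real.sqrt_nonneg _),
    Real.sq_sqrt hr]

lemma min_inv_le_one (u : ℝ) : min u u⁻¹ ≤ 1 := by
  rcases le_total u 1 with h | h
  · exact (min_le_left _ _).trans h
  · exact (min_le_right _ _).trans (inv_le_one_of_one_le₀ h)

/-- Assembles a block estimate and a bound beyond the turning point. -/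
lemma norm_integral_le_of_blocks {F : ℝ → ℂ} {l x D q E : ℝ} {u : ℕ → ℝ → ℝ} {n : ℕ}
    (hl : 2 ≤ l) (hx : 1 / 256 ≤ x) (hx' : x ≤ 256) (hD : 0 ≤ D) (hq : 0 < q) (hq1 : q < 1)
    (hF : ContinuousOn F (Set.Icc (1 / 256) x))
    (hblock : ∀ (k : ℕ) (α β : ℝ), 1 / 256 ≤ α → α ≤ β → β ≤ x →
      β - α ≤ 512 * (dyZ ^ (2 * k)) ^ 12 →
      (∀ w ∈ Set.Icc α β, (dyZ ^ (2 * k)) ^ 12 / 2 ≤ 1 - oscC (l ^ 12) n * w) →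
      (∀ w ∈ Set.Icc α β, 1 - oscC (l ^ 12) n * w ≤ (dyZ ^ (2 * k)) ^ 12) →
      (32:ℝ) ^ 2 ≤ (l ^ 12) ^ 2 * ((dyZ ^ (2 * k)) ^ 12 / 2) ^ 3 →
      ‖∫ w in α..β, F w‖ ≤ D * min (u k α) (u k α)⁻¹)
    (hu : ∀ k α, 1 / 256 ≤ α → oscC (l ^ 12) n * α < 1 → 0 < u k α)
    (huq : ∀ k α β, 1 / 256 ≤ α → α ≤ β → oscC (l ^ 12) n * β < 1 →
      (1 - oscC (l ^ 12) n * α) / 2 ≤ 1 - oscC (l ^ 12) n * β → u (k + 1) β ≤ q * u k α)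
    (hE0 : 0 ≤ E)
    (hE : ∀ b ∈ Set.Icc (1 / 256) x, 1 / 512 ≤ oscC (l ^ 12) n →
      (∀ w ∈ Set.Ioc b x, 1 - oscC (l ^ 12) n * w ≤ 22 / l ^ 8) → ‖∫ w in b..x, F w‖ ≤ E) :
    ‖∫ w in (1 / 256)..x, F w‖ ≤ D * (4 / (1 - q)) + E := by
  have hl0 : 0 < l := by linarith
  set c := oscC (l ^ 12) n with hc
  have hc0 : 0 ≤ c := oscC_nonneg _ _
  have h4 : 4 ≤ 4 / (1 - q) := by rw [le_div_iff₀ (by linarith)]; linarith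
  rcases lt_or_ge c (1 / 512) with h | h
  · have h1 : ∀ w ∈ Set.Icc (1 / 256) x, c * w ≤ 1 / 2 := fun w hw => by
      nlinarith [hw.1, hw.2]
    have h2 := hblock 0 (1 / 256) x le_rfl hx le_rfl (by norm_num; linarith)
      (fun w hw => by norm_num; linarith [h1 w hw])
      (fun w hw => by
        have : 0 ≤ c * w := mul_nonneg hc0 (le_trans (by norm_num) hw.1)
        norm_num; linarith)
      (by
        have : (2:ℝ) ^ 24 ≤ l ^ 24 := by gcongr
        norm_num at this ⊢
        rw [← pow_mul]
        norm_num
        linarith)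
    have h3 := min_inv_le_one (u 0 (1 / 256))
    calc _ ≤ D * 1 := h2.trans (by gcongr)
      _ ≤ D * (4 / (1 - q)) := by gcongr; linarith
      _ ≤ _ := by linarith
  · have hc' : 0 < c := by linarith
    obtain ⟨b, hb, h1, h2⟩ : ∃ b ∈ Set.Icc (1 / 256) x,
        ‖∫ w in (1 / 256)..b, F w‖ ≤ D * (4 / (1 - q)) ∧
        ∀ w ∈ Set.Ioc b x, 1 - c * w ≤ 22 / l ^ 8 := by
      rcases le_or_gt 1 (c * (1 / 256)) with h3 | h3
      · refine ⟨1 / 256, ⟨le_rfl, hx⟩, by simp; positivity, fun w hw => ?_⟩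
        have : 1 ≤ c * w := h3.trans (by gcongr; exact hw.1.le)
        have : 0 < 22 / l ^ 8 := by positivity
        linarith
      · refine exists_dyadic_chain hx hc' h3 (by norm_num) (by positivity) hD hq hq1 hF
          (fun k α β hα hαβ hβ hk hw => ?_) hu huq
        refine hblock k α β hα hαβ hβ ?_ ?_ ?_ ?_ <;> rw [dyZ_scale]
        · have := (hw α ⟨le_rfl, hαβ⟩).2
          have := (hw β ⟨hαβ, le_rfl⟩).1
          have : 0 ≤ β - α := by linarith
          have : 1 / 512 * (β - α) ≤ c * (β - α) := by gcongr
          have : (0:ℝ) < (1 / 2) ^ k := by positivity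
          nlinarith
        · exact fun w hw' => (hw w hw').1
        · exact fun w hw' => (hw w hw').2
        · have h5 : 11 / l ^ 8 ≤ (1 / 2) ^ k / 2 := by
            rw [show (11:ℝ) / l ^ 8 = 22 / l ^ 8 / 2 by ring]; linarith
          calc (32:ℝ) ^ 2 ≤ 11 ^ 3 := by norm_num
            _ = (l ^ 12) ^ 2 * (11 / l ^ 8) ^ 3 := by field_simp
            _ ≤ _ := by gcongr
    have hi : ∀ a a', 1 / 256 ≤ a → a ≤ a' → a' ≤ x → IntervalIntegrable F volume a a' :=
      fun a a' h h' h'' =>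
        (hF.mono (Set.Icc_subset_Icc h h'')).intervalIntegrable_of_Icc h'
    rw [← intervalIntegral.integral_add_adjacent_intervals (hi _ b le_rfl hb.1 hb.2)
      (hi b x hb.1 hb.2 le_rfl)]
    exact (norm_add_le _ _).trans (add_le_add h1 (hE b hb h h2))

lemma norm_integral_besselY_bottom_le {G : ℝ → ℂ} {l b x M : ℝ} (hl : 1 ≤ l) (hb : 1 / 256 ≤ b)
    (hbx : b ≤ x) (hx : x ≤ 256) (n : ℕ) (hc : 1 / 512 ≤ oscC (l ^ 12) n)
    (h : ∀ w ∈ Set.Ioc b x, 1 - oscC (l ^ 12) n * w ≤ 22 / l ^ 8) (hM : 0 ≤ M)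
    (hG : ∀ w ∈ Set.Icc b x, ‖G w‖ ≤ M * |besselY n (oscX (l ^ 12) w)|) :
    ‖∫ w in b..x, G w‖ ≤ M * (3 * 10 ^ 9 / l ^ 12) := by
  have w0 : ∀ w ∈ Set.Icc b x, 0 < w := fun w hw => lt_of_lt_of_le (by norm_num) (hb.trans hw.1)
  have hi : IntervalIntegrable (fun w => M * |besselY n (oscX (l ^ 12) w)|) volume b x :=
    (continuousOn_const.mul (continuousOn_besselY_oscX _ n w0).abs).intervalIntegrable_of_Icc hbx
  refine (intervalIntegral.norm_integral_le_of_norm_le hbx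
    (Filter.Eventually.of_forall fun w hw => hG w (Set.Ioc_subset_Icc_self hw)) hi).trans ?_
  rw [intervalIntegral.integral_const_mul]
  gcongr
  exact integral_abs_besselY_bottom_le hl hb hbx hx n hc h

lemma exists_norm_integral_besselY₃_le : ∃ C > 0, ∀ (l κ x : ℝ) (n₁ n₂ n₃ : ℕ), 2 ≤ l →
    1 / 256 ≤ x → x ≤ 256 → n₂ ≤ n₁ → n₃ ≤ n₂ →
    ‖∫ w in (1 / 256)..x, oscE (l ^ 12) κ w * (besselY n₁ (oscX (l ^ 12) w) *
      besselY n₂ (oscX (l ^ 12) w) * besselY n₃ (oscX (l ^ 12) w) : ℂ)‖ ≤ C / l ^ 20 := by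
  have hz := dyZ_pos
  have hz1 := dyZ_lt_one
  have hq1 : dyZ ^ 3 < 1 := pow_lt_one₀ hz.le hz1 (by norm_num)
  refine ⟨8 * 10 ^ 27 * (4 / (1 - dyZ ^ 3)) + 440 ^ 2 * (3 * 10 ^ 9), by
    have : 0 < 1 - dyZ ^ 3 := by linarith
    positivity, fun l κ x n₁ n₂ n₃ hl hx hx' hn12 hn23 => ?_⟩
  have hl0 : 0 < l := by linarith
  have hl1 : 1 ≤ l := by linarith
  have w0 : ∀ w ∈ Set.Icc (1 / 256) x, 0 < w := fun w hw => lt_of_lt_of_le (by norm_num) hw.1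
  have hc13 := oscC_mono (l ^ 12) (hn23.trans hn12)
  have lt3 : ∀ w, 1 / 256 ≤ w → oscC (l ^ 12) n₁ * w < 1 → oscC (l ^ 12) n₃ * w < 1 :=
    fun w hw h => (mul_le_mul_of_nonneg_right hc13 (by linarith)).trans_lt h
  have rpos : ∀ w, 1 / 256 ≤ w → oscC (l ^ 12) n₁ * w < 1 →
    0 < √√(oscR (oscC (l ^ 12) n₃) w) := fun w hw h =>
      Real.sqrt_pos.2 (Real.sqrt_pos.2 (oscR_pos (lt3 w hw h)))
  have hY : ∀ n, ContinuousOn (fun w => (besselY n (oscX (l ^ 12) w) : ℂ))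
    (Set.Icc (1 / 256) x) := fun n =>
      Complex.continuous_ofReal.comp_continuousOn (continuousOn_besselY_oscX _ n w0)
  refine (norm_integral_le_of_blocks (n := n₁) (D := 8 * 10 ^ 27 / l ^ 20) (q := dyZ ^ 3)
    (E := 440 ^ 2 / l ^ 8 * (3 * 10 ^ 9 / l ^ 12))
    (u := fun k α => l * (dyZ ^ (2 * k)) ^ 3 / √√(oscR (oscC (l ^ 12) n₃) α))
    hl hx hx' (by positivity) (by positivity) hq1
    ((continuousOn_oscE _ _ w0).mul (((hY n₁).mul (hY n₂)).mul (hY n₃)))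
    ?_ ?_ ?_ (by positivity) ?_).trans (le_of_eq ?_)
  · intro k α β hα hαβ hβ hlen h1 hlh hth
    have hη : 0 < dyZ ^ (2 * k) := by positivity
    have lt1 : oscC (l ^ 12) n₁ * α < 1 := by
      have := h1 α ⟨le_rfl, hαβ⟩
      have : 0 < (dyZ ^ (2 * k)) ^ 12 := by positivity
      linarith
    exact norm_integral_besselY₃_block_le hl1 hη (pow_le_one₀ hz.le hz1.le) (rpos α hα lt1) hα hαβ
      (hβ.trans hx') hlen hn12 hn23 h1 hlh
      (sqrt_sqrt_pow_four (oscR_pos (lt3 α hα lt1)).le) hth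
  · intro k α hα h
    have := rpos α hα h
    positivity
  · intro k α β hα hαβ h h2
    have lt1 : oscC (l ^ 12) n₁ * α < 1 :=
      (mul_le_mul_of_nonneg_left hαβ (oscC_nonneg _ _)).trans_lt h
    have ra := rpos α hα lt1
    have rb := rpos β (hα.trans hαβ) h
    have key : dyZ ^ 3 * √√(oscR (oscC (l ^ 12) n₃) α) ≤ √√(oscR (oscC (l ^ 12) n₃) β) := by
      refine le_of_pow_le_pow_left₀ (n := 8) (by norm_num) rb.le ?_
      have e : ∀ w, 1 / 256 ≤ w → oscC (l ^ 12) n₁ * w < 1 →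
          √√(oscR (oscC (l ^ 12) n₃) w) ^ 8 = 1 - oscC (l ^ 12) n₃ * w := fun w hw h => by
        rw [show ∀ r : ℝ, r ^ 8 = (r ^ 4) ^ 2 from fun r => by ring,
          sqrt_sqrt_pow_four (oscR_pos (lt3 w hw h)).le, oscR_sq (lt3 w hw h)]
      rw [mul_pow, e α hα lt1, e β (hα.trans hαβ) h, ← pow_mul, dyZ_pow]
      nlinarith [mul_le_mul_of_nonneg_right hc13 (by linarith : 0 ≤ 2 * β - α)]
    have hk : (dyZ ^ (2 * (k + 1))) ^ 3 = dyZ ^ 3 * (dyZ ^ 3 * (dyZ ^ (2 * k)) ^ 3) := by ring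
    rw [hk, ← mul_div_assoc, div_le_div_iff₀ rb ra]
    have : 0 ≤ dyZ ^ 3 * (l * (dyZ ^ (2 * k)) ^ 3) := by positivity
    nlinarith [mul_le_mul_of_nonneg_left key this]
  · intro b hb hc h
    refine norm_integral_besselY_bottom_le hl1 hb.1 hb.2 hx' n₁ hc h (by positivity)
      fun w hw => ?_
    have h1 := hb.1.trans hw.1
    have h2 := hw.2.trans hx'
    simp only [Pi.mul_apply]
    rw [norm_mul, norm_oscE, one_mul, norm_mul, norm_mul, Complex.norm_real, Complex.norm_real,
      Complex.norm_real, Real.norm_eq_abs, Real.norm_eq_abs, Real.norm_eq_abs, mul_assoc, mul_comm]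
    gcongr
    calc _ ≤ 440 / l ^ 4 * (440 / l ^ 4) := mul_le_mul (abs_besselY_oscX_le hl0 h1 h2 _)
          (abs_besselY_oscX_le hl0 h1 h2 _) (abs_nonneg _) (by positivity)
      _ = _ := by rw [div_mul_div_comm, ← pow_two, ← pow_add]
  · generalize 4 / (1 - dyZ ^ 3) = a
    field_simp

lemma exists_norm_integral_besselY₂_le : ∃ C > 0, ∀ (l κ x : ℝ) (n₁ n₂ : ℕ), 2 ≤ l →
    1 / 256 ≤ x → x ≤ 256 → n₂ ≤ n₁ →
    ‖∫ w in (1 / 256)..x, oscE (l ^ 12) κ w * (besselY n₁ (oscX (l ^ 12) w) *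
      besselY n₂ (oscX (l ^ 12) w) : ℂ)‖ ≤ C / l ^ 15 := by
  have hz := dyZ_pos
  have hz1 := dyZ_lt_one
  have hq1 : dyZ ^ 4 < 1 := pow_lt_one₀ hz.le hz1 (by norm_num)
  refine ⟨4 * 10 ^ 27 * (4 / (1 - dyZ ^ 4)) + 440 * (3 * 10 ^ 9), by
    have : 0 < 1 - dyZ ^ 4 := by linarith
    positivity, fun l κ x n₁ n₂ hl hx hx' hn12 => ?_⟩
  have hl0 : 0 < l := by linarith
  have hl1 : 1 ≤ l := by linarith
  have w0 : ∀ w ∈ Set.Icc (1 / 256) x, 0 < w := fun w hw => lt_of_lt_of_le (by norm_num) hw.1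
  have hY : ∀ n, ContinuousOn (fun w => (besselY n (oscX (l ^ 12) w) : ℂ))
    (Set.Icc (1 / 256) x) := fun n =>
      Complex.continuous_ofReal.comp_continuousOn (continuousOn_besselY_oscX _ n w0)
  refine (norm_integral_le_of_blocks (n := n₁) (D := 4 * 10 ^ 27 / l ^ 15) (q := dyZ ^ 4)
    (E := 440 / l ^ 3 * (3 * 10 ^ 9 / l ^ 12)) (u := fun k _ => l * (dyZ ^ (2 * k)) ^ 2)
    hl hx hx' (by positivity) (by positivity) hq1
    ((continuousOn_oscE _ _ w0).mul ((hY n₁).mul (hY n₂)))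
    ?_ ?_ ?_ (by positivity) ?_).trans (le_of_eq ?_)
  · intro k α β hα hαβ hβ hlen h1 hlh hth
    exact norm_integral_besselY₂_block_le hl1 (by positivity) (pow_le_one₀ hz.le hz1.le) hα hαβ
      (hβ.trans hx') hlen hn12 h1 hlh hth
  · intro k α _ _
    positivity
  · intro k α β _ _ _ _
    exact le_of_eq (by ring)
  · intro b hb hc h
    refine norm_integral_besselY_bottom_le hl1 hb.1 hb.2 hx' n₁ hc h (by positivity)
      fun w hw => ?_
    have h1 := hb.1.trans hw.1
    have h2 := hw.2.trans hx'
    simp only [Pi.mul_apply]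
    rw [norm_mul, norm_oscE, one_mul, norm_mul, Complex.norm_real, Complex.norm_real,
      Real.norm_eq_abs, Real.norm_eq_abs, mul_comm]
    gcongr
    refine (abs_besselY_oscX_le hl0 h1 h2 _).trans ?_
    gcongr
    norm_num
  · generalize 4 / (1 - dyZ ^ 4) = a
    field_simp

lemma besselY_pow_four_le {l w : ℝ} (hl : 1 ≤ l) (hw : 1 / 256 ≤ w) (hw' : w ≤ 256) (n : ℕ)
    (h : 22 / l ^ 8 ≤ 1 - oscC (l ^ 12) n * w) :
    besselY n (oscX (l ^ 12) w) ^ 4 ≤ 10 ^ 10 / l ^ 24 * (1 - oscC (l ^ 12) n * w)⁻¹ := by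
  have hl0 : 0 < l := by linarith
  have hw0 : 0 < w := lt_of_lt_of_le (by norm_num) hw
  have ht : 0 < l ^ 12 := by positivity
  have hX := oscX_pos ht hw0
  have hXge := oscX_ge ht hw0 hw'
  set X := oscX (l ^ 12) w
  set v := 1 - oscC (l ^ 12) n * w with hv
  have hv0 : 0 < v := lt_of_lt_of_le (by positivity) h
  have hς : 0 < √v := Real.sqrt_pos.2 hv0
  have hς2 : √v ^ 2 = v := Real.sq_sqrt hv0.le
  have hς4 : 4 / l ^ 4 ≤ √v := Real.le_sqrt_of_sq_le (le_trans (by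
    rw [div_pow, ← pow_mul]; gcongr; norm_num) h)
  have := abs_besselY_le n hX hς (by rw [hς2, hv, oscX_ratio ht hw0]) (by
    calc (1:ℝ) ≤ l ^ 12 / 32 * (4 / l ^ 4) ^ 3 := by field_simp; norm_num
      _ ≤ _ := by gcongr)
  calc besselY n X ^ 4 = |besselY n X| ^ 4 := (Even.pow_abs (by decide) _).symm
    _ ≤ (50 / √(X * √v)) ^ 4 := by gcongr
    _ = 50 ^ 4 / (X ^ 2 * v) := by
        rw [div_pow, show ∀ r : ℝ, r ^ 4 = (r ^ 2) ^ 2 from fun r => by ring,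
          show ∀ r : ℝ, r ^ 4 = (r ^ 2) ^ 2 from fun r => by ring,
          Real.sq_sqrt (by positivity), mul_pow, hς2]
    _ ≤ 50 ^ 4 / ((l ^ 12 / 32) ^ 2 * v) := by gcongr
    _ = 50 ^ 4 * 32 ^ 2 / l ^ 24 * v⁻¹ := by field_simp
    _ ≤ _ := by
        gcongr
        norm_num

lemma integral_inv_one_sub_mul {c a b : ℝ} (hc : 0 < c) (hab : a ≤ b) (hb : c * b < 1) :
    ∫ w in a..b, (1 - c * w)⁻¹ = (Real.log (1 - c * a) - Real.log (1 - c * b)) / c := by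
  have hpos : ∀ w ∈ Set.uIcc a b, 0 < 1 - c * w := fun w hw => by
    rw [Set.uIcc_of_le hab] at hw
    nlinarith [hw.2]
  rw [intervalIntegral.integral_eq_sub_of_hasDerivAt (f := fun w => -(Real.log (1 - c * w) / c))]
  · ring
  · intro w hw
    have h1 : HasDerivAt (fun w => 1 - c * w) (-c) w := by
      simpa using ((hasDerivAt_id w).const_mul c).const_sub 1
    refine ((h1.log (hpos w hw).ne').div_const c).fun_neg.congr_deriv ?_
    field_simp
  · exact (ContinuousOn.inv₀ (by fun_prop) fun w hw => (hpos w hw).ne').intervalIntegrable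

lemma integral_besselY_pow_four_le {l : ℝ} (hl : 2 ≤ l) (n : ℕ) :
    ∫ w in (1 / 256)..256, besselY n (oscX (l ^ 12) w) ^ 4 ≤
      10 ^ 18 * (1 + Real.log l) / l ^ 24 := by
  have hl0 : 0 < l := by linarith
  have hl1 : 1 ≤ l := by linarith
  have hlog : 0 ≤ Real.log l := Real.log_nonneg hl1
  have w0 : ∀ w ∈ Set.Icc (1 / 256) 256, (0:ℝ) < w := fun w hw =>
    lt_of_lt_of_le (by norm_num) hw.1
  have hcont : ContinuousOn (fun w => besselY n (oscX (l ^ 12) w) ^ 4) (Set.Icc (1 / 256) 256) :=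
    (continuousOn_besselY_oscX _ n w0).pow 4
  have hc0 := oscC_nonneg (l ^ 12) n
  have hpt := fun w (hw : w ∈ Set.Icc (1 / 256 : ℝ) 256) => besselY_pow_four_le hl1 hw.1 hw.2 n
  have hm : 22 / l ^ 8 ≤ 1 / 2 := by
    rw [div_le_div_iff₀ (by positivity) (by norm_num)]
    have : (2:ℝ) ^ 8 ≤ l ^ 8 := by gcongr
    linarith
  set c := oscC (l ^ 12) n with hc
  rcases lt_or_ge c (1 / 512) with h | h
  · have h1 : ∀ w ∈ Set.Icc (1 / 256 : ℝ) 256, 1 / 2 ≤ 1 - c * w := fun w hw => by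
      nlinarith [hw.1, hw.2]
    calc _ ≤ ∫ w in (1 / 256 : ℝ)..256, 10 ^ 10 / l ^ 24 * 2 := by
          refine intervalIntegral.integral_mono_on (by norm_num)
            (hcont.intervalIntegrable_of_Icc (by norm_num)) intervalIntegrable_const
            fun w hw => (hpt w hw (hm.trans (h1 w hw))).trans ?_
          gcongr
          rw [inv_le_comm₀ (by linarith [h1 w hw]) (by norm_num)]
          linarith [h1 w hw]
      _ = (256 - 1 / 256) * 10 ^ 10 * 2 / l ^ 24 := by
          rw [intervalIntegral.integral_const, smul_eq_mul]; ring
      _ ≤ _ := by gcongr ?_ / _; linarith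
  · have hc' : 0 < c := by linarith
    obtain ⟨b, hb, h1, h2⟩ : ∃ b ∈ Set.Icc (1 / 256 : ℝ) 256,
        (1 / 256 < b → c * b ≤ 1 - 22 / l ^ 8) ∧
        ∀ w ∈ Set.Ioc b 256, 1 - c * w ≤ 22 / l ^ 8 := by
      refine ⟨max (1 / 256) (min 256 ((1 - 22 / l ^ 8) / c)), ⟨le_max_left _ _,
        max_le (by norm_num) (min_le_left _ _)⟩, fun hb => ?_, fun w hw => ?_⟩
      · rw [lt_max_iff, lt_self_iff_false, false_or] at hb
        rw [max_eq_right hb.le]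
        have := min_le_right 256 ((1 - 22 / l ^ 8) / c)
        rwa [le_div_iff₀ hc', mul_comm] at this
      · have h3 := (le_max_right _ _).trans_lt hw.1
        rcases min_lt_iff.1 h3 with h4 | h4
        · exact absurd hw.2 (not_le.2 h4)
        · rw [div_lt_iff₀ hc'] at h4
          linarith
    have hi1 := (hcont.mono (Set.Icc_subset_Icc_right hb.2)).intervalIntegrable_of_Icc
      (μ := volume) hb.1
    have hi2 := (hcont.mono (Set.Icc_subset_Icc_left hb.1)).intervalIntegrable_of_Icc
      (μ := volume) hb.2
    rw [← intervalIntegral.integral_add_adjacent_intervals hi1 hi2]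
    have p1 : ∫ w in (1 / 256)..b, besselY n (oscX (l ^ 12) w) ^ 4 ≤
        10 ^ 10 / l ^ 24 * (512 * (8 * Real.log l)) := by
      rcases eq_or_lt_of_le hb.1 with h3 | h3
      · rw [← h3]; simp; positivity
      have hcb := h1 h3
      have hm0 : 0 < 22 / l ^ 8 := by positivity
      have hge : ∀ w ∈ Set.Icc (1 / 256) b, 22 / l ^ 8 ≤ 1 - c * w := fun w hw => by
        nlinarith [hw.2]
      calc _ ≤ ∫ w in (1 / 256)..b, 10 ^ 10 / l ^ 24 * (1 - c * w)⁻¹ := by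
            refine intervalIntegral.integral_mono_on hb.1 hi1 ?_
              fun w hw => hpt w ⟨hw.1, hw.2.trans hb.2⟩ (hge w hw)
            exact (continuousOn_const.mul (ContinuousOn.inv₀ (by fun_prop) fun w hw =>
              (hm0.trans_le (hge w hw)).ne')).intervalIntegrable_of_Icc hb.1
        _ ≤ _ := by
            rw [intervalIntegral.integral_const_mul, integral_inv_one_sub_mul hc' hb.1
              (by linarith)]
            gcongr
            have l1 : Real.log (1 - c * (1 / 256)) ≤ 0 := Real.log_nonpos
              (hm0.le.trans (hge _ ⟨le_rfl, hb.1⟩)) (by linarith)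
            have l2 : Real.log (1 / l ^ 8) ≤ Real.log (1 - c * b) :=
              Real.log_le_log (by positivity) (le_trans (by gcongr; norm_num)
                (hge b ⟨hb.1, le_rfl⟩))
            rw [one_div, Real.log_inv, Real.log_pow] at l2
            push_cast at l2
            rw [div_le_iff₀ hc']
            nlinarith
    have p2 : ∫ w in b..256, besselY n (oscX (l ^ 12) w) ^ 4 ≤
        (440 / l ^ 4) ^ 3 * (3 * 10 ^ 9 / l ^ 12) := by
      refine (le_abs_self _).trans ((Real.norm_eq_abs _).symm.le.trans ?_)
      refine (intervalIntegral.norm_integral_le_of_norm_le (g := fun w => (440 / l ^ 4) ^ 3 *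
        |besselY n (oscX (l ^ 12) w)|) hb.2 (Filter.Eventually.of_forall fun w hw => ?_)
        ?_).trans ?_
      · rw [norm_pow, Real.norm_eq_abs, pow_succ]
        gcongr
        exact abs_besselY_oscX_le hl0 (hb.1.trans hw.1.le) hw.2 n
      · exact (continuousOn_const.mul (continuousOn_besselY_oscX _ n fun w hw =>
          w0 w ⟨hb.1.trans hw.1, hw.2⟩).abs).intervalIntegrable_of_Icc hb.2
      · rw [intervalIntegral.integral_const_mul]
        gcongr
        exact integral_abs_besselY_bottom_le hl1 hb.1 hb.2 le_rfl n h h2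
    calc _ ≤ 10 ^ 10 / l ^ 24 * (512 * (8 * Real.log l)) +
          (440 / l ^ 4) ^ 3 * (3 * 10 ^ 9 / l ^ 12) := add_le_add p1 p2
      _ = (10 ^ 10 * (512 * (8 * Real.log l)) + 440 ^ 3 * (3 * 10 ^ 9)) / l ^ 24 := by
          generalize Real.log l = L
          field_simp
      _ ≤ _ := by gcongr ?_ / _; linarith

lemma norm_integral_besselY₄_le {l κ x : ℝ} (n : Fin 4 → ℕ) (hl : 2 ≤ l)
    (hx : 1 / 256 ≤ x) (hx' : x ≤ 256) :
    ‖∫ w in (1 / 256)..x, oscE (l ^ 12) κ w * ∏ j, (besselY (n j) (oscX (l ^ 12) w) : ℂ)‖ ≤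
      10 ^ 18 * (1 + Real.log l) / l ^ 24 := by
  have hcont : ∀ j, ContinuousOn (fun w => besselY (n j) (oscX (l ^ 12) w) ^ 4)
      (Set.Icc (1 / 256) 256) := fun j =>
    (continuousOn_besselY_oscX _ _ fun w hw => lt_of_lt_of_le (by norm_num) hw.1).pow 4
  have hi : ∀ j, IntervalIntegrable (fun w => besselY (n j) (oscX (l ^ 12) w) ^ 4) volume
    (1 / 256) 256 := fun j => (hcont j).intervalIntegrable_of_Icc (by norm_num)
  have hsum : IntervalIntegrable (fun w => 1 / 4 * ∑ j, besselY (n j) (oscX (l ^ 12) w) ^ 4) volume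
    (1 / 256) 256 := ContinuousOn.intervalIntegrable_of_Icc (by norm_num)
      (continuousOn_const.mul (continuousOn_finsetSum _ fun j _ => hcont j))
  calc _ ≤ ∫ w in (1 / 256)..x, 1 / 4 * ∑ j, besselY (n j) (oscX (l ^ 12) w) ^ 4 := by
        refine intervalIntegral.norm_integral_le_of_norm_le hx
          (Filter.Eventually.of_forall fun w hw => ?_) (hsum.mono_set ?_)
        · rw [norm_mul, norm_oscE, one_mul, norm_prod]
          simp only [Complex.norm_real, Real.norm_eq_abs, Fin.prod_univ_four, Fin.sum_univ_four]
          set a := besselY (n 0) (oscX (l ^ 12) w)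
          set b := besselY (n 1) (oscX (l ^ 12) w)
          set c := besselY (n 2) (oscX (l ^ 12) w)
          set d := besselY (n 3) (oscX (l ^ 12) w)
          have h4 : ∀ r : ℝ, r ^ 4 = |r| ^ 4 := fun r => (Even.pow_abs (by decide) _).symm
          rw [h4 a, h4 b, h4 c, h4 d]
          nlinarith [sq_nonneg (|a| ^ 2 - |b| ^ 2), sq_nonneg (|c| ^ 2 - |d| ^ 2),
            sq_nonneg (|a| * |b| - |c| * |d|)]
        · rw [Set.uIcc_of_le hx, Set.uIcc_of_le (by norm_num)]
          exact Set.Icc_subset_Icc_right hx'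
    _ ≤ ∫ w in (1 / 256)..256, 1 / 4 * ∑ j, besselY (n j) (oscX (l ^ 12) w) ^ 4 := by
        refine intervalIntegral.integral_mono_interval le_rfl hx hx'
          (Filter.Eventually.of_forall fun w => ?_) hsum
        simp only [Pi.zero_apply]
        positivity
    _ = 1 / 4 * ∑ j, ∫ w in (1 / 256)..256, besselY (n j) (oscX (l ^ 12) w) ^ 4 := by
        rw [intervalIntegral.integral_const_mul, intervalIntegral.integral_finsetSum
          fun j _ => hi j]
    _ ≤ 1 / 4 * ∑ j : Fin 4, 10 ^ 18 * (1 + Real.log l) / l ^ 24 := by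
        gcongr with j
        exact integral_besselY_pow_four_le hl _
    _ = _ := by simp

/-- Decay of the reduced oscillatory integral in dimensions two, three and four. -/
lemma exists_norm_integral_besselY_prod_le {d : ℕ} (hd : d = 2 ∨ d = 3 ∨ d = 4) {δ : ℝ}
    (hδ : 0 < δ) : ∃ C > 0, ∀ (t κ x : ℝ) (n : Fin d → ℕ), 4096 ≤ t → 1 / 256 ≤ x → x ≤ 256 →
    ‖∫ w in (1 / 256)..x, oscE t κ w * ∏ j, (besselY (n j) (oscX t w) : ℂ)‖ ≤
      C * t ^ (-(1 / 2 + sigmaD d δ)) := by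
  have hroot : ∀ t : ℝ, 4096 ≤ t → ∃ l : ℝ, 2 ≤ l ∧ t = l ^ 12 ∧ ∀ k : ℕ,
      1 / l ^ k = t ^ (-((k : ℝ) / 12)) := fun t ht => by
    have ht0 : 0 < t := by linarith
    have e : (t ^ (1 / 12 : ℝ)) ^ 12 = t := by
      rw [← Real.rpow_natCast, ← Real.rpow_mul ht0.le]; norm_num
    refine ⟨t ^ (1 / 12 : ℝ), ?_, e.symm, fun k => ?_⟩
    · refine le_of_pow_le_pow_left₀ (n := 12) (by norm_num) (by positivity) ?_
      rw [e]; linarith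
    · rw [Real.rpow_neg ht0.le, ← Real.rpow_natCast, ← Real.rpow_mul ht0.le, one_div]
      congr 2; ring
  have hsort : ∀ n : Fin d → ℕ, ∃ n' : Fin d → ℕ, Antitone n' ∧ ∀ f : ℕ → ℂ,
      ∏ j, f (n j) = ∏ j, f (n' j) := fun n => by
    refine ⟨fun j => n (Tuple.sort n (Fin.rev j)), fun i j h => ?_, fun f => ?_⟩
    · exact Tuple.monotone_sort n (Fin.rev_le_rev.2 h)
    · exact (Equiv.prod_comp (Fin.revPerm.trans (Tuple.sort n)) fun j => f (n j)).symm
  rcases hd with rfl | rfl | rfl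
  · obtain ⟨C, hC, H⟩ := exists_norm_integral_besselY₂_le
    refine ⟨C, hC, fun t κ x n ht hx hx' => ?_⟩
    obtain ⟨l, hl, rfl, hk⟩ := hroot t ht
    obtain ⟨n', hn', hp⟩ := hsort n
    have e : -(1 / 2 + sigmaD 2 δ) = -(((15 : ℕ) : ℝ) / 12) := by norm_num [sigmaD]
    have hp' : ∀ w, ∏ j, (besselY (n j) (oscX (l ^ 12) w) : ℂ) =
      ∏ j, (besselY (n' j) (oscX (l ^ 12) w) : ℂ) := fun w => hp fun m => (besselY m _ : ℂ)
    simp only [hp']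
    simp only [Fin.prod_univ_two]
    rw [e, ← hk, mul_one_div]
    exact H l κ x _ _ hl hx hx' (hn' (by decide))
  · obtain ⟨C, hC, H⟩ := exists_norm_integral_besselY₃_le
    refine ⟨C, hC, fun t κ x n ht hx hx' => ?_⟩
    obtain ⟨l, hl, rfl, hk⟩ := hroot t ht
    obtain ⟨n', hn', hp⟩ := hsort n
    have e : -(1 / 2 + sigmaD 3 δ) = -(((20 : ℕ) : ℝ) / 12) := by norm_num [sigmaD]
    have hp' : ∀ w, ∏ j, (besselY (n j) (oscX (l ^ 12) w) : ℂ) =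
      ∏ j, (besselY (n' j) (oscX (l ^ 12) w) : ℂ) := fun w => hp fun m => (besselY m _ : ℂ)
    simp only [hp']
    simp only [Fin.prod_univ_three]
    rw [e, ← hk, mul_one_div]
    exact H l κ x _ _ _ hl hx hx' (hn' (by decide)) (hn' (by decide))
  · refine ⟨10 ^ 18 * (1 + 1 / δ), by positivity, fun t κ x n ht hx hx' => ?_⟩
    have ht0 : 0 < t := by linarith
    have ht1 : 1 ≤ t ^ δ := Real.one_le_rpow (by linarith) hδ.le
    obtain ⟨l, hl, hlt, hk⟩ := hroot t ht
    have h1 := norm_integral_besselY₄_le (κ := κ) n hl hx hx'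
    rw [← hlt] at h1
    have e : -(1 / 2 + sigmaD 4 δ) = δ + -(((24 : ℕ) : ℝ) / 12) := by norm_num [sigmaD]; ring
    rw [e, Real.rpow_add ht0, ← hk]
    have hll : l ≤ t := by rw [hlt]; exact le_self_pow₀ (by linarith) (by norm_num)
    have h2 : Real.log l ≤ t ^ δ / δ :=
      (Real.log_le_log (by linarith) hll).trans (Real.log_le_rpow_div ht0.le hδ)
    refine h1.trans ?_
    rw [mul_div_assoc, mul_assoc, ← mul_assoc (1 + 1 / δ), div_eq_mul_one_div]
    gcongr
    calc 1 + Real.log l ≤ t ^ δ + t ^ δ / δ := add_le_add ht1 h2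
      _ = _ := by ring

lemma integral_exp_cos_nat (n : ℕ) (X : ℝ) :
    ∫ ξ in (0:ℝ)..2 * π, Complex.exp (Complex.I * ((n * ξ + X * Real.cos ξ : ℝ) : ℂ)) =
      2 * Complex.exp (Complex.I * ((n * (π / 2) : ℝ) : ℂ)) * besselY n X := by
  set f : ℝ → ℂ := fun ξ => Complex.exp (Complex.I * ((n * ξ + X * Real.cos ξ : ℝ) : ℂ)) with hf
  set g : ℝ → ℂ := fun θ => Complex.exp (Complex.I * ((n * θ - X * Real.sin θ : ℝ) : ℂ)) with hg
  have hper : Function.Periodic f (2 * π) := fun ξ => by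
    simp only [hf]
    rw [Real.cos_add_two_pi, show Complex.I * ((n * (ξ + 2 * π) + X * Real.cos ξ : ℝ) : ℂ) =
      Complex.I * ((n * ξ + X * Real.cos ξ : ℝ) : ℂ) + n * (2 * π * Complex.I) by push_cast; ring,
      Complex.exp_add, Complex.exp_nat_mul_two_pi_mul_I, mul_one]
  have hgc : Continuous g := by fun_prop
  have h1 := hper.intervalIntegral_add_eq 0 (-(π / 2))
  rw [zero_add, show -(π / 2) + 2 * π = π + π / 2 by ring,
    show -(π / 2) = -π + π / 2 by ring, ← intervalIntegral.integral_comp_add_right] at h1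
  have h2 : ∀ θ, f (θ + π / 2) = Complex.exp (Complex.I * ((n * (π / 2) : ℝ) : ℂ)) * g θ :=
    fun θ => by
      simp only [hf, hg]
      rw [← Complex.exp_add, Real.cos_add_pi_div_two]
      congr 1; push_cast; ring
  rw [h1]
  simp only [h2]
  rw [intervalIntegral.integral_const_mul,
    ← intervalIntegral.integral_add_adjacent_intervals (b := 0)
      (hgc.intervalIntegrable _ _) (hgc.intervalIntegrable _ _)]
  have h3 : ∫ θ in -π..0, g θ = ∫ θ in (0:ℝ)..π, g (-θ) := by
    rw [intervalIntegral.integral_comp_neg, neg_zero]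
  have h4 : ∀ θ : ℝ, g (-θ) + g θ = ((2 * Real.cos (n * θ - X * Real.sin θ) : ℝ) : ℂ) :=
    fun θ => by
      push_cast
      rw [Complex.two_cos]
      simp only [hg, Real.sin_neg]
      rw [add_comm]
      congr 2 <;> push_cast <;> ring
  rw [h3, ← intervalIntegral.integral_add (Continuous.intervalIntegrable (by fun_prop) _ _)
    (hgc.intervalIntegrable _ _)]
  simp only [h4]
  rw [intervalIntegral.integral_ofReal, intervalIntegral.integral_const_mul, besselY]
  push_cast
  ring

lemma integral_exp_cos (m : ℤ) (X : ℝ) :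
    ∫ ξ in (0:ℝ)..2 * π, Complex.exp (Complex.I * ((m * ξ + X * Real.cos ξ : ℝ) : ℂ)) =
      2 * Complex.exp (Complex.I * ((m.natAbs * (π / 2) : ℝ) : ℂ)) * besselY m.natAbs X := by
  rw [← integral_exp_cos_nat]
  rcases Int.natAbs_eq m with h | h
  · rw [h]; simp
  · set n := m.natAbs
    rw [h]
    have := intervalIntegral.integral_comp_sub_left (a := 0) (b := 2 * π)
      (fun ξ : ℝ => Complex.exp (Complex.I * ((n * ξ + X * Real.cos ξ : ℝ) : ℂ))) (2 * π)
    rw [sub_self, sub_zero] at this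
    rw [← this]
    refine intervalIntegral.integral_congr fun ξ _ => ?_
    rw [Real.cos_two_pi_sub, show Complex.I * ((n * (2 * π - ξ) + X * Real.cos ξ : ℝ) : ℂ) =
      Complex.I * ((((-n : ℤ) : ℝ) * ξ + X * Real.cos ξ : ℝ) : ℂ) + n * (2 * π * Complex.I) by
        push_cast; ring, Complex.exp_add, Complex.exp_nat_mul_two_pi_mul_I, mul_one]

lemma omegaKG_sq (d : ℕ) (ξ : Fin d → ℝ) :
    omegaKG d ξ ^ 2 = 1 + 2 * d - 2 * ∑ j, Real.cos (ξ j) := by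
  rw [omegaKG, Real.sq_sqrt]
  · simp_rw [mul_sub]
    rw [Finset.sum_sub_distrib, Finset.mul_sum]
    simp; ring
  · exact add_nonneg zero_le_one (Finset.sum_nonneg fun j _ => by linarith [Real.cos_le_one (ξ j)])

lemma one_le_omegaKG (d : ℕ) (ξ : Fin d → ℝ) : 1 ≤ omegaKG d ξ :=
  Real.le_sqrt_of_sq_le (by
    have : 0 ≤ ∑ j : Fin d, 2 * (1 - Real.cos (ξ j)) :=
      Finset.sum_nonneg fun j _ => by linarith [Real.cos_le_one (ξ j)]
    linarith)

lemma omegaKG_le (d : ℕ) (hd : d ≤ 6) (ξ : Fin d → ℝ) : omegaKG d ξ ≤ 5 := by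
  refine Real.sqrt_le_iff.2 ⟨by norm_num, ?_⟩
  have : ∑ j : Fin d, 2 * (1 - Real.cos (ξ j)) ≤ ∑ j : Fin d, (4 : ℝ) :=
    Finset.sum_le_sum fun j _ => by linarith [Real.neg_one_le_cos (ξ j)]
  simp at this
  have : (d : ℝ) ≤ 6 := by exact_mod_cast hd
  linarith

lemma continuous_omegaKG (d : ℕ) : Continuous (omegaKG d) := by
  unfold omegaKG; fun_prop

/-- The character of `ℤ^d`. -/
def charZ {d : ℕ} (x : Fin d → ℤ) (ξ : Fin d → ℝ) : ℂ :=
  Complex.exp (Complex.I * ((∑ j : Fin d, (x j : ℝ) * ξ j : ℝ) : ℂ))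

lemma norm_charZ {d : ℕ} (x : Fin d → ℤ) (ξ : Fin d → ℝ) : ‖charZ x ξ‖ = 1 := norm_cexp_I_mul _

lemma continuous_charZ {d : ℕ} (x : Fin d → ℤ) : Continuous (charZ x) := by
  unfold charZ; fun_prop

lemma isCompact_cube (d : ℕ) : IsCompact (cube d) := isCompact_Icc

lemma volume_real_cube (d : ℕ) : volume.real (cube d) = (2 * π) ^ d := by
  rw [Measure.real, cube, Real.volume_Icc_pi_toReal (fun j => by simp [Real.pi_pos.le])]
  simp

lemma charZ_mul_oscE {d : ℕ} (x : Fin d → ℤ) (ξ : Fin d → ℝ) (t w : ℝ) :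
    charZ x ξ * oscE t (omegaKG d ξ ^ 2) w = oscE t (1 + 2 * d) w *
      ∏ j, Complex.exp (Complex.I * ((x j * ξ j + oscX t w * Real.cos (ξ j) : ℝ) : ℂ)) := by
  rw [charZ, oscE, oscE, ← Complex.exp_sum, ← Complex.exp_add, ← Complex.exp_add, omegaKG_sq,
    oscX, ← Finset.mul_sum, ← mul_add, ← mul_add, ← Complex.ofReal_add, ← Complex.ofReal_sum,
    ← Complex.ofReal_add, Finset.sum_add_distrib, ← Finset.mul_sum]
  congr 3
  ring

lemma integral_cube_charZ_mul_oscE {d : ℕ} (x : Fin d → ℤ) (t w : ℝ) :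
    ∫ ξ in cube d, charZ x ξ * oscE t (omegaKG d ξ ^ 2) w = oscE t (1 + 2 * d) w *
      ∏ j, (2 * Complex.exp (Complex.I * (((x j).natAbs * (π / 2) : ℝ) : ℂ)) *
        besselY (x j).natAbs (oscX t w)) := by
  simp_rw [charZ_mul_oscE]
  rw [integral_const_mul]
  congr 1
  have : (volume : Measure (Fin d → ℝ)).restrict (cube d) =
      Measure.pi fun _ => (volume : Measure ℝ).restrict (Set.Icc 0 (2 * π)) := by
    rw [cube, ← Set.pi_univ_Icc, volume_pi, Measure.restrict_pi_pi]; rfl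
  rw [this, integral_fintype_prod_eq_prod fun j (ξ : ℝ) =>
    Complex.exp (Complex.I * ((x j * ξ + oscX t w * Real.cos ξ : ℝ) : ℂ))]
  refine Finset.prod_congr rfl fun j _ => ?_
  rw [← integral_exp_cos, integral_Icc_eq_integral_Ioc,
    intervalIntegral.integral_of_le (by positivity)]

lemma continuousOn_ampW (k : ℕ) : ContinuousOn (ampW k) (Set.Icc (1 / 256) 256) :=
  (contDiffOn_ampW k).continuousOn.mono fun _ hw => lt_of_lt_of_le (by norm_num) hw.1

/-- The subordinated kernel is an oscillatory integral of Bessel functions. -/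
lemma integral_cube_integral_ampW {d : ℕ} (k : ℕ) (x : Fin d → ℤ) (t : ℝ) :
    ∫ ξ in cube d, charZ x ξ * ∫ w in (1 / 256)..256, (ampW k w : ℂ) * oscE t (omegaKG d ξ ^ 2) w =
      (∏ j, 2 * Complex.exp (Complex.I * (((x j).natAbs * (π / 2) : ℝ) : ℂ))) *
      ∫ w in (1 / 256)..256, (ampW k w : ℂ) *
        (oscE t (1 + 2 * d) w * ∏ j, (besselY (x j).natAbs (oscX t w) : ℂ)) := by
  have h0 : (1 / 256 : ℝ) ≤ 256 := by norm_num
  have hcont : ContinuousOn (Function.uncurry fun (ξ : Fin d → ℝ) (w : ℝ) =>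
      charZ x ξ * ((ampW k w : ℂ) * oscE t (omegaKG d ξ ^ 2) w))
      (cube d ×ˢ Set.Icc (1 / 256) 256) := by
    refine ((continuous_charZ x).comp continuous_fst).continuousOn.mul (ContinuousOn.mul ?_ ?_)
    · exact Complex.continuous_ofReal.comp_continuousOn
        ((continuousOn_ampW k).comp continuousOn_snd fun p hp => hp.2)
    · unfold oscE
      have := (continuous_omegaKG d)
      refine Complex.continuous_exp.comp_continuousOn (continuousOn_const.mul
        (Complex.continuous_ofReal.comp_continuousOn (continuousOn_const.mul
        (ContinuousOn.add (by fun_prop) (ContinuousOn.div (by fun_prop) (by fun_prop)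
          fun p hp => ?_)))))
      exact (Real.sqrt_pos.2 (lt_of_lt_of_le (by norm_num) hp.2.1)).ne'
  have hint : Integrable (Function.uncurry fun (ξ : Fin d → ℝ) (w : ℝ) =>
      charZ x ξ * ((ampW k w : ℂ) * oscE t (omegaKG d ξ ^ 2) w))
      ((volume.restrict (cube d)).prod (volume.restrict (Set.Ioc (1 / 256) 256))) := by
    rw [Measure.prod_restrict]
    exact (hcont.integrableOn_compact ((isCompact_cube d).prod isCompact_Icc)).mono_set
      (Set.prod_mono le_rfl Set.Ioc_subset_Icc_self)
  simp_rw [intervalIntegral.integral_of_le h0, ← integral_const_mul]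
  rw [integral_integral_swap hint]
  refine setIntegral_congr_fun measurableSet_Ioc fun w _ => ?_
  have : ∀ ξ, charZ x ξ * ((ampW k w : ℂ) * oscE t (omegaKG d ξ ^ 2) w) =
    (ampW k w : ℂ) * (charZ x ξ * oscE t (omegaKG d ξ ^ 2) w) := fun ξ => by ring
  simp only [this]
  rw [integral_const_mul, integral_cube_charZ_mul_oscE, Finset.prod_mul_distrib]
  ring

lemma exists_norm_cube_ampW_le {d : ℕ} (hd : d = 2 ∨ d = 3 ∨ d = 4) {δ : ℝ} (hδ : 0 < δ) (k : ℕ) :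
    ∃ C > 0, ∀ (t : ℝ) (x : Fin d → ℤ), 4096 ≤ t →
      ‖∫ ξ in cube d, charZ x ξ *
        ∫ w in (1 / 256)..256, (ampW k w : ℂ) * oscE t (omegaKG d ξ ^ 2) w‖ ≤
      C * t ^ (-(1 / 2 + sigmaD d δ)) := by
  obtain ⟨C, hC, H⟩ := exists_norm_integral_besselY_prod_le hd hδ
  have h0 : (1 / 256 : ℝ) ≤ 256 := by norm_num
  have hs : ∀ w ∈ Set.Icc (1 / 256 : ℝ) 256, w ∈ Set.Ioi (0:ℝ) := fun w hw =>
    lt_of_lt_of_le (by norm_num) hw.1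
  have hA : ∀ w ∈ Set.Icc (1 / 256 : ℝ) 256,
      HasDerivAt (fun w => (ampW k w : ℂ)) ((deriv (ampW k) w : ℝ) : ℂ) w := fun w hw =>
    HasDerivAt.ofReal_comp (((contDiffOn_ampW k).contDiffAt (Ioi_mem_nhds (hs w hw))).differentiableAt
      (by norm_num)).hasDerivAt
  have hA' : ContinuousOn (fun w => ((deriv (ampW k) w : ℝ) : ℂ)) (Set.Icc (1 / 256 : ℝ) 256) :=
    Complex.continuous_ofReal.comp_continuousOn
      (((contDiffOn_ampW k).continuousOn_deriv_of_isOpen isOpen_Ioi (by norm_num)).mono hs)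
  set V := ∫ w in (1 / 256 : ℝ)..256, ‖((deriv (ampW k) w : ℝ) : ℂ)‖ with hV
  have hV0 : 0 ≤ V := intervalIntegral.integral_nonneg h0 fun w _ => norm_nonneg _
  refine ⟨2 ^ d * (C * (V + 1)), by positivity, fun t x ht => ?_⟩
  have ht0 : 0 < t := by linarith
  rw [integral_cube_integral_ampW, norm_mul, norm_prod]
  have e1 : ∀ j, ‖2 * Complex.exp (Complex.I * (((x j).natAbs * (π / 2) : ℝ) : ℂ))‖ = 2 := fun j => by
    rw [norm_mul, norm_cexp_I_mul]; simp
  simp_rw [e1]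
  rw [Finset.prod_const, Finset.card_univ, Fintype.card_fin, mul_assoc (2 ^ d)]
  gcongr
  have hcont : ContinuousOn (fun w => oscE t (1 + 2 * d) w *
      ∏ j, (besselY (x j).natAbs (oscX t w) : ℂ)) (Set.Icc (1 / 256 : ℝ) 256) :=
    (continuousOn_oscE t _ hs).mul (continuousOn_finsetProd _ fun j _ =>
      Complex.continuous_ofReal.comp_continuousOn (continuousOn_besselY_oscX t _ hs))
  refine (norm_integral_amplitude_le h0 hcont (fun y hy => H t (1 + 2 * d) y
    (fun j => (x j).natAbs) ht hy.1 hy.2) hA hA' (M := 0) ?_ hV.ge).trans ?_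
  · simp [ampW_eq_zero k (Or.inr le_rfl)]
  · have : 0 ≤ C * t ^ (-(1 / 2 + sigmaD d δ)) := by positivity
    nlinarith

/-- Decay of the half-wave kernels. -/
lemma exists_norm_cube_exp_le {d : ℕ} (hd : d = 2 ∨ d = 3 ∨ d = 4) {δ : ℝ} (hδ : 0 < δ) :
    ∃ C > 0, ∀ (t : ℝ) (x : Fin d → ℤ), 4096 ≤ t →
      ‖∫ ξ in cube d, charZ x ξ * Complex.exp (Complex.I * ((-t * omegaKG d ξ : ℝ) : ℂ))‖ ≤
        C * t ^ (-sigmaD d δ) ∧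
      ‖∫ ξ in cube d, charZ x ξ * (Complex.exp (Complex.I * ((-t * omegaKG d ξ : ℝ) : ℂ)) /
        omegaKG d ξ)‖ ≤ C * t ^ (-sigmaD d δ) := by
  obtain ⟨C₃, hC₃, H₃⟩ := exists_norm_cube_ampW_le hd hδ 3
  obtain ⟨C₅, hC₅, H₅⟩ := exists_norm_cube_ampW_le hd hδ 5
  obtain ⟨C₀, hC₀, H₀⟩ := exists_subordination
  have hd6 : d ≤ 6 := by omega
  have hσ : sigmaD d δ ≤ 3 / 2 := by
    rcases hd with rfl | rfl | rfl <;> norm_num [sigmaD]; exact hδ.le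
  set c := (2 * π) ^ d with hc
  have hc0 : 0 < c := by positivity
  have hω : ∀ ξ : Fin d → ℝ, omegaKG d ξ ∈ Set.Icc (1:ℝ) 5 := fun ξ =>
    ⟨one_le_omegaKG d ξ, omegaKG_le d hd6 ξ⟩
  have hωc := continuous_omegaKG d
  have hω0 : ∀ ξ : Fin d → ℝ, (omegaKG d ξ : ℂ) ≠ 0 := fun ξ => by
    exact_mod_cast (zero_lt_one.trans_le (one_le_omegaKG d ξ)).ne'
  have main : ∀ (t : ℝ), 4096 ≤ t → ∀ (A E : (Fin d → ℝ) → ℂ) (x : Fin d → ℤ), Continuous E →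
      IntegrableOn (fun ξ => charZ x ξ * A ξ) (cube d) →
      (∀ ξ, ‖A ξ - E ξ * subD t‖ ≤ C₀ / t ^ 2) →
      ‖∫ ξ in cube d, charZ x ξ * A ξ‖ ≤ (C₃ + C₅) * t ^ (-(1 / 2 + sigmaD d δ)) →
      ‖∫ ξ in cube d, charZ x ξ * E ξ‖ ≤
        40 * (C₃ + C₅ + C₀ * c) * t ^ (-sigmaD d δ) := by
    intro t ht A E x hE hi hAE hA
    have ht0 : 0 < t := by linarith
    have hst : 0 < √t := Real.sqrt_pos.2 ht0
    have hEi : IntegrableOn (fun ξ => charZ x ξ * E ξ) (cube d) :=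
      ((continuous_charZ x).mul hE).continuousOn.integrableOn_compact (isCompact_cube d)
    have h1 : ‖(∫ ξ in cube d, charZ x ξ * E ξ) * subD t‖ ≤
        (C₃ + C₅) * t ^ (-(1 / 2 + sigmaD d δ)) + C₀ / t ^ 2 * c := by
      have : (∫ ξ in cube d, charZ x ξ * E ξ) * subD t = (∫ ξ in cube d, charZ x ξ * A ξ) -
          ∫ ξ in cube d, charZ x ξ * (A ξ - E ξ * subD t) := by
        rw [← integral_mul_const, ← integral_sub hi]
        · refine integral_congr_ae (Filter.Eventually.of_forall fun ξ => ?_)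
          simp only
          ring
        · refine (hi.sub (hEi.mul_const (subD t))).congr
            (Filter.Eventually.of_forall fun ξ => ?_)
          simp only [Pi.sub_apply]
          ring
      rw [this]
      refine (norm_sub_le _ _).trans (add_le_add hA ?_)
      rw [hc, ← volume_real_cube]
      refine norm_setIntegral_le_of_norm_le_const (isCompact_cube d).measure_lt_top fun ξ _ => ?_
      rw [norm_mul, norm_charZ, one_mul]
      exact hAE ξ
    rw [norm_mul] at h1
    have h2 := norm_subD_ge (by linarith : 16 ≤ t)
    have e1 : t ^ (-(1 / 2 + sigmaD d δ)) = t ^ (-sigmaD d δ) / √t := by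
      rw [Real.sqrt_eq_rpow, ← Real.rpow_sub ht0]; congr 1; ring
    have e2 : 1 / t ^ 2 ≤ t ^ (-sigmaD d δ) / √t := by
      rw [← e1, ← Real.rpow_natCast, one_div, ← Real.rpow_neg ht0.le]
      exact Real.rpow_le_rpow_of_exponent_le (by linarith) (by push_cast; linarith)
    have h3 : ‖∫ ξ in cube d, charZ x ξ * E ξ‖ * (1 / 40 / √t) ≤
        (C₃ + C₅ + C₀ * c) * (t ^ (-sigmaD d δ) / √t) := by
      calc _ ≤ _ := mul_le_mul_of_nonneg_left h2 (norm_nonneg _)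
        _ ≤ _ := h1
        _ = (C₃ + C₅) * (t ^ (-sigmaD d δ) / √t) + C₀ * c * (1 / t ^ 2) := by rw [e1]; ring
        _ ≤ (C₃ + C₅) * (t ^ (-sigmaD d δ) / √t) + C₀ * c * (t ^ (-sigmaD d δ) / √t) := by gcongr
        _ = _ := by ring
    have h4 := mul_le_mul_of_nonneg_right h3 (by positivity : 0 ≤ 40 * √t)
    calc _ = ‖∫ ξ in cube d, charZ x ξ * E ξ‖ * (1 / 40 / √t) * (40 * √t) := by field_simp
      _ ≤ _ := h4
      _ = _ := by field_simp
  have hint : ∀ k t x, IntegrableOn (fun ξ => charZ x ξ *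
      ∫ w in (1 / 256)..256, (ampW k w : ℂ) * oscE t (omegaKG d ξ ^ 2) w) (cube d) := fun k t x => by
    refine ContinuousOn.integrableOn_compact (isCompact_cube d) (ContinuousOn.mul
      (continuous_charZ x).continuousOn (Continuous.continuousOn ?_))
    have h0 : (1 / 256 : ℝ) ≤ 256 := by norm_num
    simp_rw [intervalIntegral.integral_of_le h0]
    refine continuous_of_dominated (bound := fun w => |ampW k w|) (fun ξ => ?_) (fun ξ => ?_) ?_ ?_
    · refine (ContinuousOn.aestronglyMeasurable ?_ measurableSet_Ioc)
      exact ((Complex.continuous_ofReal.comp_continuousOn (continuousOn_ampW k)).mul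
        (continuousOn_oscE t _ fun w hw => lt_of_lt_of_le (by norm_num) hw.1)).mono
          Set.Ioc_subset_Icc_self
    · refine Filter.Eventually.of_forall fun w => ?_
      rw [norm_mul, norm_oscE, mul_one, Complex.norm_real, Real.norm_eq_abs]
    · exact ((continuousOn_ampW k).abs.integrableOn_compact isCompact_Icc).mono_set
        Set.Ioc_subset_Icc_self
    · refine Filter.Eventually.of_forall fun w => ?_
      unfold oscE
      fun_prop
  refine ⟨40 * (C₃ + C₅ + C₀ * c), by positivity, fun t x ht => ?_⟩
  have ht0 : 0 < t := by linarith
  have hp : 0 ≤ t ^ (-(1 / 2 + sigmaD d δ)) := by positivity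
  constructor
  · refine main t ht _ _ x (by fun_prop) (hint 3 t x) (fun ξ => (H₀ _ (hω ξ) t ht0).1)
      ((H₃ t x ht).trans ?_)
    gcongr
    linarith
  · refine main t ht (fun ξ => (∫ w in (1 / 256)..256, (ampW 5 w : ℂ) *
      oscE t (omegaKG d ξ ^ 2) w) * (1 / 2)) _ x ?_ ?_ (fun ξ => ?_) ?_
    · exact Continuous.div (by fun_prop) (by fun_prop) hω0
    · refine ((hint 5 t x).mul_const (1 / 2)).congr (Filter.Eventually.of_forall fun ξ => ?_)
      simp only
      ring
    · have h5 := (H₀ _ (hω ξ) t ht0).2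
      have h1 := (hω ξ).1
      have hne := hω0 ξ
      have e : ((∫ w in (1 / 256)..256, (ampW 5 w : ℂ) *
          oscE t (omegaKG d ξ ^ 2) w) * (1 / 2)) -
          Complex.exp (Complex.I * ((-t * omegaKG d ξ : ℝ) : ℂ)) / omegaKG d ξ * subD t =
          ((∫ w in (1 / 256)..256, (ampW 5 w : ℂ) * oscE t (omegaKG d ξ ^ 2) w) *
            ((omegaKG d ξ / 2 : ℝ) : ℂ) -
          Complex.exp (Complex.I * ((-t * omegaKG d ξ : ℝ) : ℂ)) * subD t) / omegaKG d ξ := by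
        push_cast
        field_simp
      rw [e, norm_div, Complex.norm_real, Real.norm_eq_abs, abs_of_pos (by linarith)]
      exact (div_le_self (norm_nonneg _) h1).trans h5
    · simp_rw [← mul_assoc]
      rw [integral_mul_const, norm_mul]
      have := H₅ t x ht
      have h2 : ‖(1 / 2 : ℂ)‖ = 1 / 2 := by norm_num
      rw [h2]
      have := norm_nonneg (∫ ξ in cube d, charZ x ξ *
        ∫ w in (1 / 256)..256, (ampW 5 w : ℂ) * oscE t (omegaKG d ξ ^ 2) w)
      nlinarith [mul_nonneg hC₃.le hp]

lemma multKernel_eq (d : ℕ) (m : (Fin d → ℝ) → ℝ) (x : Fin d → ℤ) :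
    multKernel d m x = ((((2 * π) ^ d)⁻¹ : ℝ) : ℂ) * ∫ ξ in cube d, charZ x ξ * (m ξ : ℂ) := rfl

lemma norm_multKernel (d : ℕ) (m : (Fin d → ℝ) → ℝ) (x : Fin d → ℤ) :
    ‖multKernel d m x‖ = ((2 * π) ^ d)⁻¹ * ‖∫ ξ in cube d, charZ x ξ * (m ξ : ℂ)‖ := by
  rw [multKernel_eq, norm_mul, Complex.norm_real, Real.norm_of_nonneg (by positivity)]

lemma norm_multKernel_le {d : ℕ} {m : (Fin d → ℝ) → ℝ} {M : ℝ} (hm : ∀ ξ, |m ξ| ≤ M)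
    (x : Fin d → ℤ) : ‖multKernel d m x‖ ≤ M := by
  rw [norm_multKernel, inv_mul_le_iff₀ (by positivity), ← volume_real_cube, mul_comm]
  refine norm_setIntegral_le_of_norm_le_const (isCompact_cube d).measure_lt_top fun ξ _ => ?_
  rw [norm_mul, norm_charZ, one_mul, Complex.norm_real]
  exact hm ξ

lemma abs_cos_omega_le (d : ℕ) (t : ℝ) (ξ : Fin d → ℝ) : |Real.cos (t * omegaKG d ξ)| ≤ 1 :=
  Real.abs_cos_le_one _

lemma abs_sin_omega_le (d : ℕ) (t : ℝ) (ξ : Fin d → ℝ) :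
    |Real.sin (t * omegaKG d ξ) / omegaKG d ξ| ≤ 1 := by
  have := one_le_omegaKG d ξ
  rw [abs_div, abs_of_pos (zero_lt_one.trans_le this)]
  exact (div_le_self (abs_nonneg _) this).trans (Real.abs_sin_le_one _)

lemma integral_charZ_mul_conj {d : ℕ} (x : Fin d → ℤ) (e : (Fin d → ℝ) → ℂ) :
    ∫ ξ in cube d, charZ x ξ * (starRingEnd ℂ) (e ξ) =
      (starRingEnd ℂ) (∫ ξ in cube d, charZ (-x) ξ * e ξ) := by
  rw [← integral_conj]
  congr 1
  funext ξ
  rw [map_mul, charZ, charZ, ← Complex.exp_conj]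
  congr 2
  simp

lemma sigmaD_nonneg {d : ℕ} (hd : d = 2 ∨ d = 3 ∨ d = 4) {δ : ℝ} (hδ' : δ ≤ 1 / 2) :
    0 ≤ sigmaD d δ := by
  rcases hd with rfl | rfl | rfl <;> norm_num [sigmaD]; linarith

/-- Dispersive decay of the Klein-Gordon propagators. -/
lemma exists_norm_kernel_le {d : ℕ} (hd : d = 2 ∨ d = 3 ∨ d = 4) {δ : ℝ} (hδ : 0 < δ)
    (hδ' : δ ≤ 1 / 2) : ∃ C ≥ 1, ∀ (t : ℝ) (x : Fin d → ℤ),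
      ‖multKernel d (fun ξ => Real.cos (t * omegaKG d ξ)) x‖ ≤ C * (1 + |t|) ^ (-sigmaD d δ) ∧
      ‖multKernel d (fun ξ => Real.sin (t * omegaKG d ξ) / omegaKG d ξ) x‖ ≤
        C * (1 + |t|) ^ (-sigmaD d δ) := by
  obtain ⟨C, hC, H⟩ := exists_norm_cube_exp_le hd hδ
  have hσ := sigmaD_nonneg hd hδ'
  set σ := sigmaD d δ
  have hωc := continuous_omegaKG d
  have hω0 : ∀ ξ : Fin d → ℝ, omegaKG d ξ ≠ 0 := fun ξ =>
    (zero_lt_one.trans_le (one_le_omegaKG d ξ)).ne'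
  have avg : ∀ (x : Fin d → ℤ) (e m : (Fin d → ℝ) → ℂ) (c : ℂ) (B : ℝ), ‖c‖ = 1 → Continuous e →
      (∀ ξ, m ξ = c * (e ξ) / 2 + (starRingEnd ℂ) (c * e ξ) / 2) →
      (∀ x, ‖∫ ξ in cube d, charZ x ξ * e ξ‖ ≤ B) →
      ‖∫ ξ in cube d, charZ x ξ * m ξ‖ ≤ B := by
    intro x e m c B hc he hm hB
    have hi : ∀ e : (Fin d → ℝ) → ℂ, Continuous e →
      IntegrableOn (fun ξ => charZ x ξ * e ξ) (cube d) := fun e he =>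
        ((continuous_charZ x).mul he).continuousOn.integrableOn_compact (isCompact_cube d)
    have : ∫ ξ in cube d, charZ x ξ * m ξ = c / 2 * (∫ ξ in cube d, charZ x ξ * e ξ) +
        (starRingEnd ℂ) c / 2 * (starRingEnd ℂ) (∫ ξ in cube d, charZ (-x) ξ * e ξ) := by
      rw [← integral_charZ_mul_conj, ← integral_const_mul, ← integral_const_mul, ← integral_add
        ((hi e he).const_mul _) ((hi (fun ξ => (starRingEnd ℂ) (e ξ)) (Complex.continuous_conj.comp he)).const_mul _)]
      refine integral_congr_ae (Filter.Eventually.of_forall fun ξ => ?_)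
      simp only [hm, map_mul]
      ring
    rw [this]
    refine (norm_add_le _ _).trans ?_
    rw [norm_mul, norm_mul, norm_div, norm_div, RCLike.norm_conj, RCLike.norm_conj, hc]
    have := hB x
    have := hB (-x)
    simp
    linarith
  have large : ∀ (t : ℝ) (x : Fin d → ℤ), 4096 ≤ t →
      ‖multKernel d (fun ξ => Real.cos (t * omegaKG d ξ)) x‖ ≤ C * t ^ (-σ) ∧
      ‖multKernel d (fun ξ => Real.sin (t * omegaKG d ξ) / omegaKG d ξ) x‖ ≤ C * t ^ (-σ) := by
    intro t x ht
    have hp : 1 ≤ (2 * π) ^ d := one_le_pow₀ (by linarith [Real.pi_gt_three])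
    have red : ∀ m : (Fin d → ℝ) → ℝ, ‖multKernel d m x‖ ≤
        ‖∫ ξ in cube d, charZ x ξ * (m ξ : ℂ)‖ := fun m => by
      rw [norm_multKernel]
      exact mul_le_of_le_one_left (norm_nonneg _) (inv_le_one_of_one_le₀ hp)
    constructor
    · refine (red _).trans (avg x _ _ 1 _ (by simp) ?_ (fun ξ => ?_) fun x => (H t x ht).1)
      · fun_prop
      · rw [one_mul, ← Complex.exp_conj, map_mul, Complex.conj_I, Complex.conj_ofReal]
        push_cast
        rw [Complex.cos]
        ring_nf
    · refine (red _).trans (avg x _ _ Complex.I _ (by simp) ?_ (fun ξ => ?_)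
        fun x => (H t x ht).2)
      · exact Continuous.div (by fun_prop) (by fun_prop) fun ξ => by exact_mod_cast hω0 ξ
      · rw [map_mul, map_div₀, ← Complex.exp_conj, map_mul, Complex.conj_I, Complex.conj_ofReal,
          Complex.conj_ofReal]
        push_cast
        rw [Complex.sin]
        ring_nf
  have small : ∀ (t : ℝ) (x : Fin d → ℤ),
      ‖multKernel d (fun ξ => Real.cos (t * omegaKG d ξ)) x‖ ≤ 1 ∧
      ‖multKernel d (fun ξ => Real.sin (t * omegaKG d ξ) / omegaKG d ξ) x‖ ≤ 1 := fun t x =>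
    ⟨norm_multKernel_le (abs_cos_omega_le d t) x, norm_multKernel_le (abs_sin_omega_le d t) x⟩
  have pos : ∀ (t : ℝ) (x : Fin d → ℤ), 0 ≤ t →
      ‖multKernel d (fun ξ => Real.cos (t * omegaKG d ξ)) x‖ ≤
        (C + 1) * 4097 ^ σ * (1 + t) ^ (-σ) ∧
      ‖multKernel d (fun ξ => Real.sin (t * omegaKG d ξ) / omegaKG d ξ) x‖ ≤
        (C + 1) * 4097 ^ σ * (1 + t) ^ (-σ) := by
    intro t x ht
    rcases le_or_gt 4096 t with h | h
    · have ht0 : 0 < t := by linarith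
      have : C * t ^ (-σ) ≤ (C + 1) * 4097 ^ σ * (1 + t) ^ (-σ) := by
        have h1 : t ^ (-σ) ≤ 4097 ^ σ * (1 + t) ^ (-σ) := by
          rw [Real.rpow_neg ht, Real.rpow_neg (by linarith), ← div_eq_mul_inv,
            ← Real.div_rpow (by norm_num) (by linarith), ← Real.inv_rpow ht]
          refine Real.rpow_le_rpow (by positivity) ?_ hσ
          rw [inv_eq_one_div, div_le_div_iff₀ ht0 (by linarith)]
          linarith
        rw [mul_assoc]
        gcongr
        linarith
      exact ⟨(large t x h).1.trans this, (large t x h).2.trans this⟩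
    · have : 1 ≤ (C + 1) * 4097 ^ σ * (1 + t) ^ (-σ) := by
        have h1 : 1 ≤ 4097 ^ σ * (1 + t) ^ (-σ) := by
          rw [Real.rpow_neg (by linarith), ← div_eq_mul_inv,
            ← Real.div_rpow (by norm_num) (by linarith)]
          refine Real.one_le_rpow ?_ hσ
          rw [one_le_div (by linarith)]
          linarith
        rw [mul_assoc]
        nlinarith
      exact ⟨(small t x).1.trans this, (small t x).2.trans this⟩
  refine ⟨(C + 1) * 4097 ^ σ, ?_, fun t x => ?_⟩
  · have : (1:ℝ) ≤ 4097 ^ σ := Real.one_le_rpow (by norm_num) hσ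
    nlinarith
  · rcases le_total 0 t with h | h
    · rw [abs_of_nonneg h]
      exact pos t x h
    · rw [abs_of_nonpos h]
      have := pos (-t) x (by linarith)
      refine ⟨?_, ?_⟩
      · simpa using this.1
      · refine le_trans (le_of_eq ?_) this.2
        rw [norm_multKernel, norm_multKernel]
        congr 1
        rw [← norm_neg, ← integral_neg]
        simp [neg_div]

/-- The analytic family `z ↦ sgn(w)|w|^{λ(z)}` used for complex interpolation. -/
def interpFamily (α β : ℝ) (w z : ℂ) : ℂ :=
  (w / ‖w‖) * Complex.exp (Real.log ‖w‖ * (α * (1 - z) + β * z))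

lemma differentiable_interpFamily (α β : ℝ) (w : ℂ) : Differentiable ℂ (interpFamily α β w) := by
  unfold interpFamily
  fun_prop

lemma norm_interpFamily {α β : ℝ} (w z : ℂ) (h : 0 < α * (1 - z.re) + β * z.re) :
    ‖interpFamily α β w z‖ = ‖w‖ ^ (α * (1 - z.re) + β * z.re) := by
  rcases eq_or_ne w 0 with rfl | hw
  · simp [interpFamily, Real.zero_rpow h.ne']
  · have hw' : 0 < ‖w‖ := norm_pos_iff.2 hw
    rw [interpFamily, norm_mul, norm_div, Complex.norm_real, norm_norm, div_self hw'.ne', one_mul,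
      Complex.norm_exp, Real.rpow_def_of_pos hw']
    congr 1
    simp

lemma interpFamily_self {α β θ : ℝ} (w : ℂ) (h : α * (1 - θ) + β * θ = 1) :
    interpFamily α β w θ = w := by
  rcases eq_or_ne w 0 with rfl | hw
  · simp [interpFamily]
  · have hw' : 0 < ‖w‖ := norm_pos_iff.2 hw
    have : (α * (1 - θ) + β * θ : ℂ) = 1 := by exact_mod_cast h
    rw [interpFamily, this, mul_one, ← Complex.ofReal_exp, Real.exp_log hw',
      div_mul_cancel₀ _ (by exact_mod_cast hw'.ne')]

/-- Riesz--Thorin interpolation for finite bilinear forms. -/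
lemma bilin_interp {ι : Type*} (A : Finset ι) (K : ι → ι → ℂ) {q₀ q₁ q θ M₀ M₁ : ℝ}
    (hq₀ : 0 < q₀) (hq₁ : 0 < q₁) (hq : 0 < q) (hθ : θ ∈ Set.Icc (0 : ℝ) 1)
    (hM₀ : 0 ≤ M₀) (hM₁ : 0 ≤ M₁) (hθq : 1 / q = (1 - θ) / q₀ + θ / q₁)
    (h₀ : ∀ c c' : ι → ℂ, ‖∑ x ∈ A, ∑ y ∈ A, c' x * c y * K x y‖ ≤
      M₀ * (∑ x ∈ A, ‖c x‖ ^ q₀) ^ (1 / q₀) * (∑ x ∈ A, ‖c' x‖ ^ q₀) ^ (1 / q₀))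
    (h₁ : ∀ c c' : ι → ℂ, ‖∑ x ∈ A, ∑ y ∈ A, c' x * c y * K x y‖ ≤
      M₁ * (∑ x ∈ A, ‖c x‖ ^ q₁) ^ (1 / q₁) * (∑ x ∈ A, ‖c' x‖ ^ q₁) ^ (1 / q₁))
    (c c' : ι → ℂ) : ‖∑ x ∈ A, ∑ y ∈ A, c' x * c y * K x y‖ ≤
      M₀ ^ (1 - θ) * M₁ ^ θ * (∑ x ∈ A, ‖c x‖ ^ q) ^ (1 / q) *
        (∑ x ∈ A, ‖c' x‖ ^ q) ^ (1 / q) := by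
  set α := q / q₀ with hα
  set β := q / q₁ with hβ
  have hα0 : 0 < α := by positivity
  have hβ0 : 0 < β := by positivity
  have hconv : ∀ r : ℝ, 0 ≤ r → r ≤ 1 → 0 < α * (1 - r) + β * r := fun r h0 h1 => by
    rcases h0.eq_or_lt with rfl | h0
    · simpa
    · have := mul_nonneg hα0.le (sub_nonneg.2 h1)
      positivity
  have hone : α * (1 - θ) + β * θ = 1 := by
    rw [hα, hβ, div_mul_eq_mul_div, div_mul_eq_mul_div, mul_div_assoc, mul_div_assoc, ← mul_add,
      ← hθq, mul_one_div_cancel hq.ne']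
  set F : ℂ → ℂ := fun z => ∑ x ∈ A, ∑ y ∈ A,
    interpFamily α β (c' x) z * interpFamily α β (c y) z * K x y with hF
  have hFd : Differentiable ℂ F := by
    have := differentiable_interpFamily α β
    rw [hF]
    fun_prop
  have hFθ : F θ = ∑ x ∈ A, ∑ y ∈ A, c' x * c y * K x y := by
    simp only [hF, interpFamily_self _ hone]
  set N : (ι → ℂ) → ℝ := fun c => ∑ x ∈ A, ‖c x‖ ^ q with hN
  have hN0 : ∀ c, 0 ≤ N c := fun c => Finset.sum_nonneg fun x _ => by positivity
  have e₀ : ∀ (c : ι → ℂ) (z : ℂ), z.re = 0 →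
      ∑ x ∈ A, ‖interpFamily α β (c x) z‖ ^ q₀ = N c := fun c z hz =>
    Finset.sum_congr rfl fun x _ => by
      rw [norm_interpFamily _ _ (hconv _ hz.ge (by linarith)), hz, sub_zero, mul_one, mul_zero,
        add_zero, ← Real.rpow_mul (norm_nonneg _), hα, div_mul_cancel₀ _ hq₀.ne']
  have e₁ : ∀ (c : ι → ℂ) (z : ℂ), z.re = 1 →
      ∑ x ∈ A, ‖interpFamily α β (c x) z‖ ^ q₁ = N c := fun c z hz =>
    Finset.sum_congr rfl fun x _ => by
      rw [norm_interpFamily _ _ (hconv _ (by linarith) hz.le), hz, sub_self, mul_one, mul_zero,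
        zero_add, ← Real.rpow_mul (norm_nonneg _), hβ, div_mul_cancel₀ _ hq₁.ne']
  have key := Complex.HadamardThreeLines.norm_le_interp_of_mem_verticalClosedStrip₀₁' F
    (z := (θ : ℂ)) (a := M₀ * N c ^ (1 / q₀) * N c' ^ (1 / q₀))
    (b := M₁ * N c ^ (1 / q₁) * N c' ^ (1 / q₁)) (by
      simpa [Complex.HadamardThreeLines.verticalClosedStrip] using hθ) hFd.diffContOnCl ?_
    (fun z hz => ?_) (fun z hz => ?_)
  · rw [hFθ, Complex.ofReal_re] at key
    refine key.trans_eq ?_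
    have hp : ∀ c, (N c ^ (1 / q₀)) ^ (1 - θ) * (N c ^ (1 / q₁)) ^ θ = N c ^ (1 / q) := fun c => by
      rw [← Real.rpow_mul (hN0 c), ← Real.rpow_mul (hN0 c), ← Real.rpow_add_of_nonneg (hN0 c)
        (mul_nonneg (by positivity) (sub_nonneg.2 hθ.2)) (mul_nonneg (by positivity) hθ.1), hθq]
      ring_nf
    have h0 := hN0 c
    have h0' := hN0 c'
    rw [Real.mul_rpow (by positivity) (by positivity), Real.mul_rpow (by positivity) (by positivity),
      Real.mul_rpow (by positivity) (by positivity), Real.mul_rpow (by positivity) (by positivity),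
      ← hp c, ← hp c']
    ring
  · refine ⟨∑ x ∈ A, ∑ y ∈ A, (1 + ‖c' x‖) ^ (α + β) * (1 + ‖c y‖) ^ (α + β) * ‖K x y‖, ?_⟩
    rintro _ ⟨z, hz, rfl⟩
    simp only [Complex.HadamardThreeLines.verticalClosedStrip, Set.mem_preimage, Set.mem_Icc] at hz
    have hb : ∀ w, ‖interpFamily α β w z‖ ≤ (1 + ‖w‖) ^ (α + β) := fun w => by
      have h1 := hconv _ hz.1 hz.2
      rw [norm_interpFamily _ _ h1]
      refine (Real.rpow_le_rpow (norm_nonneg _) (by linarith [norm_nonneg w]) h1.le).trans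
        (Real.rpow_le_rpow_of_exponent_le (by linarith [norm_nonneg w]) ?_)
      nlinarith [hz.1, hz.2]
    refine norm_sum_le_of_le _ fun x _ => norm_sum_le_of_le _ fun y _ => ?_
    rw [norm_mul, norm_mul]
    gcongr <;> exact hb _
  · have := h₀ (fun y => interpFamily α β (c y) z) (fun y => interpFamily α β (c' y) z)
    rwa [e₀ _ _ hz, e₀ _ _ hz] at this
  · have := h₁ (fun y => interpFamily α β (c y) z) (fun y => interpFamily α β (c' y) z)
    rwa [e₁ _ _ hz, e₁ _ _ hz] at this

/-- `LpLE p f B` says that the `ℓ^p` norm of `f` is at most `B`. -/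
def LpLE {ι : Type*} (p : ℝ) (f : ι → ℂ) (B : ℝ) : Prop :=
  0 ≤ B ∧ ∀ A : Finset ι, ∑ x ∈ A, ‖f x‖ ^ p ≤ B ^ p

/-- The Hilbert space `ℓ²`. -/
abbrev L2 (ι : Type*) := lp (fun _ : ι => ℂ) 2

section LpLE

variable {ι : Type*} {p q : ℝ} {f g : ι → ℂ} {B B' : ℝ}

lemma eLpNorm_count_le_iff [Countable ι] [MeasurableSpace ι] [MeasurableSingletonClass ι]
    (hp : 0 < p) (hB : 0 ≤ B) :
    eLpNorm f (ENNReal.ofReal p) Measure.count ≤ ENNReal.ofReal B ↔ LpLE p f B := by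
  have hp' : ENNReal.ofReal p ≠ 0 := by simpa using hp
  rw [eLpNorm_eq_lintegral_rpow_enorm_toReal hp' ENNReal.ofReal_ne_top, lintegral_count,
    ENNReal.toReal_ofReal hp.le, one_div, ENNReal.rpow_inv_le_iff hp,
    ENNReal.ofReal_rpow_of_nonneg hB hp.le, ENNReal.tsum_eq_iSup_sum, iSup_le_iff, LpLE,
    and_iff_right hB]
  refine forall_congr' fun A => ?_
  rw [← ENNReal.ofReal_le_ofReal_iff (by positivity), ENNReal.ofReal_sum_of_nonneg fun x _ => by
    positivity]
  rw [← Finset.sum_congr rfl fun x _ => ?_]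
  rw [← ofReal_norm, ENNReal.ofReal_rpow_of_nonneg (norm_nonneg _) hp.le]

lemma LpLE.norm_le (hp : 0 < p) (h : LpLE p f B) (x : ι) : ‖f x‖ ≤ B := by
  have := h.2 {x}
  rw [Finset.sum_singleton] at this
  exact (Real.rpow_le_rpow_iff (norm_nonneg _) h.1 hp).1 this

lemma LpLE.mono (hp : 0 ≤ p) (h : LpLE p f B) (hB : B ≤ B') : LpLE p f B' :=
  ⟨h.1.trans hB, fun A => (h.2 A).trans (Real.rpow_le_rpow h.1 hB hp)⟩

lemma LpLE.of_norm_le (hp : 0 ≤ p) (h : LpLE p f B) (hg : ∀ x, ‖g x‖ ≤ ‖f x‖) : LpLE p g B :=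
  ⟨h.1, fun A => (Finset.sum_le_sum fun x _ => Real.rpow_le_rpow (norm_nonneg _) (hg x) hp).trans
    (h.2 A)⟩

lemma LpLE.exponent_mono (hp : 0 < p) (hpq : p ≤ q) (h : LpLE p f B) : LpLE q f B := by
  refine ⟨h.1, fun A => ?_⟩
  rcases h.1.eq_or_lt with rfl | hB
  · rw [Real.zero_rpow (hp.trans_le hpq).ne']
    refine (Finset.sum_eq_zero fun x _ => ?_).le
    rw [le_antisymm (h.norm_le hp x) (norm_nonneg _), Real.zero_rpow (hp.trans_le hpq).ne']
  · calc ∑ x ∈ A, ‖f x‖ ^ q ≤ ∑ x ∈ A, ‖f x‖ ^ p * B ^ (q - p) := by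
          refine Finset.sum_le_sum fun x _ => ?_
          rcases (norm_nonneg (f x)).eq_or_lt with h0 | h0
          · rw [← h0, Real.zero_rpow (hp.trans_le hpq).ne', Real.zero_rpow hp.ne', zero_mul]
          · calc ‖f x‖ ^ q = ‖f x‖ ^ p * ‖f x‖ ^ (q - p) := by
                  rw [← Real.rpow_add h0]; ring_nf
              _ ≤ _ := by
                gcongr
                exact h.norm_le hp x
      _ ≤ B ^ p * B ^ (q - p) := by
          rw [← Finset.sum_mul]
          gcongr
          exact h.2 A
      _ = B ^ q := by rw [← Real.rpow_add hB]; ring_nf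

lemma LpLE.dual (hpq : p.HolderConjugate q) (h : LpLE p f B) (A : Finset ι) (k : ι → ℂ) :
    ‖∑ x ∈ A, k x * f x‖ ≤ B * (∑ x ∈ A, ‖k x‖ ^ q) ^ (1 / q) := by
  have := Real.inner_le_Lp_mul_Lq A (fun x => ‖f x‖) (fun x => ‖k x‖) hpq
  simp only [abs_norm] at this
  calc ‖∑ x ∈ A, k x * f x‖ ≤ ∑ x ∈ A, ‖f x‖ * ‖k x‖ :=
        norm_sum_le_of_le _ fun x _ => by rw [norm_mul, mul_comm]
    _ ≤ _ := this
    _ ≤ _ := by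
        gcongr
        rw [one_div, Real.rpow_inv_le_iff_of_pos (Finset.sum_nonneg fun x _ => by positivity) h.1
          hpq.pos]
        exact h.2 A

lemma LpLE.of_dual (hpq : p.HolderConjugate q) (hB : 0 ≤ B)
    (h : ∀ (A : Finset ι) (k : ι → ℂ),
      ‖∑ x ∈ A, k x * f x‖ ≤ B * (∑ x ∈ A, ‖k x‖ ^ q) ^ (1 / q)) : LpLE p f B := by
  refine ⟨hB, fun A => ?_⟩
  set S := ∑ x ∈ A, ‖f x‖ ^ p with hS
  have hS0 : 0 ≤ S := Finset.sum_nonneg fun x _ => by positivity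
  rcases hS0.eq_or_lt with h0 | h0
  · rw [← h0]; exact Real.rpow_nonneg hB _
  have key := h A fun x => (starRingEnd ℂ) (f x) * ((‖f x‖ ^ (p - 2) : ℝ) : ℂ)
  have e1 : ∀ x, (starRingEnd ℂ) (f x) * ((‖f x‖ ^ (p - 2) : ℝ) : ℂ) * f x =
      ((‖f x‖ ^ p : ℝ) : ℂ) := fun x => by
    rcases eq_or_ne (f x) 0 with hx | hx
    · simp [hx, Real.zero_rpow hpq.pos.ne']
    · rw [mul_right_comm, mul_comm ((starRingEnd ℂ) (f x)), Complex.mul_conj, Complex.normSq_eq_norm_sq,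
        ← Complex.ofReal_mul, ← Real.rpow_natCast, ← Real.rpow_add (norm_pos_iff.2 hx)]
      congr 2
      push_cast
      ring
  have e2 : ∀ x, ‖(starRingEnd ℂ) (f x) * ((‖f x‖ ^ (p - 2) : ℝ) : ℂ)‖ ^ q = ‖f x‖ ^ p := fun x => by
    rcases eq_or_ne (f x) 0 with hx | hx
    · simp [hx, Real.zero_rpow hpq.pos.ne', Real.zero_rpow hpq.symm.pos.ne']
    · have hx' := norm_pos_iff.2 hx
      rw [norm_mul, RCLike.norm_conj, Complex.norm_real, Real.norm_of_nonneg (by positivity)]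
      nth_rewrite 1 [← Real.rpow_one ‖f x‖]
      rw [← Real.rpow_add hx', ← Real.rpow_mul hx'.le]
      congr 1
      have := hpq.sub_one_mul_conj
      linarith
  simp only [e1, e2] at key
  rw [← Complex.ofReal_sum, Complex.norm_real, Real.norm_of_nonneg hS0, ← hS] at key
  have h1 : S ^ (1 / p) ≤ B := by
    have hq1 : 1 / p = 1 - 1 / q := by
      have := hpq.inv_add_inv_eq_one
      rw [one_div, one_div]; linarith
    rw [hq1, Real.rpow_sub h0, Real.rpow_one, div_le_iff₀ (by positivity)]
    exact key
  rw [one_div, Real.rpow_inv_le_iff_of_pos hS0 hB hpq.pos] at h1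
  exact h1

lemma LpLE.add (hpq : p.HolderConjugate q) (hf : LpLE p f B) (hg : LpLE p g B') :
    LpLE p (f + g) (B + B') :=
  .of_dual hpq (add_nonneg hf.1 hg.1) fun A k => by
    simp only [Pi.add_apply, mul_add, Finset.sum_add_distrib, add_mul]
    exact norm_add_le_of_le (hf.dual hpq A k) (hg.dual hpq A k)

lemma LpLE.const_mul (hf : LpLE p f B) (c : ℂ) :
    LpLE p (fun x => c * f x) (‖c‖ * B) := by
  refine ⟨mul_nonneg (norm_nonneg _) hf.1, fun A => ?_⟩
  simp only [norm_mul, Real.mul_rpow (norm_nonneg _) (norm_nonneg _),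
    Real.mul_rpow (norm_nonneg _) hf.1, ← Finset.mul_sum]
  exact mul_le_mul_of_nonneg_left (hf.2 A) (by positivity)

lemma LpLE.of_tendsto {α : Type*} {l : Filter α} [l.NeBot] (hp : 0 < p) {b : α → ℝ}
    {F : α → ι → ℂ} (hb : Filter.Tendsto b l (nhds B))
    (hF : ∀ x, Filter.Tendsto (fun a => F a x) l (nhds (f x)))
    (h : ∀ a, LpLE p (F a) (b a)) : LpLE p f B := by
  refine ⟨ge_of_tendsto hb (.of_forall fun a => (h a).1), fun A => ?_⟩
  refine le_of_tendsto_of_tendsto (tendsto_finsetSum A fun x _ =>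
    ((hF x).norm.rpow_const (.inr hp.le))) (hb.rpow_const (.inr hp.le))
    (.of_forall fun a => (h a).2 A)

/-- Hölder's inequality with general exponents. -/
lemma LpLE.mul {r : ℝ} (hp : 0 < p) (hq : 0 < q) (hr : 0 < r) (hpqr : 1 / r = 1 / p + 1 / q)
    (hf : LpLE p f B) (hg : LpLE q g B') : LpLE r (fun x => f x * g x) (B * B') := by
  refine ⟨mul_nonneg hf.1 hg.1, fun A => ?_⟩
  have hc : (p / r).HolderConjugate (q / r) := by
    rw [Real.holderConjugate_iff]
    refine ⟨?_, ?_⟩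
    · rw [one_lt_div hr, ← one_div_lt_one_div hp hr, hpqr]
      linarith [one_div_pos.2 hq]
    · rw [inv_div, inv_div, div_eq_mul_one_div, div_eq_mul_one_div r q, ← mul_add, ← hpqr,
        mul_one_div_cancel hr.ne']
  have := Real.inner_le_Lp_mul_Lq A (fun x => ‖f x‖ ^ r) (fun x => ‖g x‖ ^ r) hc
  have e : ∀ (p : ℝ) (f : ι → ℂ) x, |‖f x‖ ^ r| ^ (p / r) = ‖f x‖ ^ p := fun p f x => by
    rw [abs_of_nonneg (by positivity), ← Real.rpow_mul (norm_nonneg _), mul_div_cancel₀ _ hr.ne']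
  simp only [e] at this
  have b : ∀ (p : ℝ) (f : ι → ℂ) (B : ℝ), 0 < p → LpLE p f B →
      (∑ x ∈ A, ‖f x‖ ^ p) ^ (1 / (p / r)) ≤ B ^ r := fun p f B hp hf => by
    calc (∑ x ∈ A, ‖f x‖ ^ p) ^ (1 / (p / r)) ≤ (B ^ p) ^ (1 / (p / r)) :=
          Real.rpow_le_rpow (Finset.sum_nonneg fun x _ => by positivity) (hf.2 A) (by positivity)
      _ = B ^ r := by
          rw [← Real.rpow_mul hf.1]
          congr 1
          field_simp
  simp only [norm_mul, Real.mul_rpow (norm_nonneg _) (norm_nonneg _), Real.mul_rpow hf.1 hg.1]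
  refine this.trans (mul_le_mul (b p f B hp hf) (b q g B' hq hg) ?_ (Real.rpow_nonneg hf.1 _))
  exact Real.rpow_nonneg (Finset.sum_nonneg fun x _ => by positivity) _

/-- Powers of an `ℓ^p` sequence. -/
lemma LpLE.rpow (hf : LpLE p f B) {a : ℝ} (ha : 0 < a)
    (hg : ∀ x, ‖g x‖ ≤ ‖f x‖ ^ a) (hp : 0 < p) : LpLE (p / a) g (B ^ a) := by
  refine ⟨Real.rpow_nonneg hf.1 _, fun A => ?_⟩
  rw [← Real.rpow_mul hf.1, mul_div_cancel₀ _ ha.ne']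
  refine (Finset.sum_le_sum fun x _ => ?_).trans (hf.2 A)
  calc ‖g x‖ ^ (p / a) ≤ (‖f x‖ ^ a) ^ (p / a) :=
        Real.rpow_le_rpow (norm_nonneg _) (hg x) (by positivity)
    _ = _ := by rw [← Real.rpow_mul (norm_nonneg _), mul_div_cancel₀ _ ha.ne']

lemma L2.lpLE (h : L2 ι) : LpLE 2 (h : ι → ℂ) ‖h‖ :=
  ⟨norm_nonneg _, fun A => by
    simpa using lp.sum_rpow_le_norm_rpow (p := 2) (by norm_num) h A⟩

lemma LpLE.norm_L2_le {h : L2 ι} (hB : LpLE 2 (h : ι → ℂ) B) : ‖h‖ ≤ B :=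
  lp.norm_le_of_forall_sum_le (by norm_num) hB.1 fun A => by simpa using hB.2 A

lemma LpLE.memℓp (h : LpLE 2 f B) : Memℓp f 2 :=
  memℓp_gen' (C := B ^ (2 : ℝ)) fun A => by simpa using h.2 A

lemma lp_evalCLM_apply (x : ι) (h : L2 ι) :
    lp.evalCLM ℂ (fun _ : ι => ℂ) 2 x h = h x := rfl

lemma lpLE_integral {h : ℝ → L2 ι} (hpq : p.HolderConjugate q) {b : ℝ → ℝ}
    (hb : Continuous b) (hh : Continuous h) (t : ℝ) (hB : ∀ τ ∈ Set.uIoc 0 t, LpLE p (h τ) (b τ)) :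
    LpLE p (∫ τ in (0 : ℝ)..t, h τ : L2 ι) |∫ τ in (0 : ℝ)..t, b τ| := by
  refine .of_dual hpq (abs_nonneg _) fun A k => ?_
  have e : ∑ x ∈ A, k x * (∫ τ in (0 : ℝ)..t, h τ : L2 ι) x =
      ∫ τ in (0 : ℝ)..t, ∑ x ∈ A, k x * h τ x := by
    have := (∑ x ∈ A, k x • lp.evalCLM ℂ (fun _ : ι => ℂ) 2 x).intervalIntegral_comp_comm
      (hh.intervalIntegrable (μ := volume) 0 t)
    simpa [lp_evalCLM_apply] using this.symm
  rw [e]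
  set N := (∑ x ∈ A, ‖k x‖ ^ q) ^ (1 / q) with hN
  have hN0 : 0 ≤ N := Real.rpow_nonneg (Finset.sum_nonneg fun x _ => by positivity) _
  have := intervalIntegral.norm_integral_le_abs_of_norm_le (μ := volume) (a := 0) (b := t)
    (f := fun τ => ∑ x ∈ A, k x * h τ x) (g := fun τ => b τ * N)
    ((ae_restrict_iff' measurableSet_uIoc).2 (.of_forall fun τ hτ => (hB τ hτ).dual hpq A k))
    ((hb.mul continuous_const).intervalIntegrable _ _)
  rwa [intervalIntegral.integral_mul_const, abs_mul, abs_of_nonneg hN0] at this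

end LpLE

section FormBound

variable {ι : Type*} [DecidableEq ι]

/-- `T` is bounded from `ℓ^q` to the dual of `ℓ^q` with constant `M`, tested on finite sums. -/
def FormBound (q M : ℝ) (T : L2 ι →L[ℂ] L2 ι) : Prop :=
  ∀ (A : Finset ι) (c c' : ι → ℂ),
    ‖∑ x ∈ A, ∑ y ∈ A, c' x * c y * (T (lp.single 2 y 1)) x‖ ≤
      M * (∑ x ∈ A, ‖c x‖ ^ q) ^ (1 / q) * (∑ x ∈ A, ‖c' x‖ ^ q) ^ (1 / q)

lemma map_sum_single (T : L2 ι →L[ℂ] L2 ι) (A : Finset ι) (c : ι → ℂ) (x : ι) :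
    (T (∑ y ∈ A, lp.single 2 y (c y))) x = ∑ y ∈ A, c y * (T (lp.single 2 y 1)) x := by
  have e : ∀ y, (lp.single 2 y (c y) : L2 ι) = c y • lp.single 2 y 1 := fun y => by
    rw [← lp.single_smul, smul_eq_mul, mul_one]
  simp only [e, map_sum, map_smul, lp.coeFn_sum, Finset.sum_apply, lp.coeFn_smul, Pi.smul_apply,
    smul_eq_mul]

lemma lpLE_sum_single {p : ℝ} (hp : 0 < p) (A : Finset ι) (c : ι → ℂ) :
    LpLE p (∑ y ∈ A, lp.single 2 y (c y) : L2 ι) ((∑ x ∈ A, ‖c x‖ ^ p) ^ (1 / p)) := by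
  have h0 : 0 ≤ ∑ x ∈ A, ‖c x‖ ^ p := Finset.sum_nonneg fun x _ => by positivity
  refine ⟨Real.rpow_nonneg h0 _, fun A' => ?_⟩
  rw [← Real.rpow_mul h0, one_div, inv_mul_cancel₀ hp.ne', Real.rpow_one]
  have e : ∀ x, ((∑ y ∈ A, lp.single 2 y (c y) : L2 ι) : ι → ℂ) x = if x ∈ A then c x else 0 :=
    fun x => by
      rw [lp.coeFn_sum, Finset.sum_apply]
      simp [Pi.single_apply]
  calc ∑ x ∈ A', ‖((∑ y ∈ A, lp.single 2 y (c y) : L2 ι) : ι → ℂ) x‖ ^ p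
      = ∑ x ∈ A', if x ∈ A then ‖c x‖ ^ p else 0 := by
        refine Finset.sum_congr rfl fun x _ => ?_
        rw [e]
        split_ifs <;> simp [Real.zero_rpow hp.ne']
    _ = ∑ x ∈ A' ∩ A, ‖c x‖ ^ p := by rw [Finset.sum_ite_mem]
    _ ≤ _ := Finset.sum_le_sum_of_subset_of_nonneg Finset.inter_subset_right
        fun x _ _ => by positivity

lemma FormBound.of_lpLE {p q M : ℝ} (hpq : p.HolderConjugate q) {T : L2 ι →L[ℂ] L2 ι}
    (h : ∀ (f : L2 ι) (B : ℝ), LpLE q f B → LpLE p (T f) (M * B)) : FormBound q M T := by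
  intro A c c'
  have := (h _ _ (lpLE_sum_single hpq.symm.pos A c)).dual hpq A c'
  simpa only [map_sum_single, Finset.mul_sum, mul_assoc] using this

lemma formBound_two {M : ℝ} {T : L2 ι →L[ℂ] L2 ι} (hT : ‖T‖ ≤ M) : FormBound 2 M T :=
  .of_lpLE Real.HolderConjugate.two_two fun f B hf =>
    (L2.lpLE (T f)).mono (by norm_num) ((T.le_opNorm f).trans
      (mul_le_mul hT hf.norm_L2_le (norm_nonneg _) ((norm_nonneg _).trans hT)))

lemma formBound_one {M : ℝ} {T : L2 ι →L[ℂ] L2 ι}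
    (hT : ∀ x y, ‖(T (lp.single 2 y 1)) x‖ ≤ M) : FormBound 1 M T := by
  intro A c c'
  simp only [Real.rpow_one, div_one]
  calc _ ≤ ∑ x ∈ A, ∑ y ∈ A, ‖c' x‖ * ‖c y‖ * M :=
        norm_sum_le_of_le _ fun x _ => norm_sum_le_of_le _ fun y _ => by
          rw [norm_mul, norm_mul]
          exact mul_le_mul_of_nonneg_left (hT x y) (by positivity)
    _ = _ := by
      simp only [← Finset.sum_mul, ← Finset.mul_sum]
      ring

lemma FormBound.interp {q₀ q θ M₀ M₁ : ℝ} {T : L2 ι →L[ℂ] L2 ι} (hq₀ : 0 < q₀) (hq : 0 < q)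
    (hθ : θ ∈ Set.Icc (0 : ℝ) 1) (hM₀ : 0 ≤ M₀) (hM₁ : 0 ≤ M₁)
    (hθq : 1 / q = (1 - θ) / q₀ + θ / 2) (h₀ : FormBound q₀ M₀ T) (h₁ : FormBound 2 M₁ T) :
    FormBound q (M₀ ^ (1 - θ) * M₁ ^ θ) T := fun A =>
  bilin_interp A (fun x y => (T (lp.single 2 y 1)) x) hq₀ two_pos hq hθ hM₀ hM₁ hθq (h₀ A) (h₁ A)

lemma FormBound.lpLE {p q M B : ℝ} (hpq : p.HolderConjugate q) (hM : 0 ≤ M) {T : L2 ι →L[ℂ] L2 ι}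
    (h : FormBound q M T) {f : L2 ι} (hf : LpLE q f B) : LpLE p (T f) (M * B) := by
  have fin : ∀ A : Finset ι, LpLE p (T (∑ y ∈ A, lp.single 2 y (f y))) (M * B) := fun A' => by
    refine .of_dual hpq (mul_nonneg hM hf.1) fun A k => ?_
    have := h (A ∪ A') (fun y => if y ∈ A' then f y else 0) (fun x => if x ∈ A then k x else 0)
    have e : ∀ (A A'' : Finset ι) (f : ι → ℂ), A ⊆ A'' →
        ∑ x ∈ A'', ‖(if x ∈ A then f x else 0)‖ ^ q = ∑ x ∈ A, ‖f x‖ ^ q := fun A A'' f hA => by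
      rw [← Finset.inter_eq_right.2 hA, ← Finset.sum_ite_mem, Finset.inter_eq_right.2 hA]
      refine Finset.sum_congr rfl fun x _ => ?_
      split_ifs <;> simp [Real.zero_rpow hpq.symm.pos.ne']
    rw [e _ _ _ Finset.subset_union_left, e _ _ _ Finset.subset_union_right] at this
    have e2 : ∑ x ∈ A ∪ A', ∑ y ∈ A ∪ A', (if x ∈ A then k x else 0) *
        (if y ∈ A' then f y else 0) * (T (lp.single 2 y 1)) x =
        ∑ x ∈ A, k x * (T (∑ y ∈ A', lp.single 2 y (f y))) x := by
      simp only [map_sum_single, ite_mul, zero_mul, mul_ite, mul_zero, Finset.mul_sum]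
      simp only [Finset.sum_ite_irrel, Finset.sum_const_zero, Finset.sum_ite_mem]
      rw [Finset.inter_eq_right.2 Finset.subset_union_left,
        Finset.inter_eq_right.2 Finset.subset_union_right]
      simp only [mul_assoc]
    rw [e2] at this
    refine this.trans ?_
    gcongr
    rw [one_div, Real.rpow_inv_le_iff_of_pos (Finset.sum_nonneg fun x _ => by positivity) hf.1
      hpq.symm.pos]
    exact hf.2 A'
  refine .of_tendsto (l := Filter.atTop) hpq.pos tendsto_const_nhds (fun x => ?_) fin
  have h1 : HasSum (fun y => lp.single 2 y (f y)) f := lp.hasSum_single (by norm_num) f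
  exact ((lp.evalCLM ℂ (fun _ : ι => ℂ) 2 x).continuous.comp
    T.continuous).continuousAt.tendsto.comp h1

end FormBound

section Fourier

open scoped BoundedContinuousFunction

/-- Normalized Lebesgue measure on the cube. -/
def cubeMeasure (d : ℕ) : Measure (Fin d → ℝ) :=
  ENNReal.ofReal ((2 * π) ^ d)⁻¹ • volume.restrict (cube d)

/-- The space of square integrable functions on the cube. -/
abbrev L2C (d : ℕ) := Lp ℂ 2 (cubeMeasure d)

/-- The lattice space `ℓ²(ℤ^d)`. -/
abbrev L2Z (d : ℕ) := L2 (Fin d → ℤ)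

/-- Bounded continuous symbols. -/
abbrev Symb (d : ℕ) := (Fin d → ℝ) →ᵇ ℂ

lemma integral_cubeMeasure {d : ℕ} (f : (Fin d → ℝ) → ℂ) :
    ∫ ξ, f ξ ∂(cubeMeasure d) = ((((2 * π) ^ d)⁻¹ : ℝ) : ℂ) * ∫ ξ in cube d, f ξ := by
  rw [cubeMeasure, integral_smul_measure, ENNReal.toReal_ofReal (by positivity), Complex.real_smul]

instance isFiniteMeasure_cubeMeasure (d : ℕ) : IsFiniteMeasure (cubeMeasure d) := by
  have : IsFiniteMeasure (volume.restrict (cube d)) :=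
    ⟨by simpa using (isCompact_cube d).measure_lt_top⟩
  exact Measure.smul_finite _ ENNReal.ofReal_ne_top

lemma integral_charZ_one {d : ℕ} (x : Fin d → ℤ) :
    ∫ ξ, charZ x ξ ∂(cubeMeasure d) = if x = 0 then 1 else 0 := by
  have : (volume : Measure (Fin d → ℝ)).restrict (cube d) =
      Measure.pi fun _ => (volume : Measure ℝ).restrict (Set.Icc 0 (2 * π)) := by
    rw [cube, ← Set.pi_univ_Icc, volume_pi, Measure.restrict_pi_pi]
    rfl
  have h1 : ∀ n : ℤ, ∫ r in Set.Icc 0 (2 * π), Complex.exp (Complex.I * ((n * r : ℝ) : ℂ)) =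
      if n = 0 then (2 * π : ℂ) else 0 := fun n => by
    rw [integral_Icc_eq_integral_Ioc, ← intervalIntegral.integral_of_le (by positivity)]
    split_ifs with hn
    · simp [hn]
    · have hc : Complex.I * n ≠ 0 := mul_ne_zero Complex.I_ne_zero (by exact_mod_cast hn)
      have e : ∀ r : ℝ, Complex.exp (Complex.I * ((n * r : ℝ) : ℂ)) =
          Complex.exp (Complex.I * n * r) := fun r => by push_cast; ring_nf
      simp only [e]
      rw [integral_exp_mul_complex hc]
      have : Complex.exp (Complex.I * n * ((2 * π : ℝ) : ℂ)) = 1 := by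
        rw [Complex.exp_eq_one_iff]
        exact ⟨n, by push_cast; ring⟩
      rw [this]
      simp
  have h2 : ∀ ξ : Fin d → ℝ, charZ x ξ =
      ∏ j, Complex.exp (Complex.I * ((x j * ξ j : ℝ) : ℂ)) := fun ξ => by
    rw [charZ, ← Complex.exp_sum, ← Finset.mul_sum, ← Complex.ofReal_sum]
  rw [integral_cubeMeasure, this]
  simp_rw [h2]
  rw [integral_fintype_prod_eq_prod (f := fun (j : Fin d) (r : ℝ) =>
    Complex.exp (Complex.I * ((x j * r : ℝ) : ℂ)))]
  simp_rw [h1]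
  split_ifs with hx
  · simp [hx]
  · obtain ⟨j, hj⟩ := Function.ne_iff.1 hx
    rw [Finset.prod_eq_zero (Finset.mem_univ j) (if_neg (by simpa using hj)), mul_zero]

/-- Multiplication operators on the cube. -/
def mulE (d : ℕ) : Symb d →L[ℂ] (L2C d →L[ℂ] L2C d) :=
  ((ContinuousLinearMap.mul ℂ ℂ).holderL (cubeMeasure d) ∞ 2 2).comp
    (BoundedContinuousFunction.toLp ∞ (cubeMeasure d) ℂ)

lemma coeFn_mulE {d : ℕ} (m : Symb d) (f : L2C d) :
    mulE d m f =ᵐ[cubeMeasure d] fun ξ => m ξ * f ξ := by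
  have h1 := (ContinuousLinearMap.mul ℂ ℂ).coeFn_holder (r := 2)
    (BoundedContinuousFunction.toLp ∞ (cubeMeasure d) ℂ m) f
  filter_upwards [h1, BoundedContinuousFunction.coeFn_toLp ∞ (cubeMeasure d) ℂ m] with ξ h1 h2
  rw [← h2]
  exact h1

lemma norm_mulE_apply_le {d : ℕ} (m : Symb d) (f : L2C d) : ‖mulE d m f‖ ≤ ‖m‖ * ‖f‖ := by
  refine Lp.norm_le_mul_norm_of_ae_le_mul ?_
  filter_upwards [coeFn_mulE m f] with ξ h
  rw [h, norm_mul]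
  exact mul_le_mul_of_nonneg_right (m.norm_coe_le_norm ξ) (norm_nonneg _)

lemma mulE_mul {d : ℕ} (m n : Symb d) (f : L2C d) : mulE d (m * n) f = mulE d m (mulE d n f) := by
  refine Lp.ext ?_
  filter_upwards [coeFn_mulE (m * n) f, coeFn_mulE m (mulE d n f), coeFn_mulE n f] with ξ h1 h2 h3
  rw [h1, h2, h3, BoundedContinuousFunction.mul_apply, mul_assoc]

lemma inner_mulE {d : ℕ} (m : Symb d) (f g : L2C d) :
    inner ℂ (mulE d m f) g = inner ℂ f (mulE d (star m) g) := by
  rw [L2.inner_def, L2.inner_def]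
  refine integral_congr_ae ?_
  filter_upwards [coeFn_mulE m f, coeFn_mulE (star m) g] with ξ h1 h2
  rw [h1, h2]
  simp [RCLike.inner_apply]
  ring

/-- The character `e^{-i x·ξ}` in `L²` of the cube. -/
def charE {d : ℕ} (x : Fin d → ℤ) : L2C d :=
  BoundedContinuousFunction.toLp 2 (cubeMeasure d) ℂ
    (.ofNormedAddCommGroup (charZ (-x)) (continuous_charZ _) 1 fun ξ => (norm_charZ _ ξ).le)

lemma coeFn_charE {d : ℕ} (x : Fin d → ℤ) : charE x =ᵐ[cubeMeasure d] charZ (-x) :=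
  BoundedContinuousFunction.coeFn_toLp _ _ _ _

lemma conj_charZ_neg_mul {d : ℕ} (x y : Fin d → ℤ) (ξ : Fin d → ℝ) :
    charZ (-y) ξ * (starRingEnd ℂ) (charZ (-x) ξ) = charZ (x - y) ξ := by
  rw [charZ, charZ, charZ, ← Complex.exp_conj, ← Complex.exp_add, map_mul, Complex.conj_I,
    Complex.conj_ofReal]
  congr 1
  simp only [Pi.sub_apply, Pi.neg_apply, Int.cast_sub, Int.cast_neg, sub_mul, neg_mul,
    Finset.sum_sub_distrib, Finset.sum_neg_distrib]
  push_cast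
  ring

lemma inner_charE_mulE {d : ℕ} (m : Symb d) (x y : Fin d → ℤ) :
    inner ℂ (charE x) (mulE d m (charE y)) = ∫ ξ, charZ (x - y) ξ * m ξ ∂(cubeMeasure d) := by
  rw [L2.inner_def]
  refine integral_congr_ae ?_
  filter_upwards [coeFn_charE x, coeFn_charE y, coeFn_mulE m (charE y)] with ξ h1 h2 h3
  rw [h3, h1, h2, RCLike.inner_apply, ← conj_charZ_neg_mul]
  ring

lemma orthonormal_charE (d : ℕ) : Orthonormal ℂ (charE (d := d)) := by
  rw [orthonormal_iff_ite]
  intro x y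
  have h1 : mulE d 1 (charE y) = charE y := by
    refine Lp.ext ?_
    filter_upwards [coeFn_mulE 1 (charE y)] with ξ h
    simp [h]
  rw [← h1, inner_charE_mulE]
  simp [integral_charZ_one, sub_eq_zero]

/-- The Fourier series as an isometry. -/
def fourierJ (d : ℕ) : L2Z d →ₗᵢ[ℂ] L2C d := (orthonormal_charE d).orthogonalFamily.linearIsometry

lemma fourierJ_single {d : ℕ} (x : Fin d → ℤ) (a : ℂ) :
    fourierJ d (lp.single 2 x a) = a • charE x := by
  rw [fourierJ, OrthogonalFamily.linearIsometry_apply_single, LinearIsometry.toSpanSingleton_apply]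

/-- The Fourier multiplier with symbol `m`. -/
def opK (d : ℕ) (m : Symb d) : L2Z d →L[ℂ] L2Z d :=
  (ContinuousLinearMap.adjoint (fourierJ d).toContinuousLinearMap).comp
    ((mulE d m).comp (fourierJ d).toContinuousLinearMap)

lemma inner_opK {d : ℕ} (m : Symb d) (f g : L2Z d) :
    inner ℂ f (opK d m g) = inner ℂ (fourierJ d f) (mulE d m (fourierJ d g)) := by
  rw [opK, ContinuousLinearMap.comp_apply, ContinuousLinearMap.adjoint_inner_right]
  rfl

lemma norm_adjoint_fourierJ_le {d : ℕ} (f : L2C d) :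
    ‖ContinuousLinearMap.adjoint (fourierJ d).toContinuousLinearMap f‖ ≤ ‖f‖ := by
  refine (ContinuousLinearMap.le_opNorm _ _).trans (mul_le_of_le_one_left (norm_nonneg _) ?_)
  rw [LinearIsometryEquiv.norm_map]
  exact (fourierJ d).norm_toContinuousLinearMap_le

lemma norm_opK_le {d : ℕ} (m : Symb d) : ‖opK d m‖ ≤ ‖m‖ :=
  ContinuousLinearMap.opNorm_le_bound _ (norm_nonneg _) fun f =>
    (norm_adjoint_fourierJ_le _).trans
      ((norm_mulE_apply_le m _).trans_eq (congrArg (‖m‖ * ·) ((fourierJ d).norm_map f)))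

lemma opK_sub {d : ℕ} (m n : Symb d) : opK d (m - n) = opK d m - opK d n := by
  simp only [opK, map_sub, ContinuousLinearMap.sub_comp, ContinuousLinearMap.comp_sub]

lemma continuous_opK (d : ℕ) : Continuous (opK d) := by
  refine LipschitzWith.continuous (K := 1) (LipschitzWith.of_dist_le_mul fun m n => ?_)
  rw [dist_eq_norm, dist_eq_norm, ← opK_sub, NNReal.coe_one, one_mul]
  exact norm_opK_le _

lemma opK_single_apply {d : ℕ} (m : Symb d) (x y : Fin d → ℤ) :
    (opK d m (lp.single 2 y 1)) x = ∫ ξ, charZ (x - y) ξ * m ξ ∂(cubeMeasure d) := by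
  have : (opK d m (lp.single 2 y 1)) x =
      inner ℂ (lp.single 2 x (1 : ℂ)) (opK d m (lp.single 2 y 1)) := by
    rw [lp.inner_single_left]
    simp
  rw [this, inner_opK, fourierJ_single, fourierJ_single, one_smul, one_smul, inner_charE_mulE]

lemma opK_apply {d : ℕ} (m : Symb d) (f : L2Z d) (x : Fin d → ℤ) :
    (opK d m f) x = ∑' y, (∫ ξ, charZ (x - y) ξ * m ξ ∂(cubeMeasure d)) * f y := by
  have h1 : HasSum (fun y => lp.single 2 y (f y)) f := lp.hasSum_single (by norm_num) f
  have h2 := (((lp.evalCLM ℂ (fun _ : Fin d → ℤ => ℂ) 2 x).comp (opK d m)).hasSum h1).tsum_eq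
  rw [ContinuousLinearMap.comp_apply, lp_evalCLM_apply] at h2
  rw [← h2]
  refine tsum_congr fun y => ?_
  have := map_sum_single (opK d m) {y} f x
  rw [Finset.sum_singleton, Finset.sum_singleton, opK_single_apply] at this
  exact this.trans (mul_comm _ _)

lemma FormBound.mono {ι : Type*} [DecidableEq ι] {q M M' : ℝ} {T : L2 ι →L[ℂ] L2 ι} (h : FormBound q M T)
    (hM : M ≤ M') : FormBound q M' T := fun A c c' => by
  refine (h A c c').trans ?_
  gcongr

lemma LpLE.norm_inner_le {ι : Type*} {p q B B' : ℝ} (hpq : p.HolderConjugate q) {f g : L2 ι}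
    (hf : LpLE p f B) (hg : LpLE q g B') : ‖inner ℂ g f‖ ≤ B * B' := by
  refine le_of_tendsto ((lp.hasSum_inner (𝕜 := ℂ) g f : Filter.Tendsto _ _ _).norm) (.of_forall fun A => ?_)
  have := hf.dual hpq A fun x => (starRingEnd ℂ) (g x)
  simp only [RCLike.norm_conj] at this
  simp only [RCLike.inner_apply]
  simp only [mul_comm (f _)]
  refine this.trans (mul_le_mul_of_nonneg_left ?_ hf.1)
  rw [one_div, Real.rpow_inv_le_iff_of_pos (Finset.sum_nonneg fun x _ => by positivity) hg.1
    hpq.symm.pos]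
  exact hg.2 A

/-- A real symbol bounded by one. -/
def realSymb {d : ℕ} (m : (Fin d → ℝ) → ℝ) (hm : Continuous m) (h : ∀ ξ, |m ξ| ≤ 1) : Symb d :=
  .ofNormedAddCommGroup (fun ξ => (m ξ : ℂ)) (Complex.continuous_ofReal.comp hm) 1 fun ξ => by
    rw [Complex.norm_real]
    exact h ξ

lemma norm_realSymb_le {d : ℕ} {m : (Fin d → ℝ) → ℝ} (hm : Continuous m) (h : ∀ ξ, |m ξ| ≤ 1) :
    ‖realSymb m hm h‖ ≤ 1 :=
  BoundedContinuousFunction.norm_ofNormedAddCommGroup_le _ zero_le_one _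

/-- The symbol `cos(tω)`. -/
def cosB (d : ℕ) (t : ℝ) : Symb d :=
  realSymb (fun ξ => cos (t * omegaKG d ξ))
    (continuous_cos.comp (continuous_const.mul (continuous_omegaKG d))) fun _ => abs_cos_le_one _

/-- The symbol `sin(tω)`. -/
def sinB (d : ℕ) (t : ℝ) : Symb d :=
  realSymb (fun ξ => sin (t * omegaKG d ξ))
    (continuous_sin.comp (continuous_const.mul (continuous_omegaKG d))) fun _ => abs_sin_le_one _

/-- The symbol `1/ω`. -/
def invB (d : ℕ) : Symb d :=
  realSymb (fun ξ => (omegaKG d ξ)⁻¹)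
    ((continuous_omegaKG d).inv₀ fun ξ => (zero_lt_one.trans_le (one_le_omegaKG d ξ)).ne') fun ξ => by
      rw [abs_inv, abs_of_pos (zero_lt_one.trans_le (one_le_omegaKG d ξ))]
      exact inv_le_one_of_one_le₀ (one_le_omegaKG d ξ)

variable {d : ℕ}

@[simp] lemma cosB_apply (t : ℝ) (ξ : Fin d → ℝ) :
    cosB d t ξ = ((cos (t * omegaKG d ξ) : ℝ) : ℂ) := rfl

@[simp] lemma sinB_apply (t : ℝ) (ξ : Fin d → ℝ) :
    sinB d t ξ = ((sin (t * omegaKG d ξ) : ℝ) : ℂ) := rfl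

@[simp] lemma invB_apply (ξ : Fin d → ℝ) : invB d ξ = (((omegaKG d ξ)⁻¹ : ℝ) : ℂ) := rfl

lemma star_cosB (t : ℝ) : star (cosB d t) = cosB d t := by
  ext ξ
  exact Complex.conj_ofReal _

lemma star_sinB (t : ℝ) : star (sinB d t) = sinB d t := by
  ext ξ
  exact Complex.conj_ofReal _

lemma norm_cosB_le (t : ℝ) : ‖cosB d t‖ ≤ 1 := norm_realSymb_le _ _

lemma norm_sinB_le (t : ℝ) : ‖sinB d t‖ ≤ 1 := norm_realSymb_le _ _

lemma norm_invB_le : ‖invB d‖ ≤ 1 := norm_realSymb_le _ _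

lemma omegaKG_le_one_add (ξ : Fin d → ℝ) : omegaKG d ξ ≤ 1 + d * 4 := by
  have h : ∑ _j : Fin d, (-1 : ℝ) ≤ ∑ j, cos (ξ j) :=
    Finset.sum_le_sum fun j _ => neg_one_le_cos (ξ j)
  rw [Finset.sum_const, Finset.card_univ, Fintype.card_fin, nsmul_eq_mul] at h
  have h2 : omegaKG d ξ ≤ omegaKG d ξ ^ 2 := by nlinarith [one_le_omegaKG d ξ]
  rw [omegaKG_sq] at h2
  linarith

lemma continuous_symb_of_comp {F : ℝ → Symb d} {φ : ℝ → ℝ} (hφ : ∀ x y, |φ x - φ y| ≤ |x - y|)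
    (hF : ∀ t ξ, F t ξ = ((φ (t * omegaKG d ξ) : ℝ) : ℂ)) : Continuous F := by
  refine LipschitzWith.continuous (K := 1 + d * 4)
    (LipschitzWith.of_dist_le_mul fun t t' => ?_)
  refine (BoundedContinuousFunction.dist_le (by positivity)).2 fun ξ => ?_
  push_cast
  rw [hF, hF, dist_eq_norm, ← Complex.ofReal_sub, Complex.norm_real, Real.dist_eq]
  refine (hφ _ _).trans ?_
  rw [← sub_mul, abs_mul, mul_comm, abs_of_pos (zero_lt_one.trans_le (one_le_omegaKG d ξ))]
  exact mul_le_mul_of_nonneg_right (omegaKG_le_one_add ξ) (abs_nonneg _)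

lemma continuous_cosB : Continuous (cosB d) :=
  continuous_symb_of_comp abs_cos_sub_cos_le fun _ _ => rfl

lemma continuous_sinB : Continuous (sinB d) :=
  continuous_symb_of_comp abs_sin_sub_sin_le fun _ _ => rfl

lemma cosB_mul_cosB (t t' : ℝ) :
    cosB d t * cosB d t' = (1 / 2 : ℂ) • (cosB d (t - t') + cosB d (t + t')) := by
  ext ξ
  simp only [BoundedContinuousFunction.mul_apply, BoundedContinuousFunction.smul_apply,
    BoundedContinuousFunction.add_apply, cosB_apply, smul_eq_mul, sub_mul, add_mul, cos_sub, cos_add]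
  push_cast
  ring

lemma sinB_mul_sinB (t t' : ℝ) :
    sinB d t * sinB d t' = (1 / 2 : ℂ) • (cosB d (t - t') - cosB d (t + t')) := by
  ext ξ
  simp only [BoundedContinuousFunction.mul_apply, BoundedContinuousFunction.smul_apply,
    BoundedContinuousFunction.sub_apply, cosB_apply, sinB_apply, smul_eq_mul, sub_mul, add_mul,
    cos_sub, cos_add]
  push_cast
  ring

lemma invB_mul_sinB_sub (t t' : ℝ) :
    invB d * sinB d (t - t') = invB d * sinB d t * cosB d t' - invB d * cosB d t * sinB d t' := by
  ext ξ
  simp only [BoundedContinuousFunction.mul_apply, BoundedContinuousFunction.sub_apply, cosB_apply,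
    sinB_apply, invB_apply, sub_mul, sin_sub]
  push_cast
  ring

/-- The operator `cos(t√(1-Δ))` on `ℓ²`. -/
def opC (d : ℕ) (t : ℝ) : L2Z d →L[ℂ] L2Z d := opK d (cosB d t)

/-- The operator `sin(t√(1-Δ))/√(1-Δ)` on `ℓ²`. -/
def opS (d : ℕ) (t : ℝ) : L2Z d →L[ℂ] L2Z d := opK d (invB d * sinB d t)

lemma continuous_opC : Continuous (opC d) := (continuous_opK d).comp continuous_cosB

lemma continuous_opS : Continuous (opS d) :=
  (continuous_opK d).comp (continuous_const.mul continuous_sinB)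

lemma norm_opC_le (t : ℝ) : ‖opC d t‖ ≤ 1 := (norm_opK_le _).trans (norm_cosB_le t)

lemma norm_opS_le (t : ℝ) : ‖opS d t‖ ≤ 1 :=
  (norm_opK_le _).trans ((norm_mul_le _ _).trans
    (mul_le_one₀ norm_invB_le (norm_nonneg _) (norm_sinB_le t)))

lemma opC_neg (t : ℝ) : opC d (-t) = opC d t := by
  rw [opC, opC]
  congr 1
  ext ξ
  simp

lemma opS_neg (t : ℝ) : opS d (-t) = -opS d t := by
  have : invB d * sinB d (-t) = (0 : Symb d) - invB d * sinB d t := by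
    ext ξ
    simp
  rw [opS, this, opK_sub, opS]
  simp [opK]

lemma multKernel_eq_integral (m : (Fin d → ℝ) → ℝ) (x : Fin d → ℤ) :
    multKernel d m x = ∫ ξ, charZ x ξ * (m ξ : ℂ) ∂(cubeMeasure d) := by
  rw [multKernel_eq, integral_cubeMeasure]

lemma opC_single_apply (t : ℝ) (x y : Fin d → ℤ) : (opC d t (lp.single 2 y 1)) x =
    multKernel d (fun ξ => cos (t * omegaKG d ξ)) (x - y) := by
  rw [opC, opK_single_apply, multKernel_eq_integral]
  rfl

lemma invB_mul_sinB_apply (t : ℝ) (ξ : Fin d → ℝ) : (invB d * sinB d t) ξ =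
    ((sin (t * omegaKG d ξ) / omegaKG d ξ : ℝ) : ℂ) := by
  rw [BoundedContinuousFunction.mul_apply, invB_apply, sinB_apply, ← Complex.ofReal_mul,
    mul_comm, div_eq_mul_inv]

lemma opS_single_apply (t : ℝ) (x y : Fin d → ℤ) : (opS d t (lp.single 2 y 1)) x =
    multKernel d (fun ξ => sin (t * omegaKG d ξ) / omegaKG d ξ) (x - y) := by
  rw [opS, opK_single_apply, multKernel_eq_integral]
  simp only [invB_mul_sinB_apply]

lemma opC_apply (t : ℝ) (f : L2Z d) (x : Fin d → ℤ) : (opC d t f) x = cosProp d t f x := by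
  rw [opC, opK_apply, cosProp]
  simp only [multKernel_eq_integral]
  rfl

lemma opS_apply (t : ℝ) (f : L2Z d) (x : Fin d → ℤ) : (opS d t f) x = sinProp d t f x := by
  rw [opS, opK_apply, sinProp]
  simp only [multKernel_eq_integral, invB_mul_sinB_apply]

/-- Dispersive decay of the propagators between dual Lebesgue exponents. -/
lemma exists_formBound_opC_opS (hd : d = 2 ∨ d = 3 ∨ d = 4) {δ : ℝ} (hδ : 0 < δ)
    (hδ' : δ ≤ 1 / 2) : ∃ C ≥ 1, ∀ (t p q : ℝ), 2 ≤ p → p.HolderConjugate q →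
      FormBound q (C * (1 + |t|) ^ (-(sigmaD d δ) * (p - 2) / p)) (opC d t) ∧
      FormBound q (C * (1 + |t|) ^ (-(sigmaD d δ) * (p - 2) / p)) (opS d t) := by
  obtain ⟨C, hC, H⟩ := exists_norm_kernel_le hd hδ hδ'
  refine ⟨C, hC, fun t p q hp hpq => ?_⟩
  have hp0 : 0 < p := by linarith
  have ht : 0 ≤ 1 + |t| := by positivity
  have key : ∀ T : L2Z d →L[ℂ] L2Z d, ‖T‖ ≤ 1 →
      (∀ x y, ‖(T (lp.single 2 y 1)) x‖ ≤ C * (1 + |t|) ^ (-sigmaD d δ)) →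
      FormBound q (C * (1 + |t|) ^ (-(sigmaD d δ) * (p - 2) / p)) T := fun T h1 h2 => by
    have hM : 0 ≤ C * (1 + |t|) ^ (-sigmaD d δ) := by positivity
    have := FormBound.interp (θ := 2 / p) one_pos hpq.symm.pos
      ⟨by positivity, (div_le_one hp0).2 hp⟩ hM zero_le_one (by
        have := hpq.inv_add_inv_eq_one
        simp only [div_one, one_div] at *
        rw [div_div_cancel_left' two_ne_zero]
        have e : 2 / p = 2 * p⁻¹ := div_eq_mul_inv _ _
        linarith) (formBound_one h2) (formBound_two h1)
    refine this.mono ?_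
    rw [one_rpow, mul_one, mul_rpow (by positivity) (by positivity), ← rpow_mul ht]
    have e : -sigmaD d δ * (1 - 2 / p) = -sigmaD d δ * (p - 2) / p := by field_simp
    rw [e]
    refine mul_le_mul_of_nonneg_right ?_ (by positivity)
    calc C ^ (1 - 2 / p) ≤ C ^ (1 : ℝ) :=
          rpow_le_rpow_of_exponent_le hC (by linarith [show 0 ≤ 2 / p by positivity])
      _ = C := rpow_one C
  exact ⟨key _ (norm_opC_le t) fun x y => by rw [opC_single_apply]; exact (H t _).1,
    key _ (norm_opS_le t) fun x y => by rw [opS_single_apply]; exact (H t _).2⟩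

section Volterra

variable {E : Type*} [NormedAddCommGroup E] [NormedSpace ℂ E]

lemma continuous_duhamel_integral {S : ℝ → E →L[ℂ] E} (hS : Continuous S) {h : ℝ → E}
    (hh : Continuous h) : Continuous fun t => ∫ τ in (0 : ℝ)..t, S (t - τ) (h τ) :=
  intervalIntegral.continuous_parametric_intervalIntegral_of_continuous
    (f := fun t τ => S (t - τ) (h τ))
    ((hS.comp (continuous_fst.sub continuous_snd)).clm_apply (hh.comp continuous_snd))
    continuous_id

lemma abs_integral_exp_abs_le {l : ℝ} (hl : 0 < l) (t : ℝ) :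
    |∫ τ in (0 : ℝ)..t, exp (l * |τ|)| ≤ l⁻¹ * exp (l * |t|) := by
  have pos : ∀ t : ℝ, 0 ≤ t → |∫ τ in (0 : ℝ)..t, exp (l * |τ|)| ≤ l⁻¹ * exp (l * |t|) :=
    fun t ht => by
      have e : ∫ τ in (0 : ℝ)..t, exp (l * |τ|) = ∫ τ in (0 : ℝ)..t, exp (l * τ) :=
        intervalIntegral.integral_congr fun τ hτ => by
          rw [Set.uIcc_of_le ht] at hτ
          simp only [abs_of_nonneg hτ.1]
      rw [abs_of_nonneg (intervalIntegral.integral_nonneg ht fun _ _ => (exp_pos _).le), e,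
        intervalIntegral.integral_comp_mul_left _ hl.ne', integral_exp, smul_eq_mul, abs_of_nonneg ht]
      refine mul_le_mul_of_nonneg_left ?_ (by positivity)
      linarith [exp_pos (l * 0)]
  rcases le_total 0 t with ht | ht
  · exact pos t ht
  · have := pos (-t) (by linarith)
    have e := intervalIntegral.integral_comp_neg (a := 0) (b := t) fun τ => exp (l * |τ|)
    simp only [abs_neg, neg_zero] at e this
    rwa [e, intervalIntegral.integral_symm, abs_neg]

/-- Global solvability of Volterra equations with Lipschitz forcing inside an invariant family of
closed sets. -/
theorem exists_volterra [CompleteSpace E] {S : ℝ → E →L[ℂ] E} (hS : Continuous S) (hS1 : ∀ t, ‖S t‖ ≤ 1)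
    {F : ℝ → E → E} {Λ : ℝ} (hΛ : 0 < Λ) (hF0 : ∀ τ, F τ 0 = 0)
    (hFL : ∀ τ x y, ‖F τ x - F τ y‖ ≤ Λ * ‖x - y‖)
    (hFc : ∀ v : ℝ → E, Continuous v → Continuous fun τ => F τ (v τ))
    {L : ℝ → E} (hL : Continuous L) {K : ℝ} (hLK : ∀ t, ‖L t‖ ≤ K)
    {A : ℝ → Set E} (hA : ∀ t, IsClosed (A t)) (hA0 : ∀ t, (0 : E) ∈ A t)
    (hinv : ∀ v : ℝ → E, Continuous v → (∀ t, v t ∈ A t) →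
      ∀ t, L t + ∫ τ in (0 : ℝ)..t, S (t - τ) (F τ (v τ)) ∈ A t) :
    ∃ v : ℝ → E, Continuous v ∧ (∀ t, v t = L t + ∫ τ in (0 : ℝ)..t, S (t - τ) (F τ (v τ))) ∧
      ∀ t, v t ∈ A t := by
  set l : ℝ := 2 * Λ with hl
  have hl0 : 0 < l := by positivity
  have he : ∀ t : ℝ, exp (l * |t|) * exp (-(l * |t|)) = 1 := fun t => by
    rw [← exp_add, add_neg_cancel, exp_zero]
  set e : ℝ → ℂ := fun t => (exp (l * |t|) : ℝ)
  set e' : ℝ → ℂ := fun t => (exp (-(l * |t|)) : ℝ)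
  have hee : ∀ t, e t * e' t = 1 := fun t => by
    simp only [e, e', ← Complex.ofReal_mul, he, Complex.ofReal_one]
  have hne : ∀ t, ‖e t‖ = exp (l * |t|) := fun t => by
    rw [Complex.norm_real, Real.norm_of_nonneg (exp_pos _).le]
  have hne' : ∀ t, ‖e' t‖ = exp (-(l * |t|)) := fun t => by
    rw [Complex.norm_real, Real.norm_of_nonneg (exp_pos _).le]
  have hce : Continuous e := by fun_prop
  have hce' : Continuous e' := by fun_prop
  have hFcw : ∀ w : ℝ →ᵇ E, Continuous fun τ => F τ (e τ • w τ) := fun w =>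
    hFc (fun τ => e τ • w τ) (hce.smul w.continuous)
  have hint : ∀ (w : ℝ →ᵇ E) t,
      IntervalIntegrable (fun τ => S (t - τ) (F τ (e τ • w τ))) volume 0 t := fun w t =>
    (((hS.comp (continuous_const.sub continuous_id)).clm_apply (hFcw w))).intervalIntegrable _ _
  have hdiff : ∀ (w w' : ℝ →ᵇ E) t, ‖e' t • ((∫ τ in (0 : ℝ)..t, S (t - τ) (F τ (e τ • w τ))) -
      ∫ τ in (0 : ℝ)..t, S (t - τ) (F τ (e τ • w' τ)))‖ ≤ 1 / 2 * ‖w - w'‖ := fun w w' t => by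
    rw [← intervalIntegral.integral_sub (hint w t) (hint w' t), norm_smul, hne']
    have h1 : ‖∫ τ in (0 : ℝ)..t, (S (t - τ) (F τ (e τ • w τ)) - S (t - τ) (F τ (e τ • w' τ)))‖ ≤
        |∫ τ in (0 : ℝ)..t, Λ * ‖w - w'‖ * exp (l * |τ|)| := by
      refine intervalIntegral.norm_integral_le_abs_of_norm_le (.of_forall fun τ => ?_)
        (Continuous.intervalIntegrable (by fun_prop) _ _)
      rw [← map_sub]
      refine (((S _).le_opNorm _).trans (mul_le_of_le_one_left (norm_nonneg _) (hS1 _))).trans ?_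
      refine (hFL _ _ _).trans ?_
      rw [← smul_sub, norm_smul, hne, mul_comm (exp _), ← mul_assoc]
      have h2 : ‖w τ - w' τ‖ ≤ ‖w - w'‖ := (w - w').norm_coe_le_norm τ
      gcongr
    rw [intervalIntegral.integral_const_mul, abs_mul, abs_of_nonneg (by positivity)] at h1
    calc _ ≤ exp (-(l * |t|)) * (Λ * ‖w - w'‖ * (l⁻¹ * exp (l * |t|))) := by
          refine mul_le_mul_of_nonneg_left (h1.trans ?_) (exp_pos _).le
          exact mul_le_mul_of_nonneg_left (abs_integral_exp_abs_le hl0 t) (by positivity)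
      _ = Λ * l⁻¹ * ‖w - w'‖ * (exp (l * |t|) * exp (-(l * |t|))) := by ring
      _ = 1 / 2 * ‖w - w'‖ := by rw [he, hl]; field_simp
  have hcont : ∀ w : ℝ →ᵇ E, Continuous fun t =>
      e' t • (L t + ∫ τ in (0 : ℝ)..t, S (t - τ) (F τ (e τ • w τ))) := fun w =>
    hce'.smul (hL.add (continuous_duhamel_integral hS (hFcw w)))
  have hbd : ∀ (w : ℝ →ᵇ E) t,
      ‖e' t • (L t + ∫ τ in (0 : ℝ)..t, S (t - τ) (F τ (e τ • w τ)))‖ ≤ K + 1 / 2 * ‖w‖ :=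
    fun w t => by
      have := hdiff w 0 t
      simp only [BoundedContinuousFunction.coe_zero, Pi.zero_apply, smul_zero, hF0, map_zero,
        intervalIntegral.integral_zero, sub_zero] at this
      rw [smul_add]
      refine norm_add_le_of_le ?_ this
      rw [norm_smul, hne']
      refine (mul_le_of_le_one_left (norm_nonneg _) (exp_le_one_iff.2 ?_)).trans (hLK t)
      have : 0 ≤ l * |t| := by positivity
      linarith
  set Φ : (ℝ →ᵇ E) → (ℝ →ᵇ E) := fun w => .ofNormedAddCommGroup _ (hcont w) _ (hbd w) with hΦ
  have hΦa : ∀ w t, Φ w t = e' t • (L t + ∫ τ in (0 : ℝ)..t, S (t - τ) (F τ (e τ • w τ))) :=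
    fun _ _ => rfl
  have hc : ContractingWith (1 / 2) Φ := by
    refine ⟨by rw [div_lt_one] <;> norm_num, LipschitzWith.of_dist_le_mul fun w w' => ?_⟩
    refine (BoundedContinuousFunction.dist_le (by positivity)).2 fun t => ?_
    rw [hΦa, hΦa, dist_eq_norm, dist_eq_norm, ← smul_sub, add_sub_add_left_eq_sub]
    simpa using hdiff w w' t
  have hcl : IsClosed {w : ℝ →ᵇ E | ∀ t, e t • w t ∈ A t} := by
    rw [Set.ofPred_forall]
    refine isClosed_iInter fun t => (hA t).preimage ?_
    exact (continuous_const_smul (e t)).comp (continuous_eval_const t)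
  have hev : ∀ w t, e t • Φ w t = L t + ∫ τ in (0 : ℝ)..t, S (t - τ) (F τ (e τ • w τ)) :=
    fun w t => by rw [hΦa, smul_smul, hee, one_smul]
  have hmem : ContractingWith.fixedPoint Φ hc ∈ {w : ℝ →ᵇ E | ∀ t, e t • w t ∈ A t} := by
    refine hcl.mem_of_tendsto (hc.tendsto_iterate_fixedPoint 0) (.of_forall fun n => ?_)
    induction n with
    | zero => exact fun t => by simpa using hA0 t
    | succ n ih =>
      intro t
      rw [Function.iterate_succ_apply', hev]
      exact hinv _ (hce.smul (Φ^[n] 0).continuous) ih t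
  refine ⟨fun t => e t • ContractingWith.fixedPoint Φ hc t,
    hce.smul (ContractingWith.fixedPoint Φ hc).continuous, fun t => ?_, hmem⟩
  rw [← hev, hc.fixedPoint_isFixedPt]

end Volterra

end Fourier

lemma rpow_neg_mul_rpow_neg_le {a b x y z : ℝ} (ha : 0 ≤ a) (ha1 : a ≤ 1) (hab : a ≤ b)
    (hx : 1 ≤ x) (hy : 1 ≤ y) (hz : 1 ≤ z) (hzxy : z ≤ x + y) :
    x ^ (-a) * y ^ (-b) ≤ z ^ (-a) * (2 * y ^ (-b) + x ^ (-b)) := by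
  have hx0 : 0 < x := by linarith
  have hy0 : 0 < y := by linarith
  have hz0 : 0 < z := by linarith
  have h1 : z ^ a ≤ x ^ a + y ^ a :=
    (rpow_le_rpow hz0.le hzxy ha).trans (rpow_add_le_add_rpow hx0.le hy0.le ha ha1)
  have h2 : x ^ (-a) * y ^ (a - b) ≤ y ^ (-b) + x ^ (-b) := by
    rcases le_total x y with h | h
    · refine le_add_of_nonneg_of_le (by positivity) ?_
      calc x ^ (-a) * y ^ (a - b) ≤ x ^ (-a) * x ^ (a - b) := mul_le_mul_of_nonneg_left
            (rpow_le_rpow_of_nonpos hx0 h (by linarith)) (by positivity)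
        _ = x ^ (-b) := by rw [← rpow_add hx0]; ring_nf
    · refine le_add_of_le_of_nonneg ?_ (by positivity)
      calc x ^ (-a) * y ^ (a - b) ≤ y ^ (-a) * y ^ (a - b) := mul_le_mul_of_nonneg_right
            (rpow_le_rpow_of_nonpos hy0 h (by linarith)) (by positivity)
        _ = y ^ (-b) := by rw [← rpow_add hy0]; ring_nf
  have h3 : z ^ a * (x ^ (-a) * y ^ (-b)) ≤ 2 * y ^ (-b) + x ^ (-b) := by
    calc z ^ a * (x ^ (-a) * y ^ (-b)) ≤ (x ^ a + y ^ a) * (x ^ (-a) * y ^ (-b)) :=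
          mul_le_mul_of_nonneg_right h1 (by positivity)
      _ = x ^ a * x ^ (-a) * y ^ (-b) + x ^ (-a) * (y ^ a * y ^ (-b)) := by ring
      _ = y ^ (-b) + x ^ (-a) * y ^ (a - b) := by
          rw [← rpow_add hx0, ← rpow_add hy0, add_neg_cancel, rpow_zero, one_mul, sub_eq_add_neg]
      _ ≤ _ := by linarith
  rwa [rpow_neg hz0.le, le_inv_mul_iff₀ (by positivity)]

lemma integrable_one_add_abs {b : ℝ} (hb : 1 < b) : Integrable fun τ : ℝ => (1 + |τ|) ^ (-b) := by
  have := integrable_one_add_norm (E := ℝ) (μ := volume) (r := b) (by simpa using hb)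
  simpa only [Real.norm_eq_abs] using this

lemma continuous_one_add_abs_rpow (c : ℝ) : Continuous fun τ : ℝ => (1 + |τ|) ^ c :=
  (continuous_const.add continuous_abs).rpow_const fun τ =>
    .inl (add_pos_of_pos_of_nonneg one_pos (abs_nonneg τ)).ne'

/-- Convolution of decaying weights. -/
lemma exists_integral_weight_le {a b : ℝ} (ha : 0 ≤ a) (ha1 : a ≤ 1) (hb : 1 < b) :
    ∃ C ≥ 1, ∀ α β t : ℝ, |∫ τ in α..β, (1 + |t - τ|) ^ (-a) * (1 + |τ|) ^ (-b)| ≤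
      C * (1 + |t|) ^ (-a) := by
  set I : ℝ := ∫ τ : ℝ, (1 + |τ|) ^ (-b)
  have hI : 0 ≤ I := integral_nonneg fun τ => by positivity
  refine ⟨1 + 3 * I, by linarith, fun α β t => ?_⟩
  have h1 := integrable_one_add_abs hb
  have h2 : Integrable fun τ : ℝ => (1 + |t - τ|) ^ (-b) := h1.comp_sub_left t
  have h3 : Integrable fun τ : ℝ =>
      (1 + |t|) ^ (-a) * (2 * (1 + |τ|) ^ (-b) + (1 + |t - τ|) ^ (-b)) :=
    ((h1.const_mul 2).add h2).const_mul _
  calc |∫ τ in α..β, (1 + |t - τ|) ^ (-a) * (1 + |τ|) ^ (-b)|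
      ≤ ∫ τ in Set.uIoc α β, (1 + |t - τ|) ^ (-a) * (1 + |τ|) ^ (-b) := by
        refine (intervalIntegral.norm_integral_le_integral_norm_uIoc (μ := volume)
          (f := fun τ : ℝ => (1 + |t - τ|) ^ (-a) * (1 + |τ|) ^ (-b))).trans_eq ?_
        refine integral_congr_ae (.of_forall fun τ => ?_)
        exact Real.norm_of_nonneg (by positivity)
    _ ≤ ∫ τ in Set.uIoc α β, (1 + |t|) ^ (-a) * (2 * (1 + |τ|) ^ (-b) + (1 + |t - τ|) ^ (-b)) := by
        refine integral_mono_of_nonneg (.of_forall fun τ => by positivity) h3.integrableOn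
          (.of_forall fun τ => ?_)
        refine rpow_neg_mul_rpow_neg_le ha ha1 (by linarith) ?_ ?_ ?_ ?_ <;>
          try exact le_add_of_nonneg_right (abs_nonneg _)
        have := abs_add_le (t - τ) τ
        rw [sub_add_cancel] at this
        linarith
    _ ≤ ∫ τ, (1 + |t|) ^ (-a) * (2 * (1 + |τ|) ^ (-b) + (1 + |t - τ|) ^ (-b)) :=
        setIntegral_le_integral h3 (.of_forall fun τ => by positivity)
    _ = (3 * I) * (1 + |t|) ^ (-a) := by
        rw [integral_const_mul, integral_add (h1.const_mul 2) h2, integral_const_mul,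
          integral_sub_left_eq_self (fun τ : ℝ => (1 + |τ|) ^ (-b))]
        ring
    _ ≤ _ := mul_le_mul_of_nonneg_right (by linarith) (by positivity)

/-- The space-time kernel controlling the dual Strichartz estimate. -/
def schurKernel (a β τ τ' : ℝ) : ℝ :=
  (1 + |τ|) ^ (-β) * (1 + |τ - τ'|) ^ (-a) * (1 + |τ'|) ^ (-β)

lemma schurKernel_nonneg (a β τ τ' : ℝ) : 0 ≤ schurKernel a β τ τ' := by
  unfold schurKernel
  positivity

lemma continuous_schurKernel (a β : ℝ) : Continuous fun z : ℝ × ℝ => schurKernel a β z.1 z.2 :=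
  (((continuous_one_add_abs_rpow _).comp continuous_fst).mul
    ((continuous_one_add_abs_rpow _).comp (continuous_fst.sub continuous_snd))).mul
    ((continuous_one_add_abs_rpow _).comp continuous_snd)

/-- Schur test for `schurKernel`. -/
lemma exists_schur {a β : ℝ} (ha : 0 ≤ a) (ha1 : a ≤ 1) (hb : 1 < a + 2 * β) :
    ∃ C ≥ 1, ∀ (T : ℝ) (_ : 0 ≤ T) (φ : ℝ → ℝ) (_ : Continuous φ),
      ∫ τ in (0 : ℝ)..T, ∫ τ' in (0 : ℝ)..T, schurKernel a β τ τ' * (φ τ * φ τ') ≤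
        C * ∫ τ in (0 : ℝ)..T, φ τ ^ 2 := by
  obtain ⟨C, hC, H⟩ := exists_integral_weight_le ha ha1 hb
  refine ⟨C, hC, fun T hT φ hφ => ?_⟩
  set G : ℝ → ℝ → ℝ := fun τ τ' =>
    φ τ ^ 2 * (1 + |τ|) ^ a * ((1 + |τ - τ'|) ^ (-a) * (1 + |τ'|) ^ (-(a + 2 * β))) with hG
  have hGc : Continuous (Function.uncurry G) :=
    (((hφ.comp continuous_fst).pow 2).mul ((continuous_one_add_abs_rpow _).comp continuous_fst)).mul
      (((continuous_one_add_abs_rpow _).comp (continuous_fst.sub continuous_snd)).mul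
        ((continuous_one_add_abs_rpow _).comp continuous_snd))
  have hGs : Continuous (Function.uncurry fun τ τ' => G τ' τ) := hGc.comp continuous_swap
  have hKc : Continuous (Function.uncurry fun τ τ' => schurKernel a β τ τ' * (φ τ * φ τ')) :=
    (continuous_schurKernel a β).mul ((hφ.comp continuous_fst).mul (hφ.comp continuous_snd))
  have hin : ∀ {K : ℝ → ℝ → ℝ}, Continuous (Function.uncurry K) →
      Continuous fun τ => ∫ τ' in (0 : ℝ)..T, K τ τ' := fun hK =>
    intervalIntegral.continuous_parametric_intervalIntegral_of_continuous' hK _ _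
  have hsl : ∀ {K : ℝ → ℝ → ℝ}, Continuous (Function.uncurry K) → ∀ τ,
      IntervalIntegrable (K τ) volume 0 T := fun hK τ =>
    (hK.comp (Continuous.prodMk_right τ)).intervalIntegrable _ _
  have hpt : ∀ τ τ', schurKernel a β τ τ' * (φ τ * φ τ') ≤ 1 / 2 * (G τ τ' + G τ' τ) :=
      fun τ τ' => by
    have hx : 0 < 1 + |τ| := by positivity
    have hy : 0 < 1 + |τ'| := by positivity
    set x := 1 + |τ|
    set y := 1 + |τ'|
    set z := (1 + |τ - τ'|) ^ (-a)
    have hz : 0 ≤ z := by positivity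
    have e1 : x ^ a * y ^ (-(a + 2 * β)) = x ^ (-β) * y ^ (-β) * (x ^ (a + β) * y ^ (-(a + β))) := by
      rw [show x ^ (-β) * y ^ (-β) * (x ^ (a + β) * y ^ (-(a + β))) =
        (x ^ (-β) * x ^ (a + β)) * (y ^ (-β) * y ^ (-(a + β))) by ring, ← rpow_add hx, ← rpow_add hy]
      ring_nf
    have e2 : y ^ a * x ^ (-(a + 2 * β)) = x ^ (-β) * y ^ (-β) * (y ^ (a + β) * x ^ (-(a + β))) := by
      rw [show x ^ (-β) * y ^ (-β) * (y ^ (a + β) * x ^ (-(a + β))) =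
        (y ^ (-β) * y ^ (a + β)) * (x ^ (-β) * x ^ (-(a + β))) by ring, ← rpow_add hx, ← rpow_add hy]
      ring_nf
    set u := x ^ (a + β) * y ^ (-(a + β)) with hu
    set u' := y ^ (a + β) * x ^ (-(a + β)) with hu'
    have huu : u * u' = 1 := by
      rw [hu, hu', show x ^ (a + β) * y ^ (-(a + β)) * (y ^ (a + β) * x ^ (-(a + β))) =
        (x ^ (a + β) * x ^ (-(a + β))) * (y ^ (a + β) * y ^ (-(a + β))) by ring, ← rpow_add hx,
        ← rpow_add hy]
      simp
    have hu0 : 0 ≤ u := by positivity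
    have hu0' : 0 ≤ u' := by positivity
    have am : φ τ * φ τ' ≤ 1 / 2 * (φ τ ^ 2 * u + φ τ' ^ 2 * u') := by
      have h3 := sq_nonneg (φ τ * √u - φ τ' * √u')
      have h4 : √u * √u' = 1 := by rw [← sqrt_mul hu0, huu, sqrt_one]
      have h5 : (φ τ * √u - φ τ' * √u') ^ 2 =
          φ τ ^ 2 * √u ^ 2 + φ τ' ^ 2 * √u' ^ 2 - 2 * (φ τ * φ τ') * (√u * √u') := by ring
      rw [h5, h4, sq_sqrt hu0, sq_sqrt hu0'] at h3
      linarith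
    have eG : G τ τ' = x ^ (-β) * z * y ^ (-β) * (φ τ ^ 2 * u) := by
      have : G τ τ' = φ τ ^ 2 * z * (x ^ a * y ^ (-(a + 2 * β))) := by
        simp only [hG, x, y, z]; ring
      rw [this, e1]; ring
    have eG' : G τ' τ = x ^ (-β) * z * y ^ (-β) * (φ τ' ^ 2 * u') := by
      have : G τ' τ = φ τ' ^ 2 * z * (y ^ a * x ^ (-(a + 2 * β))) := by
        simp only [hG, x, y, z, abs_sub_comm τ' τ]; ring
      rw [this, e2]; ring
    rw [eG, eG', schurKernel]
    calc _ ≤ x ^ (-β) * z * y ^ (-β) * (1 / 2 * (φ τ ^ 2 * u + φ τ' ^ 2 * u')) :=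
          mul_le_mul_of_nonneg_left am (by positivity)
      _ = _ := by ring
  have hGi : ∀ τ, ∫ τ' in (0 : ℝ)..T, G τ τ' ≤ C * φ τ ^ 2 := fun τ => by
    rw [hG]
    simp only
    rw [intervalIntegral.integral_const_mul]
    have hx : 0 < 1 + |τ| := by positivity
    calc _ ≤ φ τ ^ 2 * (1 + |τ|) ^ a * (C * (1 + |τ|) ^ (-a)) :=
          mul_le_mul_of_nonneg_left ((le_abs_self _).trans (H 0 T τ)) (by positivity)
      _ = C * φ τ ^ 2 * ((1 + |τ|) ^ a * (1 + |τ|) ^ (-a)) := by ring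
      _ = C * φ τ ^ 2 := by rw [← rpow_add hx]; simp
  have hGG : ∫ τ in (0 : ℝ)..T, ∫ τ' in (0 : ℝ)..T, G τ τ' ≤ C * ∫ τ in (0 : ℝ)..T, φ τ ^ 2 := by
    rw [← intervalIntegral.integral_const_mul]
    exact intervalIntegral.integral_mono_on hT ((hin hGc).intervalIntegrable _ _)
      (((hφ.pow 2).const_mul C).intervalIntegrable _ _) fun τ _ => hGi τ
  have hswap : ∫ τ in (0 : ℝ)..T, ∫ τ' in (0 : ℝ)..T, G τ' τ =
      ∫ τ in (0 : ℝ)..T, ∫ τ' in (0 : ℝ)..T, G τ τ' := by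
    refine (intervalIntegral_intervalIntegral_swap ?_).symm
    exact (hGc.continuousOn.integrableOn_compact (isCompact_uIcc.prod isCompact_uIcc)).mono_set
      (Set.prod_mono Set.uIoc_subset_uIcc Set.uIoc_subset_uIcc)
  calc ∫ τ in (0 : ℝ)..T, ∫ τ' in (0 : ℝ)..T, schurKernel a β τ τ' * (φ τ * φ τ')
      ≤ ∫ τ in (0 : ℝ)..T, 1 / 2 * ((∫ τ' in (0 : ℝ)..T, G τ τ') + ∫ τ' in (0 : ℝ)..T, G τ' τ) := by
        refine intervalIntegral.integral_mono_on hT ((hin hKc).intervalIntegrable _ _)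
          ((((hin hGc).add (hin hGs)).const_mul _).intervalIntegrable _ _) fun τ _ => ?_
        rw [← intervalIntegral.integral_add (hsl hGc τ) (hsl hGs τ),
          ← intervalIntegral.integral_const_mul]
        exact intervalIntegral.integral_mono_on hT (hsl hKc τ)
          (((hsl hGc τ).add (hsl hGs τ)).const_mul _) fun τ' _ => hpt τ τ'
    _ = 1 / 2 * ((∫ τ in (0 : ℝ)..T, ∫ τ' in (0 : ℝ)..T, G τ τ') +
        ∫ τ in (0 : ℝ)..T, ∫ τ' in (0 : ℝ)..T, G τ' τ) := by
        rw [intervalIntegral.integral_const_mul, intervalIntegral.integral_add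
          ((hin hGc).intervalIntegrable _ _) ((hin hGs).intervalIntegrable _ _)]
    _ ≤ _ := by rw [hswap]; linarith

lemma norm_integral_sq_le {H : Type*} [NormedAddCommGroup H] [InnerProductSpace ℂ H]
    [CompleteSpace H] {y : ℝ → H} (hy : Continuous y) {T : ℝ} (hT : 0 ≤ T) {G : ℝ → ℝ → ℝ}
    (hG : Continuous (Function.uncurry G))
    (h : ∀ τ τ', 0 ≤ τ → 0 ≤ τ' → ‖inner ℂ (y τ) (y τ')‖ ≤ G τ τ') :
    ‖∫ τ in (0 : ℝ)..T, y τ‖ ^ 2 ≤ ∫ τ in (0 : ℝ)..T, ∫ τ' in (0 : ℝ)..T, G τ τ' := by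
  have hi : IntervalIntegrable y volume 0 T := hy.intervalIntegrable _ _
  have hcomm : ∀ w : H, inner ℂ w (∫ τ in (0 : ℝ)..T, y τ) = ∫ τ in (0 : ℝ)..T, inner ℂ w (y τ) :=
    fun w => ((innerSL ℂ w).intervalIntegral_comp_comm hi).symm
  have hin : Continuous fun τ => ∫ τ' in (0 : ℝ)..T, G τ τ' :=
    intervalIntegral.continuous_parametric_intervalIntegral_of_continuous' hG _ _
  set A := ∫ τ in (0 : ℝ)..T, y τ with hA
  have e : ‖A‖ ^ 2 = ‖inner ℂ A A‖ := by
    rw [inner_self_eq_norm_sq_to_K, norm_pow]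
    simp
  rw [e]
  nth_rewrite 2 [hA]
  rw [hcomm]
  refine intervalIntegral.norm_integral_le_of_norm_le hT (.of_forall fun τ hτ => ?_)
    (hin.intervalIntegrable _ _)
  rw [norm_inner_symm, hcomm]
  exact intervalIntegral.norm_integral_le_of_norm_le hT
    (.of_forall fun τ' hτ' => h τ τ' hτ.1.le hτ'.1.le)
    ((hG.comp (Continuous.prodMk_right τ)).intervalIntegrable _ _)

lemma inner_opK_left {d : ℕ} {m : Symb d} (hm : star m = m) (f g : L2Z d) :
    inner ℂ (opK d m f) g = inner ℂ f (opK d m g) := by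
  rw [← inner_conj_symm, inner_opK, inner_opK, inner_conj_symm, inner_mulE, hm]

lemma inner_opC_left {d : ℕ} (t : ℝ) (f g : L2Z d) :
    inner ℂ (opC d t f) g = inner ℂ f (opC d t g) := inner_opK_left (star_cosB t) f g

lemma inner_opS_left {d : ℕ} (t : ℝ) (f g : L2Z d) :
    inner ℂ (opS d t f) g = inner ℂ f (opS d t g) := by
  refine inner_opK_left ?_ f g
  ext ξ
  rw [BoundedContinuousFunction.star_apply, invB_mul_sinB_apply]
  exact Complex.conj_ofReal _

/-- Dispersive decay at rate `a` for the propagators from `ℓ^q` to `ℓ^P`, together with the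
convolution estimates for the weights `(1+|t|)^(-a)` and `(1+|t|)^(-β)`. -/
structure Dispersive (d : ℕ) (P q a β K : ℝ) : Prop where
  conj : P.HolderConjugate q
  one_le : 1 ≤ K
  rate_nonneg : 0 ≤ a
  formC : ∀ t, FormBound q (K * (1 + |t|) ^ (-a)) (opC d t)
  formS : ∀ t, FormBound q (K * (1 + |t|) ^ (-a)) (opS d t)
  conv : ∀ α γ t : ℝ, |∫ τ in α..γ, (1 + |t - τ|) ^ (-a) * (1 + |τ|) ^ (-(a + 2 * β))| ≤
    K * (1 + |t|) ^ (-a)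
  schur : ∀ T : ℝ, 0 ≤ T → ∀ φ : ℝ → ℝ, Continuous φ →
    ∫ τ in (0 : ℝ)..T, ∫ τ' in (0 : ℝ)..T, schurKernel a β τ τ' * (φ τ * φ τ') ≤
      K * ∫ τ in (0 : ℝ)..T, φ τ ^ 2

/-- Bounded self-adjoint operators decaying as multiplication by a function in `ℓ^r`,
`1/r = 1/2 - 1/P`, of norm `ρ (1+|t|)^(-β)`. -/
structure IsWeight (d : ℕ) (P q ρ β : ℝ) (b : ℝ → L2Z d →L[ℂ] L2Z d) : Prop where
  cont : Continuous b
  norm_le : ∀ t, ‖b t‖ ≤ 1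
  symm : ∀ t f g, inner ℂ (b t f) g = inner ℂ f (b t g)
  lpLE : ∀ t f, LpLE q (b t f) (ρ * (1 + |t|) ^ (-β) * ‖f‖)
  norm_apply_le : ∀ t (f : L2Z d) (B : ℝ), LpLE P f B → ‖b t f‖ ≤ ρ * (1 + |t|) ^ (-β) * B

section Energy

variable {d : ℕ} {P q a β K : ℝ}

lemma Dispersive.duhamel_lpLE (D : Dispersive d P q a β K) {h : ℝ → L2Z d} (hh : Continuous h)
    {M : ℝ} (hM : ∀ τ, LpLE q (h τ) (M * (1 + |τ|) ^ (-(a + 2 * β)))) (t : ℝ) :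
    LpLE P (∫ τ in (0 : ℝ)..t, opS d (t - τ) (h τ) : L2Z d) (K ^ 2 * M * (1 + |t|) ^ (-a)) := by
  have hK := D.one_le
  have hM0 : 0 ≤ M := by
    have := (hM 0).1
    simpa using this
  have hbc : Continuous fun τ => K * M * ((1 + |t - τ|) ^ (-a) * (1 + |τ|) ^ (-(a + 2 * β))) :=
    (((continuous_one_add_abs_rpow (-a)).comp (continuous_const.sub continuous_id)).mul
      (continuous_one_add_abs_rpow _)).const_mul _
  have := lpLE_integral (h := fun τ => opS d (t - τ) (h τ)) D.conj hbc
    ((continuous_opS.comp (continuous_const.sub continuous_id)).clm_apply hh) t fun τ _ => by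
      have := (D.formS (t - τ)).lpLE D.conj (by positivity) (hM τ)
      convert this using 1
      ring
  refine this.mono D.conj.nonneg ?_
  rw [intervalIntegral.integral_const_mul, abs_mul, abs_of_nonneg (by positivity)]
  calc K * M * _ ≤ K * M * (K * (1 + |t|) ^ (-a)) :=
        mul_le_mul_of_nonneg_left (D.conv 0 t t) (by positivity)
    _ = _ := by ring

lemma Dispersive.linear_lpLE (D : Dispersive d P q a β K) {f g : L2Z d} {B B' : ℝ}
    (hf : LpLE q f B) (hg : LpLE q g B') (t : ℝ) :
    LpLE P (opC d t f + opS d t g : L2Z d) (K * (B + B') * (1 + |t|) ^ (-a)) := by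
  have hK := D.one_le
  have h1 := (D.formC t).lpLE D.conj (by positivity) hf
  have h2 := (D.formS t).lpLE D.conj (by positivity) hg
  rw [show K * (B + B') * (1 + |t|) ^ (-a) =
    K * (1 + |t|) ^ (-a) * B + K * (1 + |t|) ^ (-a) * B' by ring]
  exact h1.add D.conj h2

variable {ρ : ℝ} {b : ℝ → L2Z d →L[ℂ] L2Z d}

/-- Dual Strichartz estimate on the Fourier side. -/
lemma Dispersive.norm_integral_mulE_sq_le (D : Dispersive d P q a β K)
    {h : ℝ → L2Z d} (hh : Continuous h) {φ : ℝ → ℝ} (hφ : Continuous φ)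
    (hφh : ∀ τ, LpLE q (h τ) (ρ * (1 + |τ|) ^ (-β) * φ τ)) {T : ℝ} (hT : 0 ≤ T)
    {m : ℝ → Symb d} (hm : Continuous m) (hms : ∀ τ, star (m τ) = m τ) {c : ℂ} (hc : ‖c‖ = 1)
    (hmm : ∀ τ τ', m τ * m τ' = (1 / 2 : ℂ) • (cosB d (τ - τ') + c • cosB d (τ + τ'))) :
    ‖∫ τ in (0 : ℝ)..T, mulE d (m τ) (fourierJ d (h τ))‖ ^ 2 ≤
      (ρ * K) ^ 2 * ∫ τ in (0 : ℝ)..T, φ τ ^ 2 := by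
  have hK := D.one_le
  have hy : Continuous fun τ => mulE d (m τ) (fourierJ d (h τ)) :=
    ((mulE d).continuous.comp hm).clm_apply ((fourierJ d).continuous.comp hh)
  have hGc : Continuous (Function.uncurry fun τ τ' =>
      ρ ^ 2 * K * (schurKernel a β τ τ' * (φ τ * φ τ'))) :=
    ((continuous_schurKernel a β).mul
      ((hφ.comp continuous_fst).mul (hφ.comp continuous_snd))).const_mul _
  refine (norm_integral_sq_le hy hT hGc fun τ τ' hτ hτ' => ?_).trans ?_
  · have hi : ∀ t, ‖inner ℂ (h τ) (opC d t (h τ'))‖ ≤ K * (1 + |t|) ^ (-a) *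
        (ρ * (1 + |τ'|) ^ (-β) * φ τ') * (ρ * (1 + |τ|) ^ (-β) * φ τ) := fun t =>
      ((D.formC t).lpLE D.conj (by positivity) (hφh τ')).norm_inner_le D.conj (hφh τ)
    have e : inner ℂ (mulE d (m τ) (fourierJ d (h τ))) (mulE d (m τ') (fourierJ d (h τ'))) =
        (1 / 2 : ℂ) * (inner ℂ (h τ) (opC d (τ - τ') (h τ')) +
          c * inner ℂ (h τ) (opC d (τ + τ') (h τ'))) := by
      rw [inner_mulE, hms, ← mulE_mul, hmm, opC, opC, inner_opK, inner_opK]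
      simp only [map_smul, map_add, smul_apply, add_apply, inner_smul_right, inner_add_right]
    have h1 := hi (τ - τ')
    have h2 : ‖inner ℂ (h τ) (opC d (τ + τ') (h τ'))‖ ≤ K * (1 + |τ - τ'|) ^ (-a) *
        (ρ * (1 + |τ'|) ^ (-β) * φ τ') * (ρ * (1 + |τ|) ^ (-β) * φ τ) := by
      refine (hi (τ + τ')).trans ?_
      have : (1 + |τ + τ'|) ^ (-a) ≤ (1 + |τ - τ'|) ^ (-a) := by
        refine rpow_le_rpow_of_nonpos (by positivity) ?_ (by linarith [D.rate_nonneg])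
        rw [abs_of_nonneg (add_nonneg hτ hτ')]
        linarith [abs_le.2 (⟨by linarith, by linarith⟩ : -(τ + τ') ≤ τ - τ' ∧ τ - τ' ≤ τ + τ')]
      have h3 := (hφh τ).1
      have h4 := (hφh τ').1
      gcongr
    rw [e, norm_mul]
    have h5 := norm_add_le_of_le h1 ((norm_mul c _).trans_le
      ((mul_le_of_le_one_left (norm_nonneg _) hc.le).trans h2))
    have h6 : ‖(1 / 2 : ℂ)‖ = 1 / 2 := by norm_num
    rw [h6, schurKernel]
    linarith
  · simp only [intervalIntegral.integral_const_mul]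
    calc _ ≤ ρ ^ 2 * K * (K * ∫ τ in (0 : ℝ)..T, φ τ ^ 2) :=
          mul_le_mul_of_nonneg_left (D.schur T hT φ hφ) (by positivity)
      _ = _ := by ring

lemma integral_opK_mul {h : ℝ → L2Z d} (hh : Continuous h) {m : ℝ → Symb d} (hm : Continuous m)
    (n : Symb d) (T : ℝ) : ‖∫ τ in (0 : ℝ)..T, opK d (n * m τ) (h τ)‖ ≤
      ‖n‖ * ‖∫ τ in (0 : ℝ)..T, mulE d (m τ) (fourierJ d (h τ))‖ := by
  have hy : Continuous fun τ => mulE d (m τ) (fourierJ d (h τ)) :=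
    ((mulE d).continuous.comp hm).clm_apply ((fourierJ d).continuous.comp hh)
  have e : ∀ τ, opK d (n * m τ) (h τ) =
      ((ContinuousLinearMap.adjoint (fourierJ d).toContinuousLinearMap).comp (mulE d n))
        (mulE d (m τ) (fourierJ d (h τ))) := fun τ => by
    rw [ContinuousLinearMap.comp_apply, ← mulE_mul]
    rfl
  simp only [e]
  rw [ContinuousLinearMap.intervalIntegral_comp_comm _ (hy.intervalIntegrable _ _)]
  exact (norm_adjoint_fourierJ_le _).trans (norm_mulE_apply_le _ _)

end Energy

section Energy

variable {d : ℕ} {P q a β K ρ : ℝ} {b : ℝ → L2Z d →L[ℂ] L2Z d}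

/-- Uniform `ℓ²` bound, forward in time, for solutions of the Klein-Gordon equation with a small
decaying potential. -/
lemma Dispersive.norm_le_of_nonneg (D : Dispersive d P q a β K) (hb : IsWeight d P q ρ β b)
    (hρ : 0 ≤ ρ) (hρK : ρ * K ≤ 1 / 2) {c : ℂ} (hc : ‖c‖ = 1) {f g : L2Z d} {v : ℝ → L2Z d}
    (hv : Continuous v) (hveq : ∀ t, v t = opC d t f + opS d t g +
      ∫ τ in (0 : ℝ)..t, opS d (t - τ) (c • b τ (b τ (v τ)))) {T : ℝ} (hT : 0 ≤ T) :
    ‖v T‖ ≤ 2 * (‖f‖ + ‖g‖) := by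
  have hK := D.one_le
  set φ : ℝ → ℝ := fun τ => ‖b τ (v τ)‖ with hφ
  have hbv : Continuous fun τ => b τ (v τ) := hb.cont.clm_apply hv
  have hφc : Continuous φ := hbv.norm
  set h : ℝ → L2Z d := fun τ => c • b τ (b τ (v τ)) with hh
  have hhc : Continuous h := (hb.cont.clm_apply hbv).const_smul c
  have hφh : ∀ τ, LpLE q (h τ) (ρ * (1 + |τ|) ^ (-β) * φ τ) := fun τ => by
    have := (hb.lpLE τ (b τ (v τ))).const_mul c
    rw [hc, one_mul] at this
    exact this
  set Q := ∫ τ in (0 : ℝ)..T, φ τ ^ 2 with hQ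
  have hQ0 : 0 ≤ Q := intervalIntegral.integral_nonneg hT fun τ _ => sq_nonneg _
  have hsqrt : ∀ {x : ℝ}, 0 ≤ x → x ^ 2 ≤ (ρ * K) ^ 2 * Q → x ≤ 1 / 2 * √Q := fun {x} hx hxQ => by
    refine abs_le_of_sq_le_sq' ?_ (by positivity) |>.2
    rw [mul_pow, sq_sqrt hQ0]
    refine hxQ.trans (mul_le_mul_of_nonneg_right ?_ hQ0)
    gcongr
  have hA := hsqrt (norm_nonneg _) (D.norm_integral_mulE_sq_le hhc hφc hφh hT continuous_cosB
    star_cosB norm_one fun τ τ' => by rw [cosB_mul_cosB, one_smul])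
  have hB := hsqrt (norm_nonneg _) (D.norm_integral_mulE_sq_le hhc hφc hφh hT continuous_sinB
    star_sinB (c := -1) (by simp) fun τ τ' => by
      rw [sinB_mul_sinB, neg_smul, one_smul, sub_eq_add_neg])
  have hop : ∀ {m : ℝ → Symb d}, Continuous m →
      ‖∫ τ in (0 : ℝ)..T, mulE d (m τ) (fourierJ d (h τ))‖ ≤ 1 / 2 * √Q → ∀ n : Symb d, ‖n‖ ≤ 1 →
      ‖∫ τ in (0 : ℝ)..T, opK d (n * m τ) (h τ)‖ ≤ 1 / 2 * √Q := fun hm hmQ n hn =>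
    (integral_opK_mul hhc hm n T).trans ((mul_le_of_le_one_left (norm_nonneg _) hn).trans hmQ)
  have hopi : ∀ {m : ℝ → Symb d}, Continuous m → ∀ n : Symb d,
      IntervalIntegrable (fun τ => opK d (n * m τ) (h τ)) volume 0 T := fun hm n =>
    (((continuous_opK d).comp (continuous_const.mul hm)).clm_apply hhc).intervalIntegrable _ _
  have hC : ‖∫ τ in (0 : ℝ)..T, opC d τ (h τ)‖ ≤ 1 / 2 * √Q := by
    have := hop continuous_cosB hA 1 (by
      refine (BoundedContinuousFunction.norm_le zero_le_one).2 fun ξ => ?_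
      simp)
    simp only [one_mul] at this
    exact this
  have hS : ‖∫ τ in (0 : ℝ)..T, opS d τ (h τ)‖ ≤ 1 / 2 * √Q :=
    hop continuous_sinB hB _ norm_invB_le
  have hD : ‖∫ τ in (0 : ℝ)..T, opS d (T - τ) (h τ)‖ ≤ √Q := by
    have e : ∀ τ, opS d (T - τ) (h τ) = opK d (invB d * sinB d T * cosB d τ) (h τ) -
        opK d (invB d * cosB d T * sinB d τ) (h τ) := fun τ => by
      rw [opS, invB_mul_sinB_sub, opK_sub, sub_apply]
    simp only [e]
    rw [intervalIntegral.integral_sub (hopi continuous_cosB _) (hopi continuous_sinB _)]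
    have h1 : ∀ m : Symb d, ‖m‖ ≤ 1 → ‖invB d * m‖ ≤ 1 := fun m hm =>
      (norm_mul_le _ _).trans (mul_le_one₀ norm_invB_le (norm_nonneg _) hm)
    have := norm_sub_le_of_le (hop continuous_cosB hA _ (h1 _ (norm_sinB_le T)))
      (hop continuous_sinB hB _ (h1 _ (norm_cosB_le T)))
    linarith
  have hQle : Q ≤ 1 / 2 * √Q * (‖f‖ + ‖g‖) + 1 / 4 * Q := by
    have i1 : ∀ τ, inner ℂ (v τ) (h τ) = c * ((φ τ ^ 2 : ℝ) : ℂ) := fun τ => by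
      rw [hh, inner_smul_right, ← hb.symm, inner_self_eq_norm_sq_to_K]
      simp [hφ]
    have i2 : ∀ τ, inner ℂ (v τ) (h τ) = inner ℂ f (opC d τ (h τ)) + inner ℂ g (opS d τ (h τ)) +
        inner ℂ (∫ τ' in (0 : ℝ)..τ, opS d (τ - τ') (h τ')) (h τ) := fun τ => by
      rw [hveq τ, inner_add_left, inner_add_left, inner_opC_left, inner_opS_left]
    have cC : Continuous fun τ => opC d τ (h τ) := continuous_opC.clm_apply hhc
    have cS : Continuous fun τ => opS d τ (h τ) := continuous_opS.clm_apply hhc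
    have cD : Continuous fun τ => ∫ τ' in (0 : ℝ)..τ, opS d (τ - τ') (h τ') :=
      continuous_duhamel_integral continuous_opS hhc
    have i3 : (∫ τ in (0 : ℝ)..T, inner ℂ (v τ) (h τ)) = c * (Q : ℂ) := by
      simp only [i1]
      rw [intervalIntegral.integral_const_mul, intervalIntegral.integral_ofReal]
    have i4 : (∫ τ in (0 : ℝ)..T, inner ℂ (v τ) (h τ)) =
        inner ℂ f (∫ τ in (0 : ℝ)..T, opC d τ (h τ)) + inner ℂ g (∫ τ in (0 : ℝ)..T, opS d τ (h τ)) +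
        ∫ τ in (0 : ℝ)..T, inner ℂ (∫ τ' in (0 : ℝ)..τ, opS d (τ - τ') (h τ')) (h τ) := by
      simp only [i2]
      rw [intervalIntegral.integral_add, intervalIntegral.integral_add]
      · congr 2
        · exact (innerSL ℂ f).intervalIntegral_comp_comm (cC.intervalIntegrable _ _)
        · exact (innerSL ℂ g).intervalIntegral_comp_comm (cS.intervalIntegrable _ _)
      · exact (continuous_const.inner cC).intervalIntegrable _ _
      · exact (continuous_const.inner cS).intervalIntegrable _ _
      · exact ((continuous_const.inner cC).add (continuous_const.inner cS)).intervalIntegrable _ _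
      · exact (cD.inner hhc).intervalIntegrable _ _
    have hGc : Continuous (Function.uncurry fun τ τ' =>
        ρ ^ 2 * K * (schurKernel a β τ τ' * (φ τ * φ τ'))) :=
      ((continuous_schurKernel a β).mul
        ((hφc.comp continuous_fst).mul (hφc.comp continuous_snd))).const_mul _
    have i5 : ‖∫ τ in (0 : ℝ)..T, inner ℂ (∫ τ' in (0 : ℝ)..τ, opS d (τ - τ') (h τ')) (h τ)‖ ≤
        ∫ τ in (0 : ℝ)..T, ∫ τ' in (0 : ℝ)..T, ρ ^ 2 * K * (schurKernel a β τ τ' * (φ τ * φ τ')) := by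
      refine intervalIntegral.norm_integral_le_of_norm_le hT (.of_forall fun τ hτ => ?_)
        ((intervalIntegral.continuous_parametric_intervalIntegral_of_continuous' hGc _ _
          ).intervalIntegrable _ _)
      have hsl := fun r s => (hGc.comp (Continuous.prodMk_right τ)).intervalIntegrable
        (μ := volume) r s
      have cSτ : Continuous fun τ' => opS d (τ - τ') (h τ') :=
        (continuous_opS.comp (continuous_const.sub continuous_id)).clm_apply hhc
      have e : inner ℂ (h τ) (∫ τ' in (0 : ℝ)..τ, opS d (τ - τ') (h τ')) =
          ∫ τ' in (0 : ℝ)..τ, inner ℂ (h τ) (opS d (τ - τ') (h τ')) :=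
        ((innerSL ℂ (h τ)).intervalIntegral_comp_comm (cSτ.intervalIntegrable _ _)).symm
      rw [norm_inner_symm, e]
      refine (intervalIntegral.norm_integral_le_of_norm_le hτ.1.le (.of_forall fun τ' _ => ?_)
        (hsl 0 τ)).trans (intervalIntegral.integral_mono_interval le_rfl hτ.1.le hτ.2
          (.of_forall fun τ' => ?_) (hsl 0 T))
      · refine (((D.formS (τ - τ')).lpLE D.conj (by positivity) (hφh τ')).norm_inner_le D.conj
          (hφh τ)).trans_eq ?_
        simp only [Function.comp_apply, Function.uncurry_apply_pair, schurKernel]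
        ring
      · exact mul_nonneg (by positivity) (mul_nonneg (schurKernel_nonneg _ _ _ _)
          (mul_nonneg (norm_nonneg _) (norm_nonneg _)))
    have i6 : ‖∫ τ in (0 : ℝ)..T, inner ℂ (∫ τ' in (0 : ℝ)..τ, opS d (τ - τ') (h τ')) (h τ)‖ ≤
        1 / 4 * Q := by
      refine i5.trans ?_
      simp only [intervalIntegral.integral_const_mul]
      calc _ ≤ ρ ^ 2 * K * (K * Q) :=
            mul_le_mul_of_nonneg_left (D.schur T hT φ hφc) (by positivity)
        _ = (ρ * K) ^ 2 * Q := by ring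
        _ ≤ (1 / 2) ^ 2 * Q := by gcongr
        _ = _ := by ring
    have i7 : ‖c * (Q : ℂ)‖ = Q := by
      rw [norm_mul, hc, one_mul, Complex.norm_real, Real.norm_of_nonneg hQ0]
    rw [i3] at i4
    have i8 := norm_add_le_of_le (norm_add_le_of_le
      (norm_inner_le_norm (𝕜 := ℂ) f (∫ τ in (0 : ℝ)..T, opC d τ (h τ)))
      (norm_inner_le_norm (𝕜 := ℂ) g (∫ τ in (0 : ℝ)..T, opS d τ (h τ)))) i6
    rw [← i4, i7] at i8
    nlinarith [mul_le_mul_of_nonneg_left hC (norm_nonneg f),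
      mul_le_mul_of_nonneg_left hS (norm_nonneg g)]
  have hX : √Q ≤ ‖f‖ + ‖g‖ := by
    by_contra! hlt
    have : 0 < √Q := lt_of_le_of_lt (by positivity) hlt
    nlinarith [sq_sqrt hQ0]
  have hL : ‖opC d T f + opS d T g‖ ≤ ‖f‖ + ‖g‖ :=
    norm_add_le_of_le
      (((opC d T).le_opNorm f).trans (mul_le_of_le_one_left (norm_nonneg _) (norm_opC_le T)))
      (((opS d T).le_opNorm g).trans (mul_le_of_le_one_left (norm_nonneg _) (norm_opS_le T)))
  rw [hveq T]
  have := norm_add_le_of_le hL hD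
  linarith

lemma IsWeight.comp_neg (hb : IsWeight d P q ρ β b) : IsWeight d P q ρ β fun t => b (-t) where
  cont := hb.cont.comp continuous_neg
  norm_le t := hb.norm_le _
  symm t := hb.symm _
  lpLE t := by simpa only [abs_neg] using hb.lpLE (-t)
  norm_apply_le t := by simpa only [abs_neg] using hb.norm_apply_le (-t)

/-- Uniform `ℓ²` bound for solutions of the Klein-Gordon equation with a small decaying
potential. -/
lemma Dispersive.norm_le (D : Dispersive d P q a β K) (hb : IsWeight d P q ρ β b)
    (hρ : 0 ≤ ρ) (hρK : ρ * K ≤ 1 / 2) {c : ℂ} (hc : ‖c‖ = 1) {f g : L2Z d} {v : ℝ → L2Z d}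
    (hv : Continuous v) (hveq : ∀ t, v t = opC d t f + opS d t g +
      ∫ τ in (0 : ℝ)..t, opS d (t - τ) (c • b τ (b τ (v τ)))) (T : ℝ) :
    ‖v T‖ ≤ 2 * (‖f‖ + ‖g‖) := by
  rcases le_total 0 T with hT | hT
  · exact D.norm_le_of_nonneg hb hρ hρK hc hv hveq hT
  · have := D.norm_le_of_nonneg (f := f) (g := -g) (v := fun t => v (-t)) hb.comp_neg hρ hρK hc
      (hv.comp continuous_neg) (fun t => by
        have e := intervalIntegral.integral_comp_neg (a := 0) (b := t)
          fun τ => opS d (-t - τ) (c • b τ (b τ (v τ)))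
        rw [hveq (-t), opC_neg, opS_neg, map_neg, neg_apply, intervalIntegral.integral_symm]
        rw [neg_zero] at e
        rw [← e, ← intervalIntegral.integral_neg]
        congr 1
        refine intervalIntegral.integral_congr fun τ _ => ?_
        rw [show -t - -τ = -(t - τ) by ring, opS_neg, neg_apply, neg_neg]) (T := -T) (by linarith)
    rwa [neg_neg, norm_neg] at this

end Energy

/-- Duhamel solutions of `v_tt + (1 - Δ) v = c b² v` with data `(f,g)`. -/
def IsSol (d : ℕ) (c : ℂ) (b : ℝ → L2Z d →L[ℂ] L2Z d) (f g : L2Z d) (v : ℝ → L2Z d) : Prop :=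
  Continuous v ∧ ∀ t, v t = opC d t f + opS d t g +
    ∫ τ in (0 : ℝ)..t, opS d (t - τ) (c • b τ (b τ (v τ)))

section Linear

variable {d : ℕ} {P q a β K ρ : ℝ} {b : ℝ → L2Z d →L[ℂ] L2Z d} {c : ℂ} {f g f' g' : L2Z d}
  {v v' : ℝ → L2Z d}

lemma norm_opC_add_opS_le (t : ℝ) (f g : L2Z d) : ‖opC d t f + opS d t g‖ ≤ ‖f‖ + ‖g‖ :=
  norm_add_le_of_le
    (((opC d t).le_opNorm f).trans (mul_le_of_le_one_left (norm_nonneg _) (norm_opC_le t)))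
    (((opS d t).le_opNorm g).trans (mul_le_of_le_one_left (norm_nonneg _) (norm_opS_le t)))

lemma continuous_opC_add_opS (f g : L2Z d) : Continuous fun t => opC d t f + opS d t g :=
  (continuous_opC.clm_apply continuous_const).add (continuous_opS.clm_apply continuous_const)

lemma IsSol.add_smul (hb : IsWeight d P q ρ β b) (h : IsSol d c b f g v)
    (h' : IsSol d c b f' g' v') (z : ℂ) :
    IsSol d c b (f + z • f') (g + z • g') (v + z • v') := by
  refine ⟨h.1.add (h'.1.const_smul z), fun t => ?_⟩
  have hi : ∀ {w : ℝ → L2Z d}, Continuous w →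
      IntervalIntegrable (fun τ => opS d (t - τ) (c • b τ (b τ (w τ)))) volume 0 t := fun hw =>
    ((continuous_opS.comp (continuous_const.sub continuous_id)).clm_apply
      ((hb.cont.clm_apply (hb.cont.clm_apply hw)).const_smul c)).intervalIntegrable _ _
  have e : ∀ τ, opS d (t - τ) (c • b τ (b τ ((v + z • v') τ))) =
      opS d (t - τ) (c • b τ (b τ (v τ))) + z • opS d (t - τ) (c • b τ (b τ (v' τ))) := fun τ => by
    simp only [Pi.add_apply, Pi.smul_apply, map_add, map_smul, smul_add, smul_comm c z]
  have e' := intervalIntegral.integral_add (hi h.1) ((hi h'.1).smul z)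
  simp only [Pi.smul_apply] at e'
  simp only [e]
  rw [e', intervalIntegral.integral_smul,
    Pi.add_apply, Pi.smul_apply, h.2 t, h'.2 t]
  simp only [map_add, map_smul, smul_add]
  abel

lemma IsSol.eq (D : Dispersive d P q a β K) (hb : IsWeight d P q ρ β b)
    (hρ : 0 ≤ ρ) (hρK : ρ * K ≤ 1 / 2) (hc : ‖c‖ = 1) (h : IsSol d c b f g v)
    (h' : IsSol d c b f g v') (t : ℝ) : v t = v' t := by
  have h1 := h.add_smul hb h' (-1)
  have := D.norm_le hb hρ hρK hc h1.1 h1.2 t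
  simp only [Pi.add_apply, neg_smul, one_smul, add_neg_cancel, norm_zero, add_zero,
    mul_zero] at this
  exact add_neg_eq_zero.1 (norm_le_zero_iff.1 this)

/-- The `ℓ^P` decay is propagated by Duhamel's formula. -/
lemma Dispersive.lpLE_of_lpLE (D : Dispersive d P q a β K) (hb : IsWeight d P q ρ β b)
    (hρ : 0 ≤ ρ) (hρK : ρ * K ≤ 1 / 2) (hc : ‖c‖ = 1) {B B' M : ℝ} (hf : LpLE q f B)
    (hg : LpLE q g B') (hM : 2 * K * (B + B') ≤ M) (hv : Continuous v)
    (hvM : ∀ t, LpLE P (v t) (M * (1 + |t|) ^ (-a))) (t : ℝ) :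
    LpLE P (opC d t f + opS d t g + ∫ τ in (0 : ℝ)..t, opS d (t - τ) (c • b τ (b τ (v τ))) : L2Z d)
      (M * (1 + |t|) ^ (-a)) := by
  have hK := D.one_le
  have hM0 : 0 ≤ M := by simpa using (hvM 0).1
  have h1 := D.duhamel_lpLE (h := fun τ => c • b τ (b τ (v τ))) (M := ρ ^ 2 * M)
    ((hb.cont.clm_apply (hb.cont.clm_apply hv)).const_smul c) (fun τ => by
      have h2 := (hb.lpLE τ (b τ (v τ))).const_mul c
      rw [hc, one_mul] at h2
      refine h2.mono D.conj.symm.nonneg ?_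
      have h3 : (1 + |τ|) ^ (-(a + 2 * β)) =
          (1 + |τ|) ^ (-β) * (1 + |τ|) ^ (-β) * (1 + |τ|) ^ (-a) := by
        rw [← rpow_add (by positivity), ← rpow_add (by positivity)]
        ring_nf
      calc _ ≤ ρ * (1 + |τ|) ^ (-β) * (ρ * (1 + |τ|) ^ (-β) * (M * (1 + |τ|) ^ (-a))) := by
            gcongr
            exact hb.norm_apply_le τ _ _ (hvM τ)
        _ = _ := by rw [h3]; ring) t
  refine ((D.linear_lpLE hf hg t).add D.conj h1).mono D.conj.nonneg ?_
  rw [← add_mul]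
  refine mul_le_mul_of_nonneg_right ?_ (by positivity)
  have : (ρ * K) ^ 2 ≤ (1 / 2) ^ 2 := pow_le_pow_left₀ (by positivity) hρK 2
  nlinarith

lemma isClosed_lpLE {p : ℝ} (hp : 0 < p) (B : ℝ) : IsClosed {h : L2Z d | LpLE p h B} :=
  isClosed_of_closure_subset fun h hh => by
    obtain ⟨F, hF, hFh⟩ := mem_closure_iff_seq_limit.1 hh
    exact .of_tendsto hp tendsto_const_nhds (fun x =>
      ((lp.evalCLM ℂ (fun _ : Fin d → ℤ => ℂ) 2 x).continuous.tendsto h).comp hFh) hF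

lemma lpLE_zero {ι : Type*} {p B : ℝ} (hp : 0 < p) (hB : 0 ≤ B) : LpLE p (0 : ι → ℂ) B :=
  ⟨hB, fun A => by
    simp only [Pi.zero_apply, norm_zero, zero_rpow hp.ne', Finset.sum_const_zero]
    positivity⟩

lemma IsWeight.exists_isSol (hb : IsWeight d P q ρ β b) (hc : ‖c‖ = 1) (f g : L2Z d)
    {A : ℝ → Set (L2Z d)} (hA : ∀ t, IsClosed (A t)) (hA0 : ∀ t, (0 : L2Z d) ∈ A t)
    (hinv : ∀ v : ℝ → L2Z d, Continuous v → (∀ t, v t ∈ A t) → ∀ t, opC d t f + opS d t g +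
      ∫ τ in (0 : ℝ)..t, opS d (t - τ) (c • b τ (b τ (v τ))) ∈ A t) :
    ∃ v, IsSol d c b f g v ∧ ∀ t, v t ∈ A t := by
  obtain ⟨v, hv, hveq, hvA⟩ := exists_volterra (F := fun τ z => c • b τ (b τ z)) continuous_opS
    norm_opS_le one_pos (fun τ => by simp) (fun τ x y => by
      rw [← smul_sub, ← map_sub, ← map_sub, norm_smul, hc]
      have h1 := fun z => ((b τ).le_opNorm z).trans
        (mul_le_of_le_one_left (norm_nonneg z) (hb.norm_le τ))
      exact mul_le_mul_of_nonneg_left ((h1 _).trans (h1 _)) zero_le_one)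
    (fun v hv => (hb.cont.clm_apply (hb.cont.clm_apply hv)).const_smul c)
    (continuous_opC_add_opS f g) (fun t => norm_opC_add_opS_le t f g) hA hA0 hinv
  exact ⟨v, ⟨hv, hveq⟩, hvA⟩

lemma Dispersive.exists_isSol_lpLE (D : Dispersive d P q a β K) (hb : IsWeight d P q ρ β b)
    (hρ : 0 ≤ ρ) (hρK : ρ * K ≤ 1 / 2) (hc : ‖c‖ = 1) {B B' M : ℝ} (hf : LpLE q f B)
    (hg : LpLE q g B') (hM : 2 * K * (B + B') ≤ M) :
    ∃ v, IsSol d c b f g v ∧ ∀ t, LpLE P (v t) (M * (1 + |t|) ^ (-a)) := by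
  have hK := D.one_le
  have hM0 : 0 ≤ M := le_trans (mul_nonneg (by positivity) (add_nonneg hf.1 hg.1)) hM
  exact hb.exists_isSol hc f g
    (A := fun t => {h | LpLE P h (M * (1 + |t|) ^ (-a))})
    (fun t => isClosed_lpLE D.conj.pos _)
    (fun t => lpLE_zero D.conj.pos (by positivity))
    fun v hv hvA t => D.lpLE_of_lpLE hb hρ hρK hc hf hg hM hv hvA t

/-- The solution operator with data `(i f, j f)`, bounded on `ℓ²` and from `ℓ^q` to `ℓ^P`. -/
lemma Dispersive.exists_solOp (D : Dispersive d P q a β K)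
    (hb : IsWeight d P q ρ β b) (hρ : 0 ≤ ρ) (hρK : ρ * K ≤ 1 / 2) (hc : ‖c‖ = 1) {i j : ℂ}
    (hij : ‖i‖ + ‖j‖ ≤ 1) (t : ℝ) : ∃ U : L2Z d →L[ℂ] L2Z d,
      (∀ f, ∃ v, IsSol d c b (i • f) (j • f) v ∧ v t = U f) ∧ FormBound 2 2 U ∧
        FormBound q (2 * K * (1 + |t|) ^ (-a)) U := by
  have hK := D.one_le
  have hex : ∀ f : L2Z d, ∃ v, IsSol d c b (i • f) (j • f) v := fun f =>
    (hb.exists_isSol hc _ _ (A := fun _ => Set.univ) (fun _ => isClosed_univ)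
      (fun _ => Set.mem_univ _) fun _ _ _ _ => Set.mem_univ _).imp fun _ h => h.1
  choose S hS using hex
  have hSa : ∀ f f' z, S (f + z • f') t = S f t + z • S f' t := fun f f' z => by
    have := (hS f).add_smul hb (hS f') z
    rw [smul_comm z i, smul_comm z j, ← smul_add, ← smul_add] at this
    exact (hS _).eq D hb hρ hρK hc this t
  have hS0 : S 0 t = 0 := by
    have := hSa 0 0 1
    rwa [one_smul, one_smul, add_zero, left_eq_add] at this
  have hn : ∀ f, ‖S f t‖ ≤ 2 * ‖f‖ := fun f => by
    refine (D.norm_le hb hρ hρK hc (hS f).1 (hS f).2 t).trans ?_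
    rw [norm_smul, norm_smul, ← add_mul]
    exact mul_le_mul_of_nonneg_left (mul_le_of_le_one_left (norm_nonneg _) hij) two_pos.le
  obtain ⟨U, hU, hU2⟩ : ∃ U : L2Z d →L[ℂ] L2Z d, (∀ f, U f = S f t) ∧ ‖U‖ ≤ 2 :=
    ⟨LinearMap.mkContinuous
      { toFun := fun f => S f t
        map_add' := fun f f' => by simpa only [one_smul] using hSa f f' 1
        map_smul' := fun z f => by simpa only [hS0, zero_add, RingHom.id_apply] using hSa 0 f z } 2 hn,
      fun f => rfl, LinearMap.mkContinuous_norm_le _ two_pos.le _⟩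
  refine ⟨U, fun f => ⟨S f, hS f, (hU f).symm⟩, formBound_two hU2,
    .of_lpLE D.conj fun f B hf => ?_⟩
  have hi : LpLE q (i • f : L2Z d) (‖i‖ * B) := hf.const_mul i
  have hj : LpLE q (j • f : L2Z d) (‖j‖ * B) := hf.const_mul j
  have hB := hf.1
  have hM : 2 * K * (‖i‖ * B + ‖j‖ * B) ≤ 2 * K * B := by
    rw [← add_mul]
    exact mul_le_mul_of_nonneg_left (mul_le_of_le_one_left hB hij) (by positivity)
  obtain ⟨w, hw, hwA⟩ := D.exists_isSol_lpLE hb hρ hρK hc hi hj hM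
  have := hwA t
  rw [hU]
  rw [hw.eq D hb hρ hρK hc (hS f) t] at this
  exact this.mono D.conj.nonneg (le_of_eq (by ring))

/-- Interpolated decay of solutions of the Klein-Gordon equation with a small decaying
potential. -/
lemma IsSol.lpLE (D : Dispersive d P q a β K) (hb : IsWeight d P q ρ β b) (hρ : 0 ≤ ρ)
    (hρK : ρ * K ≤ 1 / 2) (hc : ‖c‖ = 1) (h : IsSol d c b f g v) {p p' θ : ℝ}
    (hp : p.HolderConjugate p') (hθ : θ ∈ Set.Icc (0 : ℝ) 1)
    (hθp : 1 / p' = (1 - θ) / q + θ / 2) {B B' : ℝ} (hf : LpLE p' f B) (hg : LpLE p' g B') (t : ℝ) :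
    LpLE p (v t) (2 * K * (1 + |t|) ^ (-(a * (1 - θ))) * (B + B')) := by
  have hK := D.one_le
  have key : ∀ U : L2Z d →L[ℂ] L2Z d, FormBound 2 2 U →
      FormBound q (2 * K * (1 + |t|) ^ (-a)) U →
      FormBound p' (2 * K * (1 + |t|) ^ (-(a * (1 - θ)))) U := fun U h2 hq' => by
    refine (hq'.interp D.conj.symm.pos hp.symm.pos hθ (by positivity) two_pos.le hθp h2).mono ?_
    rw [mul_rpow (by positivity) (by positivity), ← rpow_mul (by positivity), neg_mul]
    have : (2 * K) ^ (1 - θ) * 2 ^ θ ≤ 2 * K := by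
      calc _ ≤ (2 * K) ^ (1 - θ) * (2 * K) ^ θ := by
            refine mul_le_mul_of_nonneg_left ?_ (by positivity)
            exact rpow_le_rpow two_pos.le (by linarith) hθ.1
        _ = _ := by rw [← rpow_add (by positivity), sub_add_cancel, rpow_one]
    nlinarith [mul_le_mul_of_nonneg_right this
      (by positivity : 0 ≤ (1 + |t|) ^ (-(a * (1 - θ))))]
  obtain ⟨U, hU, hU2, hUq⟩ := D.exists_solOp hb hρ hρK hc (i := 1) (j := 0) (by simp) t
  obtain ⟨V, hV, hV2, hVq⟩ := D.exists_solOp hb hρ hρK hc (i := 0) (j := 1) (by simp) t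
  obtain ⟨u, hu, hut⟩ := hU f
  obtain ⟨w, hw, hwt⟩ := hV g
  have h1 := hu.add_smul hb hw 1
  simp only [zero_smul, one_smul, add_zero, zero_add] at h1
  rw [h.eq D hb hρ hρK hc h1 t, Pi.add_apply, hut, hwt, mul_add]
  exact ((key U hU2 hUq).lpLE hp (by positivity) hf).add hp
    ((key V hV2 hVq).lpLE hp (by positivity) hg)

end Linear

section Weight

variable {ι : Type*} {s : ℝ}

/-- The truncated power `min(|z|^s, 1)`. -/
def truncPow (s : ℝ) (z : ℂ) : ℝ := min (‖z‖ ^ s) 1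

lemma truncPow_nonneg (s : ℝ) (z : ℂ) : 0 ≤ truncPow s z :=
  le_min (rpow_nonneg (norm_nonneg _) _) zero_le_one

lemma norm_truncPow (s : ℝ) (z : ℂ) : ‖(truncPow s z : ℂ)‖ = truncPow s z := by
  rw [Complex.norm_real, norm_of_nonneg (truncPow_nonneg s z)]

lemma min_rpow_one (hs : 0 ≤ s) {x : ℝ} (hx : 0 ≤ x) : min (x ^ s) 1 = min x 1 ^ s := by
  rcases le_total x 1 with h | h
  · rw [min_eq_left h, min_eq_left (rpow_le_one hx h hs)]
  · rw [min_eq_right h, min_eq_right (one_le_rpow h hs), one_rpow]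

lemma uniformContinuous_truncPow (hs : 0 ≤ s) : UniformContinuous (truncPow s) := by
  have h1 : UniformContinuous fun y : Set.Icc (0 : ℝ) 1 => (y : ℝ) ^ s :=
    CompactSpace.uniformContinuous_of_continuous
      (continuous_subtype_val.rpow_const fun _ => .inr hs)
  have h2 := h1.comp ((LipschitzWith.projIcc (zero_le_one (α := ℝ))).uniformContinuous.comp
    (uniformContinuous_norm (E := ℂ)))
  have e : truncPow s = (fun y : Set.Icc (0 : ℝ) 1 => (y : ℝ) ^ s) ∘
      (Set.projIcc 0 1 zero_le_one ∘ fun z : ℂ => ‖z‖) := funext fun z => by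
    simp only [Function.comp_apply, Set.coe_projIcc]
    rw [truncPow, min_rpow_one hs (norm_nonneg _), min_comm,
      max_eq_right (le_min zero_le_one (norm_nonneg z))]
  rwa [e]

lemma sq_min_rpow_sub_mul_le (hs : 1 ≤ 2 * s) {x y : ℝ} (hy : 0 ≤ y) (hyx : y ≤ x) :
    |min (x ^ s) 1 ^ 2 - min (y ^ s) 1 ^ 2| * y ≤ 2 * s * (x - y) := by
  have hs0 : 0 ≤ s := by linarith
  have hx := hy.trans hyx
  have hp : ∀ {z : ℝ}, 0 ≤ z → (z ^ s) ^ 2 = z ^ (2 * s) := fun hz => by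
    rw [← rpow_natCast, ← rpow_mul hz, mul_comm]; norm_num
  have hm : min y 1 ≤ min x 1 := min_le_min_right _ hyx
  have hm0 : 0 ≤ min y 1 := le_min hy zero_le_one
  rw [min_rpow_one hs0 hx, min_rpow_one hs0 hy, hp (hm0.trans hm), hp hm0,
    abs_of_nonneg (sub_nonneg.2 (rpow_le_rpow hm0 hm (by linarith)))]
  rcases le_total 1 y with h | h
  · rw [min_eq_right h, min_eq_right (h.trans hyx), sub_self, zero_mul]
    exact mul_nonneg (by linarith) (by linarith)
  rw [min_eq_left h] at hm ⊢
  set m := min x 1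
  have hmx : m ≤ x := min_le_left _ _
  have hm1 : m ≤ 1 := min_le_right _ _
  rcases (hy.trans hm).eq_or_lt with h0 | h0
  · rw [le_antisymm (h0 ▸ hm) hy, mul_zero, sub_zero]
    exact mul_nonneg (by linarith) hx
  have hb := one_add_mul_self_le_rpow_one_add (s := y / m - 1)
    (by linarith [div_nonneg hy h0.le]) hs
  rw [add_sub_cancel, div_rpow hy h0.le, le_div_iff₀ (rpow_pos_of_pos h0 _)] at hb
  have e : m ^ (2 * s) = m ^ (2 * s - 1) * m := by
    rw [← rpow_add_one h0.ne', sub_add_cancel]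
  have h2 : m ^ (2 * s - 1) ≤ 1 := rpow_le_one h0.le hm1 (by linarith)
  have h3 : 0 ≤ m ^ (2 * s - 1) := rpow_nonneg h0.le _
  have e2 : (1 + 2 * s * (y / m - 1)) * m ^ (2 * s) =
      m ^ (2 * s) - 2 * s * (m - y) * m ^ (2 * s - 1) := by
    rw [e]
    field_simp
    ring
  rw [e2] at hb
  have h4 : 0 ≤ 2 * s * (m - y) := mul_nonneg (by linarith) (by linarith)
  have h5 : m ^ (2 * s) - y ^ (2 * s) ≤ 2 * s * (m - y) := by nlinarith
  have h6 : 0 ≤ m ^ (2 * s) - y ^ (2 * s) := sub_nonneg.2 (rpow_le_rpow hy hm (by linarith))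
  nlinarith

lemma norm_truncPow_mul_sub_le (hs : 1 ≤ 2 * s) (z w : ℂ) :
    ‖(truncPow s z : ℂ) * (truncPow s z * z) - truncPow s w * (truncPow s w * w)‖ ≤
      (1 + 2 * s) * ‖z - w‖ := by
  wlog h : ‖w‖ ≤ ‖z‖ generalizing z w
  · rw [norm_sub_rev, norm_sub_rev z]
    exact this w z (le_of_not_ge h)
  have e : (truncPow s z : ℂ) * (truncPow s z * z) - truncPow s w * (truncPow s w * w) =
      ((truncPow s z ^ 2 : ℝ) : ℂ) * (z - w) +
        ((truncPow s z ^ 2 - truncPow s w ^ 2 : ℝ) : ℂ) * w := by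
    push_cast
    ring
  have h1 : truncPow s z ^ 2 ≤ 1 := pow_le_one₀ (truncPow_nonneg s z) (min_le_right _ _)
  have h2 := sq_min_rpow_sub_mul_le hs (norm_nonneg w) h
  have h3 : ‖z‖ - ‖w‖ ≤ ‖z - w‖ := norm_sub_norm_le z w
  rw [e]
  refine (norm_add_le _ _).trans ?_
  rw [norm_mul, norm_mul, Complex.norm_real, Complex.norm_real, norm_of_nonneg (sq_nonneg _),
    add_mul, Real.norm_eq_abs]
  exact add_le_add (mul_le_mul_of_nonneg_right h1 (norm_nonneg _))
    (h2.trans (mul_le_mul_of_nonneg_left h3 (by linarith)))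

lemma norm_truncPow_mul_le (s : ℝ) (z w : ℂ) : ‖(truncPow s z : ℂ) * w‖ ≤ ‖w‖ := by
  rw [norm_mul, norm_truncPow]
  exact mul_le_of_le_one_left (norm_nonneg _) (min_le_right _ _)

/-- Multiplication by `min(|u|^s, 1)` on `ℓ²`. -/
def weightOp (s : ℝ) (u : L2 ι) : L2 ι →L[ℂ] L2 ι :=
  LinearMap.mkContinuous
    { toFun := fun f => ⟨fun x => (truncPow s (u x) : ℂ) * f x,
        ((L2.lpLE f).of_norm_le two_pos.le fun x => norm_truncPow_mul_le s (u x) (f x)).memℓp⟩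
      map_add' := fun f g => lp.ext (funext fun x => mul_add _ _ _)
      map_smul' := fun z f => lp.ext (funext fun x => mul_left_comm _ _ _) } 1 fun f => by
    rw [one_mul]
    exact LpLE.norm_L2_le
      ((L2.lpLE f).of_norm_le two_pos.le fun x => norm_truncPow_mul_le s (u x) (f x))

lemma weightOp_apply (s : ℝ) (u f : L2 ι) (x : ι) :
    weightOp s u f x = (truncPow s (u x) : ℂ) * f x := rfl

lemma norm_weightOp_le (s : ℝ) (u : L2 ι) : ‖weightOp s u‖ ≤ 1 :=
  LinearMap.mkContinuous_norm_le _ zero_le_one _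

lemma inner_weightOp_left (s : ℝ) (u f g : L2 ι) :
    inner ℂ (weightOp s u f) g = inner ℂ f (weightOp s u g) := by
  rw [lp.inner_eq_tsum, lp.inner_eq_tsum]
  refine tsum_congr fun x => ?_
  rw [weightOp_apply, weightOp_apply, RCLike.inner_apply, RCLike.inner_apply, map_mul,
    Complex.conj_ofReal]
  ring

lemma norm_le_of_forall_norm_apply_le {f g : L2 ι} {B : ℝ} (hB : 0 ≤ B)
    (h : ∀ x, ‖f x‖ ≤ B * ‖g x‖) : ‖f‖ ≤ B * ‖g‖ := by
  have := (L2.lpLE g).const_mul (B : ℂ)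
  rw [Complex.norm_real, norm_of_nonneg hB] at this
  refine (this.of_norm_le two_pos.le fun x => ?_).norm_L2_le
  rw [norm_mul, Complex.norm_real, norm_of_nonneg hB]
  exact h x

lemma continuous_weightOp (hs : 0 ≤ s) : Continuous (weightOp s : L2 ι → _) := by
  refine Metric.continuous_iff.2 fun u ε hε => ?_
  obtain ⟨η, hη, h⟩ := Metric.uniformContinuous_iff.1 (uniformContinuous_truncPow hs) (ε / 2)
    (half_pos hε)
  refine ⟨η, hη, fun v hv => ?_⟩
  rw [dist_eq_norm]
  refine lt_of_le_of_lt (ContinuousLinearMap.opNorm_le_bound _ (half_pos hε).le fun f =>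
    norm_le_of_forall_norm_apply_le (half_pos hε).le fun x => ?_) (half_lt_self hε)
  have hx : dist (v x) (u x) < η := by
    rw [dist_eq_norm] at hv ⊢
    exact (lp.norm_apply_le_norm two_ne_zero (v - u) x).trans_lt hv
  have e : (weightOp s v - weightOp s u) f x =
      ((truncPow s (v x) - truncPow s (u x) : ℝ) : ℂ) * f x := by
    rw [sub_apply, lp.coeFn_sub, Pi.sub_apply, weightOp_apply, weightOp_apply]
    push_cast
    ring
  rw [e, norm_mul, Complex.norm_real]
  exact mul_le_mul_of_nonneg_right (h hx).le (norm_nonneg _)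

lemma norm_weightOp_weightOp_sub_le (hs : 1 ≤ 2 * s) (u v : L2 ι) :
    ‖weightOp s u (weightOp s u u) - weightOp s v (weightOp s v v)‖ ≤ (1 + 2 * s) * ‖u - v‖ :=
  norm_le_of_forall_norm_apply_le (by linarith) fun x => by
    rw [lp.coeFn_sub, lp.coeFn_sub, Pi.sub_apply, Pi.sub_apply, weightOp_apply, weightOp_apply,
      weightOp_apply, weightOp_apply]
    exact norm_truncPow_mul_sub_le hs _ _

end Weight

section Nonlinear

variable {d : ℕ} {P q a s K R : ℝ}

lemma isWeight_weightOp (hPq : P.HolderConjugate q) (hP : 2 < P) (hPs : P - 2 ≤ 2 * s)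
    (hR0 : 0 ≤ R) {v : ℝ → L2Z d} (hv : Continuous v)
    (hvR : ∀ t, LpLE P (v t) (R * (1 + |t|) ^ (-a))) :
    IsWeight d P q (R ^ s) (s * a) fun t => weightOp s (v t) := by
  have hs : 0 < s := by linarith
  have hr : 0 < 2 * P / (P - 2) := by have := hPq.pos; have : 0 < P - 2 := by linarith
                                      positivity
  have hq : q = P / (P - 1) := hPq.conjugate_eq
  have hw : ∀ t, LpLE (2 * P / (P - 2)) (fun x => (truncPow s (v t x) : ℂ))
      (R ^ s * (1 + |t|) ^ (-(s * a))) := fun t => by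
    have := (hvR t).rpow (g := fun x => (truncPow s (v t x) : ℂ)) hs (fun x => by
      rw [norm_truncPow]
      exact min_le_left _ _) hPq.pos
    rw [mul_rpow hR0 (by positivity), ← rpow_mul (by positivity), neg_mul, mul_comm a] at this
    refine this.exponent_mono (div_pos hPq.pos hs) ?_
    rw [div_le_div_iff₀ hs (by linarith)]
    nlinarith [hPq.pos]
  refine ⟨(continuous_weightOp hs.le).comp hv, fun t => norm_weightOp_le _ _,
    fun t => inner_weightOp_left _ _, fun t f => ?_, fun t f B hf => ?_⟩
  · refine (hw t).mul hr two_pos hPq.symm.pos ?_ (L2.lpLE f)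
    have := hPq.pos
    rw [hq]
    field_simp
    ring
  · have h2 : 1 / (2 : ℝ) = 1 / (2 * P / (P - 2)) + 1 / P := by
      have := hPq.pos
      field_simp
      ring
    have h3 := (hw t).mul hr hPq.pos two_pos h2 hf
    exact LpLE.norm_L2_le (h := weightOp s (v t) f) h3

/-- Small solutions of the truncated nonlinear Klein-Gordon equation. -/
lemma Dispersive.exists_nonlinear (D : Dispersive d P q a (s * a) K) (hP : 2 < P)
    (hPs : P - 2 ≤ 2 * s) (hs : 1 ≤ 2 * s) (hR0 : 0 ≤ R) (hRK : R ^ s * K ≤ 1 / 2)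
    {c : ℂ} (hc : ‖c‖ = 1) {f g : L2Z d} {B B' : ℝ} (hf : LpLE q f B) (hg : LpLE q g B')
    (hB : 2 * K * (B + B') ≤ R) :
    ∃ u, IsSol d c (fun τ => weightOp s (u τ)) f g u ∧
      ∀ t, LpLE P (u t) (R * (1 + |t|) ^ (-a)) := by
  have hlip : ∀ x y : L2Z d, ‖c • weightOp s x (weightOp s x x) -
      c • weightOp s y (weightOp s y y)‖ ≤ (1 + 2 * s) * ‖x - y‖ := fun x y => by
    rw [← smul_sub, norm_smul, hc, one_mul]
    exact norm_weightOp_weightOp_sub_le hs x y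
  obtain ⟨u, hu, hueq, huA⟩ := exists_volterra (F := fun _ z => c • weightOp s z (weightOp s z z))
    (A := fun t => {h | LpLE P h (R * (1 + |t|) ^ (-a))}) continuous_opS norm_opS_le
    (by linarith : 0 < 1 + 2 * s) (fun τ => by simp only [map_zero, smul_zero])
    (fun _ => hlip)
    (fun v hv => by
      have h := continuous_weightOp (ι := Fin d → ℤ) (s := s) (by linarith)
      exact ((h.comp hv).clm_apply ((h.comp hv).clm_apply hv)).const_smul c)
    (continuous_opC_add_opS f g) (fun t => norm_opC_add_opS_le t f g)
    (fun t => isClosed_lpLE D.conj.pos _) (fun t => lpLE_zero D.conj.pos (by positivity))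
    (fun v hv hvA t => D.lpLE_of_lpLE (isWeight_weightOp D.conj hP hPs hR0 hv hvA)
      (rpow_nonneg hR0 s) hRK hc hf hg hB hv hvA t)
  exact ⟨u, ⟨hu, hueq⟩, huA⟩

end Nonlinear

lemma pD_eq (d : ℕ) : pD d = 2 * sD d + 2 := by
  rw [pD, sD]
  split_ifs <;> ring

lemma half_le_sD {d : ℕ} (hd : d = 2 ∨ d = 3 ∨ d = 4) : 1 / 2 ≤ sD d := by
  rcases hd with rfl | rfl | rfl
  · have : (5 : ℝ) ≤ √97 := le_sqrt_of_sq_le (by norm_num)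
    norm_num [sD]
    linarith
  · have : (15 : ℝ) ≤ √337 := le_sqrt_of_sq_le (by norm_num)
    norm_num [sD]
    linarith
  · norm_num [sD]

lemma holderConjugate_conjR {p : ℝ} (hp : 2 ≤ p) : p.HolderConjugate (conjR p) :=
  .conjExponent (by linarith)

lemma conjR_le_two {p : ℝ} (hp : 2 ≤ p) : conjR p ≤ 2 := by
  rw [conjR, div_le_iff₀ (by linarith)]
  linarith

lemma conjR_anti {p r : ℝ} (hp : 2 ≤ p) (hpr : p ≤ r) : conjR r ≤ conjR p := by
  rw [conjR, conjR, div_le_div_iff₀ (by linarith) (by linarith)]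
  linarith

/-- The exponents for which the nonlinear decay closes. -/
lemma exists_sigmaD_gt {d : ℕ} (hd : d = 2 ∨ d = 3 ∨ d = 4) {δ : ℝ} (hδ : 0 < δ) {s : ℝ}
    (hs : sD d < s) : ∃ δ' > 0, δ' ≤ δ ∧ δ' ≤ 1 / 2 ∧
      sigmaD d δ' * (pD d - 2) / pD d ≤ 1 ∧ 1 < sigmaD d δ' * (pD d - 2) / pD d * (2 * s + 1) := by
  have h2 := half_le_sD hd
  have hP := pD_eq d
  have hP0 : 0 < pD d := by linarith
  rcases hd with rfl | rfl | rfl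
  · have hsq : √97 ^ 2 = 97 := sq_sqrt (by norm_num)
    have e : sD 2 = (1 + √97) / 12 := by norm_num [sD]
    refine ⟨min δ (1 / 2), by positivity, min_le_left _ _, min_le_right _ _, ?_, ?_⟩
    · rw [div_le_one hP0, sigmaD, if_pos rfl]
      linarith
    · rw [div_mul_eq_mul_div, one_lt_div hP0, sigmaD, if_pos rfl, hP]
      nlinarith
  · have hsq : √337 ^ 2 = 337 := sq_sqrt (by norm_num)
    have hr : √337 ≤ 19 := (sqrt_le_left (by norm_num)).2 (by norm_num)
    have e : sD 3 = (√337 - 1) / 28 := by norm_num [sD]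
    have e2 : ∀ δ', sigmaD 3 δ' = 7 / 6 := fun δ' => by norm_num [sigmaD]
    refine ⟨min δ (1 / 2), by positivity, min_le_left _ _, min_le_right _ _, ?_, ?_⟩
    · rw [div_le_one hP0, e2]
      linarith
    · rw [div_mul_eq_mul_div, one_lt_div hP0, e2, hP]
      nlinarith
  · have e : sD 4 = 1 / 2 := by norm_num [sD]
    have e2 : ∀ δ', sigmaD 4 δ' = 3 / 2 - δ' := fun δ' => by norm_num [sigmaD]
    rw [e] at hs
    have hm : 0 < (2 * s - 1) / (2 * s + 1) := div_pos (by linarith) (by linarith)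
    refine ⟨min (min δ (1 / 2)) ((2 * s - 1) / (2 * s + 1)), lt_min (by positivity) hm,
      (min_le_left _ _).trans (min_le_left _ _), (min_le_left _ _).trans (min_le_right _ _), ?_, ?_⟩
    · rw [div_le_one hP0, e2, hP, e]
      have : 0 < min (min δ (1 / 2)) ((2 * s - 1) / (2 * s + 1)) := lt_min (by positivity) hm
      linarith
    · rw [div_mul_eq_mul_div, one_lt_div hP0, e2, hP, e]
      have : min (min δ (1 / 2)) ((2 * s - 1) / (2 * s + 1)) * (2 * s + 1) ≤ 2 * s - 1 := by
        rw [← le_div_iff₀ (by linarith)]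
        exact min_le_right _ _
      linarith

lemma exists_dispersive {d : ℕ} (hd : d = 2 ∨ d = 3 ∨ d = 4) {δ : ℝ} (hδ : 0 < δ) {s : ℝ}
    (hs : sD d < s) : ∃ σ K : ℝ, sigmaD d δ ≤ σ ∧
      Dispersive d (pD d) (conjR (pD d)) (σ * (pD d - 2) / pD d)
        (s * (σ * (pD d - 2) / pD d)) K := by
  obtain ⟨δ', hδ', hδδ', hδ'2, ha1, ha⟩ := exists_sigmaD_gt hd hδ hs
  have h2 := half_le_sD hd
  have hP := pD_eq d
  have hP2 : 2 ≤ pD d := by linarith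
  have ha0 : 0 ≤ sigmaD d δ' * (pD d - 2) / pD d :=
    div_nonneg (mul_nonneg (sigmaD_nonneg hd hδ'2) (by linarith)) (by linarith)
  obtain ⟨C₁, hC₁, h₁⟩ := exists_formBound_opC_opS hd hδ' hδ'2
  set a := sigmaD d δ' * (pD d - 2) / pD d with ha_def
  obtain ⟨C₂, hC₂, h₂⟩ := exists_integral_weight_le ha0 ha1
    (by linarith : 1 < a + 2 * (s * a))
  obtain ⟨C₃, hC₃, h₃⟩ := exists_schur (β := s * a) ha0 ha1 (by linarith)
  have h1' := fun t => h₁ t _ _ hP2 (holderConjugate_conjR hP2)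
  have hexp : -sigmaD d δ' * (pD d - 2) / pD d = -a := by rw [ha_def]; ring
  rw [hexp] at h1'
  have k1 : C₁ ≤ max C₁ (max C₂ C₃) := le_max_left _ _
  have k2 : C₂ ≤ max C₁ (max C₂ C₃) := (le_max_left _ _).trans (le_max_right _ _)
  have k3 : C₃ ≤ max C₁ (max C₂ C₃) := (le_max_right _ _).trans (le_max_right _ _)
  refine ⟨sigmaD d δ', max C₁ (max C₂ C₃), ?_, holderConjugate_conjR hP2, hC₁.trans k1, ha0,
    fun t => (h1' t).1.mono (by gcongr), fun t => (h1' t).2.mono (by gcongr),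
    fun α γ t => (h₂ α γ t).trans (by gcongr), fun T hT φ hφ => (h₃ T hT φ hφ).trans ?_⟩
  · unfold sigmaD
    split_ifs <;> linarith
  · exact mul_le_mul_of_nonneg_right k3
      (intervalIntegral.integral_nonneg hT fun _ _ => sq_nonneg _)

lemma lpLE_toReal_eLpNorm {ι : Type*} [Countable ι] [MeasurableSpace ι]
    [MeasurableSingletonClass ι] {p : ℝ} (hp : 0 < p) {f : ι → ℂ}
    (hf : eLpNorm f (ENNReal.ofReal p) Measure.count ≠ ∞) :
    LpLE p f (eLpNorm f (ENNReal.ofReal p) Measure.count).toReal :=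
  (eLpNorm_count_le_iff hp ENNReal.toReal_nonneg).1 (ENNReal.ofReal_toReal hf).ge

lemma IsSol.apply_eq {d : ℕ} {s sgn : ℝ} {f g : L2Z d} {u : ℝ → L2Z d} (hs : 0 ≤ s)
    (h : IsSol d (-(sgn : ℂ)) (fun τ => weightOp s (u τ)) f g u) (hu : ∀ t x, ‖u t x‖ ≤ 1)
    (t : ℝ) (x : Fin d → ℤ) : u t x = cosProp d t f x + sinProp d t g x -
      (sgn : ℂ) * ∫ τ in (0 : ℝ)..t, sinProp d (t - τ) (nonlin d s (fun t => u t) τ) x := by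
  have hw : ∀ τ, ((weightOp s (u τ) (weightOp s (u τ) (u τ)) : L2Z d) : (Fin d → ℤ) → ℂ) =
      nonlin d s (fun t => u t) τ := fun τ => funext fun y => by
    have h1 : truncPow s (u τ y) = ‖u τ y‖ ^ s :=
      min_eq_left (rpow_le_one (norm_nonneg _) (hu τ y) hs)
    rw [weightOp_apply, weightOp_apply, nonlin, h1, ← mul_assoc, ← Complex.ofReal_mul,
      ← rpow_add_of_nonneg (norm_nonneg _) hs hs, two_mul]
  have hc : Continuous fun τ =>
      opS d (t - τ) (-(sgn : ℂ) • weightOp s (u τ) (weightOp s (u τ) (u τ))) := by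
    have h1 : Continuous fun τ => weightOp s (u τ) := (continuous_weightOp hs).comp h.1
    have h2 : Continuous fun τ => -(sgn : ℂ) • weightOp s (u τ) (weightOp s (u τ) (u τ)) :=
      (h1.clm_apply (h1.clm_apply h.1)).const_smul (-(sgn : ℂ))
    exact (continuous_opS.comp (continuous_const.sub continuous_id)).clm_apply h2
  have e := (lp.evalCLM ℂ (fun _ : Fin d → ℤ => ℂ) 2 x).intervalIntegral_comp_comm
    (hc.intervalIntegrable (μ := volume) 0 t)
  simp only [map_smul, lp_evalCLM_apply, opS_apply, hw, smul_eq_mul,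
    intervalIntegral.integral_const_mul] at e
  have h1 := h.2 t
  simp only [map_smul] at h1
  rw [h1, lp.coeFn_add, lp.coeFn_add, Pi.add_apply, Pi.add_apply, opC_apply, opS_apply, ← e]
  ring

/-- Decay of small solutions of the discrete nonlinear Klein--Gordon equation
`u_tt − Δu + u ± |u|^{2s} u = 0` in dimensions `d = 2, 3, 4` for `s > s_d`: if the
data are small in `ℓ^{p_d'} × ℓ^{p_d'}`, there is a global Duhamel solution which
decays in `ℓ^p` at the rate of the linear equation for every `p ∈ [2, p_d]`. -/
theorem decay_small_solutions (d : ℕ) (hd : d = 2 ∨ d = 3 ∨ d = 4)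
    (δ : ℝ) (hδ : 0 < δ) (s : ℝ) (hs : sD d < s) (sgn : ℝ) (hsgn : sgn = 1 ∨ sgn = -1) :
    ∃ ε > (0:ℝ), ∃ C : ℝ → ℝ, (∀ p, 0 < C p) ∧
      ∀ f g : (Fin d → ℤ) → ℂ,
        eLpNorm f (ENNReal.ofReal (conjR (pD d))) Measure.count
            + eLpNorm g (ENNReal.ofReal (conjR (pD d))) Measure.count
          ≤ ENNReal.ofReal ε →
        ∃ u : ℝ → (Fin d → ℤ) → ℂ,
          (∀ (t : ℝ) (x : Fin d → ℤ),
            u t x = cosProp d t f x + sinProp d t g x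
              - (sgn : ℂ) * ∫ τ in (0:ℝ)..t, sinProp d (t - τ) (nonlin d s u τ) x) ∧
          ∀ p : ℝ, 2 ≤ p → p ≤ pD d → ∀ t : ℝ,
            eLpNorm (u t) (ENNReal.ofReal p) Measure.count ≤
              ENNReal.ofReal (C p * (1 + |t|) ^ (-(sigmaD d δ) * (p - 2) / p)) *
                (eLpNorm f (ENNReal.ofReal (conjR p)) Measure.count
                  + eLpNorm g (ENNReal.ofReal (conjR p)) Measure.count) := by
  obtain ⟨σ, K, hσ, D⟩ := exists_dispersive hd hδ hs
  have h2 := half_le_sD hd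
  have hP := pD_eq d
  have hP2 : 2 < pD d := by linarith
  have hs0 : 0 < s := by linarith
  have hK := D.one_le
  set R : ℝ := (1 / (2 * K)) ^ (1 / s) with hR_def
  have hR0 : 0 < R := by positivity
  have hR1 : R ≤ 1 := rpow_le_one (by positivity)
    ((div_le_one (by positivity)).2 (by linarith)) (by positivity)
  have hRs : R ^ s * K ≤ 1 / 2 := by
    rw [hR_def, ← rpow_mul (by positivity), one_div_mul_cancel hs0.ne', rpow_one]
    exact le_of_eq (by field_simp)
  have hc : ‖-(sgn : ℂ)‖ = 1 := by
    rcases hsgn with rfl | rfl <;> simp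
  refine ⟨R / (2 * K), by positivity, fun _ => 2 * K, fun _ => by positivity, fun f g hfg => ?_⟩
  obtain ⟨hf, hg⟩ := ENNReal.add_ne_top.1 (hfg.trans_lt ENNReal.ofReal_lt_top).ne
  have hq := D.conj.symm.pos
  have hB := ENNReal.toReal_mono ENNReal.ofReal_ne_top hfg
  rw [ENNReal.toReal_add hf hg, ENNReal.toReal_ofReal (by positivity),
    le_div_iff₀ (by positivity)] at hB
  replace hf := lpLE_toReal_eLpNorm hq hf
  replace hg := lpLE_toReal_eLpNorm hq hg
  have hq2 := conjR_le_two hP2.le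
  let F : L2Z d := ⟨f, (hf.exponent_mono hq hq2).memℓp⟩
  let G : L2Z d := ⟨g, (hg.exponent_mono hq hq2).memℓp⟩
  obtain ⟨u, hu, huR⟩ := D.exists_nonlinear hP2 (by linarith) (by linarith) hR0.le hRs hc
    (f := F) (g := G) hf hg (by linarith)
  have hu1 : ∀ t x, ‖u t x‖ ≤ 1 := fun t x => by
    refine ((huR t).norm_le D.conj.pos x).trans (mul_le_one₀ hR1 (by positivity) ?_)
    exact rpow_le_one_of_one_le_of_nonpos (by linarith [abs_nonneg t])
      (by linarith [D.rate_nonneg])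
  refine ⟨fun t => u t, hu.apply_eq hs0.le hu1, fun p hp hpP t => ?_⟩
  have hpp := holderConjugate_conjR hp
  have hmono := conjR_anti hp hpP
  have hfin : ∀ {h : (Fin d → ℤ) → ℂ} {B : ℝ}, LpLE (conjR (pD d)) h B →
      eLpNorm h (ENNReal.ofReal (conjR p)) Measure.count ≠ ∞ := fun hB =>
    (((eLpNorm_count_le_iff hpp.symm.pos hB.1).2 (hB.exponent_mono hq hmono)).trans_lt
      ENNReal.ofReal_lt_top).ne
  have hfp := lpLE_toReal_eLpNorm hpp.symm.pos (hfin hf)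
  have hgp := lpLE_toReal_eLpNorm hpp.symm.pos (hfin hg)
  have hp0 : 0 < p := by linarith
  have hd0 : 0 < pD d - 2 := by linarith
  have hd1 : 0 < pD d := by linarith
  set θ : ℝ := 1 - (p - 2) * pD d / (p * (pD d - 2)) with hθ_def
  have hθ : θ ∈ Set.Icc (0 : ℝ) 1 := by
    refine ⟨sub_nonneg.2 ?_, sub_le_self _ (by have : 0 ≤ p - 2 := by linarith
                                               positivity)⟩
    rw [div_le_one (by positivity)]
    nlinarith
  have hθp : 1 / conjR p = (1 - θ) / conjR (pD d) + θ / 2 := by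
    rw [hθ_def, conjR, conjR]
    field_simp
    ring
  have hsol := hu.lpLE D (isWeight_weightOp D.conj hP2 (by linarith) hR0.le hu.1 huR)
    (rpow_nonneg hR0.le s) hRs hc hpp hθ hθp hfp hgp t
  have hexp : σ * (pD d - 2) / pD d * (1 - θ) = σ * (p - 2) / p := by
    rw [hθ_def]
    field_simp
    ring
  rw [hexp] at hsol
  rw [← ENNReal.ofReal_toReal (hfin hf), ← ENNReal.ofReal_toReal (hfin hg),
    ← ENNReal.ofReal_add ENNReal.toReal_nonneg ENNReal.toReal_nonneg,
    ← ENNReal.ofReal_mul (by positivity),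
    eLpNorm_count_le_iff hp0 (mul_nonneg (by positivity) (add_nonneg hfp.1 hgp.1))]
  refine hsol.mono hp0.le (mul_le_mul_of_nonneg_right ?_ (add_nonneg hfp.1 hgp.1))
  refine mul_le_mul_of_nonneg_left ?_ (by positivity)
  refine rpow_le_rpow_of_exponent_le (by linarith [abs_nonneg t]) ?_
  rw [neg_mul, neg_div, neg_le_neg_iff]
  have : 0 ≤ p - 2 := by linarith
  gcongr
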